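/- Let X be a smooth complex projective hypersurface of odd dimension n in ℙ^{n+1}. Then the singular cohomology groups H^k(X, ℤ) are torsion free for all k, and likewise the singular homology groups H_k(X, ℤ) are torsion free for all k. -/

import Mathlib

open CategoryTheory MvPolynomial

/-- The singular chain complex of a topological space, with `ℤ` coefficients:
free `ℤ`-modules on the singular simplicial set, with alternating face maps. -/
noncomputable def singularChains : TopCat ⥤ ChainComplex (ModuleCat ℤ) ℕ :=
  TopCat.toSSet ⋙ ((SimplicialObject.whiskering _ _).obj (ModuleCat.free ℤ)) ⋙
    AlgebraicTopology.alternatingFaceMapComplex _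

/-- Singular homology `H_n(X, ℤ)`. -/
noncomputable def SingularHomology (X : TopCat) (n : ℕ) : ModuleCat ℤ :=
  (singularChains.obj X).homology n

/-- The singular cochain complex with coefficients in a commutative ring `R`,
obtained by dualizing the singular chain complex into `R`. -/
noncomputable def singularCochains (R : Type) [CommRing R] :
    TopCatᵒᵖ ⥤ CochainComplex (ModuleCat ℤ) ℕ :=
  singularChains.op ⋙ HomologicalComplex.opFunctor _ _ ⋙
    (((linearYoneda ℤ (ModuleCat ℤ)).obj (ModuleCat.of ℤ R)).mapHomologicalComplex _)

/-- Singular cohomology `H^n(X, R)` (as a `ℤ`-module). -/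
noncomputable def SingularCohomology (R : Type) [CommRing R] (X : TopCat) (n : ℕ) :
    ModuleCat ℤ :=
  ((singularCochains R).obj (Opposite.op X)).homology n

/-- The functor `X ↦ H_n(X, ℤ)`. -/
noncomputable def singularHomologyFunctor (n : ℕ) : TopCat ⥤ ModuleCat ℤ :=
  singularChains ⋙ HomologicalComplex.homologyFunctor _ _ n

/-- The (contravariant) functor `X ↦ H^n(X, R)`. -/
noncomputable def singularCohomologyFunctor (R : Type) [CommRing R] (n : ℕ) :
    TopCatᵒᵖ ⥤ ModuleCat ℤ :=
  singularCochains R ⋙ HomologicalComplex.homologyFunctor _ _ n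

/-- The topology on complex projective `N`-space, as a quotient of
`ℂ^{N+1} \ {0}`. -/
noncomputable instance (N : ℕ) : TopologicalSpace (Projectivization ℂ (Fin (N + 1) → ℂ)) :=
  instTopologicalSpaceQuotient

/-- The vanishing locus in `ℙ^N(ℂ)` of a (homogeneous) polynomial `f`, described
via the chosen representatives. -/
def projHypersurface {N : ℕ} (f : MvPolynomial (Fin (N + 1)) ℂ) :
    Set (Projectivization ℂ (Fin (N + 1) → ℂ)) :=
  {p | eval p.rep f = 0}

/-- Smoothness of the hypersurface `{f = 0}`: the gradient of `f` does not vanish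
at any nonzero point of the affine cone. -/
def IsSmoothHypersurface {N : ℕ} (f : MvPolynomial (Fin (N + 1)) ℂ) : Prop :=
  ∀ v : Fin (N + 1) → ℂ, v ≠ 0 → eval v f = 0 → ∃ i, eval v (pderiv i f) ≠ 0

namespace SimplexChains

/-- The quotient topology on a complex projective space. -/
@[reducible] noncomputable def projTopology (V : Type) [AddCommGroup V] [Module ℂ V]
    [TopologicalSpace V] : TopologicalSpace (Projectivization ℂ V) :=
  instTopologicalSpaceQuotient

attribute [local instance] projTopology

section

open Finsupp

/-- Finite integral combinations of elements of `α`. -/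
abbrev Ch (α : Type) := α →₀ ℤ

/-- The span of the basis elements in `S`. -/
abbrev C {α : Type} (S : Set α) : Submodule ℤ (Ch α) := Finsupp.supported ℤ ℤ S

/-- The standard simplex with `n` vertices. -/
abbrev Dl (n : ℕ) := stdSimplex ℝ (Fin n)

/-- Convex combinations in a standard simplex. -/
noncomputable def combS {k n : ℕ} (t : Dl k) (w : Fin k → Dl n) : Dl n :=
  ⟨∑ i, t i • (w i : Fin n → ℝ),
    (convex_stdSimplex ℝ (Fin n)).sum_mem (fun i _ => t.2.1 i) t.2.2 fun i _ => (w i).2⟩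

/-- A topological space with finite convex combinations. -/
class Cvx (V : Type) [TopologicalSpace V] where
  comb : ∀ {k : ℕ}, Dl k → (Fin k → V) → V
  comb_vertex : ∀ {k : ℕ} (i : Fin k) (w : Fin k → V), comb (stdSimplex.vertex i) w = w i
  comb_comb : ∀ {k l : ℕ} (t : Dl l) (s : Fin l → Dl k) (w : Fin k → V),
    comb t (fun i => comb (s i) w) = comb (combS t s) w
  comb_const : ∀ {k : ℕ} (t : Dl k) (c : V), comb t (fun _ => c) = c
  continuous_comb : ∀ {k : ℕ} (w : Fin k → V), Continuous fun t => comb t w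

open Cvx

/-- Convex combinations in a convex set. -/
@[reducible] noncomputable def cvxOfConvex {F : Type} [AddCommGroup F] [Module ℝ F]
    [TopologicalSpace F] [ContinuousAdd F] [ContinuousSMul ℝ F] {S : Set F} (hS : Convex ℝ S) :
    Cvx S where
  comb t w := ⟨∑ i, t i • (w i : F), hS.sum_mem (fun i _ => t.2.1 i) t.2.2 fun i _ => (w i).2⟩
  comb_vertex {k} i w := by
    apply Subtype.ext
    change ∑ j, (Pi.single i (1 : ℝ) : Fin k → ℝ) j • (w j : F) = _
    simp [Pi.single_apply]
  comb_comb {k l} t s w := by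
    apply Subtype.ext
    change ∑ j, t j • ∑ i, s j i • (w i : F) =
      ∑ i, (∑ j, t j • (s j : Fin _ → ℝ)) i • (w i : F)
    simp only [Finset.smul_sum, Finset.sum_apply, Finset.sum_smul, Pi.smul_apply, smul_smul,
      smul_eq_mul]
    exact Finset.sum_comm
  comb_const t c := by
    apply Subtype.ext
    change ∑ i, t i • (c : F) = c
    rw [← Finset.sum_smul, stdSimplex.sum_eq_one, one_smul]
  continuous_comb {k} w := by
    refine Continuous.subtype_mk ?_ _
    refine continuous_finsetSum _ fun i _ => ?_
    have : Continuous fun t : Dl k => (t : Fin k → ℝ) i :=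
      (continuous_apply i).comp continuous_subtype_val
    exact this.smul continuous_const

noncomputable instance (n : ℕ) : Cvx (Dl n) := cvxOfConvex (convex_stdSimplex ℝ (Fin n))

noncomputable instance : Cvx (Set.Icc (0 : ℝ) 1) := cvxOfConvex (convex_Icc 0 1)

noncomputable instance {V W : Type} [TopologicalSpace V] [TopologicalSpace W] [Cvx V] [Cvx W] :
    Cvx (V × W) where
  comb t w := (comb t fun i => (w i).1, comb t fun i => (w i).2)
  comb_vertex i w := by simp [comb_vertex]
  comb_comb t s w := by simp [comb_comb]
  comb_const t c := by simp [comb_const]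
  continuous_comb w := (continuous_comb _).prodMk (continuous_comb _)

/-- Maps that preserve convex combinations. -/
def IsAff {V W : Type} [TopologicalSpace V] [TopologicalSpace W] [Cvx V] [Cvx W]
    (f : V → W) : Prop :=
  ∀ ⦃k : ℕ⦄ (t : Dl k) (w : Fin k → V), f (comb t w) = comb t fun i => f (w i)

section

variable {V W : Type} [TopologicalSpace V] [TopologicalSpace W] [Cvx V] [Cvx W]

theorem isAff_comb {k : ℕ} (w : Fin k → V) : IsAff fun t : Dl k => comb t w :=
  fun _ t s => (comb_comb t s w).symm

theorem IsAff.prodMap_id {f : V → W} (hf : IsAff f) (U : Type) [TopologicalSpace U] [Cvx U] :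
    IsAff (fun x : V × U => (f x.1, x.2)) :=
  fun _ t _ => Prod.ext (hf t _) rfl

theorem isAff_mk_const (c : W) : IsAff fun x : V => (x, c) :=
  fun _ t _ => Prod.ext rfl (comb_const t c).symm

end

/-- Ordered simplices with vertices in `V`. -/
abbrev LS (V : Type) := Σ k : ℕ, (Fin k → V)

/-- Not necessarily continuous singular simplices. -/
abbrev Sing (E : Type) := Σ k : ℕ, (Dl k → E)

section linear

variable {V W : Type}

/-- Boundary of an ordered simplex. -/
noncomputable def bdAux : ∀ k : ℕ, (Fin k → V) → Ch (LS V)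
  | 0, _ => 0
  | k + 1, w => ∑ i : Fin (k + 1), (-1 : ℤ) ^ (i : ℕ) • single ⟨k, w ∘ i.succAbove⟩ 1

/-- Boundary operator. -/
noncomputable def bd : Ch (LS V) →ₗ[ℤ] Ch (LS V) :=
  linearCombination ℤ fun s => bdAux s.1 s.2

/-- Prepending a vertex to a simplex. -/
def consS (v : V) (s : LS V) : LS V := ⟨s.1 + 1, Fin.cons v s.2⟩

/-- Prepending a vertex to a chain. -/
noncomputable def cone (v : V) : Ch (LS V) →ₗ[ℤ] Ch (LS V) := lmapDomain ℤ ℤ (consS v)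

/-- The image of a simplex under a map of vertices. -/
def mapS (f : V → W) (s : LS V) : LS W := ⟨s.1, f ∘ s.2⟩

/-- The image of a chain under a map of vertices. -/
noncomputable def lmap (f : V → W) : Ch (LS V) →ₗ[ℤ] Ch (LS W) := lmapDomain ℤ ℤ (mapS f)

@[simp] theorem bd_single (s : LS V) : bd (single s 1) = bdAux s.1 s.2 := by simp [bd]

@[simp] theorem cone_single (v : V) (s : LS V) (a : ℤ) :
    cone v (single s a) = single (consS v s) a := by
  simp [cone, mapDomain_single]

@[simp] theorem lmap_single (f : V → W) (s : LS V) (a : ℤ) :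
    lmap f (single s a) = single (mapS f s) a := by
  simp [lmap, mapDomain_single]

/-- Two linear maps agree if they agree on all simplices. -/
theorem hom_ext {α M : Type} [AddCommGroup M] {f g : Ch α →ₗ[ℤ] M}
    (h : ∀ s, f (single s 1) = g (single s 1)) : f = g :=
  Finsupp.lhom_ext' fun s => LinearMap.ext_ring (h s)

theorem bd_nil (w : Fin 0 → V) : bd (single ⟨0, w⟩ 1) = 0 := by simp [bdAux]

theorem bd_consS (v : V) (s : LS V) :
    bd (single (consS v s) 1) = single s 1 - cone v (bd (single s 1)) := by
  obtain ⟨k, w⟩ := s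
  cases k with
  | zero =>
    simp only [bd_single, consS, bdAux]
    simp
  | succ k =>
    simp only [bd_single, consS, bdAux]
    rw [Fin.sum_univ_succ]
    simp only [Fin.val_zero, pow_zero, one_smul, map_sum, sub_eq_add_neg, map_smul, cone_single]
    congr 1
    rw [← Finset.sum_neg_distrib]
    refine Finset.sum_congr rfl fun i _ => ?_
    rw [Fin.val_succ, pow_succ, mul_neg, mul_one, neg_smul]
    congr 3
    simp only [consS]
    congr 1
    funext j
    refine Fin.cases ?_ (fun j => ?_) j
    · simp
    · simp

theorem bd_cone (v : V) (x : Ch (LS V)) : bd (cone v x) = x - cone v (bd x) := by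
  have : bd ∘ₗ cone v = LinearMap.id - cone v ∘ₗ bd :=
    hom_ext fun s => by simpa using bd_consS v s
  exact LinearMap.congr_fun this x

theorem exists_consS (k : ℕ) (w : Fin (k + 1) → V) :
    (⟨k + 1, w⟩ : LS V) = consS (w 0) ⟨k, Fin.tail w⟩ := by
  simp [consS]

/-- Induction on the number of vertices. -/
theorem LS.ind {p : LS V → Prop} (h0 : ∀ w, p ⟨0, w⟩)
    (h1 : ∀ v s, p s → p (consS v s)) (s : LS V) : p s := by
  obtain ⟨k, w⟩ := s
  induction k with
  | zero => exact h0 w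
  | succ k ih => rw [exists_consS]; exact h1 _ _ (ih _)

theorem bd_bd (x : Ch (LS V)) : bd (bd x) = 0 := by
  have : bd ∘ₗ bd = (0 : Ch (LS V) →ₗ[ℤ] Ch (LS V)) := by
    refine hom_ext fun s => ?_
    induction s using LS.ind with
    | h0 w => simp [bdAux]
    | h1 v s ih =>
      have ih' : bd (bd (single s 1)) = 0 := ih
      simp only [LinearMap.comp_apply, LinearMap.zero_apply]
      rw [bd_consS, map_sub, bd_cone, ih', map_zero, sub_zero, sub_self]
  exact LinearMap.congr_fun this x

theorem lmap_consS (f : V → W) (v : V) (s : LS V) : mapS f (consS v s) = consS (f v) (mapS f s) := by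
  simp only [mapS, consS]
  congr 1
  funext j
  refine Fin.cases ?_ (fun j => ?_) j <;> simp

theorem lmap_cone (f : V → W) (v : V) (x : Ch (LS V)) :
    lmap f (cone v x) = cone (f v) (lmap f x) := by
  have : lmap f ∘ₗ cone v = cone (f v) ∘ₗ lmap f := hom_ext fun s => by simp [lmap_consS]
  exact LinearMap.congr_fun this x

theorem lmap_bd (f : V → W) (x : Ch (LS V)) : lmap f (bd x) = bd (lmap f x) := by
  have : lmap f ∘ₗ bd = bd ∘ₗ lmap f := by
    refine hom_ext fun s => ?_
    obtain ⟨k, w⟩ := s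
    cases k <;> simp [bdAux, mapS, Function.comp_assoc]
  exact LinearMap.congr_fun this x

theorem lmap_lmap {U : Type} (f : V → W) (g : W → U) (x : Ch (LS V)) :
    lmap g (lmap f x) = lmap (g ∘ f) x := by
  have : lmap g ∘ₗ lmap f = lmap (g ∘ f) := hom_ext fun s => by simp [mapS, Function.comp_assoc]
  exact LinearMap.congr_fun this x

end linear

/-- The ordered simplex formed by the vertices of the standard simplex. -/
noncomputable def verts (n : ℕ) : LS (Dl n) := ⟨n, fun i => stdSimplex.vertex i⟩

section realization

variable {V W E E' : Type} [TopologicalSpace V] [TopologicalSpace W] [Cvx V] [Cvx W]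

/-- The singular simplex obtained from an affine simplex in `V` and a map `V → E`. -/
def realS (σ : V → E) (s : LS V) : Sing E := ⟨s.1, fun t => σ (comb t s.2)⟩

/-- Linear extension of `realS`. -/
noncomputable def real (σ : V → E) : Ch (LS V) →ₗ[ℤ] Ch (Sing E) := lmapDomain ℤ ℤ (realS σ)

@[simp] theorem real_single (σ : V → E) (s : LS V) (a : ℤ) :
    real σ (single s a) = single (realS σ s) a := by
  simp [real, mapDomain_single]

theorem real_lmap {f : V → W} (hf : IsAff f) (σ : W → E) (x : Ch (LS V)) :
    real σ (lmap f x) = real (σ ∘ f) x := by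
  have : real σ ∘ₗ lmap f = real (σ ∘ f) := hom_ext fun s => by
    simp [realS, mapS, hf _ _, Function.comp_def]
  exact LinearMap.congr_fun this x

theorem mapS_verts (s : LS V) : mapS (fun t : Dl s.1 => comb t s.2) (verts s.1) = s := by
  simp [mapS, verts, Function.comp_def, comb_vertex]

/-- The operator on singular chains given by a family of chains in the standard simplices. -/
noncomputable def extend (Φ : ∀ n, (Dl n → E) → Ch (Sing E')) : Ch (Sing E) →ₗ[ℤ] Ch (Sing E') :=
  linearCombination ℤ fun s => Φ s.1 s.2

@[simp] theorem extend_single (Φ : ∀ n, (Dl n → E) → Ch (Sing E')) (s : Sing E) :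
    extend Φ (single s 1) = Φ s.1 s.2 := by simp [extend]

theorem realS_verts (n : ℕ) (σ : Dl n → E) : realS σ (verts n) = ⟨n, σ⟩ := by
  simp only [realS, verts]
  congr 1
  funext t
  congr 1
  apply Subtype.ext
  change ∑ j, t j • ((stdSimplex.vertex j : Dl _) : Fin n → ℝ) = _
  funext i
  simp [Finset.sum_apply, Pi.single_apply]
  rfl

/-- Boundary of singular chains. -/
noncomputable def d : Ch (Sing E) →ₗ[ℤ] Ch (Sing E) :=
  extend fun n σ => real σ (bd (single (verts n) 1))

theorem d_real (σ : V → E) (x : Ch (LS V)) : d (real σ x) = real σ (bd x) := by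
  have : d ∘ₗ real σ = real σ ∘ₗ bd := hom_ext fun s => by
    simp only [LinearMap.comp_apply, real_single, d, extend_single]
    conv_rhs => rw [← mapS_verts s, ← lmap_single, ← lmap_bd, real_lmap (isAff_comb s.2)]
    rfl
  exact LinearMap.congr_fun this x

theorem d_single (s : Sing E) : d (single s 1) = real s.2 (bd (single (verts s.1) 1)) := by
  simp [d]

theorem single_eq_real (s : Sing E) : single s (1 : ℤ) = real s.2 (single (verts s.1) 1) := by
  rw [real_single, realS_verts]

theorem d_d (x : Ch (Sing E)) : d (d x) = 0 := by
  have : d ∘ₗ d = (0 : Ch (Sing E) →ₗ[ℤ] Ch (Sing E)) := hom_ext fun s => by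
    simp [d_single, d_real, bd_bd, -bd_single]
  exact LinearMap.congr_fun this x

/-- Push-forward of singular simplices. -/
def pushS (f : E → E') (s : Sing E) : Sing E' := ⟨s.1, f ∘ s.2⟩

/-- Push-forward of singular chains. -/
noncomputable def push (f : E → E') : Ch (Sing E) →ₗ[ℤ] Ch (Sing E') := lmapDomain ℤ ℤ (pushS f)

@[simp] theorem push_single (f : E → E') (s : Sing E) (a : ℤ) :
    push f (single s a) = single (pushS f s) a := by
  simp [push, mapDomain_single]

theorem push_real (f : E → E') (σ : V → E) (x : Ch (LS V)) :
    push f (real σ x) = real (f ∘ σ) x := by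
  have : push f ∘ₗ real σ = real (f ∘ σ) := hom_ext fun s => by simp; rfl
  exact LinearMap.congr_fun this x

theorem push_d (f : E → E') (x : Ch (Sing E)) : push f (d x) = d (push f x) := by
  have : push f ∘ₗ d = d ∘ₗ push f := hom_ext fun s => by
    simp only [LinearMap.comp_apply, d_single, push_real, push_single]; rfl
  exact LinearMap.congr_fun this x

end realization

section subcomplexes

variable {V E E' : Type} [TopologicalSpace V] [Cvx V]

/-- Sets of singular simplices closed under composition with affine maps. -/
def Stable (S : Set (Sing E)) : Prop :=
  ∀ s ∈ S, ∀ u : LS (Dl s.1), realS s.2 u ∈ S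

/-- A linear map sends `C S` to a submodule if it does so on basis elements. -/
theorem map_C {α M : Type} [AddCommGroup M] {S : Set α} {f : Ch α →ₗ[ℤ] M} {N : Submodule ℤ M}
    (h : ∀ s ∈ S, f (single s 1) ∈ N) {x : Ch α} (hx : x ∈ C S) : f x ∈ N := by
  have : C S ≤ N.comap f := by
    rw [C, Finsupp.supported_eq_span_single]
    exact Submodule.span_le.2 (by rintro _ ⟨s, hs, rfl⟩; exact h s hs)
  exact this hx

theorem single_mem_C {α : Type} {S : Set α} {s : α} (hs : s ∈ S) : single s (1 : ℤ) ∈ C S :=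
  Finsupp.single_mem_supported ℤ 1 hs

theorem Stable.real_mem {S : Set (Sing E)} (hS : Stable S) {s : Sing E} (hs : s ∈ S)
    (x : Ch (LS (Dl s.1))) : real s.2 x ∈ C S :=
  map_C (S := Set.univ) (fun u _ => by rw [real_single]; exact single_mem_C (hS s hs u))
    (by simp)

theorem Stable.d_mem {S : Set (Sing E)} (hS : Stable S) {x : Ch (Sing E)} (hx : x ∈ C S) :
    d x ∈ C S :=
  map_C (fun s hs => by rw [d_single]; exact hS.real_mem hs _) hx

theorem Stable.iUnion {ι : Type} {S : ι → Set (Sing E)} (hS : ∀ i, Stable (S i)) :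
    Stable (⋃ i, S i) := by
  intro s hs u
  obtain ⟨i, hi⟩ := Set.mem_iUnion.1 hs
  exact Set.mem_iUnion.2 ⟨i, hS i s hi u⟩

variable [TopologicalSpace E] [TopologicalSpace E']

/-- The singular simplices of a subset. -/
def sg (A : Set E) : Set (Sing E) := {s | Continuous s.2 ∧ ∀ t, s.2 t ∈ A}

theorem stable_sg (A : Set E) : Stable (sg A) :=
  fun _ hs _ => ⟨hs.1.comp (continuous_comb _), fun _ => hs.2 _⟩

theorem sg_mono {A B : Set E} (h : A ⊆ B) : sg A ⊆ sg B := fun _ hs => ⟨hs.1, fun t => h (hs.2 t)⟩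

theorem sg_inter (A B : Set E) : sg (A ∩ B) = sg A ∩ sg B := by
  ext s
  exact ⟨fun h => ⟨⟨h.1, fun t => (h.2 t).1⟩, ⟨h.1, fun t => (h.2 t).2⟩⟩,
    fun h => ⟨h.1.1, fun t => ⟨h.1.2 t, h.2.2 t⟩⟩⟩

theorem realS_mem_sg {A : Set E} {D : Set V} {σ : V → E} (hσ : ContinuousOn σ D)
    (hA : Set.MapsTo σ D A) {u : LS V} (hu : ∀ t, comb t u.2 ∈ D) : realS σ u ∈ sg A :=
  ⟨hσ.comp_continuous (continuous_comb _) hu, fun t => hA (hu t)⟩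

theorem pushS_mem_sg {A : Set E} {B : Set E'} {f : E → E'} (hf : ContinuousOn f A)
    (hAB : Set.MapsTo f A B) {s : Sing E} (hs : s ∈ sg A) : pushS f s ∈ sg B :=
  ⟨hf.comp_continuous hs.1 hs.2, fun t => hAB (hs.2 t)⟩

theorem push_mem_sg {A : Set E} {B : Set E'} {f : E → E'} (hf : ContinuousOn f A)
    (hAB : Set.MapsTo f A B) {x : Ch (Sing E)} (hx : x ∈ C (sg A)) : push f x ∈ C (sg B) :=
  map_C (fun s hs => by rw [push_single]; exact single_mem_C (pushS_mem_sg hf hAB hs)) hx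

end subcomplexes

end

section

open Finsupp Cvx

section prism

variable {V W E E' : Type}

/-- The prism over an ordered simplex. -/
noncomputable def prAux : ∀ k : ℕ, (Fin k → V) → Ch (LS (V × Set.Icc (0 : ℝ) 1))
  | 0, _ => 0
  | k + 1, w => cone (w 0, 0) (single (mapS (fun v => (v, 1)) ⟨k + 1, w⟩) 1 -
      prAux k (Fin.tail w))

/-- The prism operator. -/
noncomputable def pr : Ch (LS V) →ₗ[ℤ] Ch (LS (V × Set.Icc (0 : ℝ) 1)) :=
  linearCombination ℤ fun s => prAux s.1 s.2

theorem pr_consS (v : V) (s : LS V) : pr (single (consS v s) 1) =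
    cone (v, 0) (cone (v, 1) (lmap (fun v => (v, 1)) (single s 1)) - pr (single s 1)) := by
  have h : consS (v, 1) (mapS (fun v => (v, 1)) s) =
      mapS (fun v => (v, (1 : Set.Icc (0 : ℝ) 1))) (consS v s) := (lmap_consS _ v s).symm
  rw [lmap_single, cone_single, h]
  simp [pr, consS, prAux]

theorem pr_nil (w : Fin 0 → V) : pr (single ⟨0, w⟩ 1) = 0 := by simp [pr, prAux]

theorem pr_cone (v : V) (x : Ch (LS V)) : pr (cone v x) =
    cone (v, 0) (cone (v, 1) (lmap (fun v => (v, 1)) x) - pr x) := by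
  have : pr ∘ₗ cone v = cone (v, 0) ∘ₗ (cone (v, 1) ∘ₗ lmap (fun v => (v, 1)) - pr) :=
    hom_ext fun s => by simpa using pr_consS v s
  exact LinearMap.congr_fun this x

theorem bd_pr (x : Ch (LS V)) : bd (pr x) + pr (bd x) =
    lmap (fun v => (v, 1)) x - lmap (fun v => (v, 0)) x := by
  have : bd ∘ₗ pr + pr ∘ₗ bd =
      lmap (fun v : V => (v, (1 : Set.Icc (0 : ℝ) 1))) - lmap (fun v => (v, 0)) := by
    refine hom_ext fun s => ?_
    induction s using LS.ind with
    | h0 w =>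
      simp only [LinearMap.add_apply, LinearMap.comp_apply, LinearMap.sub_apply, pr_nil, bd_nil,
        map_zero, lmap_single, mapS]
      rw [eq_comm, add_zero, sub_eq_zero]
      congr 2
      exact Subsingleton.elim _ _
    | h1 v s ih =>
      simp only [LinearMap.add_apply, LinearMap.comp_apply, LinearMap.sub_apply] at ih ⊢
      have e : single (consS v s) (1 : ℤ) = cone v (single s 1) := by simp
      generalize single s (1 : ℤ) = y at ih e
      rw [e]
      simp only [pr_cone, bd_cone, lmap_cone, map_sub, lmap_bd]
      rw [eq_sub_of_add_eq ih]
      simp only [map_sub]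
      abel
  exact LinearMap.congr_fun this x

theorem lmap_pr (f : V → W) (x : Ch (LS V)) :
    lmap (fun x : V × Set.Icc (0 : ℝ) 1 => (f x.1, x.2)) (pr x) = pr (lmap f x) := by
  have : lmap (fun x : V × Set.Icc (0 : ℝ) 1 => (f x.1, x.2)) ∘ₗ pr = pr ∘ₗ lmap f := by
    refine hom_ext fun s => ?_
    induction s using LS.ind with
    | h0 w => simp [pr_nil, mapS]
    | h1 v s ih =>
      simp only [LinearMap.comp_apply] at ih ⊢
      have e : single (consS v s) (1 : ℤ) = cone v (single s 1) := by simp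
      generalize single s (1 : ℤ) = y at ih e
      rw [e]
      simp only [pr_cone, lmap_cone, map_sub, ih, lmap_lmap, Function.comp_def]
  exact LinearMap.congr_fun this x

variable [TopologicalSpace V] [Cvx V] [TopologicalSpace W] [Cvx W]

/-- The chain homotopy induced by a homotopy. -/
noncomputable def prism (h : ℝ × E → E') : Ch (Sing E) →ₗ[ℤ] Ch (Sing E') :=
  extend fun n σ => real (fun p : Dl n × Set.Icc (0 : ℝ) 1 => h (p.2, σ p.1))
    (pr (single (verts n) 1))

theorem prism_real (h : ℝ × E → E') (σ : V → E) (x : Ch (LS V)) :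
    prism h (real σ x) = real (fun p : V × Set.Icc (0 : ℝ) 1 => h (p.2, σ p.1)) (pr x) := by
  have : prism h ∘ₗ real σ =
      real (fun p : V × Set.Icc (0 : ℝ) 1 => h (p.2, σ p.1)) ∘ₗ pr := hom_ext fun s => by
    simp only [LinearMap.comp_apply, real_single, prism, extend_single]
    conv_rhs => rw [← mapS_verts s, ← lmap_single, ← lmap_pr,
      real_lmap ((isAff_comb s.2).prodMap_id _)]
    rfl
  exact LinearMap.congr_fun this x

theorem d_prism (h : ℝ × E → E') (x : Ch (Sing E)) : d (prism h x) + prism h (d x) =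
    push (fun e => h (1, e)) x - push (fun e => h (0, e)) x := by
  have : d ∘ₗ prism h + prism h ∘ₗ d =
      push (fun e => h (1, e)) - push (fun e => h (0, e)) := hom_ext fun s => by
    simp only [LinearMap.add_apply, LinearMap.comp_apply, LinearMap.sub_apply]
    rw [single_eq_real, prism_real, d_real, d_real, prism_real, ← map_add, bd_pr, map_sub,
      real_lmap (isAff_mk_const _), real_lmap (isAff_mk_const _), push_real, push_real]
    rfl
  exact LinearMap.congr_fun this x

theorem prism_mem [TopologicalSpace E] [TopologicalSpace E'] {h : ℝ × E → E'} {A : Set E}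
    {B : Set E'} (hc : ContinuousOn h (Set.Icc 0 1 ×ˢ A))
    (hm : Set.MapsTo h (Set.Icc 0 1 ×ˢ A) B) {x : Ch (Sing E)} (hx : x ∈ C (sg A)) :
    prism h x ∈ C (sg B) := by
  refine map_C (fun s hs => ?_) hx
  rw [prism, extend_single]
  refine map_C (S := Set.univ) (fun u _ => ?_) (by simp)
  rw [real_single]
  refine single_mem_C (realS_mem_sg (D := Set.univ) ?_ ?_ fun _ => trivial)
  · refine hc.comp (Continuous.continuousOn ?_) fun q _ => ⟨q.2.2, hs.2 _⟩
    exact (continuous_subtype_val.comp continuous_snd).prodMk (hs.1.comp continuous_fst)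
  · exact fun q _ => hm ⟨q.2.2, hs.2 _⟩

end prism

end

section

open Finsupp Cvx

section acyclic

variable {M : Type} [AddCommGroup M] {D : M →ₗ[ℤ] M} {R S T A A' B B' : Submodule ℤ M}

/-- Vanishing of the homology of `T` relative to `S`. -/
def Acyc (D : M →ₗ[ℤ] M) (T S : Submodule ℤ M) : Prop :=
  ∀ x ∈ T, D x ∈ S → ∃ y ∈ T, x - D y ∈ S

end acyclic

section subdivision

theorem bd_single_mem {V : Type} (k : ℕ) (w : Fin (k + 1) → V) :
    bd (single ⟨k + 1, w⟩ 1) ∈ C {s : LS V | s.1 = k} := by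
  rw [bd_single]
  exact sum_mem fun i _ => Submodule.smul_mem _ _ (single_mem_C rfl)

/-- Induction on the number of vertices for identities between natural operators. -/
theorem eq_of_bd {V M : Type} [AddCommGroup M] {f g : Ch (LS V) →ₗ[ℤ] M}
    (h0 : ∀ w, f (single ⟨0, w⟩ 1) = g (single ⟨0, w⟩ 1))
    (h1 : ∀ k w, f (bd (single ⟨k + 1, w⟩ 1)) = g (bd (single ⟨k + 1, w⟩ 1)) →
      f (single ⟨k + 1, w⟩ 1) = g (single ⟨k + 1, w⟩ 1)) : f = g := by
  have key : ∀ k w, f (single ⟨k, w⟩ 1) = g (single ⟨k, w⟩ 1) := by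
    intro k
    induction k with
    | zero => exact h0
    | succ k ih =>
      intro w
      refine h1 k w ?_
      have := map_C (f := f - g) (N := ⊥) (S := {s : LS V | s.1 = k})
        (by rintro ⟨_, u⟩ rfl; simp [ih]) (bd_single_mem k w)
      simpa [sub_eq_zero] using this
  exact hom_ext fun s => key s.1 s.2

variable {V W : Type} [TopologicalSpace V] [Cvx V] [TopologicalSpace W] [Cvx W]

/-- The barycenter of a nonempty ordered simplex. -/
noncomputable def bary {k : ℕ} (w : Fin (k + 1) → V) : V := comb stdSimplex.barycenter w

/-- Barycentric subdivision of an ordered simplex. -/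
noncomputable def sdAux : ∀ k : ℕ, (Fin k → V) → Ch (LS V)
  | 0, w => single ⟨0, w⟩ 1
  | k + 1, w => cone (bary w)
      (∑ i : Fin (k + 1), (-1 : ℤ) ^ (i : ℕ) • sdAux k (w ∘ i.succAbove))

/-- Barycentric subdivision. -/
noncomputable def sd : Ch (LS V) →ₗ[ℤ] Ch (LS V) := linearCombination ℤ fun s => sdAux s.1 s.2

/-- The homotopy from the subdivision of an ordered simplex to itself. -/
noncomputable def sdhAux : ∀ k : ℕ, (Fin k → V) → Ch (LS V)
  | 0, _ => 0
  | k + 1, w => cone (bary w) (single ⟨k + 1, w⟩ 1 - sd (single ⟨k + 1, w⟩ 1) -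
      ∑ i : Fin (k + 1), (-1 : ℤ) ^ (i : ℕ) • sdhAux k (w ∘ i.succAbove))

/-- The homotopy from subdivision to the identity. -/
noncomputable def sdh : Ch (LS V) →ₗ[ℤ] Ch (LS V) := linearCombination ℤ fun s => sdhAux s.1 s.2

theorem sd_nil (w : Fin 0 → V) : sd (single ⟨0, w⟩ 1) = single ⟨0, w⟩ 1 := by simp [sd, sdAux]

theorem sdh_nil (w : Fin 0 → V) : sdh (single ⟨0, w⟩ 1) = 0 := by simp [sdh, sdhAux]

theorem sd_succ (k : ℕ) (w : Fin (k + 1) → V) : sd (single ⟨k + 1, w⟩ 1) =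
    cone (bary w) (sd (bd (single ⟨k + 1, w⟩ 1))) := by
  simp [sd, sdAux, bdAux]

theorem sdh_succ (k : ℕ) (w : Fin (k + 1) → V) : sdh (single ⟨k + 1, w⟩ 1) =
    cone (bary w) (single ⟨k + 1, w⟩ 1 - sd (single ⟨k + 1, w⟩ 1) -
      sdh (bd (single ⟨k + 1, w⟩ 1))) := by
  simp [sdh, sdhAux, bdAux]

theorem bd_sd (x : Ch (LS V)) : bd (sd x) = sd (bd x) := by
  have : bd ∘ₗ sd = sd ∘ₗ (bd : Ch (LS V) →ₗ[ℤ] _) := by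
    refine eq_of_bd (fun w => ?_) fun k w ih => ?_
    · simp only [LinearMap.comp_apply, sd_nil, bd_nil, map_zero]
    · simp only [LinearMap.comp_apply, bd_bd, map_zero] at ih ⊢
      rw [sd_succ, bd_cone, ih, map_zero, sub_zero]
  exact LinearMap.congr_fun this x

theorem bd_sdh (x : Ch (LS V)) : bd (sdh x) + sdh (bd x) = x - sd x := by
  have : bd ∘ₗ sdh + sdh ∘ₗ (bd : Ch (LS V) →ₗ[ℤ] _) = LinearMap.id - sd := by
    refine eq_of_bd (fun w => ?_) fun k w ih => ?_
    · simp only [LinearMap.comp_apply, LinearMap.add_apply, LinearMap.sub_apply, sdh_nil, sd_nil,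
        bd_nil, map_zero, LinearMap.id_apply, sub_self, add_zero]
    · simp only [LinearMap.comp_apply, LinearMap.add_apply, LinearMap.sub_apply, bd_bd, map_zero,
        LinearMap.id_apply, add_zero] at ih ⊢
      rw [sdh_succ, bd_cone, map_sub bd, map_sub bd, bd_sd, ih, sub_self, map_zero, sub_zero,
        sub_add_cancel]
  exact LinearMap.congr_fun this x

theorem IsAff.bary {f : V → W} (hf : IsAff f) {k : ℕ} (w : Fin (k + 1) → V) :
    f (bary w) = SimplexChains.bary (f ∘ w) := hf _ _

theorem lmap_sd {f : V → W} (hf : IsAff f) (x : Ch (LS V)) : lmap f (sd x) = sd (lmap f x) := by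
  have : lmap f ∘ₗ sd = sd ∘ₗ lmap f := by
    refine eq_of_bd (fun w => ?_) fun k w ih => ?_
    · simp [sd_nil, mapS]
    · simp only [LinearMap.comp_apply] at ih ⊢
      rw [sd_succ, lmap_cone, ih, lmap_bd, lmap_single, hf.bary]
      exact (sd_succ _ _).symm
  exact LinearMap.congr_fun this x

theorem lmap_sdh {f : V → W} (hf : IsAff f) (x : Ch (LS V)) :
    lmap f (sdh x) = sdh (lmap f x) := by
  have : lmap f ∘ₗ sdh = sdh ∘ₗ lmap f := by
    refine eq_of_bd (fun w => ?_) fun k w ih => ?_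
    · simp [sdh_nil, mapS]
    · simp only [LinearMap.comp_apply] at ih ⊢
      rw [sdh_succ, lmap_cone, map_sub (lmap f), map_sub (lmap f), ih, lmap_sd hf, lmap_bd, lmap_single, hf.bary]
      exact (sdh_succ _ _).symm
  exact LinearMap.congr_fun this x

end subdivision

section singular

variable {V E : Type} [TopologicalSpace V] [Cvx V]

/-- Barycentric subdivision of singular chains. -/
noncomputable def Sd : Ch (Sing E) →ₗ[ℤ] Ch (Sing E) :=
  extend fun n σ => real σ (sd (single (verts n) 1))

/-- The homotopy from the subdivision to the identity. -/
noncomputable def Sdh : Ch (Sing E) →ₗ[ℤ] Ch (Sing E) :=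
  extend fun n σ => real σ (sdh (single (verts n) 1))

theorem Sd_real (σ : V → E) (x : Ch (LS V)) : Sd (real σ x) = real σ (sd x) := by
  have : Sd ∘ₗ real σ = real σ ∘ₗ sd := hom_ext fun s => by
    simp only [LinearMap.comp_apply, real_single, Sd, extend_single]
    conv_rhs => rw [← mapS_verts s, ← lmap_single, ← lmap_sd (isAff_comb s.2),
      real_lmap (isAff_comb s.2)]
    rfl
  exact LinearMap.congr_fun this x

theorem Sdh_real (σ : V → E) (x : Ch (LS V)) : Sdh (real σ x) = real σ (sdh x) := by
  have : Sdh ∘ₗ real σ = real σ ∘ₗ sdh := hom_ext fun s => by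
    simp only [LinearMap.comp_apply, real_single, Sdh, extend_single]
    conv_rhs => rw [← mapS_verts s, ← lmap_single, ← lmap_sdh (isAff_comb s.2),
      real_lmap (isAff_comb s.2)]
    rfl
  exact LinearMap.congr_fun this x

theorem d_Sd (x : Ch (Sing E)) : d (Sd x) = Sd (d x) := by
  have : d ∘ₗ Sd = Sd ∘ₗ (d : Ch (Sing E) →ₗ[ℤ] _) := hom_ext fun s => by
    simp only [LinearMap.comp_apply]
    rw [single_eq_real, Sd_real, d_real, d_real, Sd_real, bd_sd]
  exact LinearMap.congr_fun this x

theorem d_Sdh (x : Ch (Sing E)) : d (Sdh x) + Sdh (d x) = x - Sd x := by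
  have : d ∘ₗ Sdh + Sdh ∘ₗ (d : Ch (Sing E) →ₗ[ℤ] _) = LinearMap.id - Sd := hom_ext fun s => by
    simp only [LinearMap.comp_apply, LinearMap.add_apply, LinearMap.sub_apply, LinearMap.id_apply]
    rw [single_eq_real, Sd_real, d_real, Sdh_real, d_real, Sdh_real, ← map_add, bd_sdh, map_sub]
  exact LinearMap.congr_fun this x

theorem Stable.Sd_mem {S : Set (Sing E)} (hS : Stable S) {x : Ch (Sing E)} (hx : x ∈ C S) :
    Sd x ∈ C S :=
  map_C (fun s hs => by rw [Sd, extend_single]; exact hS.real_mem hs _) hx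

theorem Stable.Sdh_mem {S : Set (Sing E)} (hS : Stable S) {x : Ch (Sing E)} (hx : x ∈ C S) :
    Sdh x ∈ C S :=
  map_C (fun s hs => by rw [Sdh, extend_single]; exact hS.real_mem hs _) hx

theorem Sd_iterate_real (σ : V → E) (x : Ch (LS V))
    (m : ℕ) : (Sd^[m]) (real σ x) = real σ ((sd^[m]) x) := by
  induction m with
  | zero => rfl
  | succ m ih => rw [Function.iterate_succ_apply', Function.iterate_succ_apply', ih, Sd_real]

end singular

section mesh

theorem comb_comp {V : Type} [TopologicalSpace V] [Cvx V] {k l : ℕ} (t : Dl l) (f : Fin l → Fin k)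
    (w : Fin k → V) : comb t (w ∘ f) = comb (combS t fun i => stdSimplex.vertex (f i)) w := by
  rw [← comb_comb]
  simp [comb_vertex, Function.comp_def]

theorem dist_comb_le {n k : ℕ} {p : Dl n} {w : Fin k → Dl n} {r : ℝ} (h : ∀ i, dist (w i) p ≤ r)
    (t : Dl k) : dist (comb t w) p ≤ r := by
  have := (convex_closedBall (p : Fin n → ℝ) r).sum_mem (t := Finset.univ) (w := t)
    (z := fun i => (w i : Fin n → ℝ)) (fun i _ => t.2.1 i) t.2.2 fun i _ => h i
  exact this

theorem dist_bary_le {n k : ℕ} {w : Fin (k + 1) → Dl n} {r : ℝ}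
    (h : ∀ i j, dist (w i) (w j) ≤ r) (j : Fin (k + 1)) :
    dist (bary w) (w j) ≤ (1 - 1 / (k + 1 : ℝ)) * r := by
  have e : ((bary w : Dl n) : Fin n → ℝ) - w j =
      ∑ i, (1 / (k + 1 : ℝ)) • ((w i : Fin n → ℝ) - w j) := by
    have : ((bary w : Dl n) : Fin n → ℝ) =
      ∑ i, (stdSimplex.barycenter : Dl (k + 1)) i • (w i : Fin n → ℝ) := rfl
    rw [this]
    simp only [smul_sub, Finset.sum_sub_distrib, Finset.sum_const, Finset.card_univ,
      Fintype.card_fin]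
    congr 1
    · refine Finset.sum_congr rfl fun i _ => ?_
      congr 1
      simp [stdSimplex.barycenter]
      rfl
    · rw [← Nat.cast_smul_eq_nsmul ℝ, smul_smul]
      push_cast
      rw [mul_one_div_cancel (by positivity), one_smul]
  have h1 : dist (bary w) (w j) = ‖((bary w : Dl n) : Fin n → ℝ) - w j‖ := by
    rw [Subtype.dist_eq, dist_eq_norm]
    rfl
  rw [h1, e, ← Finset.add_sum_erase _ _ (Finset.mem_univ j), sub_self, smul_zero, zero_add]
  refine (norm_sum_le _ _).trans ?_
  have h2 : ∀ i ∈ Finset.univ.erase j,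
      ‖(1 / (k + 1 : ℝ)) • ((w i : Fin n → ℝ) - w j)‖ ≤ 1 / (k + 1 : ℝ) * r := by
    intro i _
    rw [norm_smul, Real.norm_of_nonneg (by positivity)]
    refine mul_le_mul_of_nonneg_left ?_ (by positivity)
    have := h i j
    rwa [Subtype.dist_eq, dist_eq_norm] at this
  refine (Finset.sum_le_card_nsmul _ _ _ h2).trans (le_of_eq ?_)
  rw [Finset.card_erase_of_mem (Finset.mem_univ j), Finset.card_univ, Fintype.card_fin, nsmul_eq_mul,
    Nat.add_sub_cancel]
  field_simp
  ring

/-- Ordered simplices with at most `N` vertices of pairwise distance at most `r`. -/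
def Fine (n N : ℕ) (r : ℝ) : Set (LS (Dl n)) :=
  {u | u.1 ≤ N ∧ ∀ i j, dist (u.2 i) (u.2 j) ≤ r}

theorem sd_single_mem {n N : ℕ} {r : ℝ} (hr : 0 ≤ r) (k : ℕ) (hk : k ≤ N) (w : Fin k → Dl n)
    (h : ∀ i j, dist (w i) (w j) ≤ r) : sd (single ⟨k, w⟩ 1) ∈
      C {u | u ∈ Fine n N ((1 - 1 / (N : ℝ)) * r) ∧ u.1 = k ∧ ∀ i, ∃ t, u.2 i = comb t w} := by
  induction k with
  | zero =>
    rw [sd_nil]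
    exact single_mem_C ⟨⟨hk, fun i => i.elim0⟩, rfl, fun i => i.elim0⟩
  | succ k ih =>
    rw [sd_succ, bd_single, bdAux, map_sum, map_sum]
    refine sum_mem fun i _ => ?_
    rw [map_smul, map_smul]
    refine Submodule.smul_mem _ _ ?_
    refine map_C (fun u hu => ?_) (ih (by omega) (w ∘ i.succAbove) fun _ _ => h _ _)
    rw [cone_single]
    refine single_mem_C ?_
    obtain ⟨m, u⟩ := u
    obtain ⟨⟨h1, h2⟩, rfl, h3⟩ := hu
    have hN : (0 : ℝ) < N := by exact_mod_cast (by omega : 0 < N)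
    have hc : (1 - 1 / (m + 1 : ℝ)) * r ≤ (1 - 1 / (N : ℝ)) * r := by
      refine mul_le_mul_of_nonneg_right (sub_le_sub_left ?_ _) hr
      exact one_div_le_one_div_of_le (by positivity) (by exact_mod_cast hk)
    have hc0 : 0 ≤ (1 - 1 / (N : ℝ)) * r := by
      refine mul_nonneg (sub_nonneg.2 ?_) hr
      rw [div_le_one hN]
      exact_mod_cast (by omega : 1 ≤ N)
    have h4 : ∀ j, ∃ t, u j = comb t w := fun j => by
      obtain ⟨t, ht⟩ := h3 j
      exact ⟨_, ht.trans (comb_comp t _ w)⟩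
    have h5 : ∀ j, dist (u j) (bary w) ≤ (1 - 1 / (N : ℝ)) * r := fun j => by
      obtain ⟨t, ht⟩ := h4 j
      rw [ht]
      exact dist_comb_le (fun i => by rw [dist_comm]; exact (dist_bary_le h i).trans hc) t
    refine ⟨⟨hk, fun a b => ?_⟩, rfl, fun a => ?_⟩
    · refine Fin.cases ?_ (fun a => ?_) a <;> refine Fin.cases ?_ (fun b => ?_) b
      · simpa [consS] using hc0
      · simpa [consS, dist_comm] using h5 b
      · simpa [consS] using h5 a
      · simpa [consS] using h2 a b
    · refine Fin.cases ⟨_, rfl⟩ (fun a => ?_) a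
      simpa [consS] using h4 a

theorem sd_mem_Fine {n N : ℕ} {r : ℝ} (hr : 0 ≤ r) {x : Ch (LS (Dl n))} (hx : x ∈ C (Fine n N r)) :
    sd x ∈ C (Fine n N ((1 - 1 / (N : ℝ)) * r)) :=
  map_C (fun u hu => Finsupp.supported_mono (fun _ h => h.1)
    (sd_single_mem hr u.1 hu.1 u.2 hu.2)) hx

theorem sd_iterate_mem_Fine {n N : ℕ} (hN : 1 ≤ N) {r : ℝ} (hr : 0 ≤ r) (m : ℕ)
    {x : Ch (LS (Dl n))} (hx : x ∈ C (Fine n N r)) :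
    (sd^[m]) x ∈ C (Fine n N ((1 - 1 / (N : ℝ)) ^ m * r)) := by
  induction m with
  | zero => simpa using hx
  | succ m ih =>
    rw [Function.iterate_succ_apply', pow_succ', mul_assoc]
    refine sd_mem_Fine (mul_nonneg (pow_nonneg (sub_nonneg.2 ?_) _) hr) ih
    rw [div_le_one (by exact_mod_cast hN)]
    exact_mod_cast hN

end mesh

section small

instance : IsEmpty (Dl 0) := ⟨fun t => zero_ne_one t.2.2⟩

variable {E : Type} [TopologicalSpace E]

theorem exists_Sd_iterate_single {ι : Type} [Nonempty ι] {A : Set E} {O : ι → Set E}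
    (hO : ∀ i, IsOpen (O i)) (hA : A ⊆ ⋃ i, O i) {s : Sing E} (hs : s ∈ sg A) :
    ∃ m, (Sd^[m]) (single s (1 : ℤ)) ∈ C (⋃ i, sg (A ∩ O i)) := by
  obtain ⟨n, σ⟩ := s
  obtain ⟨hc, hσ⟩ := hs
  change Continuous σ at hc
  change ∀ t, σ t ∈ A at hσ
  obtain ⟨δ, hδ, hL⟩ := lebesgue_number_lemma_of_metric (s := (Set.univ : Set (Dl n)))
    (c := fun i => σ ⁻¹' O i) isCompact_univ (fun i => (hO i).preimage hc)
    (fun t _ => by simpa using hA (hσ t))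
  obtain ⟨m, hm⟩ := exists_pow_lt_of_lt_one (show 0 < δ from hδ)
    (show 1 - 1 / ((n + 1 : ℕ) : ℝ) < 1 by
      have : 0 < 1 / ((n + 1 : ℕ) : ℝ) := by positivity
      linarith)
  refine ⟨m, ?_⟩
  rw [single_eq_real, Sd_iterate_real]
  have h1 : single (verts n) (1 : ℤ) ∈ C (Fine n (n + 1) 1) := by
    refine single_mem_C ⟨Nat.le_succ n, fun i j => ?_⟩
    have := Metric.dist_le_diam_of_mem (bounded_stdSimplex (Fin n))
      (stdSimplex.vertex (S := ℝ) i).2 (stdSimplex.vertex (S := ℝ) j).2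
    exact this.trans diam_stdSimplex_le
  refine map_C (fun u hu => ?_) (sd_iterate_mem_Fine (by omega) zero_le_one m h1)
  rw [real_single]
  refine single_mem_C ?_
  obtain ⟨k, u⟩ := u
  obtain ⟨-, h2⟩ := hu
  cases k with
  | zero =>
    refine Set.mem_iUnion.2 ⟨Classical.arbitrary ι, hc.comp (continuous_comb _), fun t => ?_⟩
    exact isEmptyElim (α := Dl 0) t
  | succ k =>
    obtain ⟨i, hi⟩ := hL (u 0) trivial
    refine Set.mem_iUnion.2 ⟨i, hc.comp (continuous_comb _), fun t => ⟨hσ _, hi ?_⟩⟩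
    rw [Metric.mem_ball]
    refine lt_of_le_of_lt (dist_comb_le (fun j => h2 j 0) t) ?_
    simpa using hm

theorem exists_Sd_iterate {ι : Type} [Nonempty ι] {A : Set E} {O : ι → Set E}
    (hO : ∀ i, IsOpen (O i)) (hA : A ⊆ ⋃ i, O i) {x : Ch (Sing E)} (hx : x ∈ C (sg A)) :
    ∃ m, (Sd^[m]) x ∈ C (⋃ i, sg (A ∩ O i)) := by
  have hst : Stable (⋃ i, sg (A ∩ O i)) := Stable.iUnion fun i => stable_sg _
  have hup : ∀ m l (y : Ch (Sing E)), (Sd^[m]) y ∈ C (⋃ i, sg (A ∩ O i)) →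
      (Sd^[l + m]) y ∈ C (⋃ i, sg (A ∩ O i)) := by
    intro m l y h
    rw [Function.iterate_add_apply]
    induction l with
    | zero => exact h
    | succ l ih => rw [Function.iterate_succ_apply']; exact hst.Sd_mem ih
  have hpow : ∀ (m : ℕ) (y : Ch (Sing E)), (Sd^[m]) y = (Sd ^ m) y := fun m y => by
    rw [Module.End.pow_apply]
  rw [C, Finsupp.supported_eq_span_single] at hx
  induction hx using Submodule.span_induction with
  | mem x h => obtain ⟨s, hs, rfl⟩ := h; exact exists_Sd_iterate_single hO hA hs
  | zero => exact ⟨0, Submodule.zero_mem _⟩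
  | add x y _ _ hx hy =>
    obtain ⟨m, hm⟩ := hx
    obtain ⟨l, hl⟩ := hy
    refine ⟨l + m, ?_⟩
    have h1 := hup m l x hm
    have h2 := hup l m y hl
    rw [add_comm m l] at h2
    rw [hpow] at *
    rw [map_add]
    exact add_mem h1 h2
  | smul a x _ hx =>
    obtain ⟨m, hm⟩ := hx
    refine ⟨m, ?_⟩
    rw [hpow] at *
    rw [map_smul]
    exact Submodule.smul_mem _ _ hm

/-- Singular homology can be computed by chains that are small with respect to an open cover. -/
theorem acyc_small {ι : Type} [Nonempty ι] {A : Set E} {O : ι → Set E}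
    (hO : ∀ i, IsOpen (O i)) (hA : A ⊆ ⋃ i, O i) :
    Acyc d (C (sg A)) (C (⋃ i, sg (A ∩ O i))) := by
  have hst : Stable (⋃ i, sg (A ∩ O i)) := Stable.iUnion fun i => stable_sg _
  have key : ∀ m, ∀ x ∈ C (sg A), d x ∈ C (⋃ i, sg (A ∩ O i)) →
      (Sd^[m]) x ∈ C (⋃ i, sg (A ∩ O i)) → ∃ y ∈ C (sg A), x - d y ∈ C (⋃ i, sg (A ∩ O i)) := by
    intro m
    induction m with
    | zero => exact fun x _ _ h => ⟨0, Submodule.zero_mem _, by simpa using h⟩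
    | succ m ih =>
      intro x hx hdx h
      obtain ⟨y, hy, hy'⟩ := ih (Sd x) ((stable_sg A).Sd_mem hx)
        (by rw [d_Sd]; exact hst.Sd_mem hdx) h
      refine ⟨y + Sdh x, add_mem hy ((stable_sg A).Sdh_mem hx), ?_⟩
      convert add_mem hy' (hst.Sdh_mem hdx) using 1
      rw [map_add, eq_sub_of_add_eq (d_Sdh x)]
      abel
  intro x hx hdx
  obtain ⟨m, hm⟩ := exists_Sd_iterate hO hA hx
  exact key m x hx hdx hm

end small

end

section

open Finsupp Cvx

section projective

/-- Subgroups of projective abelian groups are projective. -/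
theorem projective_of_injective {K P : Type} [AddCommGroup K] [AddCommGroup P]
    [Module.Projective ℤ P] (i : K →ₗ[ℤ] P) (hi : Function.Injective i) :
    Module.Projective ℤ K := by
  let q : (K →₀ ℤ) →ₗ[ℤ] K := Finsupp.linearCombination ℤ id
  have hq : Function.Surjective q := fun k => ⟨single k 1, by simp [q]⟩
  let ι : (K →₀ ℤ) →ₗ[ℤ] (K →₀ ℚ) := Finsupp.mapRange.linearMap (Algebra.linearMap ℤ ℚ)
  have hι : Function.Injective ι :=
    Finsupp.mapRange_injective _ (map_zero _) Int.cast_injective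
  let N : Submodule ℤ (K →₀ ℚ) := (LinearMap.ker q).map ι
  have : ∀ n : ℤ, n ≠ 0 → Function.Surjective fun x : (K →₀ ℚ) ⧸ N => n • x := by
    intro n hn x
    obtain ⟨x, rfl⟩ := N.mkQ_surjective x
    refine ⟨N.mkQ ((n : ℚ)⁻¹ • x), ?_⟩
    have hn' : (n : ℚ) ≠ 0 := by exact_mod_cast hn
    change n • N.mkQ ((n : ℚ)⁻¹ • x) = N.mkQ x
    rw [← map_zsmul, ← Int.cast_smul_eq_zsmul ℚ, smul_smul, mul_inv_cancel₀ hn', one_smul]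
  let _ : DivisibleBy ((K →₀ ℚ) ⧸ N) ℤ :=
    divisibleByOfSMulRightSurj _ _ fun {n} hn => this n hn
  have hker : LinearMap.ker q ≤ LinearMap.ker (N.mkQ ∘ₗ ι) := fun x hx => by
    simpa [LinearMap.mem_ker] using Submodule.mem_map_of_mem hx
  let e : K →ₗ[ℤ] (K →₀ ℚ) ⧸ N :=
    (LinearMap.ker q).liftQ (N.mkQ ∘ₗ ι) hker ∘ₗ (q.quotKerEquivOfSurjective hq).symm.toLinearMap
  have he : ∀ x, e (q x) = N.mkQ (ι x) := fun x => by
    have h : (q.quotKerEquivOfSurjective hq).symm (q x) = (LinearMap.ker q).mkQ x := by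
      rw [LinearEquiv.symm_apply_eq]; rfl
    simp [e, h]
  obtain ⟨e', he'⟩ := (Module.Baer.of_divisible ((K →₀ ℚ) ⧸ N)).extension_property i hi e
  obtain ⟨g, hg⟩ := Module.projective_lifting_property N.mkQ e' N.mkQ_surjective
  have hr : ∀ k, g (i k) ∈ LinearMap.range ι := fun k => by
    obtain ⟨x, rfl⟩ := hq k
    have h1 : N.mkQ (g (i (q x))) = N.mkQ (ι x) := by
      rw [← he, ← he', ← hg]; rfl
    have h2 : g (i (q x)) - ι x ∈ N := (Submodule.Quotient.eq N).1 h1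
    obtain ⟨y, -, hy⟩ := h2
    exact ⟨y + x, by rw [map_add, hy, sub_add_cancel]⟩
  let s : K →ₗ[ℤ] (K →₀ ℤ) := (LinearEquiv.ofInjective ι hι).symm.toLinearMap ∘ₗ
    (g ∘ₗ i).codRestrict (LinearMap.range ι) hr
  have hs : ∀ k, ι (s k) = g (i k) := fun k => by
    have := congrArg Subtype.val ((LinearEquiv.ofInjective ι hι).apply_symm_apply
      ((g ∘ₗ i).codRestrict (LinearMap.range ι) hr k))
    exact this
  refine Module.Projective.of_split s q (LinearMap.ext fun k => ?_)
  obtain ⟨x, rfl⟩ := hq k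
  have h1 : N.mkQ (ι (s (q x))) = N.mkQ (ι x) := by rw [hs, ← he, ← he', ← hg]; rfl
  have h2 : ι (s (q x)) - ι x ∈ N := (Submodule.Quotient.eq N).1 h1
  obtain ⟨y, hy, hy'⟩ := h2
  rw [← map_sub] at hy'
  rw [hι hy'] at hy
  simpa [sub_eq_zero] using hy

theorem projective_of_ker {Q Q' : Type} [AddCommGroup Q] [AddCommGroup Q']
    [Module.Projective ℤ Q'] (f : Q →ₗ[ℤ] Q') (hf : Module.Projective ℤ (LinearMap.ker f)) :
    Module.Projective ℤ Q := by
  have := projective_of_injective (LinearMap.range f).subtype Subtype.val_injective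
  obtain ⟨s, hs⟩ := Module.projective_lifting_property f.rangeRestrict LinearMap.id
    f.surjective_rangeRestrict
  have hs' : ∀ r, f (s r) = r := fun r => congrArg Subtype.val (LinearMap.congr_fun hs r)
  let φ : (LinearMap.ker f × LinearMap.range f) →ₗ[ℤ] Q := (LinearMap.ker f).subtype.coprod s
  refine Module.Projective.of_equiv (LinearEquiv.ofBijective φ ⟨?_, fun x => ?_⟩)
  · rw [← LinearMap.ker_eq_bot, LinearMap.ker_eq_bot']
    rintro ⟨k, r⟩ h
    have h : (k : Q) + s r = 0 := by simpa [φ] using h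
    have h' := congrArg f h
    rw [map_add, hs', k.2, zero_add, map_zero] at h'
    have hr : r = 0 := Subtype.ext h'
    subst hr
    simp only [map_zero, add_zero] at h
    exact Prod.ext (Subtype.ext h) rfl
  · refine ⟨(⟨x - s (f.rangeRestrict x), ?_⟩, f.rangeRestrict x), by simp [φ]⟩
    rw [LinearMap.mem_ker, map_sub, hs']; simp

end projective

section subquotient

variable {M M' : Type} [AddCommGroup M] [AddCommGroup M']
  {Z B : Submodule ℤ M} {Z' B' : Submodule ℤ M'}

/-- The subquotient `Z / (Z ∩ B)` is projective. -/
def Pr (Z B : Submodule ℤ M) : Prop := Module.Projective ℤ (Z ⧸ B.submoduleOf Z)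

/-- The map induced on subquotients. -/
noncomputable def subquotMap (f : M →ₗ[ℤ] M') (hZ : ∀ z ∈ Z, f z ∈ Z')
    (hB : ∀ z ∈ Z, z ∈ B → f z ∈ B') :
    (Z ⧸ B.submoduleOf Z) →ₗ[ℤ] (Z' ⧸ B'.submoduleOf Z') :=
  Submodule.mapQ _ _ (f.restrict hZ) fun z hz => hB z z.2 hz

theorem subquot_surj (z : Z ⧸ B.submoduleOf Z) : ∃ x, ∃ h : x ∈ Z, (B.submoduleOf Z).mkQ ⟨x, h⟩ = z := by
  obtain ⟨⟨x, h⟩, rfl⟩ := (B.submoduleOf Z).mkQ_surjective z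
  exact ⟨x, h, rfl⟩

theorem subquot_eq_zero {x : M} (h : x ∈ Z) : (B.submoduleOf Z).mkQ ⟨x, h⟩ = 0 ↔ x ∈ B := by
  rw [Submodule.mkQ_apply, Submodule.Quotient.mk_eq_zero]
  rfl

theorem subquotMap_mk (f : M →ₗ[ℤ] M') (hZ : ∀ z ∈ Z, f z ∈ Z')
    (hB : ∀ z ∈ Z, z ∈ B → f z ∈ B') {x : M} (h : x ∈ Z) :
    subquotMap f hZ hB ((B.submoduleOf Z).mkQ ⟨x, h⟩) = (B'.submoduleOf Z').mkQ ⟨f x, hZ x h⟩ := rfl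

theorem Pr.of_le (h : Z ≤ B) : Pr Z B := by
  have : Subsingleton (Z ⧸ B.submoduleOf Z) := subsingleton_of_forall_eq 0 fun z => by
    obtain ⟨x, hx, rfl⟩ := subquot_surj z
    exact (subquot_eq_zero hx).2 (h hx)
  exact (inferInstance : Module.Projective ℤ (Z ⧸ B.submoduleOf Z))

theorem subquotMap_injective (f : M →ₗ[ℤ] M') (hZ : ∀ z ∈ Z, f z ∈ Z')
    (hB : ∀ z ∈ Z, z ∈ B → f z ∈ B') (hi : ∀ z ∈ Z, f z ∈ B' → z ∈ B) :
    Function.Injective (subquotMap f hZ hB) := by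
  rw [← LinearMap.ker_eq_bot, LinearMap.ker_eq_bot']
  intro z hz
  obtain ⟨x, h, rfl⟩ := subquot_surj z
  rw [subquotMap_mk, subquot_eq_zero] at hz
  exact (subquot_eq_zero h).2 (hi x h hz)

theorem subquotMap_surjective (f : M →ₗ[ℤ] M') (hZ : ∀ z ∈ Z, f z ∈ Z')
    (hB : ∀ z ∈ Z, z ∈ B → f z ∈ B') (hs : ∀ z ∈ Z', ∃ x ∈ Z, z - f x ∈ B') :
    Function.Surjective (subquotMap f hZ hB) := by
  intro z
  obtain ⟨x, h, rfl⟩ := subquot_surj z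
  obtain ⟨y, hy, hxy⟩ := hs x h
  refine ⟨(B.submoduleOf Z).mkQ ⟨y, hy⟩, ?_⟩
  rw [subquotMap_mk, eq_comm, ← sub_eq_zero, ← map_sub]
  exact (subquot_eq_zero (Z := Z') (sub_mem h (hZ y hy))).2 hxy

theorem Pr.of_inj (f : M →ₗ[ℤ] M') (hZ : ∀ z ∈ Z, f z ∈ Z')
    (hB : ∀ z ∈ Z, z ∈ B → f z ∈ B') (hi : ∀ z ∈ Z, f z ∈ B' → z ∈ B) (h : Pr Z' B') : Pr Z B := by
  have : Module.Projective ℤ (Z' ⧸ B'.submoduleOf Z') := h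
  exact projective_of_injective _ (subquotMap_injective f hZ hB hi)

theorem Pr.of_bij (f : M →ₗ[ℤ] M') (hZ : ∀ z ∈ Z, f z ∈ Z')
    (hB : ∀ z ∈ Z, z ∈ B → f z ∈ B') (hi : ∀ z ∈ Z, f z ∈ B' → z ∈ B)
    (hs : ∀ z ∈ Z', ∃ x ∈ Z, z - f x ∈ B') (h : Pr Z B) : Pr Z' B' := by
  have : Module.Projective ℤ (Z ⧸ B.submoduleOf Z) := h
  exact Module.Projective.of_equiv (LinearEquiv.ofBijective _
    ⟨subquotMap_injective f hZ hB hi, subquotMap_surjective f hZ hB hs⟩)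

theorem Pr.of_ker (f : M →ₗ[ℤ] M') (hZ : ∀ z ∈ Z, f z ∈ Z')
    (hB : ∀ z ∈ Z, z ∈ B → f z ∈ B') (h : Pr Z' B') (hK : Pr (Z ⊓ B'.comap f) B) : Pr Z B := by
  have : Module.Projective ℤ (Z' ⧸ B'.submoduleOf Z') := h
  refine projective_of_ker (subquotMap f hZ hB) ?_
  have : Module.Projective ℤ (↥(Z ⊓ B'.comap f) ⧸ B.submoduleOf (Z ⊓ B'.comap f)) := hK
  let g : (↥(Z ⊓ B'.comap f) ⧸ B.submoduleOf (Z ⊓ B'.comap f)) →ₗ[ℤ] (Z ⧸ B.submoduleOf Z) :=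
    subquotMap LinearMap.id (fun z hz => hz.1) fun z _ h => h
  have hg : Function.Injective g := subquotMap_injective _ _ _ fun _ _ h => h
  have hr : LinearMap.range g = LinearMap.ker (subquotMap f hZ hB) := by
    ext z
    constructor
    · rintro ⟨y, rfl⟩
      obtain ⟨x, hx, rfl⟩ := subquot_surj y
      rw [LinearMap.mem_ker, subquotMap_mk, subquotMap_mk, subquot_eq_zero]
      exact hx.2
    · intro hz
      obtain ⟨x, hx, rfl⟩ := subquot_surj z
      rw [LinearMap.mem_ker, subquotMap_mk, subquot_eq_zero] at hz
      exact ⟨(B.submoduleOf (Z ⊓ B'.comap f)).mkQ ⟨x, hx, hz⟩, rfl⟩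
  rw [← hr]
  exact Module.Projective.of_equiv (LinearEquiv.ofInjective g hg)

end subquotient

end

section

open Finsupp Cvx

section degree

variable {E E' : Type}

theorem eq_on_C {α M : Type} [AddCommGroup M] {S : Set α} {f g : Ch α →ₗ[ℤ] M}
    (h : ∀ s ∈ S, f (single s 1) = g (single s 1)) {x : Ch α} (hx : x ∈ C S) : f x = g x := by
  have := map_C (f := f - g) (N := ⊥) (fun s hs => by simp [h s hs]) hx
  exact sub_eq_zero.1 this

theorem C_mono {α : Type} {S T : Set α} (h : S ⊆ T) : C S ≤ C T := Finsupp.supported_mono h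

/-- Singular chains on simplices with `n` vertices. -/
abbrev Dg (E : Type) (n : ℕ) : Submodule ℤ (Ch (Sing E)) := C {s : Sing E | s.1 = n}

/-- The projection to the part with `n` vertices. -/
noncomputable def prn (n : ℕ) : Ch (Sing E) →ₗ[ℤ] Ch (Sing E) :=
  linearCombination ℤ fun s => if s.1 = n then single s 1 else 0

theorem prn_single (n : ℕ) (s : Sing E) :
    prn n (single s 1) = if s.1 = n then single s 1 else 0 := by simp [prn]

theorem prn_mem (n : ℕ) {S : Set (Sing E)} {x : Ch (Sing E)} (hx : x ∈ C S) : prn n x ∈ C S := by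
  refine map_C (fun s hs => ?_) hx
  rw [prn_single]
  split_ifs
  · exact single_mem_C hs
  · exact zero_mem _

theorem prn_mem_Dg (n : ℕ) (x : Ch (Sing E)) : prn n x ∈ Dg E n := by
  refine map_C (S := Set.univ) (fun s _ => ?_) (by simp)
  rw [prn_single]
  split_ifs with h
  · exact single_mem_C h
  · exact zero_mem _

theorem prn_of_mem {n : ℕ} {x : Ch (Sing E)} (hx : x ∈ Dg E n) : prn n x = x := by
  refine eq_on_C (g := LinearMap.id) (fun s hs => ?_) hx
  have hs : s.1 = n := hs
  simp [prn_single, hs]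

theorem prn_of_ne {n m : ℕ} (h : m ≠ n) {x : Ch (Sing E)} (hx : x ∈ Dg E m) : prn n x = 0 := by
  have : (prn n) x ∈ (⊥ : Submodule ℤ (Ch (Sing E))) := by
    refine map_C (fun s hs => ?_) hx
    have hs : s.1 = m := hs
    simp [prn_single, hs, h]
  exact this

theorem d_mem_Dg {n : ℕ} {x : Ch (Sing E)} (hx : x ∈ Dg E (n + 1)) : d x ∈ Dg E n := by
  refine map_C (fun s hs => ?_) hx
  obtain ⟨k, σ⟩ := s
  obtain rfl : k = n + 1 := hs
  rw [d_single]
  refine map_C (fun u hu => ?_) (bd_single_mem n _)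
  rw [real_single]
  exact single_mem_C hu

theorem d_Dg_zero {x : Ch (Sing E)} (hx : x ∈ Dg E 0) : d x = 0 := by
  have : d x ∈ (⊥ : Submodule ℤ (Ch (Sing E))) := by
    refine map_C (fun s hs => ?_) hx
    obtain ⟨k, σ⟩ := s
    obtain rfl : k = 0 := hs
    rw [d_single, verts, bd_nil, map_zero]
    exact zero_mem _
  exact this

theorem d_prn (n : ℕ) (x : Ch (Sing E)) : d (prn (n + 1) x) = prn n (d x) := by
  have : d ∘ₗ prn (n + 1) = (prn n ∘ₗ d : Ch (Sing E) →ₗ[ℤ] _) := hom_ext fun s => by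
    obtain ⟨k, σ⟩ := s
    have hm : single (⟨k, σ⟩ : Sing E) (1 : ℤ) ∈ Dg E k := single_mem_C rfl
    simp only [LinearMap.comp_apply]
    by_cases h : k = n + 1
    · subst h
      rw [prn_of_mem hm, prn_of_mem (d_mem_Dg hm)]
    · rw [prn_of_ne h hm, map_zero]
      cases k with
      | zero => rw [d_Dg_zero hm, map_zero]
      | succ j => rw [prn_of_ne (by omega) (d_mem_Dg hm)]
  exact LinearMap.congr_fun this x

theorem push_mem_Dg (f : E → E') {n : ℕ} {x : Ch (Sing E)} (hx : x ∈ Dg E n) :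
    push f x ∈ Dg E' n :=
  map_C (fun s hs => by rw [push_single]; exact single_mem_C hs) hx

end degree

section relative

variable {E E' : Type} [TopologicalSpace E] [TopologicalSpace E'] {n : ℕ} {R S T A B : Set E}

/-- Relative cycles with `n` vertices. -/
noncomputable def Z (n : ℕ) (A B : Set E) : Submodule ℤ (Ch (Sing E)) :=
  C (sg A) ⊓ Dg E n ⊓ (C (sg B)).comap d

/-- Relative boundaries. -/
noncomputable def Bd (A B : Set E) : Submodule ℤ (Ch (Sing E)) := C (sg B) ⊔ (C (sg A)).map d

/-- Vanishing of relative homology. -/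
def Van (n : ℕ) (A B : Set E) : Prop := Z n A B ≤ Bd A B

/-- Projectivity of relative homology. -/
def Pj (n : ℕ) (A B : Set E) : Prop := Pr (Z n A B) (Bd A B)

theorem Csg_mono (h : A ⊆ B) : C (sg A) ≤ C (sg B) := C_mono (sg_mono h)

theorem d_mem_sg {x : Ch (Sing E)} (hx : x ∈ C (sg A)) : d x ∈ C (sg A) := (stable_sg A).d_mem hx

theorem mem_Z {x : Ch (Sing E)} :
    x ∈ Z n A B ↔ x ∈ C (sg A) ∧ x ∈ Dg E n ∧ d x ∈ C (sg B) := by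
  rw [Z, Submodule.mem_inf, Submodule.mem_inf, and_assoc]; rfl

theorem mem_Bd {x : Ch (Sing E)} :
    x ∈ Bd A B ↔ ∃ y ∈ C (sg A), x - d y ∈ C (sg B) := by
  rw [Bd, Submodule.mem_sup]
  constructor
  · rintro ⟨s, hs, _, ⟨y, hy, rfl⟩, rfl⟩
    exact ⟨y, hy, by simpa using hs⟩
  · rintro ⟨y, hy, h⟩
    exact ⟨_, h, _, ⟨y, hy, rfl⟩, by simp⟩

theorem exists_of_mem_Bd {x : Ch (Sing E)} (hx : x ∈ Bd A B) (hn : x ∈ Dg E n) :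
    ∃ y ∈ C (sg A), y ∈ Dg E (n + 1) ∧ x - d y ∈ C (sg B) := by
  obtain ⟨y, hy, h⟩ := mem_Bd.1 hx
  refine ⟨prn (n + 1) y, prn_mem _ hy, prn_mem_Dg _ _, ?_⟩
  have := prn_mem n h
  rwa [map_sub, prn_of_mem hn, ← d_prn] at this

theorem mem_Bd_of_Csg {x : Ch (Sing E)} (hx : x ∈ C (sg B)) : x ∈ Bd A B :=
  mem_Bd.2 ⟨0, zero_mem _, by simpa using hx⟩

theorem Bd_mono_left (h : A ⊆ S) : Bd A B ≤ Bd S B := fun x hx => by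
  obtain ⟨y, hy, hxy⟩ := mem_Bd.1 hx
  exact mem_Bd.2 ⟨y, Csg_mono h hy, hxy⟩

theorem Bd_mono_right (h : B ⊆ S) : Bd A B ≤ Bd A S := fun x hx => by
  obtain ⟨y, hy, hxy⟩ := mem_Bd.1 hx
  exact mem_Bd.2 ⟨y, hy, Csg_mono h hxy⟩

theorem Van.pj (h : Van n A B) : Pj n A B := Pr.of_le h

theorem Van.zero : Van 0 A B := by
  intro x hx
  obtain ⟨h1, h2, h3⟩ := mem_Z.1 hx
  refine mem_Bd_of_Csg (map_C (S := sg A ∩ {s | s.1 = 0}) (f := LinearMap.id) (fun s hs => ?_) ?_)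
  · obtain ⟨k, σ⟩ := s
    obtain ⟨hs, rfl⟩ : _ ∧ k = 0 := hs
    exact single_mem_C ⟨hs.1, fun t => isEmptyElim t⟩
  · rw [C, Finsupp.supported_inter]; exact ⟨h1, h2⟩

theorem van_of_acyc (h : Acyc d (C (sg A)) (C (sg B))) (n : ℕ) : Van n A B := fun x hx => by
  obtain ⟨h1, -, h3⟩ := mem_Z.1 hx
  exact mem_Bd.2 (h x h1 h3)

theorem Van.trans (hRS : R ⊆ S) (hST : S ⊆ T) (h1 : Van n S R) (h2 : Van n T S) : Van n T R := by
  intro x hx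
  obtain ⟨hx1, hx2, hx3⟩ := mem_Z.1 hx
  obtain ⟨y, hy, hyn, hxy⟩ := exists_of_mem_Bd (h2 (mem_Z.2 ⟨hx1, hx2, Csg_mono hRS hx3⟩)) hx2
  have : x - d y ∈ Bd S R := h1 (mem_Z.2 ⟨hxy, sub_mem hx2 (d_mem_Dg hyn),
    by rwa [map_sub, d_d, sub_zero]⟩)
  obtain ⟨w, hw, h⟩ := mem_Bd.1 this
  exact mem_Bd.2 ⟨y + w, add_mem hy (Csg_mono hST hw), by rwa [map_add, ← sub_sub]⟩

theorem Van.of_left (hRS : R ⊆ S) (hST : S ⊆ T) (h1 : Van n S R) (h2 : Van (n + 1) T R) :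
    Van (n + 1) T S := by
  intro x hx
  obtain ⟨hx1, hx2, hx3⟩ := mem_Z.1 hx
  obtain ⟨y, hy, hyn, hxy⟩ := exists_of_mem_Bd
    (h1 (mem_Z.2 ⟨hx3, d_mem_Dg hx2, by rw [d_d]; exact zero_mem _⟩)) (d_mem_Dg hx2)
  have : x - y ∈ Bd T R := h2 (mem_Z.2 ⟨sub_mem hx1 (Csg_mono hST hy), sub_mem hx2 hyn,
    by rwa [map_sub]⟩)
  obtain ⟨w, hw, h⟩ := mem_Bd.1 this
  refine mem_Bd.2 ⟨w, hw, ?_⟩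
  convert add_mem hy (Csg_mono hRS h) using 1
  abel

/-- Projectivity for a triple with vanishing connecting map. -/
theorem Pj.trans (hRS : R ⊆ S) (hST : S ⊆ T) (hδ : ∀ y ∈ Z (n + 1) T S, d y ∈ Bd S R)
    (h1 : Pj n S R) (h2 : Pj n T S) : Pj n T R := by
  have hZ : Z n T R ≤ Z n T S := fun x hx => by
    obtain ⟨hx1, hx2, hx3⟩ := mem_Z.1 hx
    exact mem_Z.2 ⟨hx1, hx2, Csg_mono hRS hx3⟩
  refine Pr.of_ker LinearMap.id (fun x hx => hZ hx) (fun x _ hx => Bd_mono_right hRS hx) h2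
    (Pr.of_bij (Z := Z n S R) (B := Bd S R) LinearMap.id (fun x hx => ?_)
      (fun x _ hx => Bd_mono_left hST hx) (fun x hx hx' => ?_) (fun x hx => ?_) h1)
  · obtain ⟨hx1, hx2, hx3⟩ := mem_Z.1 hx
    exact ⟨mem_Z.2 ⟨Csg_mono hST hx1, hx2, hx3⟩, mem_Bd_of_Csg hx1⟩
  · obtain ⟨hx1, hx2, hx3⟩ := mem_Z.1 hx
    obtain ⟨y, hy, hyn, hxy⟩ := exists_of_mem_Bd (x := x) hx' hx2
    have hdy : d y ∈ C (sg S) := by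
      convert sub_mem hx1 (Csg_mono hRS hxy) using 1
      abel
    convert add_mem (mem_Bd_of_Csg hxy) (hδ y (mem_Z.2 ⟨hy, hyn, hdy⟩)) using 1
    abel
  · obtain ⟨hx1, hx2, hx3⟩ := mem_Z.1 hx.1
    obtain ⟨y, hy, hyn, hxy⟩ := exists_of_mem_Bd (x := x) hx.2 hx2
    refine ⟨x - d y, mem_Z.2 ⟨hxy, sub_mem hx2 (d_mem_Dg hyn),
      by rwa [map_sub, d_d, sub_zero]⟩, mem_Bd.2 ⟨y, hy, ?_⟩⟩
    simp

theorem Pj.trans_of_left (hRS : R ⊆ S) (hST : S ⊆ T) (h1 : Van n S R) (h2 : Pj n T S) :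
    Pj n T R :=
  Pj.trans hRS hST (fun y hy => h1 (mem_Z.2 ⟨(mem_Z.1 hy).2.2, d_mem_Dg (mem_Z.1 hy).2.1,
    by rw [d_d]; exact zero_mem _⟩)) h1.pj h2

theorem Pj.trans_of_right (hRS : R ⊆ S) (hST : S ⊆ T) (hv : Van (n + 1) T S) (h1 : Pj n S R)
    (h2 : Pj n T S) : Pj n T R := by
  refine Pj.trans hRS hST (fun y hy => ?_) h1 h2
  obtain ⟨w, hw, h⟩ := mem_Bd.1 (hv hy)
  refine mem_Bd.2 ⟨_, h, ?_⟩
  simp [d_d]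

theorem Pj.of_connecting (hRS : R ⊆ S) (hST : S ⊆ T) (hv : Van (n + 1) T R) (h1 : Pj n S R) :
    Pj (n + 1) T S := by
  refine Pr.of_inj (Z' := Z n S R) (B' := Bd S R) d (fun x hx => ?_) (fun x hx hx' => ?_)
    (fun x hx hx' => ?_) h1
  · obtain ⟨hx1, hx2, hx3⟩ := mem_Z.1 hx
    exact mem_Z.2 ⟨hx3, d_mem_Dg hx2, by rw [d_d]; exact zero_mem _⟩
  · obtain ⟨y, hy, hxy⟩ := mem_Bd.1 hx'
    refine mem_Bd.2 ⟨_, hxy, by simp [d_d]⟩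
  · obtain ⟨hx1, hx2, hx3⟩ := mem_Z.1 hx
    obtain ⟨y, hy, hyn, hxy⟩ := exists_of_mem_Bd hx' (d_mem_Dg hx2)
    have := hv (mem_Z.2 ⟨sub_mem hx1 (Csg_mono hST hy), sub_mem hx2 hyn, by rwa [map_sub]⟩)
    convert add_mem (Bd_mono_right hRS this) (mem_Bd_of_Csg hy) using 1
    abel

/-- Deformation of `A` into `B`. -/
theorem van_of_deformation (h : ℝ × E → E) (hc : ContinuousOn h (Set.Icc 0 1 ×ˢ A))
    (hA : ∀ t ∈ Set.Icc (0 : ℝ) 1, ∀ x ∈ A, h (t, x) ∈ A)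
    (hB : ∀ t ∈ Set.Icc (0 : ℝ) 1, ∀ x ∈ B, h (t, x) ∈ B) (hBA : B ⊆ A)
    (h0 : ∀ x ∈ A, h (0, x) = x) (h1 : ∀ x ∈ A, h (1, x) ∈ B) (n : ℕ) : Van n A B := by
  have e0 : ∀ x ∈ C (sg A), push (fun e => h (0, e)) x = x := fun x hx => by
    refine eq_on_C (g := LinearMap.id) (fun s hs => ?_) hx
    have : pushS (fun e => h (0, e)) s = s := by
      obtain ⟨k, σ⟩ := s
      exact congrArg (Sigma.mk k) (funext fun t => h0 _ (hs.2 t))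
    simp [this]
  have h01 : (1 : ℝ) ∈ Set.Icc (0 : ℝ) 1 := ⟨zero_le_one, le_rfl⟩
  refine van_of_acyc (fun x hx hdx => ⟨-prism h x, neg_mem (prism_mem hc (fun p hp =>
    hA _ hp.1 _ hp.2) hx), ?_⟩) n
  have e1 := d_prism h x
  rw [e0 x hx] at e1
  have e2 : push (fun e => h (1, e)) x ∈ C (sg B) :=
    push_mem_sg (hc.comp (f := fun e => ((1 : ℝ), e)) (Continuous.continuousOn (by fun_prop))
      fun y hy => ⟨h01, hy⟩) h1 hx
  have e3 : prism h (d x) ∈ C (sg B) :=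
    prism_mem (hc.mono (Set.prod_mono le_rfl hBA)) (fun p hp => hB _ hp.1 _ hp.2) hdx
  convert sub_mem e2 e3 using 1
  rw [map_neg, eq_sub_iff_add_eq, sub_neg_eq_add, add_assoc, e1]
  abel

theorem push_push_eq {f : E → E'} {g : E' → E} (h : ∀ x ∈ A, g (f x) = x) {x : Ch (Sing E)}
    (hx : x ∈ C (sg A)) : push g (push f x) = x := by
  refine eq_on_C (f := push g ∘ₗ push f) (g := LinearMap.id) (fun s hs => ?_) hx
  have : pushS g (pushS f s) = s := by
    obtain ⟨k, σ⟩ := s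
    exact congrArg (Sigma.mk k) (funext fun t => h _ (hs.2 t))
  simp [this]

variable {A' B' : Set E'} {f : E → E'} {g : E' → E}

theorem push_mem_Z (hf : ContinuousOn f A) (hA : Set.MapsTo f A A') (hB : Set.MapsTo f B B')
    (hBA : B ⊆ A) {x : Ch (Sing E)} (hx : x ∈ Z n A B) : push f x ∈ Z n A' B' := by
  obtain ⟨hx1, hx2, hx3⟩ := mem_Z.1 hx
  exact mem_Z.2 ⟨push_mem_sg hf hA hx1, push_mem_Dg f hx2,
    by rw [← push_d]; exact push_mem_sg (hf.mono hBA) hB hx3⟩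

theorem push_mem_Bd (hf : ContinuousOn f A) (hA : Set.MapsTo f A A') (hB : Set.MapsTo f B B')
    (hBA : B ⊆ A) {x : Ch (Sing E)} (hx : x ∈ Bd A B) : push f x ∈ Bd A' B' := by
  obtain ⟨y, hy, hxy⟩ := mem_Bd.1 hx
  exact mem_Bd.2 ⟨push f y, push_mem_sg hf hA hy,
    by rw [← push_d, ← map_sub]; exact push_mem_sg (hf.mono hBA) hB hxy⟩

theorem exists_small {O₁ O₂ : Set E} (h1 : IsOpen O₁) (h2 : IsOpen O₂) (hA : A ⊆ O₁ ∪ O₂)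
    {x : Ch (Sing E)} (hx : x ∈ C (sg A)) (hd : d x ∈ C (sg (A ∩ O₁)) ⊔ C (sg (A ∩ O₂))) :
    ∃ u₁ ∈ C (sg (A ∩ O₁)), ∃ u₂ ∈ C (sg (A ∩ O₂)), ∃ w ∈ C (sg A), x = u₁ + u₂ + d w := by
  have e : C (⋃ i : Bool, sg (A ∩ cond i O₁ O₂)) = C (sg (A ∩ O₁)) ⊔ C (sg (A ∩ O₂)) := by
    have : ⋃ i : Bool, sg (A ∩ cond i O₁ O₂) = sg (A ∩ O₁) ∪ sg (A ∩ O₂) := by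
      ext; simp [or_comm]
    rw [this, C, Finsupp.supported_union]
  obtain ⟨y, hy, h⟩ := acyc_small (A := A) (O := fun i : Bool => cond i O₁ O₂)
    (by rintro (_ | _) <;> assumption)
    (fun z hz => by simpa [or_comm] using hA hz) x hx (by rw [e]; exact hd)
  rw [e] at h
  obtain ⟨u₁, hu₁, u₂, hu₂, hu⟩ := Submodule.mem_sup.1 h
  exact ⟨u₁, hu₁, u₂, hu₂, y, hy, by rw [hu]; abel⟩

theorem mem_sg_inter {x : Ch (Sing E)} (h1 : x ∈ C (sg A)) (h2 : x ∈ C (sg B)) :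
    x ∈ C (sg (A ∩ B)) := by
  rw [sg_inter, C, Finsupp.supported_inter]; exact ⟨h1, h2⟩

theorem excision_surj {O₁ O₂ : Set E} (h1 : IsOpen O₁) (h2 : IsOpen O₂) (hA : A ⊆ O₁ ∪ O₂)
    {x : Ch (Sing E)} (hx : x ∈ Z n A (A ∩ O₂)) :
    ∃ u ∈ Z n (A ∩ O₁) (A ∩ O₁ ∩ O₂), x - u ∈ Bd A (A ∩ O₂) := by
  obtain ⟨hx1, hx2, hx3⟩ := mem_Z.1 hx
  obtain ⟨u₁, hu₁, u₂, hu₂, w, hw, hu⟩ :=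
    exists_small h1 h2 hA hx1 (Submodule.mem_sup_right hx3)
  have hd : d (prn n u₁) ∈ C (sg (A ∩ O₂)) := by
    cases n with
    | zero => rw [d_Dg_zero (prn_mem_Dg 0 _)]; exact zero_mem _
    | succ n =>
      have : d u₁ = d x - d u₂ := by rw [hu]; simp [d_d]
      rw [d_prn, this]
      exact prn_mem _ (sub_mem hx3 (d_mem_sg hu₂))
  refine ⟨prn n u₁, mem_Z.2 ⟨prn_mem _ hu₁, prn_mem_Dg _ _, ?_⟩, ?_⟩
  · refine Csg_mono ?_ (mem_sg_inter (d_mem_sg (prn_mem n hu₁)) hd)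
    exact fun y hy => ⟨hy.1, hy.2.2⟩
  · refine mem_Bd.2 ⟨prn (n + 1) w, prn_mem _ hw, ?_⟩
    convert prn_mem n hu₂ using 1
    rw [d_prn, ← prn_of_mem hx2, ← map_sub, ← map_sub, hu]
    congr 1
    abel

theorem excision_inj {O₁ O₂ : Set E} (h1 : IsOpen O₁) (h2 : IsOpen O₂) (hA : A ⊆ O₁ ∪ O₂)
    {x : Ch (Sing E)} (hx : x ∈ C (sg (A ∩ O₁))) (hb : x ∈ Bd A (A ∩ O₂)) :
    x ∈ Bd (A ∩ O₁) (A ∩ O₁ ∩ O₂) := by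
  obtain ⟨y, hy, hxy⟩ := mem_Bd.1 hb
  have hdy : d y ∈ C (sg (A ∩ O₁)) ⊔ C (sg (A ∩ O₂)) := by
    convert sub_mem (Submodule.mem_sup_left hx) (Submodule.mem_sup_right hxy) using 1
    abel
  obtain ⟨u₁, hu₁, u₂, hu₂, w, hw, hu⟩ := exists_small h1 h2 hA hy hdy
  refine mem_Bd.2 ⟨u₁, hu₁, ?_⟩
  refine Csg_mono (A := (A ∩ O₁) ∩ (A ∩ O₂)) (B := A ∩ O₁ ∩ O₂) (fun y hy => ⟨hy.1, hy.2.2⟩)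
    (mem_sg_inter (sub_mem hx (d_mem_sg hu₁)) ?_)
  convert add_mem hxy (d_mem_sg hu₂) using 1
  rw [hu]
  simp [d_d]
  abel

theorem Van.excision {O₁ O₂ : Set E} (h1 : IsOpen O₁) (h2 : IsOpen O₂) (hA : A ⊆ O₁ ∪ O₂)
    (h : Van n (A ∩ O₁) (A ∩ O₁ ∩ O₂)) : Van n A (A ∩ O₂) := fun x hx => by
  obtain ⟨u, hu, hxu⟩ := excision_surj h1 h2 hA hx
  obtain ⟨y, hy, hxy⟩ := mem_Bd.1 (h hu)
  have : u ∈ Bd A (A ∩ O₂) := mem_Bd.2 ⟨y, Csg_mono Set.inter_subset_left hy,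
    Csg_mono (Set.inter_subset_inter_left _ Set.inter_subset_left) hxy⟩
  simpa using add_mem hxu this

theorem Pj.excision {O₁ O₂ : Set E} (h1 : IsOpen O₁) (h2 : IsOpen O₂) (hA : A ⊆ O₁ ∪ O₂)
    (h : Pj n (A ∩ O₁) (A ∩ O₁ ∩ O₂)) : Pj n A (A ∩ O₂) := by
  refine Pr.of_bij LinearMap.id (fun x hx => ?_) (fun x _ hx => ?_)
    (fun x hx hb => excision_inj h1 h2 hA (mem_Z.1 hx).1 hb)
    (fun x hx => excision_surj h1 h2 hA hx) h
  · obtain ⟨hx1, hx2, hx3⟩ := mem_Z.1 hx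
    exact mem_Z.2 ⟨Csg_mono Set.inter_subset_left hx1, hx2,
      Csg_mono (Set.inter_subset_inter_left _ Set.inter_subset_left) hx3⟩
  · exact Bd_mono_left Set.inter_subset_left (Bd_mono_right (Set.inter_subset_inter_left _ Set.inter_subset_left) hx)

end relative

end

section

open Finsupp Cvx

section htpy

variable {E E' : Type} [TopologicalSpace E] [TopologicalSpace E'] {n : ℕ} {A B : Set E}
  {A' B' : Set E'} {f : E → E'} {g : E' → E}

theorem prism_sub_mem_Bd {h : ℝ × E → E'} (hc : ContinuousOn h (Set.Icc 0 1 ×ˢ A))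
    (hA : ∀ t ∈ Set.Icc (0 : ℝ) 1, ∀ x ∈ A, h (t, x) ∈ A')
    (hB : ∀ t ∈ Set.Icc (0 : ℝ) 1, ∀ x ∈ B, h (t, x) ∈ B') (hBA : B ⊆ A)
    {x : Ch (Sing E)} (hx : x ∈ Z n A B) :
    push (fun e => h (1, e)) x - push (fun e => h (0, e)) x ∈ Bd A' B' := by
  obtain ⟨hx1, -, hx3⟩ := mem_Z.1 hx
  refine mem_Bd.2 ⟨prism h x, prism_mem hc (fun p hp => hA _ hp.1 _ hp.2) hx1, ?_⟩
  rw [← d_prism, add_sub_cancel_left]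
  exact prism_mem (hc.mono (Set.prod_mono le_rfl hBA)) (fun p hp => hB _ hp.1 _ hp.2) hx3

theorem push_congr {f f' : E → E'} (h : ∀ x ∈ A, f x = f' x) {x : Ch (Sing E)}
    (hx : x ∈ C (sg A)) : push f x = push f' x := by
  refine eq_on_C (fun s hs => ?_) hx
  have : pushS f s = pushS f' s := by
    obtain ⟨k, σ⟩ := s
    exact congrArg (Sigma.mk k) (funext fun t => h _ (hs.2 t))
  rw [push_single, push_single, this]

theorem push_comp {E'' : Type} (g : E' → E'') (f : E → E') (x : Ch (Sing E)) :
    push g (push f x) = push (g ∘ f) x := by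
  have : push g ∘ₗ push f = push (g ∘ f) := hom_ext fun s => by simp [pushS, Function.comp_assoc]
  exact LinearMap.congr_fun this x

theorem push_id' {f : E → E} (h : ∀ x ∈ A, f x = x) {x : Ch (Sing E)} (hx : x ∈ C (sg A)) :
    push f x = x := by
  have := push_push_eq (f := id) (g := f) h hx
  rwa [push_comp] at this

/-- The pair `(A, B)` is a homotopy retract of the pair `(A', B')`. -/
structure HRetract (A B : Set E) (A' B' : Set E') (f : E → E') (g : E' → E) (h : ℝ × E → E) :
    Prop where
  subset : B ⊆ A
  subset' : B' ⊆ A'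
  cont_f : ContinuousOn f A
  fA : Set.MapsTo f A A'
  fB : Set.MapsTo f B B'
  cont_g : ContinuousOn g A'
  gA : Set.MapsTo g A' A
  gB : Set.MapsTo g B' B
  cont_h : ContinuousOn h (Set.Icc 0 1 ×ˢ A)
  hA : ∀ t ∈ Set.Icc (0 : ℝ) 1, ∀ x ∈ A, h (t, x) ∈ A
  hB : ∀ t ∈ Set.Icc (0 : ℝ) 1, ∀ x ∈ B, h (t, x) ∈ B
  h0 : ∀ x ∈ A, h (0, x) = x
  h1 : ∀ x ∈ A, h (1, x) = g (f x)

variable {h : ℝ × E → E}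

theorem HRetract.mem_Bd (H : HRetract A B A' B' f g h) {x : Ch (Sing E)} (hx : x ∈ Z n A B)
    (hfx : push f x ∈ Bd A' B') : x ∈ Bd A B := by
  have e := prism_sub_mem_Bd H.cont_h H.hA H.hB H.subset hx
  rw [push_id' H.h0 (mem_Z.1 hx).1, push_congr H.h1 (mem_Z.1 hx).1] at e
  have e2 := push_mem_Bd H.cont_g H.gA H.gB H.subset' hfx
  rw [push_comp] at e2
  convert sub_mem e2 e using 1
  exact (sub_sub_cancel _ _).symm

theorem HRetract.van (H : HRetract A B A' B' f g h) (hv : Van n A' B') : Van n A B :=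
  fun _ hx => H.mem_Bd hx (hv (push_mem_Z H.cont_f H.fA H.fB H.subset hx))

theorem HRetract.pj (H : HRetract A B A' B' f g h) (hv : Pj n A' B') : Pj n A B :=
  Pr.of_inj (push f) (fun _ hx => push_mem_Z H.cont_f H.fA H.fB H.subset hx)
    (fun _ _ hx => push_mem_Bd H.cont_f H.fA H.fB H.subset hx) (fun _ hx hx' => H.mem_Bd hx hx') hv

end htpy

section point

variable {E : Type} [TopologicalSpace E]

/-- Collapse all simplices to a vertex. -/
noncomputable def collapse : Ch (Sing E) →ₗ[ℤ] Ch (LS (Dl 1)) :=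
  lmapDomain ℤ ℤ fun s => ⟨s.1, fun _ => stdSimplex.vertex 0⟩

theorem collapse_single (s : Sing E) :
    collapse (single s 1) = single ⟨s.1, fun _ => stdSimplex.vertex 0⟩ 1 := by
  simp [collapse, mapDomain_single]

theorem collapse_d (x : Ch (Sing E)) : collapse (d x) = bd (collapse x) := by
  have : collapse ∘ₗ d = (bd ∘ₗ collapse : Ch (Sing E) →ₗ[ℤ] _) := hom_ext fun s => by
    have h : ∀ y : Ch (LS (Dl s.1)), collapse (real s.2 y) =
        lmap (fun _ => (stdSimplex.vertex 0 : Dl 1)) y := fun y => by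
      have : collapse ∘ₗ real s.2 = lmap (fun _ => (stdSimplex.vertex 0 : Dl 1)) :=
        hom_ext fun u => by simp [collapse_single, mapS, realS, Function.comp_def]
      exact LinearMap.congr_fun this y
    simp only [LinearMap.comp_apply]
    rw [d_single, h, lmap_bd, collapse_single, lmap_single]
    rfl
  exact LinearMap.congr_fun this x

theorem exists_d_of_point (p : E) {x : Ch (Sing E)} (hx : x ∈ C (sg {p})) (hd : d x = 0) :
    ∃ y ∈ C (sg {p}), d y = x := by
  have e : real (fun _ : Dl 1 => p) (collapse x) = x := by
    refine eq_on_C (f := real (fun _ : Dl 1 => p) ∘ₗ collapse) (g := LinearMap.id)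
      (fun s hs => ?_) hx
    have : realS (fun _ : Dl 1 => p) ⟨s.1, fun _ => stdSimplex.vertex 0⟩ = s := by
      obtain ⟨k, σ⟩ := s
      exact congrArg (Sigma.mk k) (funext fun t => (hs.2 t).symm)
    simp [collapse_single, this]
  refine ⟨real (fun _ : Dl 1 => p) (cone (stdSimplex.vertex 0) (collapse x)), ?_, ?_⟩
  · refine map_C (S := Set.univ) (fun s _ => ?_) (by simp)
    rw [real_single]
    exact single_mem_C ⟨continuous_const, fun _ => rfl⟩
  · rw [d_real, bd_cone, ← collapse_d, hd, map_zero, map_zero, sub_zero, e]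

theorem Csg_empty_le : C (sg (∅ : Set E)) ≤ Dg E 0 := by
  refine C_mono fun s hs => ?_
  by_contra h
  have : Nonempty (Fin s.1) := ⟨⟨0, Nat.pos_of_ne_zero h⟩⟩
  exact hs.2 (stdSimplex.vertex (Classical.arbitrary _))

theorem van_point (p : E) {n : ℕ} (hn : n ≠ 1) : Van n {p} ∅ := by
  rcases n with _ | n
  · exact Van.zero
  intro x hx
  obtain ⟨h1, h2, h3⟩ := mem_Z.1 hx
  have : d x = 0 := by rw [← prn_of_mem (d_mem_Dg h2), prn_of_ne (by omega) (Csg_empty_le h3)]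
  obtain ⟨y, hy, rfl⟩ := exists_d_of_point p h1 this
  exact mem_Bd.2 ⟨y, hy, by simp⟩

theorem pj_point (p : E) (n : ℕ) : Pj n {p} ∅ := by
  by_cases hn : n = 1
  · subst hn
    have hproj : Module.Projective ℤ (Dg E 0) :=
      Module.Projective.of_equiv (Finsupp.supportedEquivFinsupp _).symm
    have hpr : Pr (Dg E 0) ⊥ := by
      rw [Pr, Submodule.submoduleOf, Submodule.comap_bot, Submodule.ker_subtype]
      exact Module.Projective.of_equiv (Submodule.quotEquivOfEqBot _ rfl).symm
    refine Pr.of_inj d (fun x hx => d_mem_Dg (mem_Z.1 hx).2.1) (fun x hx hb => ?_)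
      (fun x hx hb => ?_) hpr
    · obtain ⟨y, hy, hyn, h⟩ := exists_of_mem_Bd hb (mem_Z.1 hx).2.1
      have := d_Dg_zero (Csg_empty_le h)
      simpa [d_d] using this
    · obtain ⟨y, hy, rfl⟩ := exists_d_of_point p (mem_Z.1 hx).1 hb
      exact mem_Bd.2 ⟨y, hy, by simp⟩
  · exact (van_point p hn).pj

end point

end

section

open Finsupp Cvx

section star

/-- The union of the rays through the `D`-th roots of unity. -/
def Ray (D : ℕ) : Set ℂ := {x | x ^ D = (‖x‖ : ℂ) ^ D}

variable {D : ℕ}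

theorem Ray.zero : (0 : ℂ) ∈ Ray D := by simp [Ray]

theorem Ray.of_eq {x : ℂ} (h : x = ‖x‖) : x ∈ Ray D := by
  rw [Ray, Set.mem_ofPred_eq, ← h]

theorem Ray.smul {x : ℂ} (hx : x ∈ Ray D) {r : ℝ} (hr : 0 ≤ r) : (r : ℂ) * x ∈ Ray D := by
  rw [Ray, Set.mem_ofPred_eq, mul_pow, norm_mul, Complex.norm_real, Real.norm_of_nonneg hr]
  push_cast
  rw [mul_pow, ← show x ^ D = (‖x‖ : ℂ) ^ D from hx]

theorem norm_mul_unit {r : ℝ} (hr : 0 ≤ r) {u : ℂ} (hu : ‖u‖ = 1) : ‖(r : ℂ) * u‖ = r := by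
  rw [norm_mul, hu, Complex.norm_real, Real.norm_of_nonneg hr, mul_one]

theorem norm_root (hD : D ≠ 0) {u : ℂ} (hu : u ^ D = 1) : ‖u‖ = 1 :=
  Complex.norm_eq_one_of_pow_eq_one hu hD

theorem Ray.exists (hD : D ≠ 0) {x : ℂ} (hx : x ∈ Ray D) : ∃ u : ℂ, u ^ D = 1 ∧ x = ‖x‖ * u := by
  by_cases h : x = 0
  · exact ⟨1, by simp, by simp [h]⟩
  have h' : (‖x‖ : ℂ) ≠ 0 := by simpa using h
  refine ⟨x / ‖x‖, ?_, by field_simp⟩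
  rw [div_pow, show x ^ D = (‖x‖ : ℂ) ^ D from hx, div_self (pow_ne_zero _ h')]

/-- The `D`-th roots of unity. -/
noncomputable def unityRoots (D : ℕ) : Finset ℂ := (Polynomial.nthRoots D (1 : ℂ)).toFinset

theorem mem_unityRoots (hD : D ≠ 0) {u : ℂ} : u ∈ unityRoots D ↔ u ^ D = 1 := by
  rw [unityRoots, Multiset.mem_toFinset, Polynomial.mem_nthRoots (Nat.pos_of_ne_zero hD)]

/-- Products of `m` copies of the star of rays. -/
def Kk (D m : ℕ) : Set (ℕ → ℂ) := {x | (∀ i < m, x i ∈ Ray D) ∧ ∀ i, m ≤ i → x i = 0}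

theorem isClosed_ray (u : ℂ) : IsClosed {z : ℂ | z = ‖z‖ * u} :=
  isClosed_eq continuous_id (by fun_prop)

open Classical in
/-- The retraction of the star onto the positive ray. -/
noncomputable def posPart (z : ℂ) : ℂ := if z = ‖z‖ then z else 0

theorem posPart_eq (z : ℂ) : posPart z = ‖posPart z‖ := by
  unfold posPart
  split_ifs with h
  · exact h
  · simp

theorem continuousOn_posPart (hD : D ≠ 0) : ContinuousOn posPart (Ray D) := by
  have hsub : Ray D ⊆ {z : ℂ | z = ‖z‖ * 1} ∪
      ⋃ u ∈ (unityRoots D).erase 1, {z : ℂ | z = ‖z‖ * u} := fun z hz => by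
    obtain ⟨u, hu, h⟩ := Ray.exists hD hz
    by_cases h1 : u = 1
    · left; rw [h1] at h; exact h
    · right
      exact Set.mem_biUnion (Finset.mem_coe.2 (Finset.mem_erase.2 ⟨h1, (mem_unityRoots hD).2 hu⟩)) h
  refine ContinuousOn.mono (ContinuousOn.union_of_isClosed ?_ ?_ (isClosed_ray 1)
    (isClosed_biUnion_finset fun u _ => isClosed_ray u)) hsub
  · exact continuousOn_id.congr fun z hz => if_pos (by simpa using hz)
  · refine (continuousOn_const (c := (0 : ℂ))).congr fun z hz => ?_
    simp only [Set.mem_iUnion, exists_prop, Finset.mem_erase] at hz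
    obtain ⟨u, ⟨hu1, -⟩, h⟩ := hz
    unfold posPart
    split_ifs with h'
    · by_contra hz
      have hz' : (‖z‖ : ℂ) ≠ 0 := by simpa using hz
      have h : z = ‖z‖ * u := h
      rw [h'] at h
      simp only [Complex.norm_real, norm_norm] at h
      exact hu1 (mul_left_cancel₀ hz' (by rw [← h, mul_one]))
    · rfl

variable {m : ℕ}

theorem Kk.update_mem {x : ℕ → ℂ} (hx : x ∈ Kk D (m + 1)) {z : ℂ} (hz : z ∈ Ray D) :
    Function.update x m z ∈ Kk D (m + 1) := by
  refine ⟨fun i hi => ?_, fun i hi => ?_⟩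
  · by_cases h : i = m
    · subst h; simpa using hz
    · rw [Function.update_of_ne h]; exact hx.1 i hi
  · rw [Function.update_of_ne (by omega)]; exact hx.2 i hi

/-- Part of the star containing the positive last ray; `Q` records whether it is everything. -/
def starPart (D m : ℕ) (Q : Prop) : Set (ℕ → ℂ) :=
  {x | x ∈ Kk D (m + 1) ∧ (Q ∨ (∃ i < m, x i ≠ 0) ∨ (x m ≠ 0 ∧ x m = ‖x m‖))}

theorem continuousOn_update {X : Type} [TopologicalSpace X] {f : X → ℕ → ℂ} {g : X → ℂ} {s : Set X}
    (hf : ContinuousOn f s) (hg : ContinuousOn g s) (i : ℕ) :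
    ContinuousOn (fun x => Function.update (f x) i (g x)) s := by
  rw [continuousOn_pi] at *
  intro j
  by_cases h : j = i
  · subst h; simpa using hg
  · simpa [Function.update_of_ne h] using hf j

theorem van_starPart (hD : D ≠ 0) (Q : Prop) (n : ℕ) :
    Van n (starPart D m Q) {Pi.single m 1} := by
  let Y : Set (ℕ → ℂ) := {x | x ∈ starPart D m Q ∧ x m = ‖x m‖}
  have hs : Pi.single m 1 ∈ Y := by
    refine ⟨⟨⟨fun i hi => ?_, fun i hi => ?_⟩, Or.inr (Or.inr ?_)⟩, by simp⟩
    · by_cases h : i = m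
      · subst h; exact Ray.of_eq (by simp)
      · simp [h, Ray.zero]
    · simp [show i ≠ m by omega]
    · simp
  refine Van.trans (S := Y) (by simpa using hs) (fun x hx => hx.1) ?_ ?_
  · refine van_of_deformation (fun p : ℝ × (ℕ → ℂ) =>
      (1 - p.1 : ℂ) • p.2 + (p.1 : ℂ) • Pi.single m 1) (by fun_prop) ?_ ?_ (by simpa using hs)
      (by simp) (by simp) n
    · rintro t ⟨ht0, ht1⟩ x ⟨⟨⟨hx1, hx2⟩, hx3⟩, hx4⟩
      have hm : ∀ i ≠ m, ((1 - t : ℂ) • x + (t : ℂ) • (Pi.single m 1 : ℕ → ℂ)) i = (1 - t : ℝ) * x i := by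
        intro i hi; simp [hi]
      have hm' : ((1 - t : ℂ) • x + (t : ℂ) • (Pi.single m 1 : ℕ → ℂ)) m =
          ((1 - t) * ‖x m‖ + t : ℝ) := by
        simp only [Pi.add_apply, Pi.smul_apply, smul_eq_mul, Pi.single_eq_same, mul_one]
        rw [hx4]; push_cast; simp
      have hnn : 0 ≤ (1 - t) * ‖x m‖ + t :=
        add_nonneg (mul_nonneg (by linarith) (norm_nonneg _)) ht0
      have hn : ((1 - t : ℂ) • x + (t : ℂ) • (Pi.single m 1 : ℕ → ℂ)) m =
          ‖((1 - t : ℂ) • x + (t : ℂ) • (Pi.single m 1 : ℕ → ℂ)) m‖ := by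
        rw [hm', Complex.norm_real, Real.norm_of_nonneg hnn]
      refine ⟨⟨⟨fun i hi => ?_, fun i hi => ?_⟩, ?_⟩, hn⟩
      · by_cases h : i = m
        · subst h; exact Ray.of_eq hn
        · rw [hm i h]; exact Ray.smul (hx1 i hi) (by linarith)
      · rw [hm i (by omega), hx2 i hi, mul_zero]
      · rcases hx3 with h | ⟨i, hi, h⟩ | ⟨h1, h2⟩
        · exact Or.inl h
        · rcases ht0.eq_or_lt with h0 | h0
          · subst h0; exact Or.inr (Or.inl ⟨i, hi, by simpa using h⟩)
          · refine Or.inr (Or.inr ⟨?_, hn⟩)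
            rw [hm']
            have : 0 < (1 - t) * ‖x m‖ + t :=
              add_pos_of_nonneg_of_pos (mul_nonneg (by linarith) (norm_nonneg _)) h0
            exact_mod_cast this.ne'
        · refine Or.inr (Or.inr ⟨?_, hn⟩)
          rw [hm']
          have h1 : 0 < ‖x m‖ := norm_pos_iff.2 h1
          have : 0 < (1 - t) * ‖x m‖ + t := by
            rcases ht0.eq_or_lt with h0 | h0
            · subst h0; simpa using h1
            · exact add_pos_of_nonneg_of_pos (mul_nonneg (by linarith) (norm_nonneg _)) h0
          exact_mod_cast this.ne'
    · rintro t - x rfl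
      ext i
      simp only [Pi.add_apply, Pi.smul_apply, smul_eq_mul]; ring
  · have hray : ∀ t ∈ Set.Icc (0 : ℝ) 1, ∀ z ∈ Ray D, (1 - t : ℂ) * z + t * posPart z ∈ Ray D ∧
        (z = ‖z‖ → (1 - t : ℂ) * z + t * posPart z = z) := by
      rintro t ⟨ht0, ht1⟩ z hz
      unfold posPart
      split_ifs with h
      · have : (1 - t : ℂ) * z + t * z = z := by ring
        rw [this]; exact ⟨hz, fun _ => rfl⟩
      · refine ⟨?_, fun h' => absurd h' h⟩
        have := Ray.smul hz (r := 1 - t) (by linarith)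
        push_cast at this
        simpa using this
    have key : ∀ t ∈ Set.Icc (0 : ℝ) 1, ∀ x ∈ starPart D m Q,
        Function.update x m ((1 - t : ℂ) * x m + t * posPart (x m)) ∈ starPart D m Q := by
      rintro t ht x ⟨hx1, hx2⟩
      have h := hray t ht _ (hx1.1 m (by omega))
      refine ⟨Kk.update_mem hx1 h.1, ?_⟩
      rcases hx2 with h' | ⟨i, hi, h'⟩ | ⟨h1, h2⟩
      · exact Or.inl h'
      · exact Or.inr (Or.inl ⟨i, hi, by rwa [Function.update_of_ne (by omega)]⟩)
      · refine Or.inr (Or.inr ?_)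
        rw [h.2 h2, Function.update_self]
        exact ⟨h1, h2⟩
    refine van_of_deformation (fun p : ℝ × (ℕ → ℂ) =>
      Function.update p.2 m ((1 - p.1 : ℂ) * p.2 m + p.1 * posPart (p.2 m))) ?_ key ?_
      (fun x hx => hx.1) (fun x _ => by simp) (fun x hx => ?_) n
    · refine continuousOn_update (by fun_prop) (ContinuousOn.add (by fun_prop)
        (ContinuousOn.mul (by fun_prop) ?_)) m
      exact (continuousOn_posPart hD).comp (t := Ray D) (Continuous.continuousOn (by fun_prop))
        fun p hp => hp.2.1.1 m (by omega)
    · intro t ht x hx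
      refine ⟨key t ht x hx.1, ?_⟩
      simp only [Function.update_self]
      rw [(hray t ht _ (hx.1.1.1 m (by omega))).2 hx.2]
      exact hx.2
    · refine ⟨key 1 (by simp) x hx, ?_⟩
      simp only [Function.update_self, Complex.ofReal_one, sub_self, zero_mul, zero_add, one_mul]
      exact posPart_eq _

/-- The complement of `0 × F` in a star, `F` a set of last-coordinate rays. -/
def starCompl (D m : ℕ) (F : Finset ℂ) : Set (ℕ → ℂ) :=
  {x | x ∈ Kk D (m + 1) ∧ ((∃ i < m, x i ≠ 0) ∨ (x m ≠ 0 ∧ ∀ u ∈ F, x m ≠ ‖x m‖ * u))}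

theorem starCompl_empty : starCompl D m ∅ = Kk D (m + 1) \ {0} := by
  ext x
  refine and_congr_right fun hx => ?_
  simp only [Finset.notMem_empty, false_imp_iff, implies_true, and_true, Set.mem_singleton_iff]
  constructor
  · rintro (⟨i, -, h⟩ | h) rfl <;> exact h rfl
  · intro h
    by_contra! hc
    refine h (funext fun i => ?_)
    rcases lt_trichotomy i m with hi | rfl | hi
    · exact hc.1 i hi
    · exact hc.2
    · exact hx.2 i hi

theorem starCompl_erase (hD : D ≠ 0) :
    starCompl D m ((unityRoots D).erase 1) = starPart D m False := by
  ext x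
  refine and_congr_right fun hx => ?_
  simp only [false_or]
  refine or_congr_right (and_congr_right fun h0 => ⟨fun h => ?_, fun h u hu h' => ?_⟩)
  · obtain ⟨u, hu, h'⟩ := Ray.exists hD (hx.1 m (by omega))
    by_cases h1 : u = 1
    · rwa [h1, mul_one] at h'
    · exact absurd h' (h u (Finset.mem_erase.2 ⟨h1, (mem_unityRoots hD).2 hu⟩))
  · have hz' : (‖x m‖ : ℂ) ≠ 0 := by simpa using h0
    exact (Finset.mem_erase.1 hu).1 (mul_left_cancel₀ hz' (by rw [← h', mul_one]; exact h))

theorem Kk_succ_eq : Kk D (m + 1) = starPart D m True := by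
  ext x; simp [starPart]

theorem isClosed_ray_coord (u : ℂ) : IsClosed {x : ℕ → ℂ | x m = ‖x m‖ * u} :=
  isClosed_eq (continuous_apply m) (by fun_prop)

theorem Kk.update_zero {x : ℕ → ℂ} (hx : x ∈ Kk D (m + 1)) :
    Function.update x m 0 ∈ Kk D m := by
  refine ⟨fun i hi => ?_, fun i hi => ?_⟩
  · rw [Function.update_of_ne (by omega)]; exact hx.1 i (by omega)
  · by_cases h : i = m
    · subst h; simp
    · rw [Function.update_of_ne h]; exact hx.2 i (by omega)

theorem Kk.succ {x : ℕ → ℂ} (hx : x ∈ Kk D m) : x ∈ Kk D (m + 1) := by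
  refine ⟨fun i hi => ?_, fun i hi => hx.2 i (by omega)⟩
  by_cases h : i = m
  · rw [hx.2 i (by omega)]; exact Ray.zero
  · exact hx.1 i (by omega)

theorem starCompl_step (hD : D ≠ 0) {F : Finset ℂ} {u : ℂ} (hF : F ⊆ unityRoots D)
    (hu : u ∈ unityRoots D) (huF : u ∉ F) (n : ℕ) :
    (Pj n (Kk D m) (Kk D m \ {0}) → Pj n (starCompl D m F) (starCompl D m (insert u F))) ∧
    (Van n (Kk D m) (Kk D m \ {0}) → Van n (starCompl D m F) (starCompl D m (insert u F))) := by
  have hu1 : u ^ D = 1 := (mem_unityRoots hD).1 hu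
  have hun : ‖u‖ = 1 := norm_root hD hu1
  have hu0 : u ≠ 0 := by rintro rfl; simp at hun
  let O₁ : Set (ℕ → ℂ) := {x | x m ≠ 0} ∩ (⋃ v ∈ (unityRoots D).erase u, {x | x m = ‖x m‖ * v})ᶜ
  let O₂ : Set (ℕ → ℂ) := (⋃ i ∈ Finset.range m, {x : ℕ → ℂ | x i ≠ 0}) ∪ {x | x m = ‖x m‖ * u}ᶜ
  have mO₁ : ∀ x, x ∈ O₁ ↔ x m ≠ 0 ∧ ∀ v ∈ (unityRoots D).erase u, x m ≠ ‖x m‖ * v := fun x => by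
    simp [O₁]
  have mO₂ : ∀ x, x ∈ O₂ ↔ (∃ i < m, x i ≠ 0) ∨ x m ≠ ‖x m‖ * u := fun x => by
    simp [O₂]
  have hne : ∀ i, IsOpen {x : ℕ → ℂ | x i ≠ 0} := fun i =>
    isOpen_ne_fun (continuous_apply i) continuous_const
  have h1 : IsOpen O₁ := (hne m).inter
    (isClosed_biUnion_finset fun v _ => isClosed_ray_coord v).isOpen_compl
  have h2 : IsOpen O₂ := (isOpen_biUnion fun i _ => hne i).union (isClosed_ray_coord u).isOpen_compl
  have hA : starCompl D m F ⊆ O₁ ∪ O₂ := fun x hx => by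
    by_contra hc
    rw [Set.mem_union, mO₁, mO₂] at hc
    push Not at hc
    obtain ⟨hc1, hc2, hc3⟩ := hc
    rcases hx.2 with ⟨i, hi, h⟩ | ⟨h, -⟩
    · exact h (hc2 i hi)
    · obtain ⟨v, hv, hv'⟩ := hc1 h
      have hz' : (‖x m‖ : ℂ) ≠ 0 := by simpa using h
      exact (Finset.mem_erase.1 hv).1 (mul_left_cancel₀ hz' (by rw [← hv', ← hc3]))
  have e2 : starCompl D m F ∩ O₂ = starCompl D m (insert u F) := by
    ext x
    rw [Set.mem_inter_iff, mO₂]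
    refine and_assoc.trans (and_congr_right fun hx => ?_)
    rw [← or_and_left]
    refine or_congr_right ?_
    simp only [Finset.mem_insert, forall_eq_or_imp]
    tauto
  have mA : ∀ x, x ∈ starCompl D m F ∩ O₁ ↔ x ∈ Kk D (m + 1) ∧ x m ≠ 0 ∧ x m = ‖x m‖ * u := by
    intro x
    rw [Set.mem_inter_iff, mO₁]
    constructor
    · rintro ⟨⟨hx, -⟩, h0, h⟩
      refine ⟨hx, h0, ?_⟩
      obtain ⟨v, hv, h'⟩ := Ray.exists hD (hx.1 m (by omega))
      by_cases hvu : v = u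
      · rwa [← hvu]
      · exact absurd h' (h v (Finset.mem_erase.2 ⟨hvu, (mem_unityRoots hD).2 hv⟩))
    · rintro ⟨hx, h0, h⟩
      have hz' : (‖x m‖ : ℂ) ≠ 0 := by simpa using h0
      have key : ∀ v ∈ (unityRoots D).erase u, x m ≠ ‖x m‖ * v := fun v hv hv' =>
        (Finset.mem_erase.1 hv).1 (mul_left_cancel₀ hz' (by rw [← hv', ← h]))
      exact ⟨⟨hx, Or.inr ⟨h0, fun v hv => key v (Finset.mem_erase.2
        ⟨fun h => huF (h ▸ hv), hF hv⟩)⟩⟩, h0, key⟩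
  have H : HRetract (starCompl D m F ∩ O₁) (starCompl D m F ∩ O₁ ∩ O₂) (Kk D m) (Kk D m \ {0})
      (fun x => Function.update x m 0) (fun x => Function.update x m u)
      (fun p => Function.update p.2 m ((1 - p.1 : ℂ) * p.2 m + p.1 * u)) := by
    have hval : ∀ t ∈ Set.Icc (0 : ℝ) 1, ∀ x ∈ starCompl D m F ∩ O₁,
        (1 - t : ℂ) * x m + t * u = ((1 - t) * ‖x m‖ + t : ℝ) * u ∧ 0 < (1 - t) * ‖x m‖ + t := by
      rintro t ⟨ht0, ht1⟩ x hx
      obtain ⟨hx1, hx2, hx3⟩ := (mA x).1 hx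
      refine ⟨?_, ?_⟩
      · conv_lhs => rw [hx3]
        push_cast; ring
      · rcases ht0.eq_or_lt with h0 | h0
        · subst h0; simpa using hx2
        · exact add_pos_of_nonneg_of_pos (mul_nonneg (by linarith) (norm_nonneg _)) h0
    have hmem : ∀ r : ℝ, 0 < r → ∀ x ∈ Kk D (m + 1),
        Function.update x m (r * u) ∈ starCompl D m F ∩ O₁ := by
      intro r hr x hx
      refine (mA _).2 ⟨Kk.update_mem hx (Ray.smul ?_ hr.le), ?_, ?_⟩
      · rw [Ray, Set.mem_ofPred_eq, hu1, hun]; simp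
      · rw [Function.update_self]
        exact mul_ne_zero (by exact_mod_cast hr.ne') hu0
      · rw [Function.update_self, norm_mul_unit hr.le hun]
    have hi2 : ∀ x ∈ starCompl D m F ∩ O₁ ∩ O₂, ∃ i < m, x i ≠ 0 := fun x hx =>
      ((mO₂ x).1 hx.2).resolve_right fun h => h ((mA x).1 hx.1).2.2
    refine ⟨Set.inter_subset_left, Set.sdiff_subset, ?_, fun x hx => ?_, fun x hx => ?_, ?_,
      fun x hx => ?_, fun x hx => ?_, ?_, ?_, ?_, fun x _ => ?_, fun x _ => ?_⟩
    · exact continuousOn_update continuousOn_id continuousOn_const m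
    · exact Kk.update_zero ((mA x).1 hx).1
    · refine ⟨Kk.update_zero ((mA x).1 hx.1).1, fun h => ?_⟩
      obtain ⟨i, hi, h'⟩ := hi2 x hx
      have := congrFun (Set.mem_singleton_iff.1 h) i
      rw [Function.update_of_ne (by omega)] at this
      exact h' this
    · exact continuousOn_update continuousOn_id continuousOn_const m
    · simpa using hmem 1 one_pos x (Kk.succ hx)
    · refine ⟨by simpa using hmem 1 one_pos x (Kk.succ hx.1), (mO₂ _).2 (Or.inl ?_)⟩
      by_contra! hc
      refine hx.2 (funext fun i => ?_)
      by_cases h : i < m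
      · have := hc i h
        rwa [Function.update_of_ne (by omega)] at this
      · exact hx.1.2 i (by omega)
    · exact continuousOn_update (by fun_prop) (by fun_prop) m
    · intro t ht x hx
      have := hval t ht x hx
      simp only [this.1]
      exact hmem _ this.2 x ((mA x).1 hx).1
    · intro t ht x hx
      have := hval t ht x hx.1
      simp only [this.1]
      refine ⟨hmem _ this.2 x ((mA x).1 hx.1).1, (mO₂ _).2 (Or.inl ?_)⟩
      obtain ⟨i, hi, h'⟩ := hi2 x hx
      exact ⟨i, hi, by rwa [Function.update_of_ne (by omega)]⟩
    · simp
    · simp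
  rw [← e2]
  exact ⟨fun h => Pj.excision h1 h2 hA (H.pj h), fun h => Van.excision h1 h2 hA (H.van h)⟩

theorem starCompl_mono {F F' : Finset ℂ} (h : F ⊆ F') : starCompl D m F' ⊆ starCompl D m F :=
  fun _ hx => ⟨hx.1, hx.2.imp_right fun h' => ⟨h'.1, fun u hu => h'.2 u (h hu)⟩⟩

theorem starCompl_all (hD : D ≠ 0) (hv : ∀ n ≠ m + 1, Van n (Kk D m) (Kk D m \ {0}))
    (hp : ∀ n, Pj n (Kk D m) (Kk D m \ {0})) {F : Finset ℂ} (hF : F ⊆ unityRoots D) (n : ℕ) :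
    Pj n (starCompl D m ∅) (starCompl D m F) ∧
    (n ≠ m + 1 → Van n (starCompl D m ∅) (starCompl D m F)) := by
  induction F using Finset.induction_on generalizing n with
  | empty =>
    have : ∀ n, Van n (starCompl D m ∅) (starCompl D m ∅) := fun n x hx =>
      mem_Bd_of_Csg (mem_Z.1 hx).1
    exact ⟨(this n).pj, fun _ => this n⟩
  | insert u F hu ih =>
    have hF' : F ⊆ unityRoots D := (Finset.subset_insert u F).trans hF
    have hs := starCompl_step (m := m) hD hF' (hF (Finset.mem_insert_self u F)) hu
    have hm := starCompl_mono (D := D) (m := m) (Finset.subset_insert u F)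
    have hm' := starCompl_mono (D := D) (m := m) (Finset.empty_subset F)
    refine ⟨?_, fun hn => Van.trans hm hm' ((hs n).2 (hv n hn)) ((ih hF' n).2 hn)⟩
    by_cases hn : n = m + 1
    · exact Pj.trans_of_right hm hm' ((ih hF' (n + 1)).2 (by omega)) ((hs n).1 (hp n)) (ih hF' n).1
    · exact Pj.trans_of_left hm hm' ((hs n).2 (hv n hn)) (ih hF' n).1

theorem star_homology (hD : D ≠ 0) (m n : ℕ) :
    Pj n (Kk D m) (Kk D m \ {0}) ∧ (n ≠ m + 1 → Van n (Kk D m) (Kk D m \ {0})) := by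
  induction m generalizing n with
  | zero =>
    have : Kk D 0 = {0} := by
      ext x
      simp only [Kk, Set.mem_singleton_iff, Set.mem_ofPred_eq]
      exact ⟨fun h => funext fun i => h.2 i (by omega), by rintro rfl; simp⟩
    rw [this, Set.sdiff_self]
    exact ⟨pj_point _ n, fun h => van_point _ h⟩
  | succ m ih =>
    have hall := starCompl_all (m := m) hD (fun n hn => (ih n).2 hn) (fun n => (ih n).1)
      (Finset.erase_subset 1 _)
    rw [starCompl_erase hD, starCompl_empty] at hall
    have hsub : starPart D m False ⊆ Kk D (m + 1) \ {0} := by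
      rw [← starCompl_erase hD, ← starCompl_empty]
      exact starCompl_mono (Finset.empty_subset _)
    have hs : ({Pi.single m 1} : Set (ℕ → ℂ)) ⊆ starPart D m False := by
      rw [Set.singleton_subset_iff]
      refine ⟨⟨fun i hi => ?_, fun i hi => ?_⟩, Or.inr (Or.inr ?_)⟩
      · by_cases h : i = m
        · subst h; exact Ray.of_eq (by simp)
        · simp [h, Ray.zero]
      · simp [show i ≠ m by omega]
      · simp
    have hK : ∀ n, Van (n + 1) (Kk D (m + 1)) (starPart D m False) := fun n => by
      refine Van.of_left hs (hsub.trans Set.sdiff_subset) (van_starPart hD _ n) ?_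
      rw [Kk_succ_eq]
      exact van_starPart hD _ _
    rcases n with _ | n
    · exact ⟨Van.zero.pj, fun _ => Van.zero⟩
    · refine ⟨Pj.of_connecting hsub Set.sdiff_subset (hK n) (hall n).1, fun hn => ?_⟩
      exact Van.of_left hsub Set.sdiff_subset ((hall n).2 (by omega)) (hK n)

end star

end

section

open Finsupp Cvx Topology

section proj

variable {V : Type} [AddCommGroup V] [Module ℂ V] [Nontrivial V]

open Classical in
/-- The point of projective space represented by a vector (arbitrary for the zero vector). -/
noncomputable def toP (v : V) : Projectivization ℂ V :=
  if h : v ≠ 0 then Projectivization.mk ℂ v h else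
    Projectivization.mk ℂ _ (exists_ne (0 : V)).choose_spec

theorem toP_of_ne {v : V} (h : v ≠ 0) : toP v = Projectivization.mk ℂ v h := dif_pos h

theorem toP_rep (p : Projectivization ℂ V) : toP p.rep = p := by
  rw [toP_of_ne p.rep_nonzero, Projectivization.mk_rep]

theorem toP_smul {c : ℂ} (hc : c ≠ 0) (v : V) : toP (c • v) = toP v := by
  by_cases h : v = 0
  · simp [h]
  · rw [toP_of_ne h, toP_of_ne (smul_ne_zero hc h), Projectivization.mk_eq_mk_iff']
    exact ⟨c, rfl⟩

theorem toP_eq {v w : V} (hv : v ≠ 0) (hw : w ≠ 0) (h : toP v = toP w) :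
    ∃ c : ℂ, c ≠ 0 ∧ v = c • w := by
  rw [toP_of_ne hv, toP_of_ne hw, Projectivization.mk_eq_mk_iff'] at h
  obtain ⟨c, hc⟩ := h
  refine ⟨c, ?_, hc.symm⟩
  rintro rfl
  exact hv (by rw [← hc, zero_smul])

theorem exists_rep {v : V} (hv : v ≠ 0) : ∃ c : ℂ, c ≠ 0 ∧ (toP v).rep = c • v :=
  toP_eq (Projectivization.rep_nonzero _) hv (toP_rep _)

/-- A set of nonzero vectors stable under nonzero scalars. -/
structure Cone (A : Set V) : Prop where
  ne : ∀ v ∈ A, v ≠ 0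
  smul : ∀ v ∈ A, ∀ c : ℂ, c ≠ 0 → c • v ∈ A

/-- The projectivization of a cone. -/
def PS (A : Set V) : Set (Projectivization ℂ V) := {p | p.rep ∈ A}

variable {A B O : Set V}

theorem Cone.smul_iff (hA : Cone A) {v : V} {c : ℂ} (hc : c ≠ 0) : c • v ∈ A ↔ v ∈ A :=
  ⟨fun h => by simpa [smul_smul, inv_mul_cancel₀ hc] using hA.smul _ h c⁻¹ (inv_ne_zero hc),
    fun h => hA.smul v h c hc⟩

theorem Cone.toP_mem_iff (hA : Cone A) {v : V} (hv : v ≠ 0) : toP v ∈ PS A ↔ v ∈ A := by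
  obtain ⟨c, hc, h⟩ := exists_rep hv
  rw [PS, Set.mem_ofPred_eq, h, hA.smul_iff hc]

theorem Cone.toP_mem (hA : Cone A) {v : V} (hv : v ∈ A) : toP v ∈ PS A :=
  (hA.toP_mem_iff (hA.ne v hv)).2 hv

theorem PS_mono (h : A ⊆ B) : PS A ⊆ PS B := fun _ hp => h hp

theorem PS_inter : PS (A ∩ B) = PS A ∩ PS B := rfl

variable [TopologicalSpace V] [ContinuousConstSMul ℂ V] [T1Space V]

theorem map_toP_nhds {v : V} (hv : v ≠ 0) : Filter.map toP (𝓝 v) = 𝓝 (toP v) := by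
  have hq : IsQuotientMap (fun w : { v : V // v ≠ 0 } => toP (w : V)) := by
    have : (fun w : { v : V // v ≠ 0 } => toP (w : V)) = Quotient.mk (projectivizationSetoid ℂ V) :=
      funext fun w => toP_of_ne w.2
    rw [this]
    exact isQuotientMap_quotient_mk'
  have ho : IsOpenMap (fun w : { v : V // v ≠ 0 } => toP (w : V)) := by
    intro U hU
    rw [← hq.isOpen_preimage]
    have hU' : IsOpen (Subtype.val '' U) := hU.trans (isOpen_compl_singleton (x := (0 : V)))
    have : (fun w : { v : V // v ≠ 0 } => toP (w : V)) ⁻¹' ((fun w : { v : V // v ≠ 0 } =>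
        toP (w : V)) '' U) = Subtype.val ⁻¹' ⋃ c : {c : ℂ // c ≠ 0},
          (fun v : V => (c : ℂ) • v) ⁻¹' (Subtype.val '' U) := by
      ext w
      simp only [Set.mem_preimage, Set.mem_image, Set.mem_iUnion]
      constructor
      · rintro ⟨u, hu, h⟩
        obtain ⟨c, hc, h⟩ := toP_eq u.2 w.2 h
        exact ⟨⟨c, hc⟩, u, hu, h⟩
      · rintro ⟨c, u, hu, h⟩
        refine ⟨u, hu, ?_⟩
        rw [h, toP_smul c.2]
    rw [this]
    exact (isOpen_iUnion fun c => hU'.preimage (continuous_const_smul _)).preimage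
      continuous_subtype_val
  have h1 : Filter.map (fun w : { v : V // v ≠ 0 } => toP (w : V)) (𝓝 ⟨v, hv⟩) = 𝓝 (toP v) :=
    le_antisymm (hq.continuous.tendsto _) (ho.nhds_le _)
  rw [← h1, ← map_nhds_subtype_coe_eq_nhds (p := fun v : V => v ≠ 0) hv
    (isOpen_compl_singleton.mem_nhds hv),
    Filter.map_map]
  rfl

theorem continuousAt_toP {v : V} (hv : v ≠ 0) : ContinuousAt toP v := (map_toP_nhds hv).le

theorem continuousOn_toP {X : Type} [TopologicalSpace X] {f : X → V} {s : Set X}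
    (hf : ContinuousOn f s) (h0 : ∀ x ∈ s, f x ≠ 0) : ContinuousOn (fun x => toP (f x)) s :=
  fun x hx => (continuousAt_toP (h0 x hx)).comp_continuousWithinAt (hf x hx)

theorem Cone.continuousOn {X Y : Type} [TopologicalSpace X] [TopologicalSpace Y] (hA : Cone A)
    {g : X × Projectivization ℂ V → Y} {s : Set X}
    (h : ContinuousOn (fun p : X × V => g (p.1, toP p.2)) (s ×ˢ A)) :
    ContinuousOn g (s ×ˢ PS A) := by
  rintro ⟨t, p⟩ ⟨ht, hp⟩
  have h1 : ContinuousWithinAt _ _ (t, p.rep) := h (t, p.rep) ⟨ht, hp⟩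
  have e : 𝓝 (t, p) = Filter.map (Prod.map id toP) (𝓝 (t, p.rep)) := by
    rw [nhds_prod_eq, nhds_prod_eq, ← Filter.prod_map_map_eq', map_toP_nhds p.rep_nonzero, toP_rep,
      Filter.map_id]
  have e2 : 𝓝[s ×ˢ PS A] (t, p) ≤ Filter.map (Prod.map id toP) (𝓝[s ×ˢ A] (t, p.rep)) := by
    rw [nhdsWithin, e, nhdsWithin, ← Filter.map_inf_principal_preimage]
    refine Filter.map_mono ?_
    have hne : ∀ᶠ q : X × V in 𝓝 (t, p.rep), q.2 ≠ 0 :=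
      continuousAt_snd.eventually_ne p.rep_nonzero
    rw [Filter.le_def]
    intro U hU
    rw [Filter.mem_inf_principal] at hU ⊢
    filter_upwards [hU, hne] with q hq hq0 hq'
    exact hq ⟨hq'.1, (hA.toP_mem_iff hq0).1 hq'.2⟩
  unfold ContinuousWithinAt
  refine Filter.Tendsto.mono_left ?_ e2
  rw [Filter.tendsto_map'_iff]
  have h2 : g (t, toP p.rep) = g (t, p) := by rw [toP_rep]
  rw [← h2]
  exact h1

theorem Cone.continuousOn' {Y : Type} [TopologicalSpace Y] (hA : Cone A)
    {g : Projectivization ℂ V → Y} (h : ContinuousOn (fun v => g (toP v)) A) :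
    ContinuousOn g (PS A) := by
  have := hA.continuousOn (X := Unit) (s := Set.univ) (g := fun p => g p.2)
    (h.comp continuousOn_snd fun p hp => hp.2)
  exact this.comp (f := fun p => ((), p)) (by fun_prop) fun p hp => ⟨trivial, hp⟩

theorem Cone.isOpen (hA : Cone O) (h : IsOpen O) : IsOpen (PS O) := by
  rw [isOpen_iff_mem_nhds]
  intro p hp
  rw [← toP_rep p, ← map_toP_nhds p.rep_nonzero, Filter.mem_map]
  filter_upwards [h.mem_nhds hp] with v hv using hA.toP_mem hv

section maps

variable {W : Type} [AddCommGroup W] [Module ℂ W] [Nontrivial W] [TopologicalSpace W]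
  [ContinuousConstSMul ℂ W] [T1Space W]

/-- The map of projective spaces induced by a homogeneous map. -/
noncomputable def projMap (F : V → W) (p : Projectivization ℂ V) : Projectivization ℂ W :=
  toP (F p.rep)

/-- The homotopy of projective spaces induced by a homogeneous homotopy. -/
noncomputable def projHtpy (F : ℝ × V → W) (q : ℝ × Projectivization ℂ V) : Projectivization ℂ W :=
  toP (F (q.1, q.2.rep))

variable {A' B' : Set W}

theorem projMap_toP {F : V → W} (hA : Cone A) (hF : ∀ v ∈ A, ∀ c : ℂ, c ≠ 0 → F (c • v) = c • F v)
    {v : V} (hv : v ∈ A) : projMap F (toP v) = toP (F v) := by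
  obtain ⟨c, hc, h⟩ := exists_rep (hA.ne v hv)
  rw [projMap, h, hF v hv c hc, toP_smul hc]

theorem continuousOn_projMap {F : V → W} (hA : Cone A)
    (hF : ∀ v ∈ A, ∀ c : ℂ, c ≠ 0 → F (c • v) = c • F v) (hc : ContinuousOn F A)
    (h0 : ∀ v ∈ A, F v ≠ 0) : ContinuousOn (projMap F) (PS A) :=
  hA.continuousOn' ((continuousOn_toP hc h0).congr fun _ hv => projMap_toP hA hF hv)

theorem continuousOn_projHtpy {F : ℝ × V → W} (hA : Cone A)
    (hF : ∀ t ∈ Set.Icc (0 : ℝ) 1, ∀ v ∈ A, ∀ c : ℂ, c ≠ 0 → F (t, c • v) = c • F (t, v))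
    (hc : ContinuousOn F (Set.Icc 0 1 ×ˢ A))
    (h0 : ∀ t ∈ Set.Icc (0 : ℝ) 1, ∀ v ∈ A, F (t, v) ≠ 0) :
    ContinuousOn (projHtpy F) (Set.Icc 0 1 ×ˢ PS A) :=
  hA.continuousOn ((continuousOn_toP hc fun p hp => h0 p.1 hp.1 p.2 hp.2).congr fun p hp =>
    projMap_toP (F := fun v => F (p.1, v)) hA (hF p.1 hp.1) hp.2)

end maps

theorem van_cone {F : ℝ × V → V} (hA : Cone A) (hB : Cone B)
    (hF : ∀ t ∈ Set.Icc (0 : ℝ) 1, ∀ v ∈ A, ∀ c : ℂ, c ≠ 0 → F (t, c • v) = c • F (t, v))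
    (hc : ContinuousOn F (Set.Icc 0 1 ×ˢ A))
    (hFA : ∀ t ∈ Set.Icc (0 : ℝ) 1, ∀ v ∈ A, F (t, v) ∈ A)
    (hFB : ∀ t ∈ Set.Icc (0 : ℝ) 1, ∀ v ∈ B, F (t, v) ∈ B) (hBA : B ⊆ A)
    (h0 : ∀ v ∈ A, F (0, v) = v) (h1 : ∀ v ∈ A, F (1, v) ∈ B) (n : ℕ) : Van n (PS A) (PS B) := by
  refine van_of_deformation (projHtpy F) (continuousOn_projHtpy hA hF hc fun t ht v hv =>
    hA.ne _ (hFA t ht v hv)) (fun t ht p hp => hA.toP_mem (hFA t ht _ hp))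
    (fun t ht p hp => hB.toP_mem (hFB t ht _ hp)) (PS_mono hBA) (fun p hp => ?_)
    (fun p hp => hB.toP_mem (h1 _ hp)) n
  rw [projHtpy, h0 _ hp, toP_rep]

/-- A pair of projectivized cones is a homotopy retract of a pair of charts. -/
theorem hretract_cone {E' : Type} [TopologicalSpace E'] {A' B' : Set E'} {f : V → E'} {g : E' → V}
    {F : ℝ × V → V} (hA : Cone A) (hB : Cone B) (hBA : B ⊆ A) (hBA' : B' ⊆ A')
    (hf : ContinuousOn f A) (hfi : ∀ v ∈ A, ∀ c : ℂ, c ≠ 0 → f (c • v) = f v)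
    (hfA : Set.MapsTo f A A') (hfB : Set.MapsTo f B B') (hg : ContinuousOn g A')
    (hgA : Set.MapsTo g A' A) (hgB : Set.MapsTo g B' B)
    (hF : ∀ t ∈ Set.Icc (0 : ℝ) 1, ∀ v ∈ A, ∀ c : ℂ, c ≠ 0 → F (t, c • v) = c • F (t, v))
    (hc : ContinuousOn F (Set.Icc 0 1 ×ˢ A))
    (hFA : ∀ t ∈ Set.Icc (0 : ℝ) 1, ∀ v ∈ A, F (t, v) ∈ A)
    (hFB : ∀ t ∈ Set.Icc (0 : ℝ) 1, ∀ v ∈ B, F (t, v) ∈ B)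
    (h0 : ∀ v ∈ A, F (0, v) = v) (h1 : ∀ v ∈ A, ∃ c : ℂ, c ≠ 0 ∧ F (1, v) = c • g (f v)) :
    HRetract (PS A) (PS B) A' B' (fun p => f p.rep) (fun x => toP (g x)) (projHtpy F) where
  subset := PS_mono hBA
  subset' := hBA'
  cont_f := hA.continuousOn' (hf.congr fun v hv => by
    obtain ⟨c, hc, h⟩ := exists_rep (hA.ne v hv)
    rw [h, hfi v hv c hc])
  fA := fun p hp => hfA hp
  fB := fun p hp => hfB hp
  cont_g := continuousOn_toP hg fun x hx => hA.ne _ (hgA hx)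
  gA := fun x hx => hA.toP_mem (hgA hx)
  gB := fun x hx => hB.toP_mem (hgB hx)
  cont_h := continuousOn_projHtpy hA hF hc fun t ht v hv => hA.ne _ (hFA t ht v hv)
  hA := fun t ht p hp => hA.toP_mem (hFA t ht _ hp)
  hB := fun t ht p hp => hB.toP_mem (hFB t ht _ hp)
  h0 := fun p hp => by rw [projHtpy, h0 _ hp, toP_rep]
  h1 := fun p hp => by
    obtain ⟨c, hc, h⟩ := h1 _ hp
    rw [projHtpy, h, toP_smul hc]

end proj

end

section

open Finsupp Cvx Topology

section euclid

/-- The coordinate subspace of vectors supported on the first `r` coordinates. -/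
def Cr (r : ℕ) : Set (ℕ → ℂ) := {x | ∀ i, r ≤ i → x i = 0}

/-- Real coordinates of a complex vector. -/
noncomputable def reIm (y : ℕ → ℂ) (j : ℕ) : ℂ :=
  if j % 2 = 0 then ((y (j / 2)).re : ℂ) else (y (j / 2)).im

/-- The complex vector with given real coordinates. -/
noncomputable def ofReIm (x : ℕ → ℂ) (i : ℕ) : ℂ := x (2 * i) + x (2 * i + 1) * Complex.I

theorem continuous_reIm : Continuous reIm := by
  refine continuous_pi fun j => ?_
  unfold reIm
  split_ifs <;> fun_prop

theorem continuous_ofReIm : Continuous ofReIm := by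
  unfold ofReIm; fun_prop

theorem reIm_even (y : ℕ → ℂ) (i : ℕ) : reIm y (2 * i) = (y i).re := by simp [reIm]

theorem reIm_odd (y : ℕ → ℂ) (i : ℕ) : reIm y (2 * i + 1) = (y i).im := by
  have : (2 * i + 1) / 2 = i := by omega
  simp [reIm, this]

theorem ofReIm_reIm (y : ℕ → ℂ) : ofReIm (reIm y) = y := by
  funext i
  rw [ofReIm, reIm_even, reIm_odd, Complex.re_add_im]

theorem im_of_ray {x : ℂ} (h : x ∈ Ray 2) : x.im = 0 := by
  obtain ⟨u, hu, h⟩ := Ray.exists two_ne_zero h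
  rcases sq_eq_one_iff.1 hu with rfl | rfl <;> rw [h] <;> simp

theorem ofReal_mem_ray (r : ℝ) : (r : ℂ) ∈ Ray 2 := by
  rw [Ray, Set.mem_ofPred_eq, Complex.norm_real, Real.norm_eq_abs]
  norm_cast
  rw [sq_abs]

theorem reIm_ofReIm {r : ℕ} {x : ℕ → ℂ} (hx : x ∈ Kk 2 (2 * r)) : reIm (ofReIm x) = x := by
  have him : ∀ j, (x j).im = 0 := fun j => by
    by_cases h : j < 2 * r
    · exact im_of_ray (hx.1 j h)
    · rw [hx.2 j (by omega), Complex.zero_im]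
  funext j
  rcases Nat.even_or_odd' j with ⟨i, rfl | rfl⟩
  · rw [reIm_even]
    apply Complex.ext <;> simp [ofReIm, him]
  · rw [reIm_odd]
    apply Complex.ext <;> simp [ofReIm, him]

theorem Cr_homology (r n : ℕ) :
    Pj n (Cr r) (Cr r \ {0}) ∧ (n ≠ 2 * r + 1 → Van n (Cr r) (Cr r \ {0})) := by
  have h0 : reIm 0 = 0 := by funext j; simp [reIm]
  have h0' : ofReIm 0 = 0 := by funext j; simp [ofReIm]
  have hf : Set.MapsTo reIm (Cr r) (Kk 2 (2 * r)) := fun y hy => by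
    refine ⟨fun j _ => ?_, fun j hj => ?_⟩
    · unfold reIm; split_ifs <;> exact ofReal_mem_ray _
    · unfold reIm
      rw [hy (j / 2) (by omega)]
      simp
  have hg : Set.MapsTo ofReIm (Kk 2 (2 * r)) (Cr r) := fun x hx i hi => by
    rw [ofReIm, hx.2 _ (by omega), hx.2 _ (by omega)]; simp
  have hf' : Set.MapsTo reIm (Cr r \ {0}) (Kk 2 (2 * r) \ {0}) := fun y hy =>
    ⟨hf hy.1, fun h => hy.2 (by
      rw [Set.mem_singleton_iff] at h ⊢
      rw [← ofReIm_reIm y, h, h0'])⟩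
  have hg' : Set.MapsTo ofReIm (Kk 2 (2 * r) \ {0}) (Cr r \ {0}) := fun x hx =>
    ⟨hg hx.1, fun h => hx.2 (by
      rw [Set.mem_singleton_iff] at h ⊢
      rw [← reIm_ofReIm hx.1, h, h0])⟩
  have H : HRetract (Cr r) (Cr r \ {0}) (Kk 2 (2 * r)) (Kk 2 (2 * r) \ {0}) reIm ofReIm
      (fun p => p.2) :=
    ⟨Set.sdiff_subset, Set.sdiff_subset, continuous_reIm.continuousOn, hf, hf',
      continuous_ofReIm.continuousOn, hg, hg', continuousOn_snd, fun _ _ _ h => h, fun _ _ _ h => h,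
      fun _ _ => rfl, fun y _ => (ofReIm_reIm y).symm⟩
  have := star_homology two_ne_zero (2 * r) n
  exact ⟨H.pj this.1, fun hn => H.van (this.2 hn)⟩

end euclid

section projspace

/-- The cone over projective `r`-space. -/
def Lc (r : ℕ) : Set (ℕ → ℂ) := {x | x ≠ 0 ∧ x ∈ Cr (r + 1)}

theorem Cr_smul {r : ℕ} {x : ℕ → ℂ} (hx : x ∈ Cr r) (c : ℂ) : c • x ∈ Cr r := fun i hi => by
  simp [hx i hi]

theorem Cr_mono {r s : ℕ} (h : r ≤ s) : Cr r ⊆ Cr s := fun _ hx i hi => hx i (h.trans hi)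

theorem cone_Lc (r : ℕ) : Cone (Lc r) :=
  ⟨fun _ h => h.1, fun _ h c hc => ⟨smul_ne_zero hc h.1, Cr_smul h.2 c⟩⟩

/-- Vectors with some nonzero coordinate among the first `r`. -/
def headNe (r : ℕ) : Set (ℕ → ℂ) := {x | ∃ i < r, x i ≠ 0}

theorem cone_headNe (r : ℕ) : Cone (headNe r) :=
  ⟨by rintro _ ⟨i, -, h⟩ rfl; exact h rfl, fun _ ⟨i, hi, h⟩ c hc => ⟨i, hi, by simp [hc, h]⟩⟩

theorem isOpen_headNe (r : ℕ) : IsOpen (headNe r) := by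
  have : headNe r = ⋃ i, ⋃ (_ : i < r), {x : ℕ → ℂ | x i ≠ 0} := by
    ext x; simp [headNe]
  rw [this]
  exact isOpen_iUnion fun i => isOpen_iUnion fun _ =>
    isOpen_ne_fun (continuous_apply i) continuous_const

/-- Vectors with nonzero `r`-th coordinate. -/
def coordNe (r : ℕ) : Set (ℕ → ℂ) := {x | x r ≠ 0}

theorem cone_coordNe (r : ℕ) : Cone (coordNe r) :=
  ⟨by rintro _ h rfl; exact h rfl, fun _ h c hc => mul_ne_zero hc h⟩

theorem isOpen_coordNe (r : ℕ) : IsOpen (coordNe r) :=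
  isOpen_ne_fun (continuous_apply r) continuous_const

theorem Cone.inter {A B : Set (ℕ → ℂ)} (hA : Cone A) (hB : Cone B) : Cone (A ∩ B) :=
  ⟨fun v h => hA.ne v h.1, fun v h c hc => ⟨hA.smul v h.1 c hc, hB.smul v h.2 c hc⟩⟩

/-- Replacing the `r`-th coordinate. -/
theorem smul_update (x : ℕ → ℂ) (r : ℕ) (c a : ℂ) :
    Function.update (c • x) r (c * a) = c • Function.update x r a := by
  funext i
  by_cases h : i = r
  · subst h; simp
  · simp [h]

theorem van_Lc_head (r n : ℕ) : Van n (PS (Lc (r + 1) ∩ headNe (r + 1))) (PS (Lc r)) := by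
  refine van_cone (F := fun p => Function.update p.2 (r + 1) ((1 - p.1 : ℂ) * p.2 (r + 1)))
    ((cone_Lc _).inter (cone_headNe _)) (cone_Lc r) ?_ ?_ ?_ ?_ ?_ ?_ ?_ n
  · intro t _ v _ c _
    rw [← smul_update]; simp only [Pi.smul_apply, smul_eq_mul]; ring_nf
  · exact continuousOn_update (by fun_prop) (by fun_prop) _
  · rintro t - v ⟨⟨-, hv⟩, i, hi, h⟩
    have h' : Function.update v (r + 1) ((1 - t : ℂ) * v (r + 1)) i ≠ 0 := by
      rwa [Function.update_of_ne (by omega)]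
    refine ⟨⟨fun h0 => h' (by rw [h0]; rfl), fun j hj => ?_⟩, i, hi, h'⟩
    rw [Function.update_of_ne (by omega)]; exact hv j hj
  · rintro t - v hv
    have : Function.update v (r + 1) ((1 - t : ℂ) * v (r + 1)) = v := by
      rw [hv.2 (r + 1) le_rfl, mul_zero, ← hv.2 (r + 1) le_rfl, Function.update_eq_self]
    simp only [this]; exact hv
  · intro v hv
    refine ⟨⟨hv.1, Cr_mono (by omega) hv.2⟩, ?_⟩
    by_contra hc
    simp only [headNe, Set.mem_ofPred_eq, not_exists, not_and, not_not] at hc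
    exact hv.1 (funext fun i => if h : i < r + 1 then hc i h else hv.2 i (by omega))
  · simp
  · rintro v ⟨⟨-, hv⟩, i, hi, h⟩
    have h' : Function.update v (r + 1) ((1 - (1 : ℝ) : ℂ) * v (r + 1)) i ≠ 0 := by
      rwa [Function.update_of_ne (by omega)]
    refine ⟨fun h0 => h' (by rw [h0]; rfl), fun j hj => ?_⟩
    by_cases hj' : j = r + 1
    · subst hj'; simp
    · rw [Function.update_of_ne hj']; exact hv j (by omega)

theorem Lc_chart (r : ℕ) : HRetract (PS (Lc r ∩ coordNe r)) (PS (Lc r ∩ coordNe r ∩ headNe r))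
    (Cr r) (Cr r \ {0}) (fun p => Function.update ((p.rep r)⁻¹ • p.rep) r 0)
    (fun x => toP (Function.update x r 1)) (projHtpy fun q => q.2) := by
  refine hretract_cone (F := fun q => q.2) (f := fun v => Function.update ((v r)⁻¹ • v) r 0)
    (g := fun x => Function.update x r 1) ((cone_Lc _).inter (cone_coordNe _))
    (((cone_Lc _).inter (cone_coordNe _)).inter (cone_headNe _)) Set.inter_subset_left
    Set.sdiff_subset ?_ ?_ ?_ ?_ ?_ ?_ ?_ ?_ ?_ (fun _ _ _ h => h) (fun _ _ _ h => h)
    (fun _ _ => rfl) ?_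
  · refine continuousOn_update (ContinuousOn.smul (ContinuousOn.inv₀ (continuous_apply r).continuousOn ?_) continuousOn_id)
      continuousOn_const _
    exact fun v hv => hv.2
  · intro v hv c hc
    simp only [Pi.smul_apply, smul_eq_mul, smul_smul]
    rw [mul_inv_rev, inv_mul_cancel_right₀ hc]
  · rintro v ⟨⟨-, hv⟩, -⟩ i hi
    by_cases h : i = r
    · subst h; simp
    · beta_reduce; rw [Function.update_of_ne h]; simp [hv i (by omega)]
  · rintro v ⟨⟨⟨-, hv⟩, hv'⟩, i, hi, h⟩
    refine ⟨fun i hi => ?_, fun h' => ?_⟩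
    · by_cases h : i = r
      · subst h; simp
      · beta_reduce; rw [Function.update_of_ne h]; simp [hv i (by omega)]
    · have := congrFun (Set.mem_singleton_iff.1 h') i
      beta_reduce at this
      rw [Function.update_of_ne (by omega)] at this
      exact mul_ne_zero (inv_ne_zero hv') h this
  · exact continuousOn_update continuousOn_id continuousOn_const _
  · intro x hx
    have h1 : Function.update x r 1 r ≠ 0 := by simp
    refine ⟨⟨fun h => h1 (congrFun h r), fun i hi => ?_⟩, h1⟩
    beta_reduce; rw [Function.update_of_ne (by omega)]; exact hx i (by omega)
  · rintro x ⟨hx, hx0⟩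
    have h1 : Function.update x r 1 r ≠ 0 := by simp
    refine ⟨⟨⟨fun h => h1 (congrFun h r), fun i hi => ?_⟩, h1⟩, ?_⟩
    · beta_reduce; rw [Function.update_of_ne (by omega)]; exact hx i (by omega)
    · by_contra hc
      simp only [headNe, Set.mem_ofPred_eq, not_exists, not_and, not_not] at hc
      refine hx0 (funext fun i => if h : i < r then ?_ else hx i (by omega))
      have := hc i h
      beta_reduce at this
      rwa [Function.update_of_ne (by omega)] at this
  · intro t _ v _ c _; rfl
  · exact continuousOn_snd
  · rintro v ⟨-, hv⟩
    refine ⟨v r, hv, funext fun i => ?_⟩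
    have hv : v r ≠ 0 := hv
    by_cases h : i = r
    · subst h; simp
    · simp [h, hv]

theorem projspace_homology (r n : ℕ) :
    Pj n (PS (Lc r)) ∅ ∧ (2 * r + 1 < n → Van n (PS (Lc r)) ∅) ∧ (n % 2 = 0 → Van n (PS (Lc r)) ∅) := by
  have chart : ∀ r n, Pj n (PS (Lc r)) (PS (Lc r ∩ headNe r)) ∧
      (n ≠ 2 * r + 1 → Van n (PS (Lc r)) (PS (Lc r ∩ headNe r))) := fun r n => by
    have hcov : PS (Lc r) ⊆ PS (coordNe r) ∪ PS (headNe r) := fun p hp => by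
      by_contra hc
      simp only [PS, headNe, coordNe, Set.mem_union, Set.mem_ofPred_eq, not_or, not_exists, not_and,
        not_not] at hc
      refine p.rep_nonzero (funext fun i => ?_)
      rcases lt_trichotomy i r with h | rfl | h
      · exact hc.2 i h
      · exact hc.1
      · exact hp.2 i h
    have h1 := (cone_coordNe r).isOpen (isOpen_coordNe r)
    have h2 := (cone_headNe r).isOpen (isOpen_headNe r)
    exact ⟨Pj.excision h1 h2 hcov ((Lc_chart r).pj (Cr_homology r n).1),
      fun hn => Van.excision h1 h2 hcov ((Lc_chart r).van ((Cr_homology r n).2 hn))⟩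
  induction r generalizing n with
  | zero =>
    have e : PS (Lc 0 ∩ headNe 0) = ∅ := by
      ext p; simp [PS, headNe]
    have := chart 0 n
    rw [e] at this
    exact ⟨this.1, fun h => this.2 (by omega), fun h => this.2 (by omega)⟩
  | succ r ih =>
    have hd : PS (Lc r) ⊆ PS (Lc (r + 1) ∩ headNe (r + 1)) := PS_mono fun v hv => by
      refine ⟨⟨hv.1, Cr_mono (by omega) hv.2⟩, ?_⟩
      by_contra hc
      simp only [headNe, Set.mem_ofPred_eq, not_exists, not_and, not_not] at hc
      exact hv.1 (funext fun i => if h : i < r + 1 then hc i h else hv.2 i (by omega))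
    have hsub : PS (Lc (r + 1) ∩ headNe (r + 1)) ⊆ PS (Lc (r + 1)) := PS_mono Set.inter_subset_left
    have hv : ∀ n, Van n (PS (Lc r)) ∅ → Van n (PS (Lc (r + 1) ∩ headNe (r + 1))) ∅ := fun n h =>
      Van.trans (Set.empty_subset _) hd h (van_Lc_head r n)
    have hp : Pj n (PS (Lc (r + 1) ∩ headNe (r + 1))) ∅ :=
      Pj.trans_of_right (Set.empty_subset _) hd (van_Lc_head r _) (ih n).1 (van_Lc_head r n).pj
    have c := chart (r + 1) n
    refine ⟨?_, fun h => Van.trans (Set.empty_subset _) hsub (hv n ((ih n).2.1 (by omega)))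
      (c.2 (by omega)), fun h => Van.trans (Set.empty_subset _) hsub (hv n ((ih n).2.2 h))
      (c.2 (by omega))⟩
    by_cases hn : n % 2 = 0
    · exact Pj.trans_of_left (Set.empty_subset _) hsub (hv n ((ih n).2.2 hn)) c.1
    · exact Pj.trans_of_right (Set.empty_subset _) hsub ((chart (r + 1) (n + 1)).2 (by omega)) hp c.1

end projspace

end

section

open Finsupp Cvx Topology

section roots

variable {d : ℕ}

/-- The `d`-th root of `W` obtained by transporting the `d`-th root `a` of `a ^ d`. -/
noncomputable def rt (d : ℕ) (a W : ℂ) : ℂ := a * (W / a ^ d) ^ ((d : ℂ)⁻¹)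

theorem rt_pow (hd : d ≠ 0) {a W : ℂ} (h : a = 0 → W = 0) : rt d a W ^ d = W := by
  rw [rt, mul_pow, Complex.cpow_nat_inv_pow _ hd]
  by_cases ha : a = 0
  · simp [ha, h ha, hd]
  · field_simp

theorem rt_self (a : ℂ) : rt d a (a ^ d) = a := by
  by_cases h : a ^ d = 0
  · rw [rt, eq_zero_of_pow_eq_zero h, zero_mul]
  · rw [rt, div_self h, Complex.one_cpow, mul_one]

theorem rt_zero_left (W : ℂ) : rt d 0 W = 0 := by simp [rt]

theorem rt_zero (hd : d ≠ 0) (a : ℂ) : rt d a 0 = 0 := by simp [rt, hd]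

theorem rt_smul {c : ℂ} (hc : c ≠ 0) (a W : ℂ) : rt d (c * a) (c ^ d * W) = c * rt d a W := by
  rw [rt, rt, mul_pow, mul_div_mul_left _ _ (pow_ne_zero d hc), mul_assoc]

theorem rt_real {r : ℝ} (hr : 0 ≤ r) (a : ℂ) :
    rt d a (r * a ^ d) = (r ^ ((d : ℝ)⁻¹) : ℝ) * a := by
  by_cases h : a = 0
  · simp [h, rt]
  · rw [rt, mul_div_cancel_right₀ _ (pow_ne_zero d h), mul_comm, Complex.ofReal_cpow hr]
    push_cast; rfl

theorem continuousOn_rt (hd : d ≠ 0) {X : Type} [TopologicalSpace X] {s : Set X} {a W : X → ℂ}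
    (ha : ContinuousOn a s) (hW : ContinuousOn W s) (h0 : ∀ x ∈ s, a x = 0 → W x = 0)
    (hs : ∀ x ∈ s, a x ≠ 0 → 0 ≤ (W x / a x ^ d).re ∨ (W x / a x ^ d).im ≠ 0) :
    ContinuousOn (fun x => rt d (a x) (W x)) s := by
  intro x hx
  by_cases h : a x = 0
  · have hval : rt d (a x) (W x) = 0 := by rw [h, rt_zero_left]
    have hWx : Filter.Tendsto W (𝓝[s] x) (𝓝 0) := by
      rw [← h0 x hx h]; exact hW x hx
    unfold ContinuousWithinAt
    beta_reduce
    rw [hval]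
    refine tendsto_zero_iff_norm_tendsto_zero.2 ?_
    have h1 : Filter.Tendsto (fun y => ‖W y‖ ^ ((d : ℝ)⁻¹)) (𝓝[s] x) (𝓝 0) := by
      have := (hWx.norm).rpow_const (p := (d : ℝ)⁻¹) (Or.inr (by positivity))
      rwa [norm_zero, Real.zero_rpow (by positivity)] at this
    refine h1.congr' ?_
    filter_upwards [self_mem_nhdsWithin] with y hy
    conv_lhs => rw [← rt_pow hd (h0 y hy)]
    rw [norm_pow, Real.pow_rpow_inv_natCast (norm_nonneg _) hd]
  · refine (ha x hx).mul (ContinuousWithinAt.comp_of_eq (t := Set.univ) (x := x)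
      (g := fun z : ℂ => z ^ ((d : ℂ)⁻¹)) (f := fun y => W y / a y ^ d)
      ?_ ((hW x hx).div ((ha x hx).pow d) (pow_ne_zero d h)) (Set.mapsTo_univ _ _) rfl)
    refine (Complex.continuousAt_cpow_const_of_re_pos (hs x hx h) ?_).continuousWithinAt
    have : ((d : ℂ)⁻¹).re = (d : ℝ)⁻¹ := by
      rw [← Complex.ofReal_natCast, ← Complex.ofReal_inv, Complex.ofReal_re]
    rw [this]; positivity

/-- A product with a bounded factor is continuous at the zeros of the other factor. -/
theorem continuousOn_mul_bounded {X : Type} [TopologicalSpace X] {s : Set X} {u φ : X → ℂ} {M : ℝ}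
    (hu : ContinuousOn u s) (hφ : ∀ x ∈ s, u x ≠ 0 → ContinuousWithinAt φ s x)
    (hb : ∀ x ∈ s, ‖φ x‖ ≤ M) : ContinuousOn (fun x => u x * φ x) s := by
  intro x hx
  by_cases h : u x = 0
  · unfold ContinuousWithinAt
    beta_reduce
    rw [h, zero_mul]
    have hux : Filter.Tendsto u (𝓝[s] x) (𝓝 0) := by rw [← h]; exact hu x hx
    refine squeeze_zero_norm' (a := fun y => ‖u y‖ * M) ?_ ?_
    · filter_upwards [self_mem_nhdsWithin] with y hy
      rw [norm_mul]
      exact mul_le_mul_of_nonneg_left (hb y hy) (norm_nonneg _)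
    · simpa using hux.norm.mul_const M
  · exact (hu x hx).mul (hφ x hx h)

/-- The open sector of half-angle `π / d` about the positive axis. -/
def Sec (d : ℕ) : Set ℂ := {u | u ≠ 0 ∧ |u.arg| < Real.pi / d}

theorem pi_div_le (hd : d ≠ 0) : Real.pi / d ≤ Real.pi :=
  div_le_self Real.pi_pos.le (by exact_mod_cast Nat.one_le_iff_ne_zero.2 hd)

theorem pi_div_nonneg : 0 ≤ Real.pi / d := by positivity

theorem mem_Sec_iff (hd : d ≠ 0) {u : ℂ} : u ∈ Sec d ↔ Real.cos (Real.pi / d) * ‖u‖ < u.re := by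
  by_cases h : u = 0
  · simp [Sec, h]
  have hn : 0 < ‖u‖ := norm_pos_iff.2 h
  rw [Sec, Set.mem_ofPred_eq, and_iff_right h, ← lt_div_iff₀ hn, ← Complex.cos_arg h,
    ← Real.cos_abs u.arg]
  exact (Real.strictAntiOn_cos.lt_iff_gt ⟨pi_div_nonneg, pi_div_le hd⟩
    ⟨abs_nonneg _, Complex.abs_arg_le_pi u⟩).symm

theorem isOpen_Sec (hd : d ≠ 0) : IsOpen (Sec d) := by
  have : Sec d = {u : ℂ | Real.cos (Real.pi / d) * ‖u‖ < u.re} := Set.ext fun u => mem_Sec_iff hd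
  rw [this]
  exact isOpen_lt (by fun_prop) (by fun_prop)

theorem Sec_smul {r : ℝ} (hr : 0 < r) {u : ℂ} : (r : ℂ) * u ∈ Sec d ↔ u ∈ Sec d := by
  rw [Sec, Set.mem_ofPred_eq, Set.mem_ofPred_eq, Complex.arg_real_mul _ hr]
  simp [hr.ne']

theorem zero_notMem_Sec : (0 : ℂ) ∉ Sec d := fun h => h.1 rfl

theorem Sec_root (hd : d ≠ 0) {u : ℂ} (hu : u ∈ Sec d) : (u ^ d) ^ ((d : ℂ)⁻¹) = u := by
  have := abs_lt.1 hu.2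
  exact Complex.pow_cpow_nat_inv hd this.1 this.2.le

theorem polar_pow (u : ℂ) (d : ℕ) : u ^ d = (‖u‖ ^ d : ℝ) * Complex.exp ((d * u.arg : ℝ) * Complex.I) := by
  conv_lhs => rw [← Complex.norm_mul_exp_arg_mul_I u]
  rw [mul_pow, ← Complex.exp_nat_mul]
  push_cast; ring_nf

theorem Sec_pow_slit (hd : d ≠ 0) {u : ℂ} (hu : u ∈ Sec d) : u ^ d ∈ Complex.slitPlane := by
  have hd' : (0 : ℝ) < d := by positivity
  have h := abs_lt.1 hu.2
  have h1 : -Real.pi < d * u.arg := by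
    have := mul_lt_mul_of_pos_left h.1 hd'
    rwa [mul_neg, mul_div_cancel₀ _ hd'.ne'] at this
  have h2 : d * u.arg < Real.pi := by
    have := mul_lt_mul_of_pos_left h.2 hd'
    rwa [mul_div_cancel₀ _ hd'.ne'] at this
  have hp : 0 < ‖u‖ ^ d := pow_pos (norm_pos_iff.2 hu.1) d
  rw [Complex.mem_slitPlane_iff_arg, polar_pow, Complex.exp_mul_I,
    Complex.arg_mul_cos_add_sin_mul_I hp ⟨h1, h2.le⟩]
  refine ⟨h2.ne, ?_⟩
  rw [← Complex.exp_mul_I]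
  exact mul_ne_zero (by exact_mod_cast hp.ne') (Complex.exp_ne_zero _)

/-- Points of the open sector do not have a `d`-th power that is real and nonpositive. -/
theorem notMem_Sec_of_pow (hd : d ≠ 0) {u : ℂ} {r : ℝ} (hr : r ≤ 0) (h : u ^ d = r) : u ∉ Sec d := by
  intro hu
  have := Sec_pow_slit hd hu
  rw [h, Complex.ofReal_mem_slitPlane] at this
  exact absurd this hr.not_gt

theorem abs_arg_of_bdry (hd : d ≠ 0) {u : ℂ} (hu : u ≠ 0) (h : Real.cos (Real.pi / d) * ‖u‖ = u.re) :
    |u.arg| = Real.pi / d := by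
  have hn : 0 < ‖u‖ := norm_pos_iff.2 hu
  rw [← eq_div_iff hn.ne', ← Complex.cos_arg hu, ← Real.cos_abs u.arg] at h
  exact (Real.injOn_cos ⟨pi_div_nonneg, pi_div_le hd⟩
    ⟨abs_nonneg _, Complex.abs_arg_le_pi u⟩ h).symm

/-- On the boundary of the sector, the `d`-th power is real and nonpositive. -/
theorem bdry_pow (hd : d ≠ 0) {u : ℂ} (h : Real.cos (Real.pi / d) * ‖u‖ = u.re) :
    u ^ d = ((-‖u‖ ^ d : ℝ) : ℂ) := by
  by_cases hu : u = 0
  · simp [hu, hd]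
  have hd' : (0 : ℝ) < d := by positivity
  rw [polar_pow]
  rcases abs_choice u.arg with h' | h'
  · rw [abs_arg_of_bdry hd hu h] at h'
    rw [← h', mul_div_cancel₀ _ hd'.ne', Complex.exp_pi_mul_I]; push_cast; ring
  · rw [abs_arg_of_bdry hd hu h] at h'
    have : u.arg = - (Real.pi / d) := by linarith
    rw [this, mul_neg, mul_div_cancel₀ _ hd'.ne', Complex.ofReal_neg, neg_mul, Complex.exp_neg,
      Complex.exp_pi_mul_I]; push_cast; ring

/-- The complement of the sector is stable under subtracting nonnegative reals. -/
theorem notMem_Sec_sub (hd : d ≠ 0) {u : ℂ} (hu : u ∉ Sec d) {s : ℝ} (hs : 0 ≤ s) :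
    u - s ∉ Sec d := by
  rw [mem_Sec_iff hd, not_lt] at hu ⊢
  have h1 := norm_sub_norm_le u (s : ℂ)
  have h2 := norm_sub_le u (s : ℂ)
  rw [Complex.norm_real, Real.norm_of_nonneg hs] at h1 h2
  have h3 : |Real.cos (Real.pi / d)| ≤ 1 := Real.abs_cos_le_one _
  have h4 := abs_le.1 h3
  rw [Complex.sub_re, Complex.ofReal_re]
  by_cases hk : 0 ≤ Real.cos (Real.pi / d)
  · nlinarith
  · nlinarith

end roots

end

section

open Finsupp Cvx Topology

section fermat

open ComplexConjugate

theorem continuousOn_glue {X Y : Type} [TopologicalSpace X] [TopologicalSpace Y] {S P Q : Set X}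
    (hP : IsClosed P) (hQ : IsClosed Q) (hS : S ⊆ P ∪ Q) {f g h : X → Y}
    (hf : ContinuousOn f (S ∩ P)) (hg : ContinuousOn g (S ∩ Q)) (h1 : ∀ x ∈ S ∩ P, h x = f x)
    (h2 : ∀ x ∈ S ∩ Q, h x = g x) : ContinuousOn h S := by
  have key : ∀ {R : Set X}, IsClosed R → ContinuousOn h (S ∩ R) → ∀ x ∈ S,
      ContinuousWithinAt h (S ∩ R) x := fun {R} hR hc x hx => by
    by_cases hxR : x ∈ R
    · exact hc x ⟨hx, hxR⟩
    · exact continuousWithinAt_of_notMem_closure fun h' =>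
        hxR (hR.closure_eq ▸ closure_mono Set.inter_subset_right h')
  intro x hx
  have e : S = S ∩ P ∪ S ∩ Q := by
    rw [← Set.inter_union_distrib_left, Set.inter_eq_left.2 hS]
  rw [e]
  exact (key hP (hf.congr h1) x hx).union (key hQ (hg.congr h2) x hx)

variable {d m : ℕ} {ζ : ℂ}

/-- The head of the Fermat form. -/
noncomputable def Qf (d m : ℕ) (z : ℕ → ℂ) : ℂ := ∑ i ∈ Finset.range m, z i ^ d

/-- The cone over the Fermat variety of degree `d` and dimension `m`. -/
def Xc (d m : ℕ) : Set (ℕ → ℂ) := {z | z ≠ 0 ∧ z ∈ Cr (m + 2) ∧ Qf d (m + 2) z = 0}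

theorem Qf_smul (c : ℂ) (z : ℕ → ℂ) : Qf d m (c • z) = c ^ d * Qf d m z := by
  simp [Qf, mul_pow, Finset.mul_sum]

theorem Qf_succ_succ (z : ℕ → ℂ) :
    Qf d (m + 2) z = Qf d m z + z m ^ d + z (m + 1) ^ d := by
  rw [Qf, Finset.sum_range_succ, Finset.sum_range_succ]; rfl

theorem continuous_Qf : Continuous (Qf d m) := by unfold Qf; fun_prop

theorem Xc_eq {z : ℕ → ℂ} (hz : z ∈ Xc d m) : Qf d m z + z m ^ d + z (m + 1) ^ d = 0 := by
  rw [← Qf_succ_succ]; exact hz.2.2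

theorem cone_Xc (d m : ℕ) : Cone (Xc d m) :=
  ⟨fun _ h => h.1, fun _ h c hc => ⟨smul_ne_zero hc h.1, Cr_smul h.2.1 c, by
    rw [Qf_smul, h.2.2, mul_zero]⟩⟩

theorem Qf_congr {z z' : ℕ → ℂ} (h : ∀ i < m, z i = z' i) : Qf d m z = Qf d m z' :=
  Finset.sum_congr rfl fun i hi => by rw [h i (Finset.mem_range.1 hi)]

theorem Qf_eq_zero (hd : d ≠ 0) {z : ℕ → ℂ} (h : z ∉ headNe m) : Qf d m z = 0 := by
  simp only [headNe, Set.mem_ofPred_eq, not_exists, not_and, not_not] at h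
  exact Finset.sum_eq_zero fun i hi => by rw [h i (Finset.mem_range.1 hi), zero_pow hd]

theorem Cr_ne {z : ℕ → ℂ} (h : z ≠ 0) (hz : z ∈ Cr (m + 2)) (h1 : z ∉ headNe m) (h2 : z m = 0) :
    z (m + 1) ≠ 0 := fun h3 => by
  simp only [headNe, Set.mem_ofPred_eq, not_exists, not_and, not_not] at h1
  refine h (funext fun i => ?_)
  rcases lt_trichotomy i m with h' | rfl | h'
  · exact h1 i h'
  · exact h2
  · by_cases h'' : i = m + 1
    · rw [h'']; exact h3
    · exact hz i (by omega)

/-- Replacing the last two homogeneous coordinates. -/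
def upd (m : ℕ) (z : ℕ → ℂ) (a b : ℂ) : ℕ → ℂ := Function.update (Function.update z m a) (m + 1) b

theorem upd_a (z : ℕ → ℂ) (a b : ℂ) : upd m z a b m = a := by
  rw [upd, Function.update_of_ne (by omega), Function.update_self]

theorem upd_b (z : ℕ → ℂ) (a b : ℂ) : upd m z a b (m + 1) = b := by simp [upd]

theorem upd_of_ne {i : ℕ} (z : ℕ → ℂ) (a b : ℂ) (h1 : i ≠ m) (h2 : i ≠ m + 1) :
    upd m z a b i = z i := by
  rw [upd, Function.update_of_ne h2, Function.update_of_ne h1]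

theorem upd_self (z : ℕ → ℂ) : upd m z (z m) (z (m + 1)) = z := by simp [upd]

theorem upd_smul (z : ℕ → ℂ) (a b c : ℂ) : upd m (c • z) (c * a) (c * b) = c • upd m z a b := by
  rw [upd, upd, smul_update, smul_update]

theorem upd_headNe {z : ℕ → ℂ} {a b : ℂ} : upd m z a b ∈ headNe m ↔ z ∈ headNe m := by
  simp only [headNe, Set.mem_ofPred_eq]
  refine exists_congr fun i => and_congr_right fun hi => ?_
  rw [upd_of_ne _ _ _ (by omega) (by omega)]

theorem Qf_upd {z : ℕ → ℂ} {a b : ℂ} : Qf d m (upd m z a b) = Qf d m z :=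
  Qf_congr fun i hi => upd_of_ne _ _ _ (by omega) (by omega)

theorem upd_mem {z : ℕ → ℂ} {a b : ℂ} (hz : z ∈ Cr (m + 2)) (h0 : z ∈ headNe m ∨ a ≠ 0 ∨ b ≠ 0)
    (h : Qf d m z + a ^ d + b ^ d = 0) : upd m z a b ∈ Xc d m := by
  refine ⟨?_, fun i hi => ?_, ?_⟩
  · rcases h0 with h0 | h0 | h0
    · exact (cone_headNe m).ne _ (upd_headNe.2 h0)
    · exact fun h' => h0 (by rw [← upd_a z a b, h']; rfl)
    · exact fun h' => h0 (by rw [← upd_b (m := m) z a b, h']; rfl)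
  · rw [upd_of_ne _ _ _ (by omega) (by omega)]; exact hz i hi
  · rw [Qf_succ_succ, Qf_upd, upd_a, upd_b, h]

theorem continuousOn_upd {X : Type} [TopologicalSpace X] {s : Set X} {f : X → ℕ → ℂ} {a b : X → ℂ}
    (hf : ContinuousOn f s) (ha : ContinuousOn a s) (hb : ContinuousOn b s) :
    ContinuousOn (fun x => upd m (f x) (a x) (b x)) s :=
  continuousOn_update (continuousOn_update hf ha _) hb _

/-- The position of `a / b` relative to the root `ζ`, up to a positive factor. -/
noncomputable def wf (m : ℕ) (ζ : ℂ) (z : ℕ → ℂ) : ℂ := z m * conj (z (m + 1)) * conj ζ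

theorem continuous_wf : Continuous (wf m ζ) := by unfold wf; fun_prop

theorem wf_smul (c : ℂ) (z : ℕ → ℂ) : wf m ζ (c • z) = (‖c‖ ^ 2 : ℝ) * wf m ζ z := by
  have := Complex.mul_conj' c
  simp only [wf, Pi.smul_apply, smul_eq_mul, map_mul]
  push_cast; rw [← this]; ring

theorem wf_smul_mem {c : ℂ} (hc : c ≠ 0) (z : ℕ → ℂ) : wf m ζ (c • z) ∈ Sec d ↔ wf m ζ z ∈ Sec d := by
  rw [wf_smul, Sec_smul (by positivity)]

theorem norm_of_pow_neg (hd : d ≠ 0) (hζ : ζ ^ d = -1) : ‖ζ‖ = 1 := by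
  have : ‖ζ‖ ^ d = 1 := by rw [← norm_pow, hζ]; simp
  exact (pow_eq_one_iff_of_nonneg (norm_nonneg _) hd).1 this

theorem wf_pow (hζ : ζ ^ d = -1) (z : ℕ → ℂ) : wf m ζ z ^ d = - (z m ^ d * conj (z (m + 1) ^ d)) := by
  rw [wf, mul_pow, mul_pow, ← map_pow, ← map_pow, hζ]; simp

/-- A point of the closed sector whose `d`-th power is a positive real is positive. -/
theorem eq_norm_of_pow (hd : d ≠ 0) {u : ℂ} {r : ℝ} (hr : 0 < r) (h : u ^ d = r)
    (hu : Real.cos (Real.pi / d) * ‖u‖ ≤ u.re) : u = ‖u‖ := by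
  have hS : u ∈ Sec d := by
    rw [mem_Sec_iff hd]
    refine lt_of_le_of_ne hu fun h' => ?_
    have := bdry_pow hd h'
    rw [h, Complex.ofReal_inj] at this
    have : 0 ≤ ‖u‖ ^ d := by positivity
    linarith
  have h1 := Sec_root hd hS
  have h2 : u = ((r ^ ((d : ℝ)⁻¹) : ℝ) : ℂ) := by
    rw [← h1, h, Complex.ofReal_cpow hr.le]; push_cast; rfl
  rw [h2, Complex.norm_real, Real.norm_of_nonneg (by positivity)]

theorem eq_mul_of_wf (hd : d ≠ 0) (hζ : ζ ^ d = -1) {z : ℕ → ℂ} (hb : z (m + 1) ≠ 0)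
    (hw : wf m ζ z = ‖wf m ζ z‖) : z m = (‖z m‖ / ‖z (m + 1)‖ : ℝ) * (ζ * z (m + 1)) := by
  have h1 := norm_of_pow_neg hd hζ
  have h2 : ζ * conj ζ = 1 := by rw [Complex.mul_conj', h1]; simp
  have h3 := Complex.mul_conj' (z (m + 1))
  have hb' : (‖z (m + 1)‖ : ℂ) ≠ 0 := by simpa using hb
  rw [wf, norm_mul, norm_mul, Complex.norm_conj, Complex.norm_conj, h1, mul_one] at hw
  have h4 : z m * (‖z (m + 1)‖ : ℂ) ^ 2 = (‖z m‖ * ‖z (m + 1)‖ : ℝ) * (ζ * z (m + 1)) := by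
    rw [← hw, ← h3]; linear_combination (-z m * z (m + 1) * conj (z (m + 1))) * h2
  push_cast at h4 ⊢
  field_simp
  have h5 : (‖z (m + 1)‖ : ℂ) * (z m * (‖z (m + 1)‖ : ℂ)) = ‖z (m + 1)‖ * (‖z m‖ * (ζ * z (m + 1))) := by
    linear_combination h4
  have := mul_left_cancel₀ hb' h5
  linear_combination this

/-- Points of the variety with vanishing head in the closed sector. -/
theorem eq_of_head (hd : d ≠ 0) (hζ : ζ ^ d = -1) {z : ℕ → ℂ} (hz : z ∈ Xc d m) (h : z ∉ headNe m)
    (hw : Real.cos (Real.pi / d) * ‖wf m ζ z‖ ≤ (wf m ζ z).re) :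
    z m = ζ * z (m + 1) ∧ z (m + 1) ≠ 0 := by
  have h1 := Xc_eq hz
  rw [Qf_eq_zero hd h, zero_add] at h1
  have h2 : z m ^ d = - z (m + 1) ^ d := eq_neg_of_add_eq_zero_left h1
  have hb : z (m + 1) ≠ 0 := fun hb => by
    rw [hb, zero_pow hd, neg_zero] at h2
    exact Cr_ne hz.1 hz.2.1 h (eq_zero_of_pow_eq_zero h2) hb
  have h3 : wf m ζ z ^ d = (‖z (m + 1) ^ d‖ ^ 2 : ℝ) := by
    rw [wf_pow hζ, h2, neg_mul, neg_neg, Complex.mul_conj']; push_cast; rfl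
  have h4 := eq_mul_of_wf hd hζ hb (eq_norm_of_pow hd
    (pow_pos (norm_pos_iff.2 (pow_ne_zero d hb)) 2) h3 hw)
  have h5 : ‖z m‖ = ‖z (m + 1)‖ := by
    have : ‖z m‖ ^ d = ‖z (m + 1)‖ ^ d := by rw [← norm_pow, h2, norm_neg, norm_pow]
    exact (pow_left_inj₀ (norm_nonneg _) (norm_nonneg _) hd).1 this
  rw [h5, div_self (by simpa using hb)] at h4
  exact ⟨by simpa using h4, hb⟩

/-- The open set avoiding the point with vanishing head over `ζ`. -/
def avoid (m : ℕ) (ζ : ℂ) : Set (ℕ → ℂ) := {z | z ∈ headNe m ∨ z m ≠ ζ * z (m + 1)}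

theorem cone_avoid (m : ℕ) (ζ : ℂ) : Cone (avoid m ζ) := by
  refine ⟨?_, fun z h c hc => ?_⟩
  · rintro _ (h | h) rfl
    · exact (cone_headNe m).ne _ h rfl
    · simp at h
  · rcases h with h | h
    · exact Or.inl ((cone_headNe m).smul z h c hc)
    · refine Or.inr fun h' => h (mul_left_cancel₀ hc ?_)
      simp only [Pi.smul_apply, smul_eq_mul] at h'
      linear_combination h'

theorem isOpen_avoid (m : ℕ) (ζ : ℂ) : IsOpen (avoid m ζ) :=
  (isOpen_headNe m).union (isOpen_ne_fun (continuous_apply _) (by fun_prop))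

/-- The cone over the complement of the open sector about `ζ`. -/
def XT (d m : ℕ) (ζ : ℂ) : Set (ℕ → ℂ) := {z | z ∈ Xc d m ∧ wf m ζ z ∉ Sec d}

theorem cone_XT (d m : ℕ) (ζ : ℂ) : Cone (XT d m ζ) :=
  ⟨fun v h => h.1.1, fun v h c hc => ⟨(cone_Xc d m).smul v h.1 c hc, by
    rw [wf_smul_mem hc]; exact h.2⟩⟩

theorem mem_Sec_of_eq (hd : d ≠ 0) {r : ℝ} (hr : 0 < r) : (r : ℂ) ∈ Sec d := by
  rw [Sec, Set.mem_ofPred_eq, Complex.arg_ofReal_of_nonneg hr.le, abs_zero]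
  exact ⟨by exact_mod_cast hr.ne', by positivity⟩

theorem wf_of_eq (hd : d ≠ 0) (hζ : ζ ^ d = -1) {z : ℕ → ℂ} {r : ℝ} (h : z m = r * (ζ * z (m + 1))) :
    wf m ζ z = (r * ‖z (m + 1)‖ ^ 2 : ℝ) := by
  have h1 := norm_of_pow_neg hd hζ
  have h2 : ζ * conj ζ = 1 := by rw [Complex.mul_conj', h1]; simp
  have h3 := Complex.mul_conj' (z (m + 1))
  rw [wf, h]; push_cast; rw [← h3]; linear_combination (r * z (m + 1) * conj (z (m + 1))) * h2

theorem XT_subset (hd : d ≠ 0) (hζ : ζ ^ d = -1) : XT d m ζ ⊆ Xc d m ∩ avoid m ζ := by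
  rintro z ⟨hz, hw⟩
  refine ⟨hz, ?_⟩
  by_contra hc
  simp only [avoid, Set.mem_ofPred_eq, not_or, not_not] at hc
  have hb : z (m + 1) ≠ 0 := fun hb =>
    Cr_ne hz.1 hz.2.1 hc.1 (by rw [hc.2, hb, mul_zero]) hb
  apply hw
  rw [wf_of_eq hd hζ (r := 1) (by simpa using hc.2)]
  exact mem_Sec_of_eq hd (by positivity)

end fermat

end

section

open Finsupp Cvx Topology

section sectorRetract

open ComplexConjugate

variable {d m : ℕ} {ζ : ℂ}

noncomputable def lamα (A B : ℂ) : ℝ := max ((A + B) * conj A).re 0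

/-- The share of `A` in the sum `A + B`. -/
noncomputable def lam (A B : ℂ) : ℝ := lamα A B / (lamα A B + lamα B A)

theorem lamα_nonneg (A B : ℂ) : 0 ≤ lamα A B := le_max_right _ _

theorem lamα_add (A B : ℂ) : ‖A + B‖ ^ 2 ≤ lamα A B + lamα B A := by
  have h1 : ((A + B) * conj A).re ≤ lamα A B := le_max_left _ _
  have h2 : ((B + A) * conj B).re ≤ lamα B A := le_max_left _ _
  have h3 : ‖A + B‖ ^ 2 = ((A + B) * conj A).re + ((B + A) * conj B).re := by
    rw [← Complex.add_re, add_comm B A, ← mul_add, ← map_add, Complex.mul_conj']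
    exact_mod_cast rfl
  linarith

theorem lam_nonneg (A B : ℂ) : 0 ≤ lam A B :=
  div_nonneg (lamα_nonneg _ _) (add_nonneg (lamα_nonneg _ _) (lamα_nonneg _ _))

theorem lam_le_one (A B : ℂ) : lam A B ≤ 1 :=
  div_le_one_of_le₀ (le_add_of_nonneg_right (lamα_nonneg _ _))
    (add_nonneg (lamα_nonneg _ _) (lamα_nonneg _ _))

theorem lam_add {A B : ℂ} (h : A + B ≠ 0) : lam A B + lam B A = 1 := by
  have h1 := lamα_add A B
  have h2 : 0 < ‖A + B‖ ^ 2 := by positivity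
  rw [lam, lam, add_comm (lamα B A), ← add_div, div_self (by linarith)]

theorem lam_mul_add (A B : ℂ) : (lam A B : ℂ) * (A + B) + lam B A * (B + A) = A + B := by
  by_cases h : A + B = 0
  · simp [h, add_comm B A]
  · have := lam_add h
    rw [add_comm B A, ← add_mul, ← Complex.ofReal_add, this]; simp

theorem continuous_lam_mul : Continuous fun p : ℂ × ℂ => (p.1 + p.2) * (lam p.1 p.2 : ℂ) := by
  rw [← continuousOn_univ]
  refine continuousOn_mul_bounded (M := 1) (by fun_prop) (fun x _ h => ?_) fun x _ => ?_
  · have h1 := lamα_add x.1 x.2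
    have h2 : 0 < ‖x.1 + x.2‖ ^ 2 := by positivity
    have c1 : Continuous fun p : ℂ × ℂ => lamα p.1 p.2 := by unfold lamα; fun_prop
    have c2 : Continuous fun p : ℂ × ℂ => lamα p.2 p.1 := by unfold lamα; fun_prop
    have : ContinuousAt (fun p : ℂ × ℂ => lam p.1 p.2) x :=
      c1.continuousAt.div (c1.add c2).continuousAt (by linarith)
    exact (Complex.continuous_ofReal.continuousAt.comp this).continuousWithinAt
  · rw [Complex.norm_real, Real.norm_of_nonneg (lam_nonneg _ _)]
    exact lam_le_one _ _

/-- The linear path from `A` to its share of the sum. -/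
noncomputable def lamPath (t : ℝ) (A B : ℂ) : ℂ := (1 - t) * A + t * ((A + B) * lam A B)

theorem lamPath_add (t : ℝ) (A B : ℂ) : lamPath t A B + lamPath t B A = A + B := by
  unfold lamPath
  linear_combination (t : ℂ) * lam_mul_add A B

theorem lamPath_zero (t : ℝ) (B : ℂ) : lamPath t 0 B = 0 := by simp [lamPath, lam, lamα]

theorem lamPath_mul {c : ℂ} (hc : c ≠ 0) (t : ℝ) (A B : ℂ) :
    lamPath t (c * A) (c * B) = c * lamPath t A B := by
  have h : ∀ A B : ℂ, lamα (c * A) (c * B) = ‖c‖ ^ 2 * lamα A B := fun A B => by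
    have e : (c * A + c * B) * conj (c * A) = (‖c‖ ^ 2 : ℝ) * ((A + B) * conj A) := by
      rw [map_mul]; push_cast; rw [← Complex.mul_conj']; ring
    rw [lamα, lamα, e, Complex.re_ofReal_mul, mul_max_of_nonneg _ _ (by positivity), mul_zero]
  have h2 : lam (c * A) (c * B) = lam A B := by
    rw [lam, lam, h, h, ← mul_add, mul_div_mul_left _ _ (by positivity)]
  rw [lamPath, lamPath, h2]; ring

theorem lamPath_re {t : ℝ} (ht : t ∈ Set.Icc (0 : ℝ) 1) {A : ℂ} (hA : A ≠ 0) (B : ℂ) :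
    0 ≤ (lamPath t A B / A).re := by
  have e : lamPath t A B / A = ((1 - t : ℝ) : ℂ) + (t * lam A B / ‖A‖ ^ 2 : ℝ) * ((A + B) * conj A) := by
    have hA' : conj A ≠ 0 := by simpa using hA
    push_cast; rw [← Complex.mul_conj', lamPath]; field_simp
  rw [e, Complex.add_re, Complex.re_ofReal_mul, Complex.ofReal_re]
  have h1 : 0 ≤ 1 - t := by linarith [ht.2]
  have h2 : 0 ≤ lam A B * ((A + B) * conj A).re := by
    by_cases h : 0 ≤ ((A + B) * conj A).re
    · exact mul_nonneg (lam_nonneg _ _) h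
    · have : lamα A B = 0 := max_eq_right (not_le.1 h).le
      rw [lam, this, zero_div, zero_mul]
  have h3 : t * lam A B / ‖A‖ ^ 2 * ((A + B) * conj A).re =
    t / ‖A‖ ^ 2 * (lam A B * ((A + B) * conj A).re) := by ring
  rw [h3]
  exact add_nonneg h1 (mul_nonneg (div_nonneg ht.1 (by positivity)) h2)

theorem lamPath_eq (t : ℝ) {A B : ℂ} {r : ℝ} (hr : 0 ≤ r) (h : A * conj B = r) : lamPath t A B = A := by
  have h' : B * conj A = r := by
    have := congrArg conj h
    rwa [map_mul, Complex.conj_conj, Complex.conj_ofReal, mul_comm] at this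
  have h1 : lamα A B = ‖A‖ ^ 2 + r := by
    rw [lamα, add_mul, h', Complex.mul_conj']
    rw [max_eq_left]
    · simp [← Complex.ofReal_pow]
    · simp [← Complex.ofReal_pow]; positivity
  have h2 : lamα B A = ‖B‖ ^ 2 + r := by
    rw [lamα, add_mul, h, Complex.mul_conj']
    rw [max_eq_left]
    · simp [← Complex.ofReal_pow]
    · simp [← Complex.ofReal_pow]; positivity
  by_cases h0 : ‖A‖ ^ 2 + r + (‖B‖ ^ 2 + r) = 0
  · have hA : A = 0 := by
      have : ‖A‖ ^ 2 = 0 := by nlinarith [sq_nonneg ‖A‖, sq_nonneg ‖B‖]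
      simpa using this
    rw [hA, lamPath_zero]
  · have h3 : (A + B) * lam A B = A := by
      rw [lam, h1, h2]
      have h0' : ((‖A‖ : ℂ) ^ 2 + r + (‖B‖ ^ 2 + r)) ≠ 0 := by exact_mod_cast h0
      push_cast
      rw [mul_div_assoc', div_eq_iff h0', ← Complex.mul_conj', ← Complex.mul_conj']
      linear_combination A * h' - B * h
    rw [lamPath, h3]; ring

theorem continuousOn_lamPath {X : Type} [TopologicalSpace X] {s : Set X} {t : X → ℝ} {A B : X → ℂ}
    (ht : ContinuousOn t s) (hA : ContinuousOn A s) (hB : ContinuousOn B s) :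
    ContinuousOn (fun x => lamPath (t x) (A x) (B x)) s := by
  have h := continuous_lam_mul.comp_continuousOn (hA.prodMk hB)
  unfold lamPath
  have ht' := Complex.continuous_ofReal.comp_continuousOn ht
  exact ((continuousOn_const.sub ht').mul hA).add (ht'.mul h)

theorem continuousOn_rt_lamPath (hd : d ≠ 0) {X : Type} [TopologicalSpace X] {s : Set X} {t : X → ℝ}
    {a b : X → ℂ} (ht : ContinuousOn t s) (ht' : ∀ x ∈ s, t x ∈ Set.Icc (0 : ℝ) 1)
    (ha : ContinuousOn a s) (hb : ContinuousOn b s) :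
    ContinuousOn (fun x => rt d (a x) (lamPath (t x) (a x ^ d) (b x ^ d))) s := by
  refine continuousOn_rt hd ha (continuousOn_lamPath ht (ha.pow d) (hb.pow d)) (fun x _ h => ?_)
    fun x hx h => Or.inl (lamPath_re (ht' x hx) (pow_ne_zero d h) _)
  rw [h, zero_pow hd, lamPath_zero]

open Classical in
/-- The deformation pushing the sector about `ζ` to its boundary. -/
noncomputable def sectorPush (d m : ℕ) (ζ : ℂ) (p : ℝ × (ℕ → ℂ)) : ℕ → ℂ :=
  if wf m ζ p.2 ∈ Sec d then
    upd m p.2 (rt d (p.2 m) (lamPath p.1 (p.2 m ^ d) (p.2 (m + 1) ^ d)))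
      (rt d (p.2 (m + 1)) (lamPath p.1 (p.2 (m + 1) ^ d) (p.2 m ^ d)))
  else p.2

theorem rt_lamPath_pow (hd : d ≠ 0) (t : ℝ) (a b : ℂ) :
    rt d a (lamPath t (a ^ d) (b ^ d)) ^ d = lamPath t (a ^ d) (b ^ d) :=
  rt_pow hd fun h => by rw [h, zero_pow hd, lamPath_zero]

theorem sectorPush_of_mem {t : ℝ} {z : ℕ → ℂ} (hz : wf m ζ z ∈ Sec d) :
    sectorPush d m ζ (t, z) = upd m z (rt d (z m) (lamPath t (z m ^ d) (z (m + 1) ^ d)))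
      (rt d (z (m + 1)) (lamPath t (z (m + 1) ^ d) (z m ^ d))) := if_pos hz

theorem sectorPush_of_notMem {t : ℝ} {z : ℕ → ℂ} (hz : wf m ζ z ∉ Sec d) :
    sectorPush d m ζ (t, z) = z := if_neg hz

theorem sectorPush_of_le (hd : d ≠ 0) (hζ : ζ ^ d = -1) {t : ℝ} {z : ℕ → ℂ}
    (hz : Real.cos (Real.pi / d) * ‖wf m ζ z‖ ≤ (wf m ζ z).re) :
    sectorPush d m ζ (t, z) = upd m z (rt d (z m) (lamPath t (z m ^ d) (z (m + 1) ^ d)))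
      (rt d (z (m + 1)) (lamPath t (z (m + 1) ^ d) (z m ^ d))) := by
  by_cases h : wf m ζ z ∈ Sec d
  · exact sectorPush_of_mem h
  rw [sectorPush_of_notMem h]
  rw [mem_Sec_iff hd, not_lt] at h
  have h1 := bdry_pow hd (le_antisymm hz h)
  rw [wf_pow hζ] at h1
  have h2 : z m ^ d * conj (z (m + 1) ^ d) = (‖wf m ζ z‖ ^ d : ℝ) := by
    rw [← neg_inj, h1]; push_cast; rfl
  have h3 : z (m + 1) ^ d * conj (z m ^ d) = (‖wf m ζ z‖ ^ d : ℝ) := by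
    have := congrArg conj h2
    rwa [map_mul, Complex.conj_conj, Complex.conj_ofReal, mul_comm] at this
  rw [lamPath_eq t (by positivity) h2, lamPath_eq t (by positivity) h3, rt_self, rt_self, upd_self]

theorem continuousOn_sectorPush (hd : d ≠ 0) (hζ : ζ ^ d = -1) :
    ContinuousOn (sectorPush d m ζ) (Set.Icc 0 1 ×ˢ Set.univ) := by
  refine continuousOn_glue
    (P := {p : ℝ × (ℕ → ℂ) | Real.cos (Real.pi / d) * ‖wf m ζ p.2‖ ≤ (wf m ζ p.2).re})
    (Q := {p : ℝ × (ℕ → ℂ) | (wf m ζ p.2).re ≤ Real.cos (Real.pi / d) * ‖wf m ζ p.2‖})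
    (isClosed_le ?_ ?_) (isClosed_le ?_ ?_) (fun p _ =>
      (le_total (Real.cos (Real.pi / d) * ‖wf m ζ p.2‖) (wf m ζ p.2).re :))
    (continuousOn_upd (m := m) (f := Prod.snd) continuousOn_snd
      (continuousOn_rt_lamPath hd (t := Prod.fst) (a := fun p : ℝ × (ℕ → ℂ) => p.2 m)
        (b := fun p : ℝ × (ℕ → ℂ) => p.2 (m + 1))
        continuousOn_fst (fun x hx => hx.1.1) (by fun_prop) (by fun_prop))
      (continuousOn_rt_lamPath hd (t := Prod.fst) (a := fun p : ℝ × (ℕ → ℂ) => p.2 (m + 1))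
        (b := fun p : ℝ × (ℕ → ℂ) => p.2 m)
        continuousOn_fst (fun x hx => hx.1.1) (by fun_prop) (by fun_prop)))
    (g := Prod.snd) continuousOn_snd (fun p hp => sectorPush_of_le hd hζ hp.2)
    fun p hp => sectorPush_of_notMem ?_
  · exact continuous_const.mul (continuous_wf.comp continuous_snd).norm
  · exact Complex.continuous_re.comp (continuous_wf.comp continuous_snd)
  · exact Complex.continuous_re.comp (continuous_wf.comp continuous_snd)
  · exact continuous_const.mul (continuous_wf.comp continuous_snd).norm
  · rw [mem_Sec_iff hd, not_lt]; exact hp.2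

theorem sectorPush_smul {c : ℂ} (hc : c ≠ 0) (t : ℝ) (z : ℕ → ℂ) :
    sectorPush d m ζ (t, c • z) = c • sectorPush d m ζ (t, z) := by
  by_cases h : wf m ζ z ∈ Sec d
  · rw [sectorPush_of_mem h, sectorPush_of_mem ((wf_smul_mem hc z).2 h), ← upd_smul]
    simp only [Pi.smul_apply, smul_eq_mul, mul_pow]
    rw [lamPath_mul (pow_ne_zero d hc), lamPath_mul (pow_ne_zero d hc), rt_smul hc, rt_smul hc]
  · rw [sectorPush_of_notMem h, sectorPush_of_notMem (mt (wf_smul_mem hc z).1 h)]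

/-- The complement of one point with vanishing head retracts to the complement of its sector. -/
theorem van_avoid_XT (hd : d ≠ 0) (hζ : ζ ^ d = -1) (n : ℕ) :
    Van n (PS (Xc d m ∩ avoid m ζ)) (PS (XT d m ζ)) := by
  have hmem : ∀ t : ℝ, ∀ v ∈ Xc d m ∩ avoid m ζ, wf m ζ v ∈ Sec d →
      v ∈ headNe m ∧ sectorPush d m ζ (t, v) ∈ Xc d m := fun t v hv hw => by
    have hh : v ∈ headNe m := by
      by_contra hc
      have := eq_of_head hd hζ hv.1 hc ((mem_Sec_iff hd).1 hw).le
      exact hv.2.elim hc fun h => h this.1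
    refine ⟨hh, ?_⟩
    rw [sectorPush_of_mem hw]
    refine upd_mem hv.1.2.1 (Or.inl hh) ?_
    rw [rt_lamPath_pow hd, rt_lamPath_pow hd, add_assoc, lamPath_add, ← add_assoc]
    exact Xc_eq hv.1
  refine van_cone (F := sectorPush d m ζ) ((cone_Xc d m).inter (cone_avoid m ζ)) (cone_XT d m ζ)
    (fun t _ v _ c hc => sectorPush_smul hc t v)
    ((continuousOn_sectorPush hd hζ).mono (Set.prod_mono le_rfl (Set.subset_univ _)))
    (fun t _ v hv => ?_) (fun t _ v hv => ?_) (XT_subset hd hζ) (fun v hv => ?_) (fun v hv => ?_) n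
  · by_cases hw : wf m ζ v ∈ Sec d
    · refine ⟨(hmem t v hv hw).2, Or.inl ?_⟩
      rw [sectorPush_of_mem hw, upd_headNe]
      exact (hmem t v hv hw).1
    · rwa [sectorPush_of_notMem hw]
  · rwa [sectorPush_of_notMem hv.2]
  · by_cases hw : wf m ζ v ∈ Sec d
    · rw [sectorPush_of_mem hw]
      simp [lamPath, rt_self, upd_self]
    · rw [sectorPush_of_notMem hw]
  · by_cases hw : wf m ζ v ∈ Sec d
    · refine ⟨(hmem 1 v hv hw).2, ?_⟩
      rw [sectorPush_of_mem hw]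
      refine notMem_Sec_of_pow hd (r := - (lam (v m ^ d) (v (m + 1) ^ d) * lam (v (m + 1) ^ d) (v m ^ d) *
        ‖v m ^ d + v (m + 1) ^ d‖ ^ 2)) ?_ ?_
      · rw [neg_nonpos]
        exact mul_nonneg (mul_nonneg (lam_nonneg _ _) (lam_nonneg _ _)) (by positivity)
      · rw [wf_pow hζ, upd_a, upd_b, rt_lamPath_pow hd, rt_lamPath_pow hd]
        push_cast
        rw [← Complex.mul_conj']
        simp only [lamPath, Complex.ofReal_one, sub_self, zero_mul, one_mul, zero_add, map_mul,
          Complex.conj_ofReal, add_comm (v (m + 1) ^ d)]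
        ring
    · rw [sectorPush_of_notMem hw]; exact ⟨hv.1, hw⟩

end sectorRetract

end

section

open Finsupp Cvx Topology

section axisRetract

open ComplexConjugate

variable {d m : ℕ} {ζ : ℂ}

theorem ratio_near {x y β : ℂ} (hβ : β ≠ 0) (hx : ‖x‖ ≤ ‖β‖ / 4) (hy : ‖y‖ ≤ ‖β‖ / 4) :
    x + β ≠ 0 ∧ y + β ≠ 0 ∧ 0 < ((x + β) / (y + β)).re ∧ ‖(x + β) / (y + β)‖ ≤ 2 := by
  have hb : 0 < ‖β‖ := norm_pos_iff.2 hβ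
  have key : ∀ {x : ℂ}, ‖x‖ ≤ ‖β‖ / 4 → 3 / 4 * ‖β‖ ≤ ‖x + β‖ := fun {x} hx => by
    have := norm_sub_norm_le β (-x)
    rw [norm_neg, sub_neg_eq_add, add_comm β x] at this
    linarith
  have h1 : 0 < ‖y + β‖ := by linarith [key hy]
  refine ⟨norm_pos_iff.1 (by linarith [key hx]), norm_pos_iff.1 h1, ?_, ?_⟩
  · have e : ((x + β) / (y + β)).re = ((x + β) * conj (y + β)).re / ‖y + β‖ ^ 2 := by
      rw [Complex.div_re, ← Complex.normSq_eq_norm_sq, Complex.mul_re, Complex.conj_re,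
        Complex.conj_im]
      ring
    rw [e]
    refine div_pos ?_ (by positivity)
    have e2 : (x + β) * conj (y + β) = β * conj β + (x * conj β + β * conj y + x * conj y) := by
      rw [map_add]; ring
    rw [e2, Complex.add_re, Complex.mul_conj', ← Complex.ofReal_pow, Complex.ofReal_re]
    have h2 := (Complex.abs_re_le_norm (x * conj β + β * conj y + x * conj y)).trans (norm_add₃_le)
    simp only [norm_mul, Complex.norm_conj] at h2
    have h3 := neg_abs_le (x * conj β + β * conj y + x * conj y).re
    nlinarith [norm_nonneg x, norm_nonneg y, mul_le_mul hx hy (norm_nonneg _) (by positivity)]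
  · rw [norm_div, div_le_iff₀ h1]
    have := norm_add_le x β
    linarith [key hy]

/-- The displacement of `a / b` away from zero. -/
noncomputable def axV (a b : ℂ) : ℝ := max 0 (1 / 4 - ‖a‖ / ‖b‖)

noncomputable def axA (ζ : ℂ) (t : ℝ) (a b : ℂ) : ℂ := a - b * ((t * axV a b : ℝ) * ζ)

noncomputable def axG (d : ℕ) (ζ : ℂ) (t : ℝ) (a b : ℂ) : ℂ :=
  ((a ^ d + b ^ d) / (axA ζ t a b ^ d + b ^ d)) ^ ((d : ℂ)⁻¹)

theorem axV_nonneg (a b : ℂ) : 0 ≤ axV a b := le_max_left _ _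

theorem axV_mul {c : ℂ} (hc : c ≠ 0) (a b : ℂ) : axV (c * a) (c * b) = axV a b := by
  rw [axV, norm_mul, norm_mul, mul_div_mul_left _ _ (norm_ne_zero_iff.2 hc)]; rfl

theorem axA_mul {c : ℂ} (hc : c ≠ 0) (t : ℝ) (a b : ℂ) :
    axA ζ t (c * a) (c * b) = c * axA ζ t a b := by
  rw [axA, axV_mul hc, axA]; ring

theorem axG_mul {c : ℂ} (hc : c ≠ 0) (t : ℝ) (a b : ℂ) :
    axG d ζ t (c * a) (c * b) = axG d ζ t a b := by
  rw [axG, axA_mul hc, mul_pow, mul_pow, mul_pow, ← mul_add, ← mul_add,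
    mul_div_mul_left _ _ (pow_ne_zero d hc), axG]

theorem norm_axA_le (h1 : ‖ζ‖ = 1) {t : ℝ} (ht : t ∈ Set.Icc (0 : ℝ) 1) {a b : ℂ} (hb : b ≠ 0)
    (h : 4 * ‖a‖ ≤ ‖b‖) : ‖axA ζ t a b‖ ≤ ‖b‖ / 4 := by
  have hb' : 0 < ‖b‖ := norm_pos_iff.2 hb
  have hv : axV a b = 1 / 4 - ‖a‖ / ‖b‖ := max_eq_right (by
    rw [sub_nonneg, div_le_div_iff₀ hb' (by norm_num)]; linarith)
  have h2 : ‖b * ((t * axV a b : ℝ) * ζ)‖ ≤ ‖b‖ / 4 - ‖a‖ := by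
    rw [norm_mul, norm_mul, h1, mul_one, Complex.norm_real,
      Real.norm_of_nonneg (mul_nonneg ht.1 (axV_nonneg _ _))]
    have : ‖b‖ * axV a b = ‖b‖ / 4 - ‖a‖ := by rw [hv]; field_simp
    rw [← this]
    exact mul_le_mul_of_nonneg_left (mul_le_of_le_one_left (axV_nonneg _ _) ht.2) hb'.le
  have := norm_sub_le a (b * ((t * axV a b : ℝ) * ζ))
  rw [axA]; linarith

theorem norm_pow_le_quarter (hd : d ≠ 0) {x b : ℂ} (h : ‖x‖ ≤ ‖b‖ / 4) : ‖x ^ d‖ ≤ ‖b ^ d‖ / 4 := by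
  rw [norm_pow, norm_pow]
  calc ‖x‖ ^ d ≤ (‖b‖ / 4) ^ d := pow_le_pow_left₀ (norm_nonneg _) h d
    _ = ‖b‖ ^ d * (1 / 4) ^ d := by rw [← mul_pow]; ring
    _ ≤ ‖b‖ ^ d * (1 / 4) := by
      refine mul_le_mul_of_nonneg_left ?_ (by positivity)
      exact pow_le_of_le_one (by norm_num) (by norm_num) hd
    _ = _ := by ring

theorem axis_near (hd : d ≠ 0) (h1 : ‖ζ‖ = 1) {t : ℝ} (ht : t ∈ Set.Icc (0 : ℝ) 1) {a b : ℂ}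
    (hb : b ≠ 0) (h : 4 * ‖a‖ ≤ ‖b‖) :
    a ^ d + b ^ d ≠ 0 ∧ axA ζ t a b ^ d + b ^ d ≠ 0 ∧
      0 < ((a ^ d + b ^ d) / (axA ζ t a b ^ d + b ^ d)).re ∧
      ‖(a ^ d + b ^ d) / (axA ζ t a b ^ d + b ^ d)‖ ≤ 2 :=
  ratio_near (pow_ne_zero d hb) (norm_pow_le_quarter hd (by linarith))
    (norm_pow_le_quarter hd (norm_axA_le h1 ht hb h))

theorem axG_pow (hd : d ≠ 0) (t : ℝ) (a b : ℂ) :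
    axG d ζ t a b ^ d = (a ^ d + b ^ d) / (axA ζ t a b ^ d + b ^ d) :=
  Complex.cpow_nat_inv_pow _ hd

theorem norm_axG_le (hd : d ≠ 0) (h1 : ‖ζ‖ = 1) {t : ℝ} (ht : t ∈ Set.Icc (0 : ℝ) 1) {a b : ℂ}
    (h : 4 * ‖a‖ ≤ ‖b‖) : ‖axG d ζ t a b‖ ≤ 2 := by
  by_cases hb : b = 0
  · have ha : a = 0 := by
      rw [hb, norm_zero] at h; exact norm_le_zero_iff.1 (by linarith)
    simp [axG, ha, hb, hd]
  · by_contra hc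
    have h2 := (axis_near hd h1 ht hb h).2.2.2
    rw [← axG_pow hd, norm_pow] at h2
    have h3 : (2 : ℝ) < ‖axG d ζ t a b‖ ^ d :=
      (not_le.1 hc).trans_le (le_self_pow₀ (by linarith) hd)
    linarith

theorem continuousWithinAt_axV {X : Type} [TopologicalSpace X] {s : Set X} {a b : X → ℂ} {x : X}
    (ha : ContinuousWithinAt a s x) (hb : ContinuousWithinAt b s x) (h : b x ≠ 0) :
    ContinuousWithinAt (fun x => axV (a x) (b x)) s x := by
  unfold axV
  refine Filter.Tendsto.max continuousWithinAt_const (continuousWithinAt_const.sub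
    (ha.norm.div hb.norm (norm_ne_zero_iff.2 h)))

theorem continuousOn_axA (h1 : ‖ζ‖ = 1) {X : Type} [TopologicalSpace X] {s : Set X} {t : X → ℝ}
    {a b : X → ℂ} (ht : ContinuousOn t s) (ht' : ∀ x ∈ s, t x ∈ Set.Icc (0 : ℝ) 1)
    (ha : ContinuousOn a s) (hb : ContinuousOn b s) :
    ContinuousOn (fun x => axA ζ (t x) (a x) (b x)) s := by
  unfold axA
  refine ha.sub (continuousOn_mul_bounded (M := 1) hb (fun x hx h => ?_) fun x hx => ?_)
  · refine ContinuousWithinAt.mul (Complex.continuous_ofReal.continuousAt.comp_continuousWithinAt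
      ((ht x hx).mul (continuousWithinAt_axV (ha x hx) (hb x hx) h))) continuousWithinAt_const
  · rw [norm_mul, h1, mul_one, Complex.norm_real,
      Real.norm_of_nonneg (mul_nonneg (ht' x hx).1 (axV_nonneg _ _))]
    have : axV (a x) (b x) ≤ 1 / 4 := max_le (by norm_num) (by
      have : 0 ≤ ‖a x‖ / ‖b x‖ := by positivity
      linarith)
    nlinarith [(ht' x hx).1, (ht' x hx).2, axV_nonneg (a x) (b x)]

theorem continuousWithinAt_axG (hd : d ≠ 0) (h1 : ‖ζ‖ = 1) {X : Type} [TopologicalSpace X] {s : Set X} {t : X → ℝ}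
    {a b : X → ℂ} (ht : ContinuousOn t s) (ht' : ∀ x ∈ s, t x ∈ Set.Icc (0 : ℝ) 1)
    (ha : ContinuousOn a s) (hb : ContinuousOn b s) {x : X} (hx : x ∈ s) (h : b x ≠ 0)
    (h4 : 4 * ‖a x‖ ≤ ‖b x‖) :
    ContinuousWithinAt (fun x => axG d ζ (t x) (a x) (b x)) s x := by
  obtain ⟨h2, h3, h5, -⟩ := axis_near hd h1 (ht' x hx) h h4
  refine ContinuousWithinAt.comp_of_eq (t := Set.univ) (x := x)
      (g := fun z : ℂ => z ^ ((d : ℂ)⁻¹))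
      (f := fun y => (a y ^ d + b y ^ d) / (axA ζ (t y) (a y) (b y) ^ d + b y ^ d))
      ?_ ((((ha x hx).pow d).add ((hb x hx).pow d)).div
        (((continuousOn_axA h1 ht ht' ha hb x hx).pow d).add ((hb x hx).pow d)) h3)
        (Set.mapsTo_univ _ _) rfl
  exact (continuousAt_cpow_const (Or.inl h5)).continuousWithinAt

open Classical in
/-- The deformation pushing the variety off the hyperplane `a = 0`. -/
noncomputable def axisPush (d m : ℕ) (ζ : ℂ) (p : ℝ × (ℕ → ℂ)) : ℕ → ℂ :=
  if 4 * ‖p.2 m‖ ≤ ‖p.2 (m + 1)‖ then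
    upd m p.2 (axA ζ p.1 (p.2 m) (p.2 (m + 1)) * axG d ζ p.1 (p.2 m) (p.2 (m + 1)))
      (p.2 (m + 1) * axG d ζ p.1 (p.2 m) (p.2 (m + 1)))
  else p.2

theorem axisPush_of_le {t : ℝ} {z : ℕ → ℂ} (h : 4 * ‖z m‖ ≤ ‖z (m + 1)‖) :
    axisPush d m ζ (t, z) = upd m z (axA ζ t (z m) (z (m + 1)) * axG d ζ t (z m) (z (m + 1)))
      (z (m + 1) * axG d ζ t (z m) (z (m + 1))) := if_pos h

theorem axisPush_of_eq (hd : d ≠ 0) {t : ℝ} {z : ℕ → ℂ} (ht : t * axV (z m) (z (m + 1)) = 0) :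
    axisPush d m ζ (t, z) = z := by
  by_cases h : 4 * ‖z m‖ ≤ ‖z (m + 1)‖
  · rw [axisPush_of_le h]
    have hA : axA ζ t (z m) (z (m + 1)) = z m := by rw [axA, ht]; simp
    by_cases hb : z (m + 1) = 0
    · have ha : z m = 0 := by
        rw [hb, norm_zero] at h; exact norm_le_zero_iff.1 (by linarith)
      have := upd_self (m := m) z
      rw [hA, hb, ha, zero_mul]
      rwa [hb, ha] at this
    · have hne : z m ^ d + z (m + 1) ^ d ≠ 0 :=
        (ratio_near (pow_ne_zero d hb) (norm_pow_le_quarter hd (by linarith))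
          (norm_pow_le_quarter hd (x := z m) (by linarith))).1
      have hG : axG d ζ t (z m) (z (m + 1)) = 1 := by
        rw [axG, hA, div_self hne, Complex.one_cpow]
      rw [hG, hA, mul_one, mul_one, upd_self]
  · exact if_neg h

theorem axV_eq_zero {a b : ℂ} (h : ‖b‖ ≤ 4 * ‖a‖) (hb : b ≠ 0) : axV a b = 0 := by
  have hb' : 0 < ‖b‖ := norm_pos_iff.2 hb
  refine max_eq_left ?_
  rw [sub_nonpos, div_le_div_iff₀ (by norm_num) hb']; linarith

theorem axisPush_of_ge (hd : d ≠ 0) {t : ℝ} {z : ℕ → ℂ} (h : ‖z (m + 1)‖ ≤ 4 * ‖z m‖) :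
    axisPush d m ζ (t, z) = z := by
  by_cases hb : z (m + 1) = 0
  · by_cases ha : z m = 0
    · rw [axisPush_of_le (by simp [ha, hb]), hb, ha]
      have := upd_self (m := m) z
      rw [hb, ha] at this
      simpa [axA] using this
    · exact if_neg (by simp [hb, ha])
  · exact axisPush_of_eq hd (by rw [axV_eq_zero h hb, mul_zero])

theorem continuousOn_axisPush (hd : d ≠ 0) (h1 : ‖ζ‖ = 1) :
    ContinuousOn (axisPush d m ζ) (Set.Icc 0 1 ×ˢ Set.univ) := by
  refine continuousOn_glue
    (P := {p : ℝ × (ℕ → ℂ) | 4 * ‖p.2 m‖ ≤ ‖p.2 (m + 1)‖})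
    (Q := {p : ℝ × (ℕ → ℂ) | ‖p.2 (m + 1)‖ ≤ 4 * ‖p.2 m‖})
    (isClosed_le (by fun_prop) (by fun_prop)) (isClosed_le (by fun_prop) (by fun_prop))
    (fun p _ => (le_total (4 * ‖p.2 m‖) ‖p.2 (m + 1)‖ :))
    (continuousOn_upd (m := m) (f := Prod.snd) continuousOn_snd
      (a := fun p : ℝ × (ℕ → ℂ) => axA ζ p.1 (p.2 m) (p.2 (m + 1)) * axG d ζ p.1 (p.2 m) (p.2 (m + 1)))
      (b := fun p : ℝ × (ℕ → ℂ) => p.2 (m + 1) * axG d ζ p.1 (p.2 m) (p.2 (m + 1)))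
      (continuousOn_mul_bounded (M := 2) (continuousOn_axA h1 (by fun_prop) (fun x hx => hx.1.1)
        (by fun_prop) (by fun_prop)) (fun p hp h => ?_) fun p hp => norm_axG_le hd h1 hp.1.1 hp.2)
      (continuousOn_mul_bounded (M := 2) (by fun_prop) (fun p hp h => continuousWithinAt_axG hd h1
        (by fun_prop) (fun x hx => hx.1.1) (by fun_prop) (by fun_prop) hp h hp.2)
        fun p hp => norm_axG_le hd h1 hp.1.1 hp.2))
    (g := Prod.snd) continuousOn_snd (fun p hp => axisPush_of_le hp.2)
    fun p hp => axisPush_of_ge hd hp.2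
  refine continuousWithinAt_axG hd h1 (by fun_prop) (fun x hx => hx.1.1) (by fun_prop)
    (by fun_prop) hp (fun hb => h ?_) hp.2
  have h2 : 4 * ‖p.2 m‖ ≤ ‖p.2 (m + 1)‖ := hp.2
  have ha : p.2 m = 0 := by
    rw [hb, norm_zero] at h2; exact norm_le_zero_iff.1 (by linarith)
  simp [axA, ha, hb]

theorem axisPush_smul {c : ℂ} (hc : c ≠ 0) (t : ℝ) (z : ℕ → ℂ) :
    axisPush d m ζ (t, c • z) = c • axisPush d m ζ (t, z) := by
  have e : 4 * ‖(c • z) m‖ ≤ ‖(c • z) (m + 1)‖ ↔ 4 * ‖z m‖ ≤ ‖z (m + 1)‖ := by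
    simp only [Pi.smul_apply, smul_eq_mul, norm_mul]
    rw [mul_left_comm, mul_le_mul_iff_right₀ (norm_pos_iff.2 hc)]
  by_cases h : 4 * ‖z m‖ ≤ ‖z (m + 1)‖
  · rw [axisPush_of_le h, axisPush_of_le (e.2 h), ← upd_smul]
    simp only [Pi.smul_apply, smul_eq_mul]
    rw [axA_mul hc, axG_mul hc, mul_assoc, mul_assoc]
  · rw [axisPush, axisPush, if_neg h, if_neg (mt e.1 h)]

/-- The cone over the part of the sector complement off the hyperplane `a = 0`, or on `b = 0`. -/
def XA (d m : ℕ) (ζ : ℂ) : Set (ℕ → ℂ) := {z | z ∈ XT d m ζ ∧ (z m = 0 → z (m + 1) = 0)}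

theorem cone_XA (d m : ℕ) (ζ : ℂ) : Cone (XA d m ζ) :=
  ⟨fun v h => h.1.1.1, fun v h c hc => ⟨(cone_XT d m ζ).smul v h.1 c hc, fun h' => by
    simp only [Pi.smul_apply, smul_eq_mul, mul_eq_zero, hc, false_or] at h' ⊢; exact h.2 h'⟩⟩

theorem wf_upd (z : ℕ → ℂ) (a b : ℂ) : wf m ζ (upd m z a b) = a * conj b * conj ζ := by
  rw [wf, upd_a, upd_b]

/-- The sector complement retracts off the hyperplane `a = 0`. -/
theorem van_XT_XA (hd : d ≠ 0) (hζ : ζ ^ d = -1) (n : ℕ) :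
    Van n (PS (XT d m ζ)) (PS (XA d m ζ)) := by
  have h1 : ‖ζ‖ = 1 := norm_of_pow_neg hd hζ
  have h2 : ζ * conj ζ = 1 := by rw [Complex.mul_conj', h1]; simp
  have hXT : ∀ t ∈ Set.Icc (0 : ℝ) 1, ∀ v ∈ XT d m ζ, axisPush d m ζ (t, v) ∈ XT d m ζ := by
    intro t ht v hv
    by_cases h : ‖v (m + 1)‖ ≤ 4 * ‖v m‖
    · rwa [axisPush_of_ge hd h]
    have h' : 4 * ‖v m‖ ≤ ‖v (m + 1)‖ := (not_le.1 h).le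
    have hb : v (m + 1) ≠ 0 := fun hb => h (by rw [hb, norm_zero]; positivity)
    obtain ⟨n1, n2, -, -⟩ := axis_near hd h1 ht hb h'
    have hG : axG d ζ t (v m) (v (m + 1)) ≠ 0 := fun hG => by
      have := axG_pow (ζ := ζ) hd t (v m) (v (m + 1))
      rw [hG, zero_pow hd] at this
      exact div_ne_zero n1 n2 this.symm
    rw [axisPush_of_le h']
    refine ⟨upd_mem hv.1.2.1 (Or.inr (Or.inr (mul_ne_zero hb hG))) ?_, ?_⟩
    · rw [mul_pow, mul_pow, add_assoc, ← add_mul, axG_pow hd, mul_div_cancel₀ _ n2, ← add_assoc]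
      exact Xc_eq hv.1
    · have e : wf m ζ (upd m v (axA ζ t (v m) (v (m + 1)) * axG d ζ t (v m) (v (m + 1)))
          (v (m + 1) * axG d ζ t (v m) (v (m + 1)))) =
          (‖axG d ζ t (v m) (v (m + 1))‖ ^ 2 : ℝ) *
            (wf m ζ v - (t * axV (v m) (v (m + 1)) * ‖v (m + 1)‖ ^ 2 : ℝ)) := by
        rw [wf_upd, wf, map_mul]
        push_cast
        rw [← Complex.mul_conj', ← Complex.mul_conj', axA]
        push_cast
        linear_combination (-v (m + 1) * (t * axV (v m) (v (m + 1))) * conj (v (m + 1)) *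
          axG d ζ t (v m) (v (m + 1)) * conj (axG d ζ t (v m) (v (m + 1)))) * h2
      rw [e, Sec_smul (by positivity)]
      exact notMem_Sec_sub hd hv.2 (mul_nonneg (mul_nonneg ht.1 (axV_nonneg _ _)) (by positivity))
  have hkey : ∀ t : ℝ, t ∈ Set.Icc (0 : ℝ) 1 → ∀ v ∈ XT d m ζ, (v m = 0 → v (m + 1) = 0 ∨ t = 1) →
      axisPush d m ζ (t, v) ∈ XA d m ζ := by
    intro t ht v hv h0
    refine ⟨hXT t ht v hv, ?_⟩
    by_cases h : ‖v (m + 1)‖ ≤ 4 * ‖v m‖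
    · rw [axisPush_of_ge hd h]
      intro ha
      rw [ha, norm_zero, mul_zero] at h
      exact norm_le_zero_iff.1 h
    have h' : 4 * ‖v m‖ ≤ ‖v (m + 1)‖ := (not_le.1 h).le
    have hb : v (m + 1) ≠ 0 := fun hb => h (by rw [hb, norm_zero]; positivity)
    rw [axisPush_of_le h', upd_a, upd_b, mul_eq_zero, mul_eq_zero, or_iff_right hb]
    refine fun h3 => h3.resolve_left fun h4 => ?_
    rw [axA, sub_eq_zero] at h4
    have h5 : v m = (t * axV (v m) (v (m + 1)) : ℝ) * (ζ * v (m + 1)) := by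
      exact h4.trans (by push_cast; ring)
    have h6 := wf_of_eq hd hζ h5
    rcases (mul_nonneg ht.1 (axV_nonneg (v m) (v (m + 1)))).eq_or_lt with h7 | h7
    · rw [← h7] at h5
      have ha : v m = 0 := by simpa using h5
      rcases h0 ha with h8 | rfl
      · exact hb h8
      · rw [ha] at h7
        norm_num [axV] at h7
    · refine hv.2 ?_
      rw [h6]
      exact mem_Sec_of_eq hd (mul_pos h7 (by positivity))
  exact van_cone (F := axisPush d m ζ) (cone_XT d m ζ) (cone_XA d m ζ)
    (fun t _ v _ c hc => axisPush_smul hc t v)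
    ((continuousOn_axisPush hd h1).mono (Set.prod_mono le_rfl (Set.subset_univ _)))
    hXT (fun t ht v hv => hkey t ht v hv.1 fun h => Or.inl (hv.2 h)) (fun v hv => hv.1)
    (fun v hv => axisPush_of_eq hd (zero_mul _)) (fun v hv => hkey 1 (by simp) v hv fun _ => Or.inr rfl) n

end axisRetract

end

section

open Finsupp Cvx Topology

section segmentRetract

open ComplexConjugate

variable {d m : ℕ} {ζ : ℂ}

theorem root_mem_Sec (hd : d ≠ 0) {x : ℂ} {k : ℕ} (hx : x ∈ Sec k) (hk : k ≠ 0) :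
    x ^ ((d : ℂ)⁻¹) ∈ Sec (k * d) := by
  have hd' : (0 : ℝ) < d := by positivity
  have e : ((Complex.log x * (d : ℂ)⁻¹)).im = x.arg / d := by
    rw [← Complex.ofReal_natCast, ← Complex.ofReal_inv, mul_comm, Complex.im_ofReal_mul,
      Complex.log_im]; ring
  have h2 : |x.arg / d| < Real.pi / (k * d : ℕ) := by
    rw [abs_div, abs_of_pos hd', Nat.cast_mul, ← div_div]
    exact div_lt_div_of_pos_right hx.2 hd'
  have h3 := abs_lt.1 (h2.trans_le (pi_div_le (Nat.mul_ne_zero hk hd)))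
  rw [Complex.cpow_def_of_ne_zero hx.1]
  refine ⟨Complex.exp_ne_zero _, ?_⟩
  rw [← Complex.log_im, Complex.log_exp (by rw [e]; exact h3.1) (by rw [e]; exact h3.2.le), e]
  exact h2

theorem mem_Sec_two {x : ℂ} (hx : 0 < x.re) : x ∈ Sec 2 :=
  ⟨fun h => by simp [h] at hx, by
    have := Complex.abs_arg_lt_pi_div_two_iff.2 (Or.inl hx); exact_mod_cast this⟩

theorem Sec_div (hd : d ≠ 0) {x y : ℂ} (hx : x ∈ Sec (2 * d)) (hy : y ∈ Sec (2 * d)) :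
    x / y ∈ Sec d := by
  have hd' : (0 : ℝ) < d := by positivity
  have e : Real.pi / (2 * d : ℕ) = Real.pi / d / 2 := by push_cast; field_simp
  have h1 := abs_lt.1 hx.2
  have h2 := abs_lt.1 hy.2
  have h3 := pi_div_le hd
  rw [e] at h1 h2
  have h4 : y⁻¹.arg = -y.arg := by
    rw [Complex.arg_inv, if_neg]
    intro h
    linarith [Real.pi_pos]
  have h5 : (x * y⁻¹).arg = x.arg - y.arg := by
    rw [Complex.arg_mul hx.1 (inv_ne_zero hy.1), h4, sub_eq_add_neg]
    rw [h4]
    constructor <;> linarith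
  rw [div_eq_mul_inv]
  refine ⟨mul_ne_zero hx.1 (inv_ne_zero hy.1), ?_⟩
  rw [h5, abs_lt]
  constructor <;> linarith

/-- The coordinate of the projection of `-B / A` to the unit interval. -/
noncomputable def segP (A B : ℂ) : ℝ := max 0 (min 1 ((-B * conj A).re / ‖A‖ ^ 2))

theorem segP_nonneg (A B : ℂ) : 0 ≤ segP A B := le_max_left _ _

theorem segP_le (A B : ℂ) : segP A B ≤ 1 := max_le zero_le_one (min_le_left _ _)

theorem segP_pos {A B : ℂ} (h : segP A B ≠ 0) : 0 < (-B * conj A).re := by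
  by_contra hc
  exact h (max_eq_left ((min_le_right _ _).trans
    (div_nonpos_of_nonpos_of_nonneg (not_lt.1 hc) (by positivity))))

theorem segP_zero_right (A : ℂ) : segP A 0 = 0 := by simp [segP]

theorem segP_mul {c : ℂ} (hc : c ≠ 0) (A B : ℂ) : segP (c * A) (c * B) = segP A B := by
  have e : -(c * B) * conj (c * A) = (‖c‖ ^ 2 : ℝ) * (-B * conj A) := by
    rw [map_mul]; push_cast; rw [← Complex.mul_conj']; ring
  have : 0 < ‖c‖ := norm_pos_iff.2 hc
  rw [segP, segP, e, Complex.re_ofReal_mul, norm_mul, mul_pow, mul_div_mul_left _ _ (by positivity)]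

theorem segP_eq {A : ℂ} (hA : A ≠ 0) {β : ℝ} (h0 : 0 ≤ β) (h1 : β ≤ 1) : segP A (-(β * A)) = β := by
  have : 0 < ‖A‖ := norm_pos_iff.2 hA
  have e : -(-(β * A)) * conj A = (β * ‖A‖ ^ 2 : ℝ) := by
    push_cast; rw [← Complex.mul_conj']; ring
  rw [segP, e, Complex.ofReal_re, mul_div_cancel_right₀ _ (by positivity), min_eq_right h1,
    max_eq_right h0]

theorem continuousWithinAt_segP {X : Type} [TopologicalSpace X] {s : Set X} {A B : X → ℂ} {x : X}
    (hA : ContinuousWithinAt A s x) (hB : ContinuousWithinAt B s x) (h : A x ≠ 0) :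
    ContinuousWithinAt (fun x => segP (A x) (B x)) s x := by
  unfold segP
  refine Filter.Tendsto.max continuousWithinAt_const (Filter.Tendsto.min continuousWithinAt_const
    (ContinuousWithinAt.div (Complex.continuous_re.continuousAt.comp_continuousWithinAt
      (hB.neg.mul (Complex.continuous_conj.continuousAt.comp_continuousWithinAt hA)))
      (hA.norm.pow 2) ?_))
  have : 0 < ‖A x‖ := norm_pos_iff.2 h
  positivity

/-- The displacement of `B` onto the segment from `0` to `-A`. -/
noncomputable def segD (A B : ℂ) : ℂ := B + A * segP A B

theorem segD_mul {c : ℂ} (hc : c ≠ 0) (A B : ℂ) : segD (c * A) (c * B) = c * segD A B := by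
  rw [segD, segD, segP_mul hc]; ring

theorem segD_zero_right (A : ℂ) : segD A 0 = 0 := by rw [segD, segP_zero_right]; simp

theorem segD_eq {A : ℂ} {β : ℝ} (h0 : 0 ≤ β) (h1 : β ≤ 1) : segD A (-(β * A)) = 0 := by
  by_cases hA : A = 0
  · simp [hA, segD]
  · rw [segD, segP_eq hA h0 h1]; ring

theorem continuousOn_segD {X : Type} [TopologicalSpace X] {s : Set X} {A B : X → ℂ}
    (hA : ContinuousOn A s) (hB : ContinuousOn B s) :
    ContinuousOn (fun x => segD (A x) (B x)) s := by
  refine hB.add (continuousOn_mul_bounded (M := 1) hA (fun x hx h =>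
    Complex.continuous_ofReal.continuousAt.comp_continuousWithinAt
      (continuousWithinAt_segP (hA x hx) (hB x hx) h)) fun x _ => ?_)
  rw [Complex.norm_real, Real.norm_of_nonneg (segP_nonneg _ _)]
  exact segP_le _ _

theorem norm_segD_le {A B : ℂ} (h : A = 0 → B = 0) : ‖segD A B‖ ≤ ‖A + B‖ := by
  by_cases hA : A = 0
  · rw [h hA, segD_zero_right, norm_zero]; positivity
  set p := -B / A with hp
  have hB : B = -(p * A) := by rw [hp]; field_simp
  have hn : 0 < ‖A‖ := norm_pos_iff.2 hA
  have hre : (-B * conj A).re / ‖A‖ ^ 2 = p.re := by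
    have : -B * conj A = (‖A‖ ^ 2 : ℝ) * p := by
      rw [hB]; push_cast; rw [← Complex.mul_conj']; ring
    rw [this, Complex.re_ofReal_mul, mul_div_cancel_left₀ _ (by positivity)]
  have e1 : segD A B = A * (segP A B - p) := by rw [segD]; nth_rw 1 [hB]; ring
  have e2 : A + B = A * (1 - p) := by rw [hB]; ring
  rw [e1, e2, norm_mul, norm_mul]
  refine mul_le_mul_of_nonneg_left ?_ (norm_nonneg _)
  rw [← sq_le_sq₀ (norm_nonneg _) (norm_nonneg _), ← Complex.normSq_eq_norm_sq,
    ← Complex.normSq_eq_norm_sq, Complex.normSq_apply, Complex.normSq_apply]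
  simp only [Complex.sub_re, Complex.sub_im, Complex.ofReal_re, Complex.ofReal_im, Complex.one_re,
    Complex.one_im]
  rw [segP, hre]
  rcases le_total p.re 0 with h1 | h1
  · rw [min_eq_right (by linarith), max_eq_left h1]; nlinarith
  rcases le_total p.re 1 with h2 | h2
  · rw [min_eq_right h2, max_eq_right h1]; nlinarith
  · rw [min_eq_left h2, max_eq_right zero_le_one]

theorem segD_re {t : ℝ} (ht : t ∈ Set.Icc (0 : ℝ) 1) (A : ℂ) {B : ℂ} (hB : B ≠ 0) :
    0 ≤ ((B - t * segD A B) / B).re := by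
  have hn : 0 < ‖B‖ := norm_pos_iff.2 hB
  have hB' : conj B ≠ 0 := by simpa using hB
  have e : (B - t * segD A B) / B =
      ((1 - t : ℝ) : ℂ) + (t * segP A B / ‖B‖ ^ 2 : ℝ) * (-A * conj B) := by
    push_cast; rw [← Complex.mul_conj', segD]; field_simp; ring
  have e2 : (-A * conj B).re = (-B * conj A).re := by simp [Complex.mul_re]; ring
  rw [e, Complex.add_re, Complex.re_ofReal_mul, Complex.ofReal_re, e2]
  have h1 : 0 ≤ 1 - t := by linarith [ht.2]
  by_cases h : segP A B = 0
  · rw [h]; simpa using h1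
  · exact add_nonneg h1 (mul_nonneg (div_nonneg (mul_nonneg ht.1 (segP_nonneg _ _))
      (by positivity)) (segP_pos h).le)

theorem segD_re_pos {t : ℝ} (ht : t ∈ Set.Icc (0 : ℝ) 1) {A B : ℂ} (h : segP A B ≠ 0) :
    0 < ((B - t * segD A B) / B).re ∧ 0 < (-(A * conj (B - t * segD A B))).re := by
  have hB : B ≠ 0 := fun hB => h (by rw [hB, segP_zero_right])
  have hA : A ≠ 0 := fun hA => by have := segP_pos h; simp [hA] at this
  have hn : 0 < ‖B‖ := norm_pos_iff.2 hB
  have hnA : 0 < ‖A‖ := norm_pos_iff.2 hA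
  have hB' : conj B ≠ 0 := by simpa using hB
  have hp : 0 < segP A B := lt_of_le_of_ne (segP_nonneg _ _) (Ne.symm h)
  have h0 := segP_pos h
  have h1 : 0 ≤ 1 - t := by linarith [ht.2]
  have e2 : (-A * conj B).re = (-B * conj A).re := by simp [Complex.mul_re]; ring
  constructor
  · have e : (B - t * segD A B) / B =
        ((1 - t : ℝ) : ℂ) + (t * segP A B / ‖B‖ ^ 2 : ℝ) * (-A * conj B) := by
      push_cast; rw [← Complex.mul_conj', segD]; field_simp; ring
    rw [e, Complex.add_re, Complex.re_ofReal_mul, Complex.ofReal_re, e2]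
    rcases ht.1.eq_or_lt with h2 | h2
    · rw [← h2]; simp
    · have := mul_pos (div_pos (mul_pos h2 hp) (by positivity : 0 < ‖B‖ ^ 2)) h0
      linarith
  · have e : -(A * conj (B - t * segD A B)) =
        ((1 - t : ℝ) : ℂ) * (-A * conj B) + (t * segP A B * ‖A‖ ^ 2 : ℝ) := by
      rw [segD, map_sub, map_mul, map_add, map_mul, Complex.conj_ofReal, Complex.conj_ofReal]
      push_cast; rw [← Complex.mul_conj']; ring
    rw [e, Complex.add_re, Complex.re_ofReal_mul, Complex.ofReal_re, e2]
    rcases ht.1.eq_or_lt with h2 | h2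
    · rw [← h2]; simpa using h0
    · have := mul_pos (mul_pos h2 hp) (by positivity : 0 < ‖A‖ ^ 2)
      nlinarith

/-- The sum of the absolute values of the first `m` powers. -/
noncomputable def Nf (d m : ℕ) (z : ℕ → ℂ) : ℝ := ∑ i ∈ Finset.range m, ‖z i ^ d‖

theorem norm_le_Nf {z : ℕ → ℂ} {i : ℕ} (hi : i < m) : ‖z i ^ d‖ ≤ Nf d m z :=
  Finset.single_le_sum (f := fun i => ‖z i ^ d‖) (fun _ _ => norm_nonneg _) (Finset.mem_range.2 hi)

theorem norm_Qf_le (z : ℕ → ℂ) : ‖Qf d m z‖ ≤ Nf d m z := norm_sum_le _ _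

theorem Nf_nonneg (z : ℕ → ℂ) : 0 ≤ Nf d m z := Finset.sum_nonneg fun _ _ => norm_nonneg _

theorem Nf_smul (c : ℂ) (z : ℕ → ℂ) : Nf d m (c • z) = ‖c ^ d‖ * Nf d m z := by
  simp [Nf, mul_pow, Finset.mul_sum]

theorem continuous_Nf : Continuous (Nf d m) := by unfold Nf; fun_prop

/-- The deformation making `-B / A` a number in the unit interval. -/
noncomputable def segPush (d m : ℕ) (p : ℝ × (ℕ → ℂ)) : ℕ → ℂ := fun i =>
  if i < m then rt d (p.2 i) (p.2 i ^ d +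
    p.1 * (‖p.2 i ^ d‖ * (segD (p.2 m ^ d) (p.2 (m + 1) ^ d) / Nf d m p.2)))
  else if i = m + 1 then rt d (p.2 i) (p.2 i ^ d - p.1 * segD (p.2 m ^ d) (p.2 (m + 1) ^ d))
  else p.2 i

theorem segPush_of_lt {t : ℝ} {z : ℕ → ℂ} {i : ℕ} (hi : i < m) : segPush d m (t, z) i =
    rt d (z i) (z i ^ d + t * (‖z i ^ d‖ * (segD (z m ^ d) (z (m + 1) ^ d) / Nf d m z))) := if_pos hi

theorem segPush_a {t : ℝ} {z : ℕ → ℂ} : segPush d m (t, z) m = z m := by simp [segPush]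

theorem segPush_b {t : ℝ} {z : ℕ → ℂ} : segPush d m (t, z) (m + 1) =
    rt d (z (m + 1)) (z (m + 1) ^ d - t * segD (z m ^ d) (z (m + 1) ^ d)) := by simp [segPush]

theorem segPush_b_pow (hd : d ≠ 0) {t : ℝ} {z : ℕ → ℂ} : segPush d m (t, z) (m + 1) ^ d =
    z (m + 1) ^ d - t * segD (z m ^ d) (z (m + 1) ^ d) := by
  rw [segPush_b, rt_pow hd]
  intro h
  rw [h, zero_pow hd, segD_zero_right]; simp

theorem segPush_of_segD {t : ℝ} {z : ℕ → ℂ} (h : segD (z m ^ d) (z (m + 1) ^ d) = 0 ∨ t = 0) :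
    segPush d m (t, z) = z := by
  funext i
  rcases h with h | rfl <;>
  · unfold segPush
    split_ifs
    · simp [*, rt_self]
    · simp [*, rt_self]
    · rfl

theorem segPush_smul {c : ℂ} (hc : c ≠ 0) (t : ℝ) (z : ℕ → ℂ) :
    segPush d m (t, c • z) = c • segPush d m (t, z) := by
  have h1 : (‖c‖ : ℂ) ^ d ≠ 0 := by simpa using fun h => absurd h hc
  have h2 := segD_mul (pow_ne_zero d hc) (z m ^ d) (z (m + 1) ^ d)
  funext i
  simp only [segPush, Pi.smul_apply, smul_eq_mul, mul_pow, h2, Nf_smul]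
  split_ifs
  · rw [← rt_smul hc]
    congr 1
    simp only [norm_mul, norm_pow]
    push_cast
    rw [mul_div_mul_comm]
    field_simp
  · rw [← rt_smul hc]; congr 1; ring
  · rfl

theorem norm_seg_ratio {z : ℕ → ℂ} (hz : z ∈ XA d m ζ) (hd : d ≠ 0) :
    ‖segD (z m ^ d) (z (m + 1) ^ d) / (Nf d m z : ℂ)‖ ≤ 1 := by
  have h1 := norm_segD_le (A := z m ^ d) (B := z (m + 1) ^ d) fun h => by
    rw [hz.2 (eq_zero_of_pow_eq_zero h), zero_pow hd]
  have h2 : z m ^ d + z (m + 1) ^ d = - Qf d m z := by linear_combination Xc_eq hz.1.1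
  rw [h2, norm_neg] at h1
  rw [norm_div, Complex.norm_real, Real.norm_of_nonneg (Nf_nonneg z)]
  exact div_le_one_of_le₀ (h1.trans (norm_Qf_le z)) (Nf_nonneg z)

theorem continuousOn_segPush (hd : d ≠ 0) :
    ContinuousOn (segPush d m) (Set.Icc 0 1 ×ˢ XA d m ζ) := by
  have hD : ContinuousOn (fun p : ℝ × (ℕ → ℂ) => segD (p.2 m ^ d) (p.2 (m + 1) ^ d))
    (Set.Icc 0 1 ×ˢ XA d m ζ) := continuousOn_segD (by fun_prop) (by fun_prop)
  have hT : Continuous fun p : ℝ × (ℕ → ℂ) => (p.1 : ℂ) := by fun_prop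
  refine continuousOn_pi.2 fun i => ?_
  unfold segPush
  by_cases hi : i < m
  · simp only [hi, if_true]
    refine continuousOn_rt hd (by fun_prop) ?_ ?_ ?_
    · refine ContinuousOn.add (by fun_prop) (hT.continuousOn.mul
        (continuousOn_mul_bounded (M := 1) (by fun_prop) (fun p hp h => ?_) fun p hp =>
          norm_seg_ratio hp.2 hd))
      refine (hD p hp).div (Complex.continuous_ofReal.comp (continuous_Nf.comp
        continuous_snd)).continuousWithinAt ?_
      have h1 := norm_le_Nf (d := d) (z := p.2) hi
      have h2 : 0 < ‖p.2 i ^ d‖ := lt_of_le_of_ne (norm_nonneg _) (Ne.symm (by exact_mod_cast h))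
      exact_mod_cast (h2.trans_le h1).ne'
    · intro p hp h
      simp [h, hd]
    · intro p hp h
      left
      have h1 := norm_seg_ratio hp.2 hd
      set φ := segD (p.2 m ^ d) (p.2 (m + 1) ^ d) / (Nf d m p.2 : ℂ)
      have h2 : p.2 i ^ d ≠ 0 := pow_ne_zero d h
      rw [add_div, div_self h2, Complex.add_re, Complex.one_re]
      have h3 : ‖(p.1 : ℂ) * (‖p.2 i ^ d‖ * φ) / p.2 i ^ d‖ ≤ 1 := by
        rw [norm_div, norm_mul, norm_mul, Complex.norm_real, Complex.norm_real, norm_norm,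
          Real.norm_of_nonneg hp.1.1, div_le_one (norm_pos_iff.2 h2)]
        have := mul_le_one₀ hp.1.2 (norm_nonneg _) h1
        nlinarith [norm_nonneg (p.2 i ^ d)]
      have := neg_le_of_abs_le (Complex.abs_re_le_norm ((p.1 : ℂ) * (‖p.2 i ^ d‖ * φ) / p.2 i ^ d))
      linarith
  · simp only [hi, if_false]
    by_cases hi' : i = m + 1
    · subst hi'
      simp only [if_true]
      refine continuousOn_rt hd (by fun_prop) ((by fun_prop : Continuous fun p : ℝ × (ℕ → ℂ) =>
        p.2 (m + 1) ^ d).continuousOn.sub (hT.continuousOn.mul hD)) ?_ ?_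
      · intro p hp h
        rw [h, zero_pow hd, segD_zero_right]; simp
      · exact fun p hp h => Or.inl (segD_re hp.1 _ (pow_ne_zero d h))
    · simp only [hi', if_false]; fun_prop

/-- The cone over the part of the variety where `-B / A` lies in the unit interval. -/
def Th (d m : ℕ) (ζ : ℂ) : Set (ℕ → ℂ) :=
  {z | z ∈ XT d m ζ ∧ ∃ β : ℝ, 0 ≤ β ∧ β ≤ 1 ∧ z (m + 1) ^ d = -(β * z m ^ d)}

theorem cone_Th (d m : ℕ) (ζ : ℂ) : Cone (Th d m ζ) := by
  refine ⟨fun v h => h.1.1.1, fun v h c hc => ⟨(cone_XT d m ζ).smul v h.1 c hc, ?_⟩⟩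
  obtain ⟨β, h0, h1, h2⟩ := h.2
  refine ⟨β, h0, h1, ?_⟩
  simp only [Pi.smul_apply, smul_eq_mul, mul_pow, h2]; ring

theorem Th_subset (hd : d ≠ 0) : Th d m ζ ⊆ XA d m ζ := fun z hz => ⟨hz.1, fun h => by
  obtain ⟨β, -, -, h2⟩ := hz.2
  rw [h, zero_pow hd] at h2
  exact eq_zero_of_pow_eq_zero (by simpa using h2)⟩

theorem segPush_wf (hd : d ≠ 0) (hζ : ζ ^ d = -1) {t : ℝ} (ht : t ∈ Set.Icc (0 : ℝ) 1) {z : ℕ → ℂ}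
    (hz : wf m ζ z ∉ Sec d) : wf m ζ (segPush d m (t, z)) ∉ Sec d := by
  intro hw
  have hb : z (m + 1) ≠ 0 := fun hb => hw.1 (by rw [wf, segPush_b, hb, rt_zero_left]; simp)
  have hB : z (m + 1) ^ d ≠ 0 := pow_ne_zero d hb
  set A := z m ^ d
  set B := z (m + 1) ^ d
  set f := (B - t * segD A B) / B with hf
  have e : wf m ζ (segPush d m (t, z)) = conj (f ^ ((d : ℂ)⁻¹)) * wf m ζ z := by
    rw [wf, segPush_a, segPush_b, rt, map_mul, wf]; ring
  by_cases hp : segP A B = 0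
  · have hf' : f = ((1 - t : ℝ) : ℂ) := by
      rw [hf, segD, hp, Complex.ofReal_zero, mul_zero, add_zero]; push_cast; field_simp
    have h1 : 0 ≤ 1 - t := by linarith [ht.2]
    have e2 : f ^ ((d : ℂ)⁻¹) = (((1 - t) ^ ((d : ℝ)⁻¹) : ℝ) : ℂ) := by
      rw [hf', Complex.ofReal_cpow h1]; push_cast; rfl
    rw [e, e2, Complex.conj_ofReal] at hw
    have h2 : 0 ≤ (1 - t) ^ ((d : ℝ)⁻¹) := by positivity
    rcases h2.eq_or_lt with h3 | h3
    · rw [← h3] at hw; simp [Sec] at hw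
    · exact hz ((Sec_smul h3).1 hw)
  · obtain ⟨h1, h2⟩ := segD_re_pos ht hp
    have h3 := root_mem_Sec hd (mem_Sec_two (x := conj f) (by simpa using h1)) two_ne_zero
    have h4 : wf m ζ (segPush d m (t, z)) ∈ Sec (2 * d) := by
      rw [← Sec_root hd hw]
      refine root_mem_Sec hd (mem_Sec_two ?_) two_ne_zero
      rw [wf_pow hζ, segPush_a, segPush_b_pow hd]
      exact h2
    have h5 : conj (f ^ ((d : ℂ)⁻¹)) = conj f ^ ((d : ℂ)⁻¹) := by
      have h6 : f.arg ≠ Real.pi := fun h => by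
        have := (mem_Sec_two h1).2
        rw [h, abs_of_pos Real.pi_pos] at this
        push_cast at this
        linarith [Real.pi_pos]
      rw [Complex.conj_cpow _ _ h6]; simp
    have h7 := Sec_div hd h4 h3
    rw [e, h5, mul_div_cancel_left₀ _ h3.1] at h7
    exact hz h7

/-- The sector complement retracts to the locus where `-B / A` lies in the unit interval. -/
theorem van_XA_Th (hd : d ≠ 0) (hζ : ζ ^ d = -1) (n : ℕ) :
    Van n (PS (XA d m ζ)) (PS (Th d m ζ)) := by
  have hfix : ∀ t : ℝ, ∀ v ∈ Th d m ζ, segPush d m (t, v) = v := fun t v hv => by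
    obtain ⟨β, h0, h1, h2⟩ := hv.2
    exact segPush_of_segD (Or.inl (by rw [h2, segD_eq h0 h1]))
  have hmem : ∀ t ∈ Set.Icc (0 : ℝ) 1, ∀ v ∈ XA d m ζ, segPush d m (t, v) ∈ XA d m ζ := by
    intro t ht v hv
    by_cases ha : v m = 0
    · rw [segPush_of_segD]
      · exact hv
      · rw [hv.2 ha, zero_pow hd, segD_zero_right]; exact Or.inl rfl
    refine ⟨⟨⟨fun h => ha ?_, fun i hi => ?_, ?_⟩, segPush_wf hd hζ ht hv.1.2⟩, fun h => ?_⟩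
    · rw [← segPush_a (d := d) (m := m) (t := t) (z := v), h]; rfl
    · rw [segPush, if_neg (by omega), if_neg (by omega)]; exact hv.1.1.2.1 i hi
    · have e : Qf d m (segPush d m (t, v)) = Qf d m v + t * segD (v m ^ d) (v (m + 1) ^ d) := by
        have h1 : ∀ i ∈ Finset.range m, segPush d m (t, v) i ^ d = v i ^ d +
            t * (‖v i ^ d‖ * (segD (v m ^ d) (v (m + 1) ^ d) / Nf d m v)) := fun i hi => by
          rw [segPush_of_lt (Finset.mem_range.1 hi), rt_pow hd]
          intro h; simp [h, hd]
        rw [Qf, Finset.sum_congr rfl h1, Finset.sum_add_distrib, ← Finset.mul_sum,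
          ← Finset.sum_mul, ← Complex.ofReal_sum, ← Nf]
        by_cases hN : Nf d m v = 0
        · have h2 := norm_segD_le (A := v m ^ d) (B := v (m + 1) ^ d) fun h =>
            absurd h (pow_ne_zero d ha)
          have h3 : v m ^ d + v (m + 1) ^ d = - Qf d m v := by linear_combination Xc_eq hv.1.1
          rw [h3, norm_neg] at h2
          have h4 : segD (v m ^ d) (v (m + 1) ^ d) = 0 := by
            rw [← norm_le_zero_iff, ← hN]; exact h2.trans (norm_Qf_le v)
          rw [h4]; simp [Qf]
        · rw [mul_div_cancel₀ _ (by exact_mod_cast hN)]; rfl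
      rw [Qf_succ_succ, e, segPush_a, segPush_b_pow hd]
      linear_combination Xc_eq hv.1.1
    · rw [segPush_a] at h; exact absurd h ha
  refine van_cone (F := segPush d m) (cone_XA d m ζ) (cone_Th d m ζ)
    (fun t _ v _ c hc => segPush_smul hc t v) (continuousOn_segPush hd) hmem
    (fun t _ v hv => by rwa [hfix t v hv]) (Th_subset hd)
    (fun v hv => segPush_of_segD (Or.inr rfl)) (fun v hv => ⟨(hmem 1 (by simp) v hv).1,
      segP (v m ^ d) (v (m + 1) ^ d), segP_nonneg _ _, segP_le _ _, ?_⟩) n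
  rw [segPush_b_pow hd, segPush_a, segD]; push_cast; ring

end segmentRetract

end

section

open Finsupp Cvx Topology

section infinityRetract

open ComplexConjugate

variable {d m : ℕ} {ζ : ℂ}

/-- The cone over the hyperplane section at infinity. -/
def Finf (d m : ℕ) : Set (ℕ → ℂ) := {z | z ∈ Xc d m ∧ z (m + 1) = 0}

theorem cone_Finf (d m : ℕ) : Cone (Finf d m) :=
  ⟨fun v h => h.1.1, fun v h c hc => ⟨(cone_Xc d m).smul v h.1 c hc, by simp [h.2]⟩⟩

theorem Finf_headNe (hd : d ≠ 0) {z : ℕ → ℂ} (hz : z ∈ Finf d m) : z ∈ headNe m := by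
  by_contra hc
  have h := Xc_eq hz.1
  rw [Qf_eq_zero hd hc, hz.2, zero_pow hd, zero_add, add_zero] at h
  exact Cr_ne hz.1.1 hz.1.2.1 hc (eq_zero_of_pow_eq_zero h) hz.2

theorem Finf_subset (hd : d ≠ 0) : Finf d m ⊆ Th d m ζ ∩ headNe m := fun z hz =>
  ⟨⟨⟨hz.1, by rw [wf, hz.2]; simpa using zero_notMem_Sec⟩, 0, le_rfl, zero_le_one, by
    simp [hz.2, hd]⟩, Finf_headNe hd hz⟩

/-- The deformation moving the last coordinate to zero. -/
noncomputable def infPush (d m : ℕ) (p : ℝ × (ℕ → ℂ)) : ℕ → ℂ :=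
  upd m p.2 (rt d (p.2 m) (p.2 m ^ d + p.1 * p.2 (m + 1) ^ d))
    (rt d (p.2 (m + 1)) (((1 - p.1 : ℝ) : ℂ) * p.2 (m + 1) ^ d))

theorem van_Th_Finf (hd : d ≠ 0) (n : ℕ) :
    Van n (PS (Th d m ζ ∩ headNe m)) (PS (Finf d m)) := by
  have hfix : ∀ t : ℝ, ∀ v : ℕ → ℂ, v (m + 1) = 0 → infPush d m (t, v) = v := fun t v hv => by
    simp only [infPush, hv, zero_pow hd, mul_zero, add_zero, rt_self, rt_zero hd]
    conv_rhs => rw [← upd_self (m := m) v, hv]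
  have ha0 : ∀ v ∈ Th d m ζ, v m = 0 → v (m + 1) = 0 := fun v hv => (Th_subset hd hv).2
  have hmem : ∀ t ∈ Set.Icc (0 : ℝ) 1, ∀ v ∈ Th d m ζ ∩ headNe m,
      infPush d m (t, v) ∈ Th d m ζ ∩ headNe m := by
    rintro t ht v ⟨hv, hh⟩
    obtain ⟨β, h0, h1, h2⟩ := hv.2
    have ht1 : 0 ≤ 1 - t := by linarith [ht.2]
    have hb1 : 0 ≤ 1 - t * β := by nlinarith [ht.1, ht.2]
    have e1 : v m ^ d + t * v (m + 1) ^ d = (1 - t * β : ℝ) * v m ^ d := by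
      rw [h2]; push_cast; ring
    have hp1 : rt d (v m) (v m ^ d + t * v (m + 1) ^ d) ^ d = v m ^ d + t * v (m + 1) ^ d :=
      rt_pow hd fun h => by rw [e1, h, zero_pow hd, mul_zero]
    have hp2 : rt d (v (m + 1)) (((1 - t : ℝ) : ℂ) * v (m + 1) ^ d) ^ d =
      ((1 - t : ℝ) : ℂ) * v (m + 1) ^ d := rt_pow hd fun h => by rw [h, zero_pow hd, mul_zero]
    refine ⟨⟨⟨upd_mem hv.1.1.2.1 (Or.inl hh) ?_, ?_⟩, (1 - t) * β / (1 - t * β),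
      by positivity, div_le_one_of_le₀ (by nlinarith) hb1, ?_⟩, upd_headNe.2 hh⟩
    · rw [hp1, hp2]; push_cast; linear_combination Xc_eq hv.1.1
    · rw [infPush, wf_upd]
      rw [e1, rt_real hb1, rt_real ht1]
      set r := (1 - t * β) ^ ((d : ℝ)⁻¹)
      set s := (1 - t) ^ ((d : ℝ)⁻¹)
      have e : r * v m * conj (s * v (m + 1)) * conj ζ = (r * s : ℝ) * wf m ζ v := by
        rw [map_mul, Complex.conj_ofReal, wf]; push_cast; ring
      rw [e]
      have hrs : 0 ≤ r * s := by positivity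
      rcases hrs.eq_or_lt with h | h
      · rw [← h]; simpa using zero_notMem_Sec
      · exact fun h' => hv.1.2 ((Sec_smul h).1 h')
    · simp only [infPush, upd_a, upd_b]
      rw [hp1, hp2, e1, h2]
      by_cases h : 1 - t * β = 0
      · have ht' : 1 - t = 0 := by nlinarith [ht.1, ht.2]
        rw [h, ht']; simp
      · have : ((1 - t * β : ℝ) : ℂ) ≠ 0 := by exact_mod_cast h
        push_cast at this ⊢
        field_simp
  have hsub : Finf d m ⊆ Th d m ζ ∩ headNe m := Finf_subset hd
  refine van_cone (F := infPush d m) ((cone_Th d m ζ).inter (cone_headNe m)) (cone_Finf d m)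
    (fun t _ v _ c hc => ?_) ?_ hmem (fun t _ v hv => by rwa [hfix t v hv.2]) hsub
    (fun v hv => ?_) (fun v hv => ⟨(hmem 1 (by simp) v hv).1.1.1, ?_⟩) n
  · rw [infPush, infPush, ← upd_smul]
    simp only [Pi.smul_apply, smul_eq_mul, mul_pow]
    rw [← rt_smul hc, ← rt_smul hc]
    congr 2 <;> ring
  · refine continuousOn_upd continuousOn_snd (continuousOn_rt hd (by fun_prop) (by fun_prop)
      (fun p hp h => ?_) fun p hp h => Or.inl ?_) (continuousOn_rt hd (by fun_prop) (by fun_prop)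
      (fun p hp h => ?_) fun p hp h => Or.inl ?_)
    · rw [h, ha0 _ hp.2.1 h, zero_pow hd]; simp
    · obtain ⟨β, h0, h1, h2⟩ := hp.2.1.2
      have e : (p.2 m ^ d + p.1 * p.2 (m + 1) ^ d) / p.2 m ^ d = (1 - p.1 * β : ℝ) := by
        rw [h2]; push_cast; field_simp; ring
      rw [e, Complex.ofReal_re]
      nlinarith [hp.1.1, hp.1.2]
    · rw [h, zero_pow hd, mul_zero]
    · rw [mul_div_cancel_right₀ _ (pow_ne_zero d h), Complex.ofReal_re]
      linarith [hp.1.2]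
  · simp [infPush, rt_self, upd_self]
  · simp [infPush, upd_b, rt_zero hd]

end infinityRetract

section sectorChart

open ComplexConjugate

variable {d m : ℕ} {ζ : ℂ}

/-- The affine coordinates near a point with vanishing head. -/
noncomputable def affY (m : ℕ) (ζ : ℂ) (z : ℕ → ℂ) : ℕ → ℂ :=
  fun i => if i < m then ζ * z i / z m else 0

theorem affY_smul {c : ℂ} (hc : c ≠ 0) (z : ℕ → ℂ) : affY m ζ (c • z) = affY m ζ z := by
  funext i
  simp only [affY, Pi.smul_apply, smul_eq_mul]
  split_ifs
  · rw [mul_left_comm, mul_div_mul_left _ _ hc]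
  · rfl

theorem Qf_affY (hζ : ζ ^ d = -1) (z : ℕ → ℂ) : Qf d m (affY m ζ z) = - Qf d m z / z m ^ d := by
  rw [Qf, Qf, ← Finset.sum_neg_distrib, Finset.sum_div]
  refine Finset.sum_congr rfl fun i hi => ?_
  rw [affY, if_pos (Finset.mem_range.1 hi), div_pow, mul_pow, hζ, neg_one_mul]

/-- The points of the variety in the sector about `ζ` with affine coordinates in `S`. -/
def chartSet (d m : ℕ) (ζ : ℂ) (S : Set (ℕ → ℂ)) : Set (ℕ → ℂ) :=
  {z | z ∈ Xc d m ∧ wf m ζ z ∈ Sec d ∧ affY m ζ z ∈ S}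

theorem cone_chartSet (d m : ℕ) (ζ : ℂ) (S : Set (ℕ → ℂ)) : Cone (chartSet d m ζ S) :=
  ⟨fun v h => h.1.1, fun v h c hc => ⟨(cone_Xc d m).smul v h.1 c hc, (wf_smul_mem hc v).2 h.2.1, by
    rw [affY_smul hc]; exact h.2.2⟩⟩

theorem Sec_conj {u : ℂ} (hu : u ∈ Sec d) (hd : d ≠ 0) : conj u ∈ Sec d := by
  rw [mem_Sec_iff hd] at hu ⊢
  simpa using hu

theorem mem_Sec_one {u : ℂ} : u ∈ Sec 1 ↔ u ∈ Complex.slitPlane := by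
  rw [Complex.mem_slitPlane_iff_arg, Sec, Set.mem_ofPred_eq, and_comm, Nat.cast_one, div_one]
  refine and_congr_left fun _ => ⟨fun h => ((abs_lt.1 h).2).ne, fun h => abs_lt.2
    ⟨Complex.neg_pi_lt_arg u, lt_of_le_of_ne (Complex.arg_le_pi u) h⟩⟩

/-- The domain on which the principal root of `1 - Q` is continuous. -/
def slitDom (d m : ℕ) : Set (ℕ → ℂ) := {y | 1 - Qf d m y ∈ Complex.slitPlane}

/-- The inverse of the affine coordinates. -/
noncomputable def affInv (d m : ℕ) (ζ : ℂ) (y : ℕ → ℂ) : ℕ → ℂ :=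
  upd m y ζ ((1 - Qf d m y) ^ ((d : ℂ)⁻¹))

theorem wf_ratio {z : ℕ → ℂ} (hd : d ≠ 0) (hw : wf m ζ z ∈ Sec d) :
    z m ≠ 0 ∧ ζ * z (m + 1) / z m ∈ Sec d := by
  have ha : z m ≠ 0 := fun h => hw.1 (by rw [wf, h]; simp)
  refine ⟨ha, ?_⟩
  have h1 := Sec_conj hw hd
  have hn : 0 < ‖z m‖ := norm_pos_iff.2 ha
  rw [← Sec_smul (r := ‖z m‖ ^ 2) (by positivity)]
  convert h1 using 1
  rw [wf, map_mul, map_mul, Complex.conj_conj, Complex.conj_conj]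
  push_cast
  rw [← Complex.mul_conj']
  field_simp

theorem chart_ratio {z : ℕ → ℂ} (hζ : ζ ^ d = -1) (hz : z ∈ Xc d m) (ha : z m ≠ 0) :
    1 - Qf d m (affY m ζ z) = (ζ * z (m + 1) / z m) ^ d := by
  rw [Qf_affY hζ, div_pow, mul_pow, hζ]
  field_simp
  linear_combination Xc_eq hz

theorem affInv_affY {z : ℕ → ℂ} (hd : d ≠ 0) (hζ : ζ ^ d = -1) (hz : z ∈ Xc d m)
    (hw : wf m ζ z ∈ Sec d) : affInv d m ζ (affY m ζ z) = (ζ / z m) • z := by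
  obtain ⟨ha, hx⟩ := wf_ratio hd hw
  rw [affInv, chart_ratio hζ hz ha, Sec_root hd hx]
  funext i
  simp only [Pi.smul_apply, smul_eq_mul]
  by_cases h1 : i = m
  · rw [h1, upd_a]; field_simp
  by_cases h2 : i = m + 1
  · rw [h2, upd_b]; ring
  rw [upd_of_ne _ _ _ h1 h2, affY]
  split_ifs with h3
  · ring
  · rw [hz.2.1 i (by omega), mul_zero]

theorem affY_affInv {y : ℕ → ℂ} (hζ : ζ ≠ 0) (hy : y ∈ Cr m) : affY m ζ (affInv d m ζ y) = y := by
  funext i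
  rw [affY]
  split_ifs with h
  · rw [affInv, upd_a, upd_of_ne _ _ _ (by omega) (by omega), mul_div_cancel_left₀ _ hζ]
  · exact (hy i (by omega)).symm

theorem affY_ne_zero {z : ℕ → ℂ} (hζ : ζ ≠ 0) (ha : z m ≠ 0) : affY m ζ z ≠ 0 ↔ z ∈ headNe m := by
  constructor
  · intro h
    by_contra hc
    simp only [headNe, Set.mem_ofPred_eq, not_exists, not_and, not_not] at hc
    refine h (funext fun i => ?_)
    rw [affY]
    split_ifs with h'
    · rw [hc i h']; simp
    · rfl
  · rintro ⟨i, hi, h⟩ h'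
    have := congrFun h' i
    rw [affY, if_pos hi, Pi.zero_apply] at this
    exact div_ne_zero (mul_ne_zero hζ h) ha this

theorem hretract_chart (hd : d ≠ 0) (hζ : ζ ^ d = -1) {S : Set (ℕ → ℂ)} (hS : S ⊆ Cr m) :
    HRetract (PS (chartSet d m ζ S)) (PS (chartSet d m ζ S ∩ headNe m)) (S ∩ slitDom d m)
      ((S ∩ slitDom d m) \ {0}) (fun p => affY m ζ p.rep) (fun y => toP (affInv d m ζ y))
      (projHtpy fun q => q.2) := by
  have h1 := norm_of_pow_neg hd hζ
  have hζ0 : ζ ≠ 0 := fun h => by simp [h] at h1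
  have hfA : Set.MapsTo (affY m ζ) (chartSet d m ζ S) (S ∩ slitDom d m) := fun z hz => by
    obtain ⟨ha, hx⟩ := wf_ratio hd hz.2.1
    refine ⟨hz.2.2, ?_⟩
    rw [slitDom, Set.mem_ofPred_eq, chart_ratio hζ hz.1 ha]
    exact Sec_pow_slit hd hx
  have hgA : Set.MapsTo (affInv d m ζ) (S ∩ slitDom d m) (chartSet d m ζ S) := by
    rintro y ⟨hy, hD⟩
    have h2 := root_mem_Sec hd (mem_Sec_one.2 hD) one_ne_zero
    rw [one_mul] at h2
    refine ⟨upd_mem (Cr_mono (by omega) (hS hy)) (Or.inr (Or.inl hζ0)) ?_, ?_, ?_⟩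
    · rw [hζ, Complex.cpow_nat_inv_pow _ hd]; ring
    · rw [affInv, wf_upd, mul_right_comm, Complex.mul_conj', h1]
      simpa using Sec_conj h2 hd
    · rwa [affY_affInv hζ0 (hS hy)]
  refine hretract_cone (F := fun q => q.2) (f := affY m ζ) (g := affInv d m ζ)
    (cone_chartSet d m ζ S) ((cone_chartSet d m ζ S).inter (cone_headNe m)) Set.inter_subset_left
    Set.sdiff_subset ?_ (fun v _ c hc => affY_smul hc v) hfA
    (fun z hz => ⟨hfA hz.1, (affY_ne_zero hζ0 (wf_ratio hd hz.1.2.1).1).2 hz.2⟩) ?_ hgA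
    (fun y hy => ⟨hgA hy.1, ?_⟩) (fun t _ v _ c _ => rfl) continuousOn_snd (fun _ _ _ h => h)
    (fun _ _ _ h => h) (fun _ _ => rfl) (fun z hz => ?_)
  · refine continuousOn_pi.2 fun i => ?_
    unfold affY
    split_ifs
    · exact ContinuousOn.div (by fun_prop) (by fun_prop) fun z hz => (wf_ratio hd hz.2.1).1
    · exact continuousOn_const
  · exact continuousOn_upd continuousOn_id continuousOn_const
      (ContinuousOn.cpow_const (continuousOn_const.sub continuous_Qf.continuousOn) fun y hy => hy.2)
  · rw [← affY_ne_zero hζ0 (wf_ratio hd (hgA hy.1).2.1).1, affY_affInv hζ0 (hS hy.1.1)]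
    exact hy.2
  · have ha := (wf_ratio hd hz.2.1).1
    refine ⟨z m / ζ, div_ne_zero ha hζ0, ?_⟩
    rw [affInv_affY hd hζ hz.1 hz.2.1, smul_smul, div_mul_div_cancel₀ hζ0, div_self ha, one_smul]

/-- Scaling into the slit domain. -/
noncomputable def slitScale (d m : ℕ) (t : ℝ) (y : ℕ → ℂ) : ℝ := 1 - t + t / (1 + ‖Qf d m y‖)

theorem slitScale_pos {t : ℝ} (ht : t ∈ Set.Icc (0 : ℝ) 1) (y : ℕ → ℂ) :
    0 < slitScale d m t y ∧ slitScale d m t y ≤ 1 := by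
  have h : 0 ≤ ‖Qf d m y‖ := norm_nonneg _
  have h1 : 0 < t / (1 + ‖Qf d m y‖) ∨ t = 0 := ht.1.eq_or_lt.symm.imp (fun h' => by positivity) Eq.symm
  have h2 : t / (1 + ‖Qf d m y‖) ≤ t := div_le_self ht.1 (by linarith)
  rw [slitScale]
  refine ⟨?_, by linarith⟩
  rcases h1 with h1 | rfl
  · linarith [ht.2]
  · simp

theorem slit_smul {s : ℝ} (h0 : 0 ≤ s) (h1 : s ≤ 1) {y : ℕ → ℂ} (hy : y ∈ slitDom d m) :
    (s : ℂ) • y ∈ slitDom d m := by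
  rw [slitDom, Set.mem_ofPred_eq, Qf_smul]
  have h2 : (0 : ℝ) ≤ s ^ d := by positivity
  have h3 : s ^ d ≤ 1 := pow_le_one₀ h0 h1
  have := Complex.starConvex_one_slitPlane hy (a := 1 - s ^ d) (b := s ^ d) (by linarith) h2 (by ring)
  convert this using 1
  simp only [Complex.real_smul]
  push_cast; ring

theorem hretract_slit (hd : d ≠ 0) {S : Set (ℕ → ℂ)}
    (hS : ∀ y ∈ S, ∀ r : ℝ, 0 < r → (r : ℂ) • y ∈ S) :
    HRetract (S ∩ slitDom d m) ((S ∩ slitDom d m) \ {0}) S (S \ {0}) id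
      (fun y => (slitScale d m 1 y : ℂ) • y) (fun q => (slitScale d m q.1 q.2 : ℂ) • q.2) := by
  have hne : ∀ t ∈ Set.Icc (0 : ℝ) 1, ∀ y : ℕ → ℂ, y ≠ 0 → (slitScale d m t y : ℂ) • y ≠ 0 :=
    fun t ht y hy => smul_ne_zero (by exact_mod_cast (slitScale_pos ht y).1.ne') hy
  have hc : Continuous fun q : ℝ × (ℕ → ℂ) => (slitScale d m q.1 q.2 : ℂ) • q.2 := by
    unfold slitScale
    refine Continuous.smul (Complex.continuous_ofReal.comp ((continuous_const.sub continuous_fst).add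
      (continuous_fst.div (continuous_const.add (continuous_Qf.comp continuous_snd).norm) ?_)))
      continuous_snd
    exact fun q => (add_pos_of_pos_of_nonneg one_pos (norm_nonneg _)).ne'
  have h1 : (1 : ℝ) ∈ Set.Icc (0 : ℝ) 1 := by simp
  have hgA : Set.MapsTo (fun y => (slitScale d m 1 y : ℂ) • y) S (S ∩ slitDom d m) := fun y hy => by
    refine ⟨hS y hy _ (slitScale_pos h1 y).1, ?_⟩
    rw [slitDom, Set.mem_ofPred_eq, Qf_smul]
    left
    have hn : 0 ≤ ‖Qf d m y‖ := norm_nonneg _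
    have e : slitScale d m 1 y = (1 + ‖Qf d m y‖)⁻¹ := by simp [slitScale]
    have h2 : ‖(slitScale d m 1 y : ℂ) ^ d * Qf d m y‖ < 1 := by
      rw [norm_mul, norm_pow, Complex.norm_real, e, norm_inv, Real.norm_of_nonneg (by positivity),
        inv_pow, inv_mul_lt_iff₀ (by positivity), mul_one]
      have := le_self_pow₀ (by linarith : 1 ≤ 1 + ‖Qf d m y‖) hd
      linarith
    have h3 := (Complex.abs_re_le_norm ((slitScale d m 1 y : ℂ) ^ d * Qf d m y)).trans_lt h2
    rw [Complex.sub_re, Complex.one_re]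
    linarith [(abs_lt.1 h3).2]
  have hh : ∀ t ∈ Set.Icc (0 : ℝ) 1, ∀ y ∈ S ∩ slitDom d m,
      (slitScale d m t y : ℂ) • y ∈ S ∩ slitDom d m := fun t ht y hy =>
    ⟨hS y hy.1 _ (slitScale_pos ht y).1, slit_smul (slitScale_pos ht y).1.le (slitScale_pos ht y).2 hy.2⟩
  exact ⟨Set.sdiff_subset, Set.sdiff_subset, continuousOn_id, fun y hy => hy.1,
    fun y hy => ⟨hy.1.1, hy.2⟩,
    (hc.comp (continuous_const.prodMk continuous_id) : Continuous fun y : ℕ → ℂ =>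
      (slitScale d m 1 y : ℂ) • y).continuousOn, hgA, fun y hy => ⟨hgA hy.1, hne 1 h1 y hy.2⟩,
    hc.continuousOn, hh, fun t ht y hy => ⟨hh t ht y hy.1, hne t ht y hy.2⟩,
    fun y _ => by simp [slitScale], fun y _ => rfl⟩

end sectorChart

end

section

open Finsupp Cvx Topology

section realCell
open ComplexConjugate

variable {d m : ℕ} {ζ : ℂ}

/-- The locus where the Fermat form takes nonnegative real values. -/
def Gp (d m : ℕ) : Set (ℕ → ℂ) := {y | y ∈ Cr m ∧ ∃ r : ℝ, 0 ≤ r ∧ Qf d m y = r}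

theorem Gp_subset : Gp d m ⊆ Cr m := fun _ h => h.1

theorem Gp_smul : ∀ y ∈ Gp d m, ∀ r : ℝ, 0 < r → (r : ℂ) • y ∈ Gp d m := by
  rintro y ⟨h, s, hs, hq⟩ r hr
  exact ⟨Cr_smul h _, r ^ d * s, by positivity, by rw [Qf_smul, hq]; push_cast; rfl⟩

/-- The straightening of powers to nonnegative reals. -/
noncomputable def straighten (d : ℕ) (q : ℝ × (ℕ → ℂ)) (i : ℕ) : ℂ :=
  rt d (q.2 i) ((1 - q.1 : ℝ) * q.2 i ^ d + (q.1 * ((q.2 i ^ d).re + ‖q.2 i ^ d‖) : ℝ))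

theorem straighten_pow (hd : d ≠ 0) (t : ℝ) (y : ℕ → ℂ) (i : ℕ) : straighten d (t, y) i ^ d =
    (1 - t : ℝ) * y i ^ d + (t * ((y i ^ d).re + ‖y i ^ d‖) : ℝ) :=
  rt_pow hd fun h => by
    change y i = 0 at h
    simp [h, hd]

theorem Qf_straighten (hd : d ≠ 0) (t : ℝ) {y : ℕ → ℂ} {r : ℝ} (h : Qf d m y = r) :
    Qf d m (straighten d (t, y)) = (r + t * Nf d m y : ℝ) := by
  have h1 : (Qf d m y).re = r := by rw [h]; simp
  simp only [Qf, straighten_pow hd, Finset.sum_add_distrib, ← Finset.mul_sum, ← Complex.ofReal_sum] at h h1 ⊢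
  rw [h, ← Complex.re_sum, h, Complex.ofReal_re, Nf]
  push_cast
  ring

theorem continuousOn_straighten (hd : d ≠ 0) (A : Set (ℕ → ℂ)) :
    ContinuousOn (straighten d) (Set.Icc 0 1 ×ˢ A) := by
  refine continuousOn_pi.2 fun i => continuousOn_rt hd (by fun_prop) (by fun_prop) ?_ ?_
  · rintro ⟨t, y⟩ _ h
    change y i = 0 at h
    simp [h, hd]
  · rintro ⟨t, y⟩ ⟨ht, -⟩ h
    dsimp only at h ht ⊢
    have hw : y i ^ d ≠ 0 := pow_ne_zero d h
    generalize y i ^ d = w at hw ⊢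
    have hn : 0 < Complex.normSq w := Complex.normSq_pos.2 hw
    rw [Complex.div_re, Complex.div_im]
    simp only [Complex.add_re, Complex.mul_re, Complex.ofReal_re, Complex.ofReal_im, zero_mul,
      sub_zero, Complex.add_im, Complex.mul_im, add_zero]
    have hp : 0 ≤ w.re + ‖w‖ := by linarith [(abs_le.1 (Complex.abs_re_le_norm w)).1]
    by_cases him : w.im = 0
    · left
      have h2 : ‖w‖ = |w.re| := Complex.abs_re_eq_norm.2 him |>.symm
      have h3 : 0 ≤ (w.re + |w.re|) * w.re := by
        rcases abs_cases w.re with ⟨e, h⟩ | ⟨e, h⟩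
        · rw [e]; positivity
        · rw [e]; simp
      rw [h2, him, ← add_div]
      refine div_nonneg ?_ hn.le
      nlinarith [mul_nonneg ht.1 h3, mul_nonneg (sub_nonneg.2 ht.2) (sq_nonneg w.re)]
    · have hp' : 0 < w.re + ‖w‖ := by
        refine lt_of_le_of_ne hp fun h' => him ?_
        have h2 : |w.re| = ‖w‖ := by
          rw [show w.re = -‖w‖ by linarith, abs_neg, abs_norm]
        exact Complex.abs_re_eq_norm.1 h2
      rcases ht.1.eq_or_lt with rfl | h0
      · left
        rw [← add_div]
        refine div_nonneg ?_ hn.le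
        nlinarith [sq_nonneg w.re, sq_nonneg w.im]
      · right
        rw [← sub_div]
        refine div_ne_zero ?_ hn.ne'
        have : t * (w.re + ‖w‖) * w.im ≠ 0 := mul_ne_zero (mul_pos h0 hp').ne' him
        intro h'
        apply this
        linear_combination -h'

theorem Kk_subset_Gp : Kk d m ⊆ Gp d m := by
  rintro x ⟨h, h'⟩
  refine ⟨h', ∑ i ∈ Finset.range m, ‖x i‖ ^ d, Finset.sum_nonneg fun i _ => by positivity, ?_⟩
  rw [Qf]
  push_cast
  exact Finset.sum_congr rfl fun i hi => h i (Finset.mem_range.1 hi)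

theorem mem_Ray_of_pow (hd : d ≠ 0) {x : ℂ} {r : ℝ} (hr : 0 ≤ r) (h : x ^ d = r) : x ∈ Ray d := by
  have : ‖x‖ ^ d = r := by rw [← norm_pow, h, Complex.norm_real, Real.norm_of_nonneg hr]
  rw [Ray, Set.mem_ofPred_eq, h, ← this]
  push_cast; rfl

theorem hretract_Gp (hd : d ≠ 0) : HRetract (Gp d m) (Gp d m \ {0}) (Kk d m) (Kk d m \ {0})
    (fun y => straighten d (1, y)) id (straighten d) := by
  have h1 : (1 : ℝ) ∈ Set.Icc (0 : ℝ) 1 := by simp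
  have hCr : ∀ t, ∀ y ∈ Cr m, straighten d (t, y) ∈ Cr m := fun t y hy i hi => by
    simp only [straighten, hy i hi]; exact rt_zero_left _
  have h0 : ∀ y : ℕ → ℂ, straighten d (0, y) = y := fun y => funext fun i => by
    simp [straighten, rt_self]
  have hA : ∀ t ∈ Set.Icc (0 : ℝ) 1, ∀ y ∈ Gp d m, straighten d (t, y) ∈ Gp d m := by
    rintro t ht y ⟨hy, r, hr, hq⟩
    exact ⟨hCr t y hy, _, add_nonneg hr (mul_nonneg ht.1 (Nf_nonneg y)), Qf_straighten hd t hq⟩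
  have hB : ∀ t ∈ Set.Icc (0 : ℝ) 1, ∀ y ∈ Gp d m, y ≠ 0 → straighten d (t, y) ≠ 0 := by
    rintro t ht y ⟨hy, r, hr, hq⟩ hne h
    rcases ht.1.eq_or_lt with rfl | h'
    · exact hne (by rw [← h0 y, h])
    · have h2 := Qf_straighten hd t hq
      obtain ⟨i, hi⟩ := Function.ne_iff.1 hne
      have him : i < m := not_le.1 fun h' => hi (hy i h')
      have h3 : 0 < Nf d m y := by
        refine lt_of_lt_of_le ?_ (norm_le_Nf him)
        exact norm_pos_iff.2 (pow_ne_zero d hi)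
      rw [h, Qf, Finset.sum_eq_zero (fun i _ => by simp [hd])] at h2
      have h4 : r + t * Nf d m y = 0 := by exact_mod_cast h2.symm
      nlinarith [mul_pos h' h3]
  have hf : Set.MapsTo (fun y => straighten d (1, y)) (Gp d m) (Kk d m) := fun y hy =>
    ⟨fun i _ => mem_Ray_of_pow hd (r := (y i ^ d).re + ‖y i ^ d‖)
      (by linarith [(abs_le.1 (Complex.abs_re_le_norm (y i ^ d))).1])
      (by rw [straighten_pow hd]; push_cast; ring), hCr 1 y hy.1⟩
  exact ⟨Set.sdiff_subset, Set.sdiff_subset, (continuousOn_straighten hd (Gp d m)).comp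
      (Continuous.continuousOn (by fun_prop)) fun y hy => ⟨h1, hy⟩, hf,
    fun y hy => ⟨hf hy.1, hB 1 h1 y hy.1 hy.2⟩, continuousOn_id, Kk_subset_Gp,
    fun y hy => ⟨Kk_subset_Gp hy.1, hy.2⟩, continuousOn_straighten hd _, hA,
    fun t ht y hy => ⟨hA t ht y hy.1, hB t ht y hy.1 hy.2⟩, fun y _ => h0 y, fun y _ => rfl⟩

end realCell

end

section

open Finsupp Cvx Topology

section invariants

variable {E E' : Type} [TopologicalSpace E] [TopologicalSpace E'] {n : ℕ} {A B R S T : Set E}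
  {A' B' : Set E'} {f : E → E'} {g : E' → E} {h : ℝ × E → E} {ρ : E → E} {ρ' : E' → E'}

/-- The relative homology in degree `n` has no nonzero element fixed by `ρ`. -/
def Inv (ρ : E → E) (n : ℕ) (A B : Set E) : Prop :=
  ∀ x ∈ Z n A B, push ρ x - x ∈ Bd A B → x ∈ Bd A B

/-- The map `ρ` acts trivially on the relative homology in degree `n`. -/
def Triv (ρ : E → E) (n : ℕ) (A B : Set E) : Prop := ∀ x ∈ Z n A B, push ρ x - x ∈ Bd A B

theorem Van.inv (h : Van n A B) : Inv ρ n A B := fun _ hx _ => h hx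

theorem HRetract.push_sub (H : HRetract A B A' B' f g h) (he : ∀ x ∈ A, f (ρ x) = ρ' (f x))
    {x : Ch (Sing E)} (hx : x ∈ Z n A B) : push f (push ρ x - x) = push ρ' (push f x) - push f x := by
  rw [map_sub, push_comp, push_comp, push_congr (f := f ∘ ρ) (f' := ρ' ∘ f) he (mem_Z.1 hx).1]

theorem HRetract.inv (H : HRetract A B A' B' f g h) (he : ∀ x ∈ A, f (ρ x) = ρ' (f x))
    (hi : Inv ρ' n A' B') : Inv ρ n A B := fun x hx hb => by
  refine H.mem_Bd hx (hi _ (push_mem_Z H.cont_f H.fA H.fB H.subset hx) ?_)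
  rw [← H.push_sub he hx]
  exact push_mem_Bd H.cont_f H.fA H.fB H.subset hb

theorem HRetract.triv (H : HRetract A B A' B' f g h) (he : ∀ x ∈ A, f (ρ x) = ρ' (f x))
    (hρ : ContinuousOn ρ A) (hA : Set.MapsTo ρ A A) (hB : Set.MapsTo ρ B B)
    (hi : Triv ρ' n A' B') : Triv ρ n A B := fun x hx => by
  refine H.mem_Bd (sub_mem (push_mem_Z hρ hA hB H.subset hx) hx) ?_
  rw [H.push_sub he hx]
  exact hi _ (push_mem_Z H.cont_f H.fA H.fB H.subset hx)

section excision

variable {O₁ O₂ : Set E}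

theorem excision_push (h1 : IsOpen O₁) (h2 : IsOpen O₂) (hA : A ⊆ O₁ ∪ O₂)
    (hρ : ContinuousOn ρ A) (mA : Set.MapsTo ρ A A) (m2 : Set.MapsTo ρ (A ∩ O₂) (A ∩ O₂))
    {x : Ch (Sing E)} (hx : x ∈ Z n A (A ∩ O₂)) : ∃ u ∈ Z n (A ∩ O₁) (A ∩ O₁ ∩ O₂),
      x - u ∈ Bd A (A ∩ O₂) ∧ (push ρ x - x) - (push ρ u - u) ∈ Bd A (A ∩ O₂) := by
  obtain ⟨u, hu, hxu⟩ := excision_surj h1 h2 hA hx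
  refine ⟨u, hu, hxu, ?_⟩
  have := sub_mem (push_mem_Bd hρ mA m2 Set.inter_subset_left hxu) hxu
  rw [map_sub] at this
  convert this using 1
  abel

theorem Bd_excision_le : Bd (A ∩ O₁) (A ∩ O₁ ∩ O₂) ≤ Bd A (A ∩ O₂) :=
  (Bd_mono_left Set.inter_subset_left).trans
    (Bd_mono_right (Set.inter_subset_inter_left _ Set.inter_subset_left))

theorem Inv.excision (h1 : IsOpen O₁) (h2 : IsOpen O₂) (hA : A ⊆ O₁ ∪ O₂)
    (hρ : ContinuousOn ρ A) (mA : Set.MapsTo ρ A A) (m1 : Set.MapsTo ρ (A ∩ O₁) (A ∩ O₁))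
    (m2 : Set.MapsTo ρ (A ∩ O₂) (A ∩ O₂)) (hi : Inv ρ n (A ∩ O₁) (A ∩ O₁ ∩ O₂)) :
    Inv ρ n A (A ∩ O₂) := fun x hx hb => by
  obtain ⟨u, hu, hxu, h⟩ := excision_push h1 h2 hA hρ mA m2 hx
  have h3 : push ρ u - u ∈ Bd A (A ∩ O₂) := by simpa using sub_mem hb h
  have hu1 := (mem_Z.1 hu).1
  have h4 := excision_inj h1 h2 hA
    (sub_mem (push_mem_sg (hρ.mono Set.inter_subset_left) m1 hu1) hu1) h3
  simpa using add_mem hxu (Bd_excision_le (hi u hu h4))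

theorem Triv.excision (h1 : IsOpen O₁) (h2 : IsOpen O₂) (hA : A ⊆ O₁ ∪ O₂)
    (hρ : ContinuousOn ρ A) (mA : Set.MapsTo ρ A A)
    (m2 : Set.MapsTo ρ (A ∩ O₂) (A ∩ O₂)) (hi : Triv ρ n (A ∩ O₁) (A ∩ O₁ ∩ O₂)) :
    Triv ρ n A (A ∩ O₂) := fun x hx => by
  obtain ⟨u, hu, -, h⟩ := excision_push h1 h2 hA hρ mA m2 hx
  simpa using add_mem h (Bd_excision_le (hi u hu))

end excision

theorem Inv.trans (hRS : R ⊆ S) (hST : S ⊆ T) (hρ : ContinuousOn ρ T) (mT : Set.MapsTo ρ T T)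
    (mS : Set.MapsTo ρ S S) (mR : Set.MapsTo ρ R R)
    (hv : Van (n + 1) T S) (h1 : Inv ρ n S R) (h2 : Inv ρ n T S) : Inv ρ n T R := by
  intro x hx hb
  obtain ⟨hx1, hx2, hx3⟩ := mem_Z.1 hx
  obtain ⟨y, hy, hyn, hxy⟩ := exists_of_mem_Bd (h2 x (mem_Z.2 ⟨hx1, hx2, Csg_mono hRS hx3⟩)
    (Bd_mono_right hRS hb)) hx2
  set s := x - d y with hs
  have hsZ : s ∈ Z n S R := mem_Z.2 ⟨hxy, sub_mem hx2 (d_mem_Dg hyn),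
    by rwa [hs, map_sub, d_d, sub_zero]⟩
  have hsZ' := sub_mem (push_mem_Z (hρ.mono hST) mS mR hRS hsZ) hsZ
  have hsb : push ρ s - s ∈ Bd T R := by
    have e : push ρ s - s = (push ρ x - x) - d (push ρ y - y) := by
      rw [hs, map_sub, map_sub, push_d]; abel
    rw [e]
    refine sub_mem hb (mem_Bd.2 ⟨_, sub_mem (push_mem_sg hρ mT hy) hy, by simp⟩)
  have hsb' : push ρ s - s ∈ Bd S R := by
    obtain ⟨w, hw, hwn, h⟩ := exists_of_mem_Bd hsb (mem_Z.1 hsZ').2.1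
    have hwZ : w ∈ Z (n + 1) T S := mem_Z.2 ⟨hw, hwn, by
      simpa using sub_mem (mem_Z.1 hsZ').1 (Csg_mono hRS h)⟩
    obtain ⟨v, hv, h'⟩ := mem_Bd.1 (hv hwZ)
    exact mem_Bd.2 ⟨_, h', by rwa [map_sub d, d_d, sub_zero]⟩
  obtain ⟨w, hw, h⟩ := mem_Bd.1 (h1 s hsZ hsb')
  exact mem_Bd.2 ⟨y + w, add_mem hy (Csg_mono hST hw), by rwa [map_add, ← sub_sub]⟩

/-- An equivariant connecting map from a trivial action to one without invariants vanishes. -/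
theorem Triv.connecting (h1 : Inv ρ n S R) (h2 : Triv ρ (n + 1) T S) :
    ∀ y ∈ Z (n + 1) T S, d y ∈ Bd S R := by
  intro y hy
  obtain ⟨hy1, hy2, hy3⟩ := mem_Z.1 hy
  refine h1 _ (mem_Z.2 ⟨hy3, d_mem_Dg hy2, by rw [d_d]; exact zero_mem _⟩) ?_
  obtain ⟨w, hw, h⟩ := mem_Bd.1 (h2 y hy)
  refine mem_Bd.2 ⟨_, h, ?_⟩
  rw [map_sub, map_sub, d_d, sub_zero, push_d, sub_self]
  exact zero_mem _

end invariants

section counting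

variable {E : Type} [TopologicalSpace E]

theorem d_eq_zero_of_const {p : E} {x : Ch (Sing E)} (hx : x ∈ C (sg {p})) (h2 : x ∈ Dg E 2) :
    d x = 0 := by
  have h : x ∈ C (sg {p} ∩ {s | s.1 = 2}) := by
    rw [C, Finsupp.supported_inter]; exact ⟨hx, h2⟩
  refine eq_on_C (g := 0) (fun s hs => ?_) h
  obtain ⟨k, σ⟩ := s
  obtain ⟨⟨-, hs⟩, h'⟩ := hs
  obtain rfl : k = 2 := h'
  have : ∀ u : LS (Dl 2), realS σ u = ⟨u.1, fun _ => p⟩ := fun u =>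
    congrArg (Sigma.mk u.1) (funext fun t => hs _)
  simp [d_single, verts, bdAux, Fin.sum_univ_two, this]

theorem eq_zero_of_const {p : E} {x : Ch (Sing E)} (hx : x ∈ C (sg {p})) (h1 : x ∈ Dg E 1)
    (hd : d x = 0) : x = 0 := by
  obtain ⟨y, hy, rfl⟩ := exists_d_of_point p hx hd
  rw [← prn_of_mem h1, ← d_prn]
  exact d_eq_zero_of_const (prn_mem 2 hy) (prn_mem_Dg 2 y)

theorem eq_zero_of_orbit {ρ : E → E} {d' : ℕ} (hd' : d' ≠ 0) {e : E} (he : ρ^[d'] e = e)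
    {F : Set E} (hF : ∀ x ∈ F, ∃ j : ℕ, x = ρ^[j] e) {y : Ch (Sing E)} (hy : y ∈ C (sg F))
    (h1 : y ∈ Dg E 1) (hdy : d y = 0) (hρ : push ρ y = y) : y = 0 := by
  have hit : ∀ k : ℕ, push (ρ^[k]) y = y := fun k => by
    induction k with
    | zero => exact push_id' (A := F) (fun _ _ => rfl) hy
    | succ k ih => rw [Function.iterate_succ, ← push_comp, hρ, ih]
  have hN : ∑ k ∈ Finset.range d', push (ρ^[k]) y =
      ∑ k ∈ Finset.range d', real (fun _ : Dl 1 => ρ^[k] e) (collapse y) := by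
    have h : y ∈ C (sg F ∩ {s | s.1 = 1}) := by
      rw [C, Finsupp.supported_inter]; exact ⟨hy, h1⟩
    have := eq_on_C (f := ∑ k ∈ Finset.range d', push (ρ^[k]))
      (g := ∑ k ∈ Finset.range d', real (fun _ : Dl 1 => ρ^[k] e) ∘ₗ collapse) (fun s hs => ?_) h
    · simpa using this
    obtain ⟨k, σ⟩ := s
    obtain ⟨⟨-, hs⟩, h'⟩ := hs
    obtain rfl : k = 1 := h'
    have huniq : ∀ t : Dl 1, t = stdSimplex.vertex 0 := fun t => Subsingleton.elim _ _
    obtain ⟨j, hj⟩ := hF _ (hs (stdSimplex.vertex 0))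
    have hσ : σ = fun _ => ρ^[j] e := funext fun t => by rw [huniq t]; exact hj
    simp only [LinearMap.sum_apply, push_single, pushS, LinearMap.comp_apply, collapse_single,
      real_single, realS]
    have key : ∀ j : ℕ, ∑ k ∈ Finset.range d', single (⟨1, fun _ => ρ^[k] (ρ^[j] e)⟩ : Sing E) (1 : ℤ) =
        ∑ k ∈ Finset.range d', single (⟨1, fun _ => ρ^[k] e⟩ : Sing E) (1 : ℤ) := fun j => by
      induction j with
      | zero => rfl
      | succ j ih =>
        rw [← ih]
        simp only [← Function.iterate_add_apply]
        have hper : ρ^[d' + j] e = ρ^[0 + j] e := by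
          rw [add_comm, Function.iterate_add_apply, he, zero_add]
        have e1 := Finset.sum_range_succ (fun k => single (⟨1, fun _ => ρ^[k + j] e⟩ : Sing E) (1 : ℤ)) d'
        rw [Finset.sum_range_succ'] at e1
        simp only [hper] at e1
        rw [← add_right_cancel e1]
        exact Finset.sum_congr rfl fun k _ => by rw [add_right_comm, add_assoc]
    rw [hσ]
    exact key j
  have hz : ∀ k, real (fun _ : Dl 1 => ρ^[k] e) (collapse y) = 0 := fun k => by
    refine eq_zero_of_const (p := ρ^[k] e) ?_ ?_ ?_
    · refine map_C (S := Set.univ) (fun s _ => ?_) (by simp)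
      rw [real_single]
      exact single_mem_C ⟨continuous_const, fun _ => rfl⟩
    · refine map_C (f := real (fun _ : Dl 1 => ρ^[k] e) ∘ₗ collapse) (fun s hs => ?_) h1
      rw [LinearMap.comp_apply, collapse_single, real_single]
      exact single_mem_C hs
    · rw [d_real, ← collapse_d, hdy, map_zero, map_zero]
  simp only [hit, hz, Finset.sum_const_zero, Finset.sum_const, Finset.card_range] at hN
  exact (smul_eq_zero.1 hN).resolve_left hd'

end counting

end

section

open Finsupp Cvx Topology

section rotation

variable {d m : ℕ} {η : ℂ}

/-- Rotation of the first coordinate. -/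
def rot (η : ℂ) (z : ℕ → ℂ) : ℕ → ℂ := Function.update z 0 (η * z 0)

theorem rot_zero (η : ℂ) (z : ℕ → ℂ) : rot η z 0 = η * z 0 := by simp [rot]

theorem rot_of_ne (η : ℂ) (z : ℕ → ℂ) {i : ℕ} (hi : i ≠ 0) : rot η z i = z i := by simp [rot, hi]

theorem rot_smul (η c : ℂ) (z : ℕ → ℂ) : rot η (c • z) = c • rot η z := by
  funext i
  by_cases hi : i = 0
  · subst hi; simp [rot_zero]; ring
  · simp [rot_of_ne, hi]

theorem rot_rot (η θ : ℂ) (z : ℕ → ℂ) : rot η (rot θ z) = rot (η * θ) z := by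
  funext i
  by_cases hi : i = 0
  · subst hi; simp [rot_zero]; ring
  · simp [rot_of_ne, hi]

theorem rot_one (z : ℕ → ℂ) : rot 1 z = z := by simp [rot]

theorem rot_ne_zero (hη : η ≠ 0) {z : ℕ → ℂ} (hz : z ≠ 0) : rot η z ≠ 0 := fun h => hz <| by
  have := rot_rot η⁻¹ η z
  rw [h, inv_mul_cancel₀ hη, rot_one] at this
  rw [← this]
  funext i
  by_cases hi : i = 0
  · subst hi; simp [rot_zero]
  · simp [rot_of_ne, hi]

theorem rot_mem_Cr {r : ℕ} {z : ℕ → ℂ} (hz : z ∈ Cr r) : rot η z ∈ Cr r := fun i hi => by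
  by_cases h0 : i = 0
  · subst h0; rw [rot_zero, hz 0 hi, mul_zero]
  · rw [rot_of_ne _ _ h0, hz i hi]

theorem rot_iterate (k : ℕ) (z : ℕ → ℂ) : (rot η)^[k] z = rot (η ^ k) z := by
  induction k with
  | zero => simp [rot_one]
  | succ k ih => rw [Function.iterate_succ_apply', ih, rot_rot, pow_succ']

theorem continuous_rot (η : ℂ) : Continuous (rot η) :=
  continuous_id.update 0 (by fun_prop)

theorem triv_Cr (hη : ‖η‖ = 1) (n : ℕ) : Triv (rot η) n (Cr m) (Cr m \ {0}) := by
  intro x hx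
  let h : ℝ × (ℕ → ℂ) → ℕ → ℂ := fun q => rot (Complex.exp ((q.1 * η.arg : ℝ) * Complex.I)) q.2
  have hc : Continuous h := by
    change Continuous fun q : ℝ × (ℕ → ℂ) => Function.update q.2 0 _
    exact continuous_snd.update 0 (by fun_prop)
  have e := prism_sub_mem_Bd (A' := Cr m) (B' := Cr m \ {0}) hc.continuousOn
    (fun t _ x hx => rot_mem_Cr hx)
    (fun t _ x hx => ⟨rot_mem_Cr hx.1, rot_ne_zero (Complex.exp_ne_zero _) hx.2⟩)
    Set.sdiff_subset hx
  have h1 : Complex.exp (η.arg * Complex.I) = η := by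
    have := Complex.norm_mul_exp_arg_mul_I η
    rwa [hη, Complex.ofReal_one, one_mul] at this
  have e0 : (fun e => h (0, e)) = id := funext fun z => by simp [h, rot_one]
  have e1 : (fun e => h (1, e)) = rot η := funext fun z => by simp [h, h1]
  rw [e0, e1, push_id' (A := Cr m) (f := id) (fun _ _ => rfl) (mem_Z.1 hx).1] at e
  exact e

theorem Kk_one_ne {x : ℕ → ℂ} (hx : x ∈ Kk d 1) (h0 : x ≠ 0) : x 0 ≠ 0 := fun h => h0 <| by
  funext i
  rcases Nat.eq_zero_or_pos i with rfl | hi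
  · exact h
  · exact hx.2 i hi

theorem Kk_smul {x : ℕ → ℂ} (hx : x ∈ Kk d m) {r : ℝ} (hr : 0 ≤ r) : (r : ℂ) • x ∈ Kk d m := by
  refine ⟨fun i hi => ?_, fun i hi => by simp [hx.2 i hi]⟩
  have := hx.1 i hi
  simp only [Ray, Set.mem_ofPred_eq, Pi.smul_apply, smul_eq_mul] at this ⊢
  rw [mul_pow, this, norm_mul, Complex.norm_real, Real.norm_of_nonneg hr]
  push_cast
  ring

/-- Radial projection along the first coordinate. -/
noncomputable def radial (q : ℝ × (ℕ → ℂ)) : ℕ → ℂ := ((1 - q.1 + q.1 * ‖q.2 0‖⁻¹ : ℝ) : ℂ) • q.2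

theorem radial_pos {t : ℝ} (ht : t ∈ Set.Icc (0 : ℝ) 1) {x : ℕ → ℂ} (hx : x 0 ≠ 0) :
    0 < 1 - t + t * ‖x 0‖⁻¹ := by
  have h1 : 0 < ‖x 0‖⁻¹ := inv_pos.2 (norm_pos_iff.2 hx)
  rcases ht.1.eq_or_lt with rfl | h
  · simp
  · linarith [mul_pos h h1, ht.2]

theorem continuousOn_radial : ContinuousOn radial (Set.Icc 0 1 ×ˢ (Kk d 1 \ {0})) := by
  refine ContinuousOn.smul (Complex.continuous_ofReal.comp_continuousOn ?_) continuousOn_snd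
  refine ContinuousOn.add (by fun_prop) (ContinuousOn.mul (by fun_prop) (ContinuousOn.inv₀ (by fun_prop) ?_))
  exact fun q hq => norm_ne_zero_iff.2 (Kk_one_ne hq.2.1 hq.2.2)

/-- The unit points of the one-dimensional star. -/
def unitPts (d : ℕ) : Set (ℕ → ℂ) := {x | x ∈ Cr 1 ∧ x 0 ^ d = 1}

theorem radial_one_mem {x : ℕ → ℂ} (hx : x ∈ Kk d 1 \ {0}) : radial (1, x) ∈ unitPts d := by
  have h0 := Kk_one_ne hx.1 hx.2
  refine ⟨Cr_smul hx.1.2 _, ?_⟩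
  have h1 : x 0 ^ d = (‖x 0‖ : ℂ) ^ d := hx.1.1 0 one_pos
  have h2 : (‖x 0‖ : ℂ) ≠ 0 := by exact_mod_cast norm_ne_zero_iff.2 h0
  simp only [radial, Pi.smul_apply, smul_eq_mul, mul_pow, h1]
  push_cast
  rw [← mul_pow]
  simp [h2]

theorem finite_unitPts (hd : d ≠ 0) : (unitPts d).Finite := by
  refine Set.Finite.of_injOn (f := fun x : ℕ → ℂ => x 0) (t := (unityRoots d : Set ℂ))
    (fun x hx => Finset.mem_coe.2 ((mem_unityRoots hd).2 hx.2)) (fun x hx y hy h => ?_)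
    (Finset.finite_toSet _)
  funext i
  rcases Nat.eq_zero_or_pos i with rfl | hi
  · exact h
  · rw [hx.1 i hi, hy.1 i hi]

theorem inv_Kk {D : ℕ} (hd : D ≠ 0) (hη : IsPrimitiveRoot η D) : Inv (rot η) 2 (Kk D 1) (Kk D 1 \ {0}) := by
  intro x hx hb
  obtain ⟨hx1, hx2, hx3⟩ := mem_Z.1 hx
  have hη1 : ‖η‖ = 1 := hη.norm'_eq_one hd
  have h1 : (1 : ℝ) ∈ Set.Icc (0 : ℝ) 1 := by simp
  have hr : ContinuousOn (fun e => radial (1, e)) (Kk D 1 \ {0}) :=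
    continuousOn_radial.comp (Continuous.continuousOn (by fun_prop)) fun e he => ⟨h1, he⟩
  obtain ⟨u, hu, hun, hs⟩ := exists_of_mem_Bd hb (sub_mem (push_mem_Dg _ hx2) hx2)
  set s := push (rot η) x - x - d u with hsdef
  have hs2 : s ∈ Dg _ 2 := sub_mem (sub_mem (push_mem_Dg _ hx2) hx2) (d_mem_Dg hun)
  have hds : d s = push (rot η) (d x) - d x := by
    rw [hsdef, map_sub, map_sub, d_d, sub_zero, push_d]
  have hrs : push (fun e => radial (1, e)) (d s) = 0 := by
    have h : s ∈ C (sg (Kk D 1 \ {0}) ∩ {s | s.1 = 2}) := by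
      rw [C, Finsupp.supported_inter]; exact ⟨hs, hs2⟩
    refine eq_on_C (f := push (fun e => radial (1, e)) ∘ₗ d) (g := 0) (fun σ hσ => ?_) h
    rw [LinearMap.comp_apply, push_d, push_single, LinearMap.zero_apply]
    obtain ⟨k, σ⟩ := σ
    obtain ⟨⟨hσ1, hσ2⟩, h'⟩ := hσ
    obtain rfl : k = 2 := h'
    have hcont : Continuous fun t => radial (1, σ t) :=
      continuousOn_univ.1 (hr.comp hσ1.continuousOn fun t _ => hσ2 t)
    have hfin : (Set.range fun t => radial (1, σ t)).Finite :=
      (finite_unitPts hd).subset (by rintro _ ⟨t, rfl⟩; exact radial_one_mem (hσ2 t))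
    have hpre : IsPreconnected (Set.range fun t => radial (1, σ t)) := by
      have : PreconnectedSpace (Dl 2) :=
        Subtype.preconnectedSpace (convex_stdSimplex ℝ (Fin 2)).isPreconnected
      exact isPreconnected_range hcont
    have hsub := Set.not_nontrivial_iff.1 fun h => hpre.infinite_of_nontrivial h hfin
    refine d_eq_zero_of_const (p := radial (1, σ (stdSimplex.vertex 0))) ?_ (single_mem_C rfl)
    exact single_mem_C ⟨hcont, fun t => hsub ⟨t, rfl⟩ ⟨_, rfl⟩⟩
  have hcomm : (rot η ∘ fun e => radial (1, e)) = (fun e => radial (1, e)) ∘ rot η :=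
    funext fun z => by
      simp only [Function.comp_apply, radial, rot_smul, rot_zero, norm_mul, hη1, one_mul]
  have hy : push (fun e => radial (1, e)) (d x) = 0 := by
    refine eq_zero_of_orbit (ρ := rot η) hd (e := Function.update 0 0 1) ?_ (F := unitPts D) ?_
      (push_mem_sg hr (fun e he => radial_one_mem he) hx3) (push_mem_Dg _ (d_mem_Dg hx2)) ?_ ?_
    · rw [rot_iterate, hη.pow_eq_one, rot_one]
    · intro z hz
      have : NeZero D := ⟨hd⟩
      obtain ⟨j, -, hj⟩ := hη.eq_pow_of_pow_eq_one hz.2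
      refine ⟨j, ?_⟩
      rw [rot_iterate]
      funext i
      rcases Nat.eq_zero_or_pos i with rfl | hi
      · simp [rot_zero, hj]
      · rw [rot_of_ne _ _ hi.ne', hz.1 i hi]; simp [hi.ne']
    · rw [← push_d, d_d, map_zero]
    · rw [push_comp, hcomm, ← push_comp, ← sub_eq_zero, ← map_sub, ← hds, hrs]
  have hp := d_prism radial (d x)
  rw [d_d, map_zero, add_zero, hy, zero_sub,
    push_id' (A := Kk D 1) (f := fun e => radial (0, e)) (fun z _ => by simp [radial])
      (d_mem_sg hx1)] at hp
  have hpm : prism radial (d x) ∈ C (sg (Kk D 1 \ {0})) :=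
    prism_mem continuousOn_radial (fun q hq => by
      have hp := radial_pos hq.1 (Kk_one_ne hq.2.1 hq.2.2)
      exact ⟨Kk_smul hq.2.1 hp.le, smul_ne_zero (by exact_mod_cast hp.ne') hq.2.2⟩) hx3
  set w := x + prn 2 (prism radial (d x)) with hw
  have hw1 : w ∈ C (sg (Kk D 1)) := add_mem hx1 (prn_mem 2 (Csg_mono Set.sdiff_subset hpm))
  have hwd : d w = 0 := by
    rw [hw, map_add, d_prn, hp, map_neg, prn_of_mem (d_mem_Dg hx2), add_neg_cancel]
  have hwZ : w ∈ Z 2 (Kk D 1) ∅ := mem_Z.2 ⟨hw1, add_mem hx2 (prn_mem_Dg _ _), by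
    rw [hwd]; exact zero_mem _⟩
  have hh : ∀ t ∈ Set.Icc (0 : ℝ) 1, ∀ x ∈ Kk D 1, ((1 - t : ℝ) : ℂ) • x ∈ Kk D 1 :=
    fun t ht x hx => Kk_smul hx (sub_nonneg.2 ht.2)
  have e := prism_sub_mem_Bd (h := fun q : ℝ × (ℕ → ℂ) => ((1 - q.1 : ℝ) : ℂ) • q.2)
    (B' := ∅) (Continuous.continuousOn (by fun_prop)) hh (by simp) (Set.empty_subset _) hwZ
  rw [push_id' (A := Kk D 1) (f := fun e => ((1 - (0 : ℝ) : ℝ) : ℂ) • e)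
    (fun z _ => by simp) hw1] at e
  have e2 : push (fun e : ℕ → ℂ => ((1 - (1 : ℝ) : ℝ) : ℂ) • e) w ∈ Z 2 {0} ∅ :=
    push_mem_Z (A := Kk D 1) (B := ∅) (Continuous.continuousOn (by fun_prop)) (fun z _ => by simp)
      (by simp) (Set.empty_subset _) hwZ
  have h0 : ({0} : Set (ℕ → ℂ)) ⊆ Kk D 1 := by
    rintro _ rfl
    exact ⟨fun i _ => Ray.zero, fun _ _ => rfl⟩
  have hwB : w ∈ Bd (Kk D 1) ∅ := by
    have := sub_mem (Bd_mono_left h0 (van_point 0 (by norm_num) e2)) e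
    simpa using this
  have : x = w - prn 2 (prism radial (d x)) := by rw [hw]; abel
  rw [this]
  exact sub_mem (Bd_mono_right (Set.empty_subset _) hwB) (mem_Bd_of_Csg (prn_mem 2 hpm))

end rotation

end

section

open Finsupp Cvx Topology

section cells

variable {d m n : ℕ} {e η : ℂ} {A S : Set (ℕ → ℂ)}

/-- The open sector about `e`. -/
def secSet (d m : ℕ) (e : ℂ) : Set (ℕ → ℂ) := {z | wf m e z ∈ Sec d}

theorem cone_secSet (d m : ℕ) (e : ℂ) : Cone (secSet d m e) :=
  ⟨fun z h h0 => h.1 (by rw [h0]; simp [wf]), fun z h _ hc => (wf_smul_mem hc z).2 h⟩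

theorem isOpen_secSet (hd : d ≠ 0) : IsOpen (secSet d m e) := (isOpen_Sec hd).preimage continuous_wf

theorem secSet_union_avoid (hd : d ≠ 0) (he : e ^ d = -1) : Xc d m ⊆ secSet d m e ∪ avoid m e := by
  intro z hz
  by_cases h : wf m e z ∈ Sec d
  · exact Or.inl h
  · exact Or.inr (XT_subset hd he ⟨hz, h⟩).2

theorem headNe_subset_avoid : headNe m ⊆ avoid m e := fun _ h => Or.inl h

theorem headNe_of_avoid (hd : d ≠ 0) (he : e ^ d = -1) {z : ℕ → ℂ} (hz : z ∈ Xc d m)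
    (hw : wf m e z ∈ Sec d) (ha : z ∈ avoid m e) : z ∈ headNe m := by
  rcases ha with ha | ha
  · exact ha
  · by_contra hc
    exact ha (eq_of_head hd he hz hc ((mem_Sec_iff hd).1 hw).le).1

/-- A cone that is given by `S` in the affine chart about the point `e`. -/
structure IsCell (d m : ℕ) (e : ℂ) (A S : Set (ℕ → ℂ)) : Prop where
  cone : Cone A
  subset : A ⊆ Xc d m
  subset' : S ⊆ Cr m
  smul : ∀ y ∈ S, ∀ r : ℝ, 0 < r → (r : ℂ) • y ∈ S
  mem_iff : ∀ z ∈ Xc d m, wf m e z ∈ Sec d → (z ∈ A ↔ affY m e z ∈ S)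

theorem IsCell.inter_eq (h : IsCell d m e A S) : A ∩ secSet d m e = chartSet d m e S := by
  ext z
  constructor
  · exact fun hz => ⟨h.subset hz.1, hz.2, (h.mem_iff z (h.subset hz.1) hz.2).1 hz.1⟩
  · exact fun hz => ⟨(h.mem_iff z hz.1 hz.2.1).2 hz.2.2, hz.2.1⟩

theorem IsCell.inter_avoid_eq (h : IsCell d m e A S) (hd : d ≠ 0) (he : e ^ d = -1) :
    A ∩ secSet d m e ∩ avoid m e = chartSet d m e S ∩ headNe m := by
  rw [h.inter_eq]
  ext z
  exact ⟨fun hz => ⟨hz.1, headNe_of_avoid hd he hz.1.1 hz.1.2.1 hz.2⟩,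
    fun hz => ⟨hz.1, headNe_subset_avoid hz.2⟩⟩

theorem IsCell.cover (h : IsCell d m e A S) (hd : d ≠ 0) (he : e ^ d = -1) :
    PS A ⊆ PS (secSet d m e) ∪ PS (avoid m e) :=
  fun _ hp => secSet_union_avoid hd he (h.subset hp)

theorem IsCell.PS_inter_eq (h : IsCell d m e A S) :
    PS A ∩ PS (secSet d m e) = PS (chartSet d m e S) := by rw [← PS_inter, h.inter_eq]

theorem IsCell.PS_inter_avoid_eq (h : IsCell d m e A S) (hd : d ≠ 0) (he : e ^ d = -1) :
    PS A ∩ PS (secSet d m e) ∩ PS (avoid m e) = PS (chartSet d m e S ∩ headNe m) := by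
  rw [← PS_inter, ← PS_inter, h.inter_avoid_eq hd he]

theorem IsCell.van (h : IsCell d m e A S) (hd : d ≠ 0) (he : e ^ d = -1) (hv : Van n S (S \ {0})) :
    Van n (PS A) (PS (A ∩ avoid m e)) := by
  rw [PS_inter]
  refine Van.excision ((cone_secSet d m e).isOpen (isOpen_secSet hd))
    ((cone_avoid m e).isOpen (isOpen_avoid m e)) (h.cover hd he) ?_
  rw [h.PS_inter_avoid_eq hd he, h.PS_inter_eq]
  exact (hretract_chart hd he h.subset').van ((hretract_slit hd h.smul).van hv)

theorem IsCell.pj (h : IsCell d m e A S) (hd : d ≠ 0) (he : e ^ d = -1) (hv : Pj n S (S \ {0})) :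
    Pj n (PS A) (PS (A ∩ avoid m e)) := by
  rw [PS_inter]
  refine Pj.excision ((cone_secSet d m e).isOpen (isOpen_secSet hd))
    ((cone_avoid m e).isOpen (isOpen_avoid m e)) (h.cover hd he) ?_
  rw [h.PS_inter_avoid_eq hd he, h.PS_inter_eq]
  exact (hretract_chart hd he h.subset').pj ((hretract_slit hd h.smul).pj hv)

theorem rot_mem_headNe (hη : η ≠ 0) {z : ℕ → ℂ} (hz : z ∈ headNe m) : rot η z ∈ headNe m := by
  obtain ⟨i, hi, h⟩ := hz
  refine ⟨i, hi, ?_⟩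
  by_cases h0 : i = 0
  · subst h0; rw [rot_zero]; exact mul_ne_zero hη h
  · rwa [rot_of_ne _ _ h0]

theorem Qf_rot (hη : η ^ d = 1) (z : ℕ → ℂ) : Qf d m (rot η z) = Qf d m z := by
  rw [Qf, Qf]
  refine Finset.sum_congr rfl fun i _ => ?_
  by_cases h0 : i = 0
  · subst h0; rw [rot_zero, mul_pow, hη, one_mul]
  · rw [rot_of_ne _ _ h0]

theorem ne_zero_of_pow_eq_one (hd : d ≠ 0) (hη : η ^ d = 1) : η ≠ 0 := by
  rintro rfl; simp [hd] at hη

theorem rot_mem_Xc (hd : d ≠ 0) (hη : η ^ d = 1) {z : ℕ → ℂ} (hz : z ∈ Xc d m) :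
    rot η z ∈ Xc d m :=
  ⟨rot_ne_zero (ne_zero_of_pow_eq_one hd hη) hz.1, rot_mem_Cr hz.2.1, by rw [Qf_rot hη, hz.2.2]⟩

theorem wf_rot (hm : m ≠ 0) (z : ℕ → ℂ) : wf m e (rot η z) = wf m e z := by
  rw [wf, wf, rot_of_ne _ _ hm, rot_of_ne _ _ (Nat.succ_ne_zero m)]

theorem rot_mem_avoid (hη : η ≠ 0) (hm : m ≠ 0) {z : ℕ → ℂ} (hz : z ∈ avoid m e) :
    rot η z ∈ avoid m e := by
  rcases hz with hz | hz
  · exact Or.inl (rot_mem_headNe hη hz)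
  · right; rwa [rot_of_ne _ _ hm, rot_of_ne _ _ (Nat.succ_ne_zero m)]

theorem affY_rot (hm : m ≠ 0) (z : ℕ → ℂ) : affY m e (rot η z) = rot η (affY m e z) := by
  funext i
  by_cases h0 : i = 0
  · subst h0
    rw [rot_zero, affY, affY, if_pos (Nat.pos_of_ne_zero hm), if_pos (Nat.pos_of_ne_zero hm),
      rot_zero, rot_of_ne _ _ hm]; ring
  · rw [rot_of_ne _ _ h0, affY, affY, rot_of_ne _ _ h0, rot_of_ne _ _ hm]

theorem mapsTo_projRot {B : Set (ℕ → ℂ)} (hB : Cone B) (h : Set.MapsTo (rot η) B B) :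
    Set.MapsTo (projMap (rot η)) (PS B) (PS B) := fun p hp => by
  rw [projMap]
  exact hB.toP_mem (h hp)

theorem continuousOn_projRot (hη : η ≠ 0) {B : Set (ℕ → ℂ)} (hB : Cone B) :
    ContinuousOn (projMap (rot η)) (PS B) :=
  continuousOn_projMap hB (fun v _ c _ => rot_smul η c v) (continuous_rot η).continuousOn
    fun v hv => rot_ne_zero hη (hB.ne v hv)

theorem affY_projRot (hη : η ≠ 0) (hm : m ≠ 0) (p : Projectivization ℂ (ℕ → ℂ)) :
    affY m e (projMap (rot η) p).rep = rot η (affY m e p.rep) := by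
  obtain ⟨c, hc, h⟩ := exists_rep (rot_ne_zero hη p.rep_nonzero)
  rw [projMap, h, affY_smul hc, affY_rot hm]

theorem IsCell.inv (h : IsCell d m e A S) (hd : d ≠ 0) (he : e ^ d = -1) (hη : η ^ d = 1)
    (hm : m ≠ 0) (hA : Set.MapsTo (rot η) A A) (hi : Inv (rot η) n S (S \ {0})) :
    Inv (projMap (rot η)) n (PS A) (PS (A ∩ avoid m e)) := by
  have h0 := ne_zero_of_pow_eq_one hd hη
  rw [PS_inter]
  refine Inv.excision ((cone_secSet d m e).isOpen (isOpen_secSet hd))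
    ((cone_avoid m e).isOpen (isOpen_avoid m e)) (h.cover hd he) (continuousOn_projRot h0 h.cone)
    (mapsTo_projRot h.cone hA)
    (mapsTo_projRot (h.cone.inter (cone_secSet d m e)) fun z hz => ⟨hA hz.1, ?_⟩)
    (mapsTo_projRot (h.cone.inter (cone_avoid m e)) fun z hz =>
      ⟨hA hz.1, rot_mem_avoid h0 hm hz.2⟩) ?_
  · rw [secSet, Set.mem_ofPred_eq, wf_rot hm]; exact hz.2
  rw [h.PS_inter_avoid_eq hd he, h.PS_inter_eq]
  exact (hretract_chart hd he h.subset').inv (fun p _ => affY_projRot h0 hm p)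
    ((hretract_slit hd h.smul).inv (fun _ _ => rfl) hi)

theorem IsCell.triv (h : IsCell d m e A S) (hd : d ≠ 0) (he : e ^ d = -1) (hη : η ^ d = 1)
    (hm : m ≠ 0) (hA : Set.MapsTo (rot η) A A) (hS : Set.MapsTo (rot η) S S)
    (hi : Triv (rot η) n S (S \ {0})) :
    Triv (projMap (rot η)) n (PS A) (PS (A ∩ avoid m e)) := by
  have h0 := ne_zero_of_pow_eq_one hd hη
  have hc : Set.MapsTo (rot η) (chartSet d m e S) (chartSet d m e S) := fun z hz =>
    ⟨rot_mem_Xc hd hη hz.1, by rw [wf_rot hm]; exact hz.2.1, by rw [affY_rot hm]; exact hS hz.2.2⟩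
  have hS' : Set.MapsTo (rot η) (S ∩ slitDom d m) (S ∩ slitDom d m) := fun y hy =>
    ⟨hS hy.1, by rw [slitDom, Set.mem_ofPred_eq, Qf_rot hη]; exact hy.2⟩
  rw [PS_inter]
  refine Triv.excision ((cone_secSet d m e).isOpen (isOpen_secSet hd))
    ((cone_avoid m e).isOpen (isOpen_avoid m e)) (h.cover hd he) (continuousOn_projRot h0 h.cone)
    (mapsTo_projRot h.cone hA)
    (mapsTo_projRot (h.cone.inter (cone_avoid m e)) fun z hz =>
      ⟨hA hz.1, rot_mem_avoid h0 hm hz.2⟩) ?_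
  rw [h.PS_inter_avoid_eq hd he, h.PS_inter_eq]
  have hcc := cone_chartSet d m e S
  refine (hretract_chart hd he h.subset').triv (fun p _ => affY_projRot h0 hm p)
    (continuousOn_projRot h0 hcc) (mapsTo_projRot hcc hc)
    (mapsTo_projRot (hcc.inter (cone_headNe m)) fun z hz => ⟨hc hz.1, rot_mem_headNe h0 hz.2⟩)
    ((hretract_slit hd h.smul).triv (fun _ _ => rfl) (continuous_rot η).continuousOn hS'
      (fun y hy => ⟨hS' hy.1, rot_ne_zero h0 hy.2⟩) hi)

end cells

end

section

open Finsupp Cvx Topology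

section filtration

variable {d m n : ℕ} {e ζ η : ℂ} {E : Finset ℂ}

theorem affY_mem_Cr (z : ℕ → ℂ) : affY m e z ∈ Cr m := fun i hi => by
  rw [affY, if_neg (by omega)]

theorem isCell_top (d m : ℕ) (e : ℂ) : IsCell d m e (Xc d m) (Cr m) :=
  ⟨cone_Xc d m, subset_rfl, subset_rfl, fun _ hy _ _ => Cr_smul hy _, fun z hz _ =>
    ⟨fun _ => affY_mem_Cr z, fun _ => hz⟩⟩

/-- The set `Th` with the points belonging to `E` removed. -/
def ThE (d m : ℕ) (ζ : ℂ) (E : Finset ℂ) : Set (ℕ → ℂ) := {z | z ∈ Th d m ζ ∧ ∀ e ∈ E, z ∈ avoid m e}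

theorem cone_ThE (d m : ℕ) (ζ : ℂ) (E : Finset ℂ) : Cone (ThE d m ζ E) :=
  ⟨fun z h => (cone_Th d m ζ).ne z h.1, fun z h c hc => ⟨(cone_Th d m ζ).smul z h.1 c hc,
    fun e he => (cone_avoid m e).smul z (h.2 e he) c hc⟩⟩

theorem ThE_empty : ThE d m ζ ∅ = Th d m ζ := by ext; simp [ThE]

theorem ThE_insert : ThE d m ζ (insert e E) = ThE d m ζ E ∩ avoid m e := by
  ext z; simp only [ThE, Finset.forall_mem_insert, Set.mem_inter_iff, Set.mem_ofPred_eq]; tauto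

theorem ThE_all (hd : d ≠ 0) (hζ : ζ ^ d = -1) (hE : ∀ e : ℂ, e ∈ E ↔ e ^ d = -1 ∧ e ≠ ζ) :
    ThE d m ζ E = Th d m ζ ∩ headNe m := by
  ext z
  refine ⟨fun hz => ⟨hz.1, ?_⟩, fun hz => ⟨hz.1, fun e _ => headNe_subset_avoid hz.2⟩⟩
  by_contra hc
  have hX := hz.1.1.1
  have h1 := Xc_eq hX
  rw [Qf_eq_zero hd hc, zero_add] at h1
  have hb : z (m + 1) ≠ 0 := fun hb => by
    rw [hb, zero_pow hd, add_zero] at h1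
    exact Cr_ne hX.1 hX.2.1 hc (pow_eq_zero_iff hd |>.1 h1) hb
  have ha : z m = z m / z (m + 1) * z (m + 1) := by field_simp
  by_cases he : z m / z (m + 1) = ζ
  · rw [he] at ha
    refine hz.1.1.2 ?_
    rw [wf_of_eq hd hζ (r := 1) (by simpa using ha)]
    exact mem_Sec_of_eq hd (by positivity)
  · have he' : (z m / z (m + 1)) ^ d = -1 := by
      rw [div_pow, div_eq_iff (pow_ne_zero d hb)]
      linear_combination h1
    exact (hz.2 _ ((hE _).2 ⟨he', he⟩)).elim hc fun h => h ha

theorem isCell_ThE (hd : d ≠ 0) (hζ : ζ ^ d = -1) (he : e ^ d = -1) (heζ : e ≠ ζ) (heE : e ∉ E) :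
    IsCell d m e (ThE d m ζ E) (Gp d m) := by
  refine ⟨cone_ThE d m ζ E, fun z hz => hz.1.1.1, Gp_subset, Gp_smul,
    fun z hz hw => ?_⟩
  obtain ⟨ha, hu⟩ := wf_ratio hd hw
  have h1 := chart_ratio he hz ha
  have ha' := pow_ne_zero d ha
  have h2 : 1 - Qf d m (affY m e z) = -(z (m + 1) ^ d / z m ^ d) := by
    rw [h1, div_pow, mul_pow, he]; ring
  constructor
  · rintro ⟨⟨-, β, hβ0, hβ1, hβ⟩, -⟩
    refine ⟨affY_mem_Cr z, 1 - β, by linarith, ?_⟩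
    rw [hβ] at h2
    have : -(-(β * z m ^ d) / z m ^ d) = (β : ℂ) := by field_simp
    rw [this] at h2
    push_cast
    linear_combination - h2
  · rintro ⟨-, r, hr, hQ⟩
    have h3 := Sec_pow_slit hd hu
    rw [← h1, hQ] at h3
    have hr1 : 0 < 1 - r := by
      have h4 : ((1 - r : ℝ) : ℂ) ∈ Complex.slitPlane := by exact_mod_cast h3
      simpa using Complex.ofReal_mem_slitPlane.1 h4
    rw [hQ, eq_neg_iff_add_eq_zero] at h2
    have hB : z (m + 1) ^ d = -(((1 - r : ℝ) : ℂ) * z m ^ d) := by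
      field_simp at h2
      push_cast
      linear_combination h2
    have hb : z (m + 1) ≠ 0 := fun hb => by
      rw [hb, zero_pow hd] at hB
      have : ((1 - r : ℝ) : ℂ) * z m ^ d = 0 := neg_eq_zero.1 hB.symm
      rcases mul_eq_zero.1 this with h | h
      · exact hr1.ne' (by exact_mod_cast h)
      · exact ha' h
    have key : ∀ ξ : ℂ, ξ ^ d = -1 → wf m ξ z ∈ Sec d →
        z m = (‖z m‖ / ‖z (m + 1)‖ : ℝ) * (ξ * z (m + 1)) := fun ξ hξ hs => by
      refine eq_mul_of_wf hd hξ hb (eq_norm_of_pow hd (r := (1 - r) * ‖z m ^ d‖ ^ 2) (by positivity)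
        ?_ ((mem_Sec_iff hd).1 hs).le)
      rw [wf_pow hξ, hB, map_neg, map_mul, Complex.conj_ofReal]
      push_cast
      rw [← Complex.mul_conj']; ring
    refine ⟨⟨⟨hz, fun hs => heζ ?_⟩, 1 - r, hr1.le, by linarith, hB⟩, fun e' he' => ?_⟩
    · have h4 := (key e he hw).symm.trans (key ζ hζ hs)
      have h5 : ((‖z m‖ / ‖z (m + 1)‖ : ℝ) : ℂ) ≠ 0 := by
        have : 0 < ‖z m‖ / ‖z (m + 1)‖ := by positivity
        exact_mod_cast this.ne'
      exact mul_right_cancel₀ hb (mul_left_cancel₀ h5 h4)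
    · by_contra hc
      simp only [avoid, Set.mem_ofPred_eq, not_or, not_not] at hc
      have h4 := eq_of_head hd he hz hc.1 ((mem_Sec_iff hd).1 hw).le
      exact heE (mul_right_cancel₀ h4.2 (h4.1.symm.trans hc.2) ▸ he')

theorem straighten_rot (hη : η ^ d = 1) (y : ℕ → ℂ) :
    straighten d (1, rot η y) = rot η (straighten d (1, y)) := by
  funext i
  by_cases hi : i = 0
  · subst hi
    simp only [straighten, rot_zero, rt, mul_pow, hη, one_mul, mul_assoc]
  · simp only [straighten, rot_of_ne _ _ hi]

/-- The relative homology is projective and concentrated in dimension `m`; when `m = 1`, it has no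
nonzero elements fixed by `ρ`. -/
structure Conc {F : Type} [TopologicalSpace F] (m : ℕ) (ρ : F → F) (T S : Set F) : Prop where
  pj : ∀ n, Pj n T S
  van : ∀ n, n ≠ m + 1 → Van n T S
  inv : m = 1 → Inv ρ 2 T S

theorem Conc.of_van {F : Type} [TopologicalSpace F] {ρ : F → F} {T S : Set F}
    (h : ∀ n, Van n T S) : Conc m ρ T S :=
  ⟨fun n => (h n).pj, fun n _ => h n, fun _ => (h 2).inv⟩

theorem Conc.trans {F : Type} [TopologicalSpace F] {ρ : F → F} {T S R : Set F} (hRS : R ⊆ S)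
    (hST : S ⊆ T) (hρ : m = 1 → ContinuousOn ρ T) (mT : m = 1 → Set.MapsTo ρ T T)
    (mS : m = 1 → Set.MapsTo ρ S S) (mR : m = 1 → Set.MapsTo ρ R R)
    (h1 : Conc m ρ S R) (h2 : Conc m ρ T S) : Conc m ρ T R := by
  refine ⟨fun n => ?_, fun n hn => Van.trans hRS hST (h1.van n hn) (h2.van n hn), fun hm => ?_⟩
  · by_cases hn : n = m + 1
    · exact Pj.trans_of_right hRS hST (h2.van _ (by omega)) (h1.pj n) (h2.pj n)
    · exact (Van.trans hRS hST (h1.van n hn) (h2.van n hn)).pj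
  · exact Inv.trans hRS hST (hρ hm) (mT hm) (mS hm) (mR hm) (h2.van 3 (by omega)) (h1.inv hm)
      (h2.inv hm)

theorem conc_Gp (hd : d ≠ 0) (hη : IsPrimitiveRoot η d) (m : ℕ) :
    Conc m (rot η) (Gp d m) (Gp d m \ {0}) := by
  have h := fun n => star_homology hd m n
  refine ⟨fun n => (hretract_Gp hd).pj (h n).1, fun n hn => (hretract_Gp hd).van ((h n).2 hn),
    fun hm => ?_⟩
  subst hm
  exact (hretract_Gp hd).inv (fun y _ => straighten_rot hη.pow_eq_one y) (inv_Kk hd hη)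

theorem rot_mem_ThE (hd : d ≠ 0) (hη : η ^ d = 1) (hm : m ≠ 0) :
    Set.MapsTo (rot η) (ThE d m ζ E) (ThE d m ζ E) := by
  rintro z ⟨⟨⟨hX, hw⟩, β, h0, h1, h2⟩, h3⟩
  refine ⟨⟨⟨rot_mem_Xc hd hη hX, by rwa [wf_rot hm]⟩, β, h0, h1, ?_⟩,
    fun e he => rot_mem_avoid (ne_zero_of_pow_eq_one hd hη) hm (h3 e he)⟩
  rwa [rot_of_ne _ _ hm, rot_of_ne _ _ (Nat.succ_ne_zero m)]

theorem conc_ThE (hd : d ≠ 0) (hη : IsPrimitiveRoot η d) (hζ : ζ ^ d = -1) (E : Finset ℂ)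
    (hE : ∀ e ∈ E, e ^ d = -1 ∧ e ≠ ζ) :
    Conc m (projMap (rot η)) (PS (Th d m ζ)) (PS (ThE d m ζ E)) := by
  have h0 := ne_zero_of_pow_eq_one hd hη.pow_eq_one
  have hmap : ∀ E, m = 1 → Set.MapsTo (projMap (rot η)) (PS (ThE d m ζ E)) (PS (ThE d m ζ E)) :=
    fun E hm => mapsTo_projRot (cone_ThE d m ζ E) (rot_mem_ThE hd hη.pow_eq_one (by omega))
  induction E using Finset.induction_on with
  | empty => rw [ThE_empty]; exact Conc.of_van fun n x hx => mem_Bd_of_Csg (mem_Z.1 hx).1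
  | insert e E he ih =>
    rw [Finset.forall_mem_insert] at hE
    have hc := isCell_ThE (m := m) hd hζ hE.1.1 hE.1.2 he
    have hG := conc_Gp hd hη m
    refine Conc.trans ?_ (PS_mono fun z hz => hz.1)
      (fun _ => continuousOn_projRot h0 (cone_Th d m ζ)) (by simpa [ThE_empty] using hmap ∅)
      (hmap E) (hmap _) ?_ (ih hE.2)
    · rw [ThE_insert]; exact PS_mono Set.inter_subset_left
    · rw [ThE_insert]
      exact ⟨fun n => hc.pj hd hE.1.1 (hG.pj n), fun n hn => hc.van hd hE.1.1 (hG.van n hn),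
        fun hm => hc.inv hd hE.1.1 hη.pow_eq_one (by omega)
          (rot_mem_ThE hd hη.pow_eq_one (by omega)) (hG.inv hm)⟩

theorem conc_avoid (hd : d ≠ 0) (hη : IsPrimitiveRoot η d) (hζ : ζ ^ d = -1) :
    Conc m (projMap (rot η)) (PS (Xc d m ∩ avoid m ζ)) (PS (Finf d m)) := by
  let E : Finset ℂ := (Polynomial.nthRootsFinset d (-1 : ℂ)).erase ζ
  have hE : ∀ e : ℂ, e ∈ E ↔ e ^ d = -1 ∧ e ≠ ζ := fun e => by
    rw [Finset.mem_erase, Polynomial.mem_nthRootsFinset (Nat.pos_of_ne_zero hd), and_comm]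
  have h1 := conc_ThE (m := m) hd hη hζ E fun e he => (hE e).1 he
  rw [ThE_all hd hζ hE] at h1
  have h0 := ne_zero_of_pow_eq_one hd hη.pow_eq_one
  have mX : m = 1 → Set.MapsTo (projMap (rot η)) (PS (Xc d m ∩ avoid m ζ))
      (PS (Xc d m ∩ avoid m ζ)) := fun hm => mapsTo_projRot ((cone_Xc d m).inter (cone_avoid m ζ))
    fun z hz => ⟨rot_mem_Xc hd hη.pow_eq_one hz.1, rot_mem_avoid h0 (by omega) hz.2⟩
  have mF : m = 1 → Set.MapsTo (projMap (rot η)) (PS (Finf d m)) (PS (Finf d m)) := fun hm =>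
    mapsTo_projRot (cone_Finf d m) fun z hz => ⟨rot_mem_Xc hd hη.pow_eq_one hz.1, by
      rw [rot_of_ne _ _ (Nat.succ_ne_zero m)]; exact hz.2⟩
  have mT : m = 1 → Set.MapsTo (projMap (rot η)) (PS (Th d m ζ)) (PS (Th d m ζ)) := fun hm => by
    rw [← ThE_empty]
    exact mapsTo_projRot (cone_ThE d m ζ ∅) (rot_mem_ThE hd hη.pow_eq_one (by omega))
  have mH : m = 1 → Set.MapsTo (projMap (rot η)) (PS (Th d m ζ ∩ headNe m))
      (PS (Th d m ζ ∩ headNe m)) := fun hm => by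
    rw [← ThE_all hd hζ hE]
    exact mapsTo_projRot (cone_ThE d m ζ E) (rot_mem_ThE hd hη.pow_eq_one (by omega))
  have hTX : Th d m ζ ⊆ Xc d m ∩ avoid m ζ :=
    fun z hz => XT_subset hd hζ hz.1
  refine Conc.trans (S := PS (Th d m ζ)) (PS_mono ((Finf_subset hd).trans Set.inter_subset_left))
    (PS_mono hTX) (fun _ => continuousOn_projRot h0 ((cone_Xc d m).inter (cone_avoid m ζ))) mX mT mF
    ?_ (Conc.of_van fun n => ?_)
  · exact Conc.trans (PS_mono (Finf_subset hd)) (PS_mono Set.inter_subset_left)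
      (fun _ => continuousOn_projRot h0 (cone_Th d m ζ)) mT mH mF
      (Conc.of_van fun n => van_Th_Finf hd n) h1
  · have hXT : XT d m ζ ⊆ Xc d m ∩ avoid m ζ := XT_subset hd hζ
    exact Van.trans (PS_mono fun z hz => hz.1) (PS_mono hXT)
      (Van.trans (PS_mono (Th_subset hd)) (PS_mono fun z hz => hz.1) (van_XA_Th hd hζ n)
        (van_XT_XA hd hζ n)) (van_avoid_XT hd hζ n)

/-- The homology of the Fermat variety relative to its hyperplane section. -/
theorem rel_homology (hd : d ≠ 0) (m n : ℕ) : Pj n (PS (Xc d m)) (PS (Finf d m)) ∧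
    (n ≠ m + 1 → n ≠ 2 * m + 1 → Van n (PS (Xc d m)) (PS (Finf d m))) := by
  obtain ⟨ζ, hζ⟩ := IsAlgClosed.exists_pow_nat_eq (-1 : ℂ) (Nat.pos_of_ne_zero hd)
  have hη := Complex.isPrimitiveRoot_exp d hd
  set η := Complex.exp (2 * Real.pi * Complex.I / d)
  have hc := isCell_top d m ζ
  have h1 := conc_avoid (m := m) hd hη hζ
  have h2 := fun n => hc.pj hd hζ (Cr_homology m n).1
  have h3 := fun n hn => hc.van hd hζ ((Cr_homology m n).2 hn)
  have hRS : PS (Finf d m) ⊆ PS (Xc d m ∩ avoid m ζ) :=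
    PS_mono (((Finf_subset hd).trans Set.inter_subset_left).trans fun z hz => XT_subset hd hζ hz.1)
  have hST : PS (Xc d m ∩ avoid m ζ) ⊆ PS (Xc d m) := PS_mono Set.inter_subset_left
  refine ⟨?_, fun hn hn' => Van.trans hRS hST (h1.van n hn) (h3 n hn')⟩
  by_cases hn : n = m + 1
  swap
  · exact Pj.trans_of_left hRS hST (h1.van n hn) (h2 n)
  by_cases hm : n + 1 = 2 * m + 1
  swap
  · exact Pj.trans_of_right hRS hST (h3 _ hm) (h1.pj n) (h2 n)
  have hm1 : m = 1 := by omega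
  subst hm1 hn
  refine Pj.trans hRS hST (Triv.connecting (h1.inv rfl) ?_) (h1.pj 2) (h2 2)
  exact hc.triv hd hζ hη.pow_eq_one one_ne_zero (fun z hz => rot_mem_Xc hd hη.pow_eq_one hz)
    (fun z hz => rot_mem_Cr hz) (triv_Cr (hη.norm'_eq_one hd) 3)

end filtration

end

section

open Finsupp Cvx Topology

section fermat

variable {d m n : ℕ} {ε : ℂ}

theorem Finf_succ (d m : ℕ) : Finf d (m + 1) = Xc d m := by
  ext z
  constructor
  · rintro ⟨⟨h0, h1, h2⟩, h3⟩
    refine ⟨h0, fun i hi => ?_, ?_⟩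
    · rcases hi.eq_or_lt with rfl | hi
      · exact h3
      · exact h1 i hi
    · by_cases hd : d = 0
      · subst hd
        simp only [Qf, pow_zero, Finset.sum_const, Finset.card_range, nsmul_eq_mul, mul_one] at h2
        norm_cast at h2
      · rw [Qf, Finset.sum_range_succ, h3, zero_pow hd, add_zero] at h2
        exact h2
  · rintro ⟨h0, h1, h2⟩
    refine ⟨⟨h0, Cr_mono (by omega) h1, ?_⟩, h1 _ le_rfl⟩
    by_cases hd : d = 0
    · subst hd
      simp only [Qf, pow_zero, Finset.sum_const, Finset.card_range, nsmul_eq_mul, mul_one] at h2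
      norm_cast at h2
    · rw [Qf, Finset.sum_range_succ, h1 _ le_rfl, zero_pow hd, add_zero]
      exact h2

theorem Finf_zero (hd : d ≠ 0) : Finf d 0 = ∅ := by
  refine Set.eq_empty_of_forall_notMem fun z hz => ?_
  obtain ⟨i, hi, -⟩ := Finf_headNe hd hz
  omega

theorem Xc_subset_succ : PS (Xc d m) ⊆ PS (Xc d (m + 1)) := by
  rw [← Finf_succ]
  exact PS_mono fun z hz => hz.1

theorem van_Xc (hd : d ≠ 0) (m n : ℕ) (hn : 2 * m + 1 < n) : Van n (PS (Xc d m)) ∅ := by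
  induction m with
  | zero =>
    have := (rel_homology hd 0 n).2 (by omega) (by omega)
    rwa [Finf_zero hd] at this
  | succ m ih =>
    have := (rel_homology hd (m + 1) n).2 (by omega) (by omega)
    rw [Finf_succ] at this
    exact Van.trans (Set.empty_subset _) Xc_subset_succ (ih (by omega)) this

theorem pj_Xc_of_lt (hd : d ≠ 0) (m n : ℕ) (hn : m < n) : Pj n (PS (Xc d m)) ∅ := by
  induction m with
  | zero =>
    have := (rel_homology hd 0 n).1
    rwa [Finf_zero hd] at this
  | succ m ih =>
    have h := fun n => rel_homology hd (m + 1) n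
    rw [Finf_succ] at h
    by_cases h2 : n = 2 * m + 2
    · exact Pj.trans_of_left (Set.empty_subset _) Xc_subset_succ (van_Xc hd m n (by omega)) (h n).1
    · exact Pj.trans_of_right (Set.empty_subset _) Xc_subset_succ ((h (n + 1)).2 (by omega) (by omega))
        (ih (by omega)) (h n).1

theorem mem_Bd_of_van {E : Type} [TopologicalSpace E] {T S R : Set E} (hRS : R ⊆ S)
    (h : Van (n + 1) T S) {x : Ch (Sing E)} (hx : x ∈ Z n S R) (hT : x ∈ Bd T R) : x ∈ Bd S R := by
  obtain ⟨hx1, hx2, -⟩ := mem_Z.1 hx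
  obtain ⟨y, hy, hyn, hxy⟩ := exists_of_mem_Bd hT hx2
  have hdy : SimplexChains.d y ∈ C (sg S) := by
    have := sub_mem hx1 (Csg_mono hRS hxy)
    rwa [sub_sub_cancel] at this
  obtain ⟨w, hw, hs⟩ := mem_Bd.1 (h (mem_Z.2 ⟨hy, hyn, hdy⟩))
  refine mem_Bd.2 ⟨_, hs, ?_⟩
  rwa [map_sub, d_d, sub_zero]

theorem mem_Bd_Xc (hd : d ≠ 0) (hn : n ≤ m) {x : Ch (Sing (Projectivization ℂ (ℕ → ℂ)))}
    (hx : x ∈ Z n (PS (Xc d m)) ∅) (k : ℕ) (hk : x ∈ Bd (PS (Xc d (m + k))) ∅) :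
    x ∈ Bd (PS (Xc d m)) ∅ := by
  have hsub : ∀ k, PS (Xc d m) ⊆ PS (Xc d (m + k)) := fun k => by
    induction k with
    | zero => exact subset_rfl
    | succ k ih => exact ih.trans Xc_subset_succ
  induction k with
  | zero => exact hk
  | succ k ih =>
    refine ih (mem_Bd_of_van (n := n) (Set.empty_subset _) (T := PS (Xc d (m + k + 1))) ?_ ?_ hk)
    · rw [← Finf_succ d (m + k)]
      exact (rel_homology hd (m + k + 1) (n + 1)).2 (by omega) (by omega)
    · obtain ⟨h1, h2, h3⟩ := mem_Z.1 hx
      exact mem_Z.2 ⟨Csg_mono (hsub k) h1, h2, h3⟩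

/-- The vector `z` together with `c` times its copy in the next `r` coordinates. -/
def double (r : ℕ) (c : ℂ) (z : ℕ → ℂ) : ℕ → ℂ := fun i => if i < r then z i else c * z (i - r)

theorem double_smul (r : ℕ) (c a : ℂ) (z : ℕ → ℂ) : double r c (a • z) = a • double r c z := by
  funext i
  simp only [double, Pi.smul_apply, smul_eq_mul]
  split_ifs
  · rfl
  · ring

theorem double_zero {r : ℕ} {z : ℕ → ℂ} (hz : z ∈ Cr r) : double r 0 z = z := by
  funext i
  rw [double]
  split_ifs with h
  · rfl
  · rw [zero_mul, hz i (by omega)]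

theorem double_mem {c : ℂ} {z : ℕ → ℂ} (h0 : z ≠ 0) (hz : z ∈ Cr (m + 2))
    (hQ : (1 + c ^ d) * Qf d (m + 2) z = 0) : double (m + 2) c z ∈ Xc d (m + (m + 2)) := by
  refine ⟨fun h => h0 (funext fun i => ?_), fun i hi => ?_, ?_⟩
  · by_cases hi : i < m + 2
    · have := congrFun h i
      rwa [double, if_pos hi] at this
    · exact hz i (by omega)
  · rw [double, if_neg (by omega), hz _ (by omega), mul_zero]
  · rw [← hQ, Qf, show m + (m + 2) + 2 = (m + 2) + (m + 2) by ring, Finset.sum_range_add, add_mul,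
      one_mul, Qf, Finset.mul_sum]
    congr 1
    · exact Finset.sum_congr rfl fun i hi => by rw [double, if_pos (Finset.mem_range.1 hi)]
    · exact Finset.sum_congr rfl fun i _ => by
        rw [double, if_neg (by omega), Nat.add_sub_cancel_left, mul_pow]

theorem continuous_double (r : ℕ) : Continuous fun q : ℂ × (ℕ → ℂ) => double r q.1 q.2 := by
  refine continuous_pi fun i => ?_
  unfold double
  split_ifs <;> fun_prop

/-- The homology of the Fermat variety is projective. -/
theorem pj_Xc (hd : d ≠ 0) (m n : ℕ) : Pj n (PS (Xc d m)) ∅ := by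
  rcases lt_or_ge m n with hn | hn
  · exact pj_Xc_of_lt hd m n hn
  obtain ⟨ε, hε⟩ := IsAlgClosed.exists_pow_nat_eq (-1 : ℂ) (Nat.pos_of_ne_zero hd)
  have hX : Xc d m ⊆ Lc (m + 1) := fun z hz => ⟨hz.1, hz.2.1⟩
  have hg : ∀ z ∈ Lc (m + 1), double (m + 2) ε z ∈ Xc d (m + (m + 2)) := fun z hz =>
    double_mem hz.1 hz.2 (by rw [hε]; ring)
  refine Pr.of_inj LinearMap.id (fun x hx => ?_) (fun x _ hx => Bd_mono_left (PS_mono hX) hx)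
    (fun x hx hb => ?_) (projspace_homology (m + 1) n).1
  · obtain ⟨h1, h2, h3⟩ := mem_Z.1 hx
    exact mem_Z.2 ⟨Csg_mono (PS_mono hX) h1, h2, h3⟩
  refine mem_Bd_Xc hd hn hx (m + 2) ?_
  have hC := cone_Xc d (m + (m + 2))
  have e1 := push_mem_Bd (f := projMap (double (m + 2) ε)) (A' := PS (Xc d (m + (m + 2)))) (B' := ∅)
    (continuousOn_projMap (cone_Lc (m + 1)) (fun v _ c _ => double_smul _ _ _ _)
      ((continuous_double (m + 2)).comp (by fun_prop : Continuous fun z : ℕ → ℂ => (ε, z))).continuousOn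
      fun v hv => hC.ne _ (hg v hv)) (fun p hp => hC.toP_mem (hg _ hp)) (Set.mapsTo_empty _ _)
    (Set.empty_subset _) hb
  let F : ℝ × (ℕ → ℂ) → ℕ → ℂ := fun q => double (m + 2) (q.1 * ε) q.2
  have hF : ∀ t : ℝ, ∀ z ∈ Xc d m, F (t, z) ∈ Xc d (m + (m + 2)) := fun t z hz =>
    double_mem hz.1 hz.2.1 (by rw [hz.2.2, mul_zero])
  have e2 := prism_sub_mem_Bd (h := projHtpy F) (A' := PS (Xc d (m + (m + 2)))) (B' := ∅)
    (continuousOn_projHtpy (cone_Xc d m) (fun t _ v _ c _ => double_smul _ _ _ _)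
      ((continuous_double (m + 2)).comp
        (by fun_prop : Continuous fun q : ℝ × (ℕ → ℂ) => ((q.1 : ℂ) * ε, q.2))).continuousOn
      fun t _ v hv => hC.ne _ (hF t v hv)) (fun t _ p hp => hC.toP_mem (hF t _ hp))
    (fun _ _ _ h => h.elim) (Set.empty_subset _) hx
  have hx1 := (mem_Z.1 hx).1
  have h0 : ∀ p ∈ PS (Xc d m), projHtpy F (0, p) = p := fun p hp => by
    simp only [projHtpy, F, Complex.ofReal_zero, zero_mul]
    rw [double_zero hp.2.1, toP_rep]
  have h1 : ∀ p ∈ PS (Xc d m), projHtpy F (1, p) = projMap (double (m + 2) ε) p := fun p _ => by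
    simp [projHtpy, F, projMap]
  rw [push_id' h0 hx1, push_congr h1 hx1] at e2
  simpa using sub_mem e1 e2

end fermat

end

section

open Finsupp Cvx Topology

section fermatPolynomial

variable {d m n N : ℕ}

/-- The affine cone over a projective hypersurface, without the origin. -/
def Xf (f : MvPolynomial (Fin (N + 1)) ℂ) : Set (Fin (N + 1) → ℂ) := {v | v ≠ 0 ∧ eval v f = 0}

theorem eval_smul {f : MvPolynomial (Fin (N + 1)) ℂ} (hf : f.IsHomogeneous d) (c : ℂ)
    (v : Fin (N + 1) → ℂ) : eval (c • v) f = c ^ d * eval v f := by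
  rw [eval_eq, eval_eq, Finset.mul_sum]
  refine Finset.sum_congr rfl fun k hk => ?_
  have h : ∑ i, k i = d := by
    have := hf (MvPolynomial.mem_support_iff.1 hk)
    rw [← this, Finsupp.weight_apply, Finsupp.sum_fintype _ _ (by simp)]
    simp
  simp only [Pi.smul_apply, smul_eq_mul, mul_pow, Finset.prod_mul_distrib,
    Finset.prod_pow_eq_pow_sum]
  rw [Finset.sum_subset (Finset.subset_univ _) (by simp), h]
  ring

theorem cone_Xf {f : MvPolynomial (Fin (N + 1)) ℂ} (hf : f.IsHomogeneous d) : Cone (Xf f) where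
  ne v hv := hv.1
  smul v hv c hc := ⟨smul_ne_zero hc hv.1, by rw [eval_smul hf, hv.2, mul_zero]⟩

/-- The Fermat polynomial. -/
noncomputable def fermat (d N : ℕ) : MvPolynomial (Fin (N + 1)) ℂ := ∑ i, X i ^ d

theorem fermat_isHomogeneous (d N : ℕ) : (fermat d N).IsHomogeneous d :=
  IsHomogeneous.sum _ _ _ fun i _ => by simpa using (isHomogeneous_X ℂ i).pow d

theorem eval_fermat (v : Fin (N + 1) → ℂ) : eval v (fermat d N) = ∑ i, v i ^ d := by
  simp [fermat]

/-- Extension of a vector by zero. -/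
def extz (v : Fin N → ℂ) (i : ℕ) : ℂ := if h : i < N then v ⟨i, h⟩ else 0

theorem extz_coe (v : Fin N → ℂ) (i : Fin N) : extz v i = v i := by simp [extz]

theorem extz_mem (v : Fin (m + 2) → ℂ) (hv : v ∈ Xf (fermat d (m + 1))) : extz v ∈ Xc d m := by
  refine ⟨fun h => hv.1 (funext fun i => ?_), fun i hi => dif_neg (by omega), ?_⟩
  · rw [← extz_coe v i, h]; rfl
  · have h2 := hv.2
    rw [eval_fermat] at h2
    rw [Qf, Finset.sum_range]
    simpa only [extz_coe] using h2

theorem restrict_mem (z : ℕ → ℂ) (hz : z ∈ Xc d m) :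
    (fun i : Fin (m + 2) => z i) ∈ Xf (fermat d (m + 1)) := by
  refine ⟨fun h => hz.1 (funext fun i => ?_), ?_⟩
  · by_cases hi : i < m + 2
    · exact congrFun h ⟨i, hi⟩
    · exact hz.2.1 i (by omega)
  · rw [eval_fermat, ← hz.2.2, Qf, Finset.sum_range]

theorem pj_fermat (hd : d ≠ 0) (m n : ℕ) : Pj n (PS (Xf (fermat d (m + 1)))) ∅ := by
  have hA := cone_Xf (fermat_isHomogeneous d (m + 1))
  have hC := cone_Xc d m
  have hs : ∀ v ∈ Xf (fermat d (m + 1)), ∀ c : ℂ, c ≠ 0 → extz (c • v) = c • extz v :=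
    fun v _ c _ => funext fun i => by simp [extz]
  have hs' : ∀ z ∈ Xc d m, ∀ c : ℂ, c ≠ 0 → (fun i : Fin (m + 2) => (c • z) i) =
    c • fun i : Fin (m + 2) => z i := fun v _ c _ => rfl
  have hco : Continuous (extz : (Fin (m + 2) → ℂ) → ℕ → ℂ) := continuous_pi fun i => by
    by_cases hi : i < m + 2
    · simp only [extz, hi, dite_true]; fun_prop
    · simp only [extz, hi, dite_false]; fun_prop
  have H : HRetract (PS (Xf (fermat d (m + 1)))) ∅ (PS (Xc d m)) ∅ (projMap extz)
      (projMap fun z (i : Fin (m + 2)) => z i) (fun q => q.2) :=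
    { subset := Set.empty_subset _
      subset' := Set.empty_subset _
      cont_f := continuousOn_projMap hA hs hco.continuousOn fun v hv => hC.ne _ (extz_mem v hv)
      fA := fun p hp => hC.toP_mem (extz_mem _ hp)
      fB := Set.mapsTo_empty _ _
      cont_g := continuousOn_projMap hC hs' (by fun_prop) fun z hz => hA.ne _ (restrict_mem z hz)
      gA := fun p hp => hA.toP_mem (restrict_mem _ hp)
      gB := Set.mapsTo_empty _ _
      cont_h := continuousOn_snd
      hA := fun _ _ _ h => h
      hB := fun _ _ _ h => h
      h0 := fun _ _ => rfl
      h1 := fun p hp => by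
        rw [show projMap extz p = toP (extz p.rep) from rfl,
          projMap_toP hC hs' (extz_mem _ hp)]
        simp only [extz_coe]
        exact (toP_rep p).symm }
  exact H.pj (pj_Xc hd m n)

end fermatPolynomial

end

section

open Finsupp Cvx Topology

section family

variable {ι : Type} [Fintype ι]

/-- Divided differences of a polynomial. -/
theorem exists_divided_difference [DecidableEq ι] (p : MvPolynomial ι ℂ) :
    ∃ q : ι → (ι → ℂ) × (ι → ℂ) → ℂ, (∀ i, Continuous (q i)) ∧
      (∀ x y, eval x p - eval y p = ∑ i, (x i - y i) * q i (x, y)) ∧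
      ∀ i x, q i (x, x) = eval x (pderiv i p) := by
  induction p using MvPolynomial.induction_on with
  | C a => exact ⟨fun _ _ => 0, fun _ => continuous_const, by simp, by simp⟩
  | add p r hp hr =>
    obtain ⟨q, h1, h2, h3⟩ := hp
    obtain ⟨q', h1', h2', h3'⟩ := hr
    refine ⟨fun i x => q i x + q' i x, fun i => (h1 i).add (h1' i), fun x y => ?_, fun i x => ?_⟩
    · simp only [map_add, mul_add, Finset.sum_add_distrib, ← h2, ← h2']
      ring
    · simp [h3, h3']
  | mul_X p j hp =>
    obtain ⟨q, h1, h2, h3⟩ := hp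
    refine ⟨fun i x => q i x * x.1 j + (if i = j then eval x.2 p else 0), fun i => ?_,
      fun x y => ?_, fun i x => ?_⟩
    · by_cases hij : i = j <;> simp only [hij, if_true, if_false]
      · exact ((h1 j).mul (by fun_prop)).add ((MvPolynomial.continuous_eval p).comp continuous_snd)
      · exact ((h1 i).mul (by fun_prop)).add continuous_const
    · simp only [map_mul, eval_X, mul_add, ← mul_assoc, Finset.sum_add_distrib, ← Finset.sum_mul,
        ← h2, mul_ite, mul_zero, Finset.sum_ite_eq', Finset.mem_univ, if_true]
      ring
    · rw [Derivation.leibniz, pderiv_X]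
      simp only [h3, smul_eq_mul, map_add, map_mul, eval_X, Pi.single_apply]
      split_ifs with h h'
      · simp [mul_comm, add_comm]
      · exact absurd h.symm h'
      · exact absurd (by tauto) h
      · simp [mul_comm]

/-- A continuous family of homogeneous functions of degree `e + 1` with divided differences `q` and
nonvanishing gradients on the zero sets. -/
structure SmoothFamily (e : ℕ) (P : ℝ × (ι → ℂ) → ℂ) (q : ι → ℝ × (ι → ℂ) × (ι → ℂ) → ℂ) :
    Prop where
  cont : Continuous P
  contq : ∀ i, Continuous (q i)
  diff : ∀ t x y, P (t, x) - P (t, y) = ∑ i, (x i - y i) * q i (t, x, y)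
  hom : ∀ t (c : ℂ) z, P (t, c • z) = c ^ (e + 1) * P (t, z)
  homq : ∀ i t (c : ℂ) z, q i (t, c • z, c • z) = c ^ e * q i (t, z, z)
  ndg : ∀ t z, z ≠ 0 → P (t, z) = 0 → ∃ i, q i (t, z, z) ≠ 0

variable {e : ℕ} {P : ℝ × (ι → ℂ) → ℂ} {q : ι → ℝ × (ι → ℂ) × (ι → ℂ) → ℂ}

open ComplexConjugate

/-- The squared norm of the gradient. -/
noncomputable def gradSq (q : ι → ℝ × (ι → ℂ) × (ι → ℂ) → ℂ) (x : ℝ × (ι → ℂ)) : ℂ :=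
  ∑ i, conj (q i (x.1, x.2, x.2)) * q i (x.1, x.2, x.2)

/-- The vector field along which the function has derivative `1`. -/
noncomputable def unitField (q : ι → ℝ × (ι → ℂ) × (ι → ℂ) → ℂ) (x : ℝ × (ι → ℂ)) (i : ι) : ℂ :=
  conj (q i (x.1, x.2, x.2)) / gradSq q x

theorem SmoothFamily.gradSq_ne (H : SmoothFamily e P q) {x : ℝ × (ι → ℂ)} (h0 : x.2 ≠ 0)
    (hP : P x = 0) : gradSq q x ≠ 0 := by
  obtain ⟨i, hi⟩ := H.ndg x.1 x.2 h0 hP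
  have : gradSq q x = ((∑ i, Complex.normSq (q i (x.1, x.2, x.2)) : ℝ) : ℂ) := by
    rw [gradSq, Complex.ofReal_sum]
    exact Finset.sum_congr rfl fun i _ => (Complex.normSq_eq_conj_mul_self).symm
  rw [this, Complex.ofReal_ne_zero]
  exact (Finset.sum_pos' (fun j _ => Complex.normSq_nonneg (q j (x.1, x.2, x.2)))
    ⟨i, Finset.mem_univ i, Complex.normSq_pos.2 hi⟩).ne'

theorem SmoothFamily.continuousAt_unitField (H : SmoothFamily e P q) {x : ℝ × (ι → ℂ)} (h0 : x.2 ≠ 0)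
    (hP : P x = 0) : ContinuousAt (unitField q) x := by
  have hc : ∀ i, Continuous fun x : ℝ × (ι → ℂ) => q i (x.1, x.2, x.2) := fun i =>
    (H.contq i).comp (by fun_prop)
  have hc' : ∀ i, Continuous fun x : ℝ × (ι → ℂ) => conj (q i (x.1, x.2, x.2)) := fun i =>
    Complex.continuous_conj.comp (hc i)
  refine continuousAt_pi.2 fun i => (hc' i).continuousAt.div ?_ (H.gradSq_ne h0 hP)
  exact (continuous_finsetSum _ fun i _ => (hc' i).mul (hc i)).continuousAt

theorem SmoothFamily.sum_unitField (H : SmoothFamily e P q) {x : ℝ × (ι → ℂ)} (h0 : x.2 ≠ 0)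
    (hP : P x = 0) : ∑ i, unitField q x i * q i (x.1, x.2, x.2) = 1 := by
  have := H.gradSq_ne h0 hP
  simp only [unitField, div_mul_eq_mul_div, ← Finset.sum_div]
  exact div_self this

theorem SmoothFamily.unitField_smul (H : SmoothFamily e P q) (t : ℝ) (z : ι → ℂ) {c : ℂ} (hc : c ≠ 0) :
    unitField q (t, c • z) = (c ^ e)⁻¹ • unitField q (t, z) := by
  have hc' : conj c ^ e ≠ 0 := pow_ne_zero _ (by simpa using hc)
  have hg : gradSq q (t, c • z) = conj c ^ e * c ^ e * gradSq q (t, z) := by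
    simp only [gradSq, H.homq, map_mul, map_pow, Finset.mul_sum]
    exact Finset.sum_congr rfl fun i _ => by ring
  ext i
  simp only [unitField, hg, H.homq, map_mul, map_pow, Pi.smul_apply, smul_eq_mul]
  rw [mul_assoc, mul_div_mul_left _ _ hc', div_mul_eq_div_div, inv_mul_eq_div, div_right_comm]

/-- Moving a point along `unitField`. -/
noncomputable def mv (q : ι → ℝ × (ι → ℂ) × (ι → ℂ) → ℂ) (s : ℝ) (z : ι → ℂ) (l : ℂ) : ι → ℂ :=
  z + l • unitField q (s, z)

theorem SmoothFamily.mv_smul (H : SmoothFamily e P q) (s : ℝ) (z : ι → ℂ) (l : ℂ) {c : ℂ}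
    (hc : c ≠ 0) : mv q s (c • z) (c ^ (e + 1) * l) = c • mv q s z l := by
  rw [mv, H.unitField_smul s z hc, mv, smul_add, smul_smul, smul_smul]
  congr 2
  field_simp
  ring

/-- The zero of a perturbation of the identity. -/
theorem exists_zero {r : ℝ} {h : ℂ → ℂ} (hr : 0 ≤ r)
    (H : ∀ l l', ‖l‖ ≤ r → ‖l'‖ ≤ r → ‖h l - h l' - (l - l')‖ ≤ 1 / 2 * ‖l - l'‖)
    (h0 : ‖h 0‖ ≤ r / 2) : ∃ l, ‖l‖ ≤ r ∧ h l = 0 := by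
  have hm : Set.MapsTo (fun l => l - h l) (Metric.closedBall 0 r) (Metric.closedBall 0 r) := by
    intro l hl
    rw [mem_closedBall_zero_iff] at hl ⊢
    have := H l 0 hl (by simpa using hr)
    have e : l - h l = -(h l - h 0 - (l - 0)) - h 0 := by ring
    change ‖l - h l‖ ≤ r
    rw [e]
    refine (norm_sub_le _ _).trans ?_
    rw [norm_neg]
    rw [sub_zero] at this ⊢
    linarith
  have hc : ContractingWith (1 / 2) (hm.restrict _ _ _) := by
    refine ⟨by norm_num [← NNReal.coe_lt_coe], LipschitzWith.of_dist_le_mul fun x y => ?_⟩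
    have := H x y (mem_closedBall_zero_iff.1 x.2) (mem_closedBall_zero_iff.1 y.2)
    rw [Subtype.dist_eq, Subtype.dist_eq, dist_eq_norm, dist_eq_norm]
    change ‖((x : ℂ) - h x) - ((y : ℂ) - h y)‖ ≤ _
    rw [← norm_neg, show -(((x : ℂ) - h x) - ((y : ℂ) - h y)) = h x - h y - (x - y) by ring]
    simpa using this
  obtain ⟨l, hl, hf, -⟩ := hc.exists_fixedPoint' Metric.isClosed_closedBall.isComplete hm
    (x := 0) (by simpa using hr) (edist_ne_top _ _)
  refine ⟨l, by simpa using hl, ?_⟩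
  simpa using (show l - h l = l from hf)

end family

end

section

open Finsupp Cvx Topology

section transport

variable {ι : Type} [Fintype ι] {e : ℕ} {P : ℝ × (ι → ℂ) → ℂ}
  {q : ι → ℝ × (ι → ℂ) × (ι → ℂ) → ℂ}

theorem SmoothFamily.diff_mv (H : SmoothFamily e P q) (s t : ℝ) (z : ι → ℂ) (l l' : ℂ) :
    P (t, mv q s z l) - P (t, mv q s z l') =
      (l - l') * ∑ i, unitField q (s, z) i * q i (t, mv q s z l, mv q s z l') := by
  rw [H.diff, Finset.mul_sum]
  refine Finset.sum_congr rfl fun i _ => ?_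
  simp only [mv, Pi.add_apply, Pi.smul_apply, smul_eq_mul]
  ring

theorem SmoothFamily.continuousAt_mv (H : SmoothFamily e P q) {Y : Type} [TopologicalSpace Y]
    {a : Y → ℝ} {b : Y → ι → ℂ} {l : Y → ℂ} {y : Y} (ha : ContinuousAt a y) (hb : ContinuousAt b y)
    (hl : ContinuousAt l y) (h0 : b y ≠ 0) (hP : P (a y, b y) = 0) :
    ContinuousAt (fun y => mv q (a y) (b y) (l y)) y := by
  have h2 : ContinuousAt (fun y => unitField q (a y, b y)) y :=
    ContinuousAt.comp (g := unitField q) (f := fun y => (a y, b y))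
      (H.continuousAt_unitField (x := (a y, b y)) h0 hP) (ha.prodMk hb)
  exact hb.add (hl.smul h2)

theorem mv_zero (s : ℝ) (z : ι → ℂ) : mv q s z 0 = z := by simp [mv]

/-- The unit sphere in the total space of the family of zero sets. -/
def sphereFamily (P : ℝ × (ι → ℂ) → ℂ) : Set (ℝ × (ι → ℂ)) :=
  {x | x.1 ∈ Set.Icc (0 : ℝ) 1 ∧ ‖x.2‖ = 1 ∧ P x = 0}

theorem SmoothFamily.isCompact_sphereFamily (H : SmoothFamily e P q) :
    IsCompact (sphereFamily P) := by
  have hK : IsCompact (Set.Icc (0 : ℝ) 1 ×ˢ Metric.sphere (0 : ι → ℂ) 1) :=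
    isCompact_Icc.prod (isCompact_sphere _ _)
  have e : sphereFamily P = (Set.Icc (0 : ℝ) 1 ×ˢ Metric.sphere (0 : ι → ℂ) 1) ∩ P ⁻¹' {0} := by
    ext x
    simp [sphereFamily, and_assoc]
  rw [e]
  exact hK.inter_right (isClosed_singleton.preimage H.cont)

theorem SmoothFamily.exists_radius (H : SmoothFamily e P q) : ∃ η > 0, ∀ x ∈ sphereFamily P,
    ∀ t : ℝ, ∀ l l' : ℂ, |t - x.1| ≤ η → ‖l‖ ≤ η → ‖l'‖ ≤ η →
      ‖(∑ i, unitField q x i * q i (t, mv q x.1 x.2 l, mv q x.1 x.2 l')) - 1‖ ≤ 1 / 2 ∧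
        mv q x.1 x.2 l ≠ 0 := by
  have key := H.isCompact_sphereFamily.eventually_forall_of_forall_eventually
    (x₀ := ((0, 0, 0) : ℝ × ℂ × ℂ)) (P := fun r x =>
      ‖(∑ i, unitField q x i * q i (x.1 + r.1, mv q x.1 x.2 r.2.1, mv q x.1 x.2 r.2.2)) - 1‖ <
        1 / 2 ∧ mv q x.1 x.2 r.2.1 ≠ 0) (by
    rintro ⟨s, z⟩ ⟨hs, hz, hP⟩
    have h0 : z ≠ 0 := by
      rintro rfl
      simp at hz
    have c0 : ContinuousAt (fun y : (ℝ × ℂ × ℂ) × (ℝ × (ι → ℂ)) => unitField q y.2)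
        ((0, 0, 0), (s, z)) :=
      ContinuousAt.comp (g := unitField q) (f := Prod.snd) (H.continuousAt_unitField (x := (s, z)) h0 hP)
        continuousAt_snd
    have c1 : ContinuousAt (fun y : (ℝ × ℂ × ℂ) × (ℝ × (ι → ℂ)) => mv q y.2.1 y.2.2 y.1.2.1)
        ((0, 0, 0), (s, z)) :=
      H.continuousAt_mv (by fun_prop) (by fun_prop) (by fun_prop) h0 hP
    have c2 : ContinuousAt (fun y : (ℝ × ℂ × ℂ) × (ℝ × (ι → ℂ)) => mv q y.2.1 y.2.2 y.1.2.2)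
        ((0, 0, 0), (s, z)) :=
      H.continuousAt_mv (by fun_prop) (by fun_prop) (by fun_prop) h0 hP
    have c3 : ContinuousAt (fun y : (ℝ × ℂ × ℂ) × (ℝ × (ι → ℂ)) =>
        ‖(∑ i, unitField q y.2 i *
          q i (y.2.1 + y.1.1, mv q y.2.1 y.2.2 y.1.2.1, mv q y.2.1 y.2.2 y.1.2.2)) - 1‖)
        ((0, 0, 0), (s, z)) := by
      refine ((tendsto_finsetSum _ fun i _ => ?_).sub tendsto_const_nhds).norm
      refine ((continuousAt_pi.1 c0 i).mul ?_)
      exact (H.contq i).continuousAt.comp ((by fun_prop : ContinuousAt _ _).prodMk (c1.prodMk c2))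
    refine (c3.eventually_lt continuousAt_const ?_).and (c1.eventually_ne ?_)
    · have := H.sum_unitField (x := (s, z)) h0 hP
      simp only at this
      simp only [mv_zero, add_zero, this]
      norm_num
    · simpa only [mv_zero] using h0)
  rw [Metric.eventually_nhds_iff] at key
  obtain ⟨η, hη, key⟩ := key
  refine ⟨η / 2, half_pos hη, fun x hx t l l' ht hl hl' => ?_⟩
  have h1 := key (y := (t - x.1, l, l')) (by
    simp only [dist_eq_norm, Prod.norm_def, Prod.fst_sub, Prod.snd_sub, sub_zero, Real.norm_eq_abs]
    refine max_lt ?_ (max_lt ?_ ?_) <;> linarith) x hx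
  simp only [add_sub_cancel] at h1
  exact ⟨h1.1.le, h1.2⟩

theorem SmoothFamily.exists_step (H : SmoothFamily e P q) {δ : ℝ} (hδ : 0 < δ) :
    ∃ ε > 0, ∀ x ∈ sphereFamily P, ∀ t : ℝ, |t - x.1| ≤ ε → ‖P (t, x.2)‖ ≤ δ := by
  have key := H.isCompact_sphereFamily.eventually_forall_of_forall_eventually
    (x₀ := (0 : ℝ)) (P := fun r x => ‖P (x.1 + r, x.2)‖ < δ) (by
    rintro ⟨s, z⟩ ⟨hs, hz, hP⟩
    have c : Continuous fun y : ℝ × (ℝ × (ι → ℂ)) => ‖P (y.2.1 + y.1, y.2.2)‖ :=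
      (H.cont.comp (by fun_prop)).norm
    refine c.continuousAt.eventually_lt continuousAt_const ?_
    simpa [hP] using hδ)
  rw [Metric.eventually_nhds_iff] at key
  obtain ⟨η, hη, key⟩ := key
  refine ⟨η / 2, half_pos hη, fun x hx t ht => ?_⟩
  have h1 := key (y := t - x.1) (by
    rw [dist_zero_right, Real.norm_eq_abs]
    linarith) x hx
  simp only [add_sub_cancel] at h1
  exact h1.le

/-- Estimates at a step of the family. -/
structure StepAt (e : ℕ) (P : ℝ × (ι → ℂ) → ℂ) (q : ι → ℝ × (ι → ℂ) × (ι → ℂ) → ℂ) (δ : ℝ)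
    (s t : ℝ) (z : ι → ℂ) : Prop where
  bound : ∀ l l', ‖l‖ ≤ δ * ‖z‖ ^ (e + 1) → ‖l'‖ ≤ δ * ‖z‖ ^ (e + 1) →
    ‖P (t, mv q s z l) - P (t, mv q s z l') - (l - l')‖ ≤ 1 / 2 * ‖l - l'‖
  ne : ∀ l, ‖l‖ ≤ δ * ‖z‖ ^ (e + 1) → mv q s z l ≠ 0
  small : ‖P (t, z)‖ ≤ δ * ‖z‖ ^ (e + 1) / 4

theorem StepAt.smul (H : SmoothFamily e P q) {δ s t : ℝ} {z : ι → ℂ} (h : StepAt e P q δ s t z)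
    {c : ℂ} (hc : c ≠ 0) : StepAt e P q δ s t (c • z) := by
  have hc' : 0 < ‖c‖ ^ (e + 1) := pow_pos (norm_pos_iff.2 hc) _
  have hce : c ^ (e + 1) ≠ 0 := pow_ne_zero _ hc
  have hn : ∀ l, ‖c ^ (e + 1) * l‖ ≤ δ * ‖c • z‖ ^ (e + 1) ↔ ‖l‖ ≤ δ * ‖z‖ ^ (e + 1) := fun l => by
    rw [norm_mul, norm_pow, norm_smul, mul_pow, mul_left_comm, mul_le_mul_iff_right₀ hc']
  have hl : ∀ l, ∃ l', c ^ (e + 1) * l' = l := fun l => ⟨(c ^ (e + 1))⁻¹ * l, by field_simp⟩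
  refine ⟨fun l l' h1 h2 => ?_, fun l h1 => ?_, ?_⟩
  · obtain ⟨l, rfl⟩ := hl l
    obtain ⟨l', rfl⟩ := hl l'
    rw [hn] at h1 h2
    rw [H.mv_smul s z l hc, H.mv_smul s z l' hc, H.hom, H.hom, ← mul_sub, ← mul_sub, ← mul_sub,
      norm_mul, norm_mul, norm_pow, mul_left_comm]
    exact mul_le_mul_of_nonneg_left (h.bound l l' h1 h2) hc'.le
  · obtain ⟨l, rfl⟩ := hl l
    rw [hn] at h1
    rw [H.mv_smul s z l hc]
    exact smul_ne_zero hc (h.ne l h1)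
  · rw [H.hom, norm_mul, norm_pow, norm_smul, mul_pow]
    have := mul_le_mul_of_nonneg_left h.small hc'.le
    linarith

theorem SmoothFamily.exists_stepAt (H : SmoothFamily e P q) : ∃ δ > 0, ∃ ε > 0,
    ∀ s ∈ Set.Icc (0 : ℝ) 1, ∀ t : ℝ, |t - s| ≤ ε → ∀ z, z ≠ 0 → P (s, z) = 0 →
      StepAt e P q δ s t z := by
  obtain ⟨η, hη, h1⟩ := H.exists_radius
  obtain ⟨ε, hε, h2⟩ := H.exists_step (δ := η / 4) (by positivity)
  refine ⟨η, hη, min η ε, lt_min hη hε, fun s hs t ht z hz hP => ?_⟩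
  have hn : ‖z‖ ≠ 0 := norm_ne_zero_iff.2 hz
  have hc : (‖z‖ : ℂ) ≠ 0 := by exact_mod_cast hn
  have hzu : z = (‖z‖ : ℂ) • ((‖z‖ : ℂ)⁻¹ • z) := by
    rw [smul_smul, mul_inv_cancel₀ hc, one_smul]
  have hu : ‖((‖z‖ : ℂ)⁻¹ • z)‖ = 1 := by
    rw [norm_smul, norm_inv, Complex.norm_real, norm_norm, inv_mul_cancel₀ hn]
  rw [hzu]
  have hx : ((s, (‖z‖ : ℂ)⁻¹ • z) : ℝ × (ι → ℂ)) ∈ sphereFamily P :=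
    ⟨hs, hu, by rw [H.hom, hP, mul_zero]⟩
  refine StepAt.smul H ⟨fun l l' hl hl' => ?_, fun l hl => ?_, ?_⟩ hc
  · rw [hu, one_pow, mul_one] at hl hl'
    have := (h1 _ hx t l l' (ht.trans (min_le_left _ _)) hl hl').1
    rw [H.diff_mv, ← mul_sub_one, norm_mul, mul_comm]
    exact mul_le_mul_of_nonneg_right this (norm_nonneg _)
  · rw [hu, one_pow, mul_one] at hl
    exact (h1 _ hx t l 0 (ht.trans (min_le_left _ _)) hl (by simpa using hη.le)).2
  · rw [hu, one_pow, mul_one]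
    exact h2 _ hx t (ht.trans (min_le_right _ _))

end transport

end

section

open Finsupp Cvx Topology

section transport

variable {ι : Type} [Fintype ι] {e : ℕ} {P : ℝ × (ι → ℂ) → ℂ}
  {q : ι → ℝ × (ι → ℂ) × (ι → ℂ) → ℂ} {δ ε s t : ℝ} {z : ι → ℂ}

theorem StepAt.exists (hδ : 0 < δ) (h : StepAt e P q δ s t z) :
    ∃ l, ‖l‖ ≤ δ * ‖z‖ ^ (e + 1) ∧ P (t, mv q s z l) = 0 :=
  exists_zero (h := fun l => P (t, mv q s z l)) (by positivity) h.bound (by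
    rw [mv_zero]
    have := h.small
    have h' : 0 ≤ δ * ‖z‖ ^ (e + 1) := by positivity
    linarith)

theorem StepAt.norm_sub_le (h : StepAt e P q δ s t z) {l l' : ℂ} (hl : ‖l‖ ≤ δ * ‖z‖ ^ (e + 1))
    (hl' : ‖l'‖ ≤ δ * ‖z‖ ^ (e + 1)) :
    ‖l - l'‖ ≤ 2 * ‖P (t, mv q s z l) - P (t, mv q s z l')‖ := by
  have h1 := h.bound l l' hl hl'
  have h2 := norm_sub_norm_le (l - l') (P (t, mv q s z l) - P (t, mv q s z l'))
  rw [norm_sub_rev (l - l')] at h2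
  linarith

open Classical in
/-- The displacement carrying a point of one zero set to a nearby one. -/
noncomputable def disp (e : ℕ) (P : ℝ × (ι → ℂ) → ℂ) (q : ι → ℝ × (ι → ℂ) × (ι → ℂ) → ℂ) (δ : ℝ)
    (s t : ℝ) (z : ι → ℂ) : ℂ :=
  if h : ∃ l, ‖l‖ ≤ δ * ‖z‖ ^ (e + 1) ∧ P (t, mv q s z l) = 0 then h.choose else 0

theorem StepAt.disp_spec (hδ : 0 < δ) (h : StepAt e P q δ s t z) :
    ‖disp e P q δ s t z‖ ≤ δ * ‖z‖ ^ (e + 1) ∧ P (t, mv q s z (disp e P q δ s t z)) = 0 := by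
  rw [disp, dif_pos (h.exists hδ)]
  exact (h.exists hδ).choose_spec

theorem StepAt.eq_disp (hδ : 0 < δ) (h : StepAt e P q δ s t z) {l : ℂ}
    (hl : ‖l‖ ≤ δ * ‖z‖ ^ (e + 1)) (h0 : P (t, mv q s z l) = 0) : disp e P q δ s t z = l := by
  have := h.norm_sub_le (h.disp_spec hδ).1 hl
  rw [h0, (h.disp_spec hδ).2, sub_zero, norm_zero, mul_zero] at this
  exact sub_eq_zero.1 (norm_le_zero_iff.1 this)

theorem StepAt.disp_lt (hδ : 0 < δ) (h : StepAt e P q δ s t z) (hz : z ≠ 0) :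
    ‖disp e P q δ s t z‖ < δ * ‖z‖ ^ (e + 1) := by
  have h' : 0 < δ * ‖z‖ ^ (e + 1) := mul_pos hδ (pow_pos (norm_pos_iff.2 hz) _)
  have h1 := h.norm_sub_le (h.disp_spec hδ).1 (l' := 0) (by simpa using h'.le)
  rw [(h.disp_spec hδ).2, sub_zero, zero_sub, norm_neg, mv_zero] at h1
  have h2 := h.small
  linarith

/-- Transport from one zero set to a nearby one. -/
noncomputable def tr (e : ℕ) (P : ℝ × (ι → ℂ) → ℂ) (q : ι → ℝ × (ι → ℂ) × (ι → ℂ) → ℂ) (δ : ℝ)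
    (s t : ℝ) (z : ι → ℂ) : ι → ℂ := mv q s z (disp e P q δ s t z)

theorem StepAt.tr_self (hδ : 0 < δ) (h : StepAt e P q δ s s z) (hP : P (s, z) = 0) :
    tr e P q δ s s z = z := by
  rw [tr, h.eq_disp hδ (l := 0) (by rw [norm_zero]; positivity) (by rw [mv_zero, hP]), mv_zero]

theorem StepAt.tr_smul (H : SmoothFamily e P q) (hδ : 0 < δ) (h : StepAt e P q δ s t z) {c : ℂ}
    (hc : c ≠ 0) : tr e P q δ s t (c • z) = c • tr e P q δ s t z := by
  have h1 := h.disp_spec hδ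
  rw [tr, (h.smul H hc).eq_disp hδ (l := c ^ (e + 1) * disp e P q δ s t z), H.mv_smul s z _ hc, tr]
  · rw [norm_mul, norm_pow, norm_smul, mul_pow, mul_left_comm]
    exact mul_le_mul_of_nonneg_left h1.1 (by positivity)
  · rw [H.mv_smul s z _ hc, H.hom, h1.2, mul_zero]

/-- The domain of the transport. -/
def trDom (e : ℕ) (P : ℝ × (ι → ℂ) → ℂ) (q : ι → ℝ × (ι → ℂ) × (ι → ℂ) → ℂ) (δ : ℝ) :
    Set (ℝ × ℝ × (ι → ℂ)) :=
  {x | x.2.2 ≠ 0 ∧ P (x.1, x.2.2) = 0 ∧ StepAt e P q δ x.1 x.2.1 x.2.2}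

theorem SmoothFamily.continuousOn_tr (H : SmoothFamily e P q) (hδ : 0 < δ) :
    ContinuousOn (fun x : ℝ × ℝ × (ι → ℂ) => tr e P q δ x.1 x.2.1 x.2.2) (trDom e P q δ) := by
  have hmv : ∀ x ∈ trDom e P q δ, ∀ l : ℂ, ContinuousAt (fun y : (ℝ × ℝ × (ι → ℂ)) × ℂ =>
      mv q y.1.1 y.1.2.2 y.2) (x, l) := fun x hx l =>
    H.continuousAt_mv (by fun_prop) (by fun_prop) (by fun_prop) hx.1 hx.2.1
  have hd : ContinuousOn (fun x : ℝ × ℝ × (ι → ℂ) => disp e P q δ x.1 x.2.1 x.2.2)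
      (trDom e P q δ) := by
    rintro ⟨s, t, z⟩ hx
    obtain ⟨h0, hP, hS⟩ := hx
    simp only at h0 hP hS
    set l := disp e P q δ s t z with hl
    have c1 : ContinuousAt (fun y : ℝ × ℝ × (ι → ℂ) => 2 * ‖P (y.2.1, mv q y.1 y.2.2 l)‖)
        (s, t, z) := by
      have h1 : ContinuousAt (fun y : ℝ × ℝ × (ι → ℂ) => mv q y.1 y.2.2 l) (s, t, z) :=
        H.continuousAt_mv (by fun_prop) (by fun_prop) (by fun_prop) h0 hP
      have h2 : ContinuousAt (fun y : ℝ × ℝ × (ι → ℂ) => P (y.2.1, mv q y.1 y.2.2 l)) (s, t, z) :=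
        H.cont.continuousAt.comp ((by fun_prop : ContinuousAt _ _).prodMk h1)
      exact continuousAt_const.mul h2.norm
    have c2 : Continuous fun y : ℝ × ℝ × (ι → ℂ) => δ * ‖y.2.2‖ ^ (e + 1) := by fun_prop
    have c3 : ∀ᶠ y : ℝ × ℝ × (ι → ℂ) in 𝓝 (s, t, z), ‖l‖ < δ * ‖y.2.2‖ ^ (e + 1) :=
      continuousAt_const.eventually_lt c2.continuousAt (hS.disp_lt hδ h0)
    rw [ContinuousWithinAt, tendsto_iff_norm_sub_tendsto_zero]
    have c4 : Filter.Tendsto (fun y : ℝ × ℝ × (ι → ℂ) => 2 * ‖P (y.2.1, mv q y.1 y.2.2 l)‖)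
        (𝓝[trDom e P q δ] (s, t, z)) (𝓝 0) := by
      have := c1.continuousWithinAt (s := trDom e P q δ)
      rw [ContinuousWithinAt] at this
      simpa only [(hS.disp_spec hδ).2, hl, norm_zero, mul_zero] using this
    refine squeeze_zero' (Filter.Eventually.of_forall fun _ => norm_nonneg _) ?_ c4
    filter_upwards [self_mem_nhdsWithin, mem_nhdsWithin_of_mem_nhds c3] with y hy hly
    have h5 := hy.2.2.norm_sub_le (hy.2.2.disp_spec hδ).1 hly.le
    rwa [(hy.2.2.disp_spec hδ).2, zero_sub, norm_neg] at h5
  intro x hx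
  exact ContinuousAt.comp_continuousWithinAt
    (f := fun x : ℝ × ℝ × (ι → ℂ) => (x, disp e P q δ x.1 x.2.1 x.2.2))
    (hmv x hx _) (continuousWithinAt_id.prodMk (hd x hx))

/-- The zero sets of a family, without the origin. -/
def Xt (P : ℝ × (ι → ℂ) → ℂ) (t : ℝ) : Set (ι → ℂ) := {v | v ≠ 0 ∧ P (t, v) = 0}

theorem SmoothFamily.cone_Xt (H : SmoothFamily e P q) (t : ℝ) : Cone (Xt P t) where
  ne v hv := hv.1
  smul v hv c hc := ⟨smul_ne_zero hc hv.1, by rw [H.hom, hv.2, mul_zero]⟩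

theorem StepAt.tr_mem (hδ : 0 < δ) (h : StepAt e P q δ s t z) : tr e P q δ s t z ∈ Xt P t :=
  ⟨h.ne _ (h.disp_spec hδ).1, (h.disp_spec hδ).2⟩

variable [Nonempty ι]

theorem SmoothFamily.hretract (H : SmoothFamily e P q) (hδ : 0 < δ)
    (hS : ∀ s ∈ Set.Icc (0 : ℝ) 1, ∀ t : ℝ, |t - s| ≤ ε → ∀ z, z ≠ 0 → P (s, z) = 0 →
      StepAt e P q δ s t z) (hs : s ∈ Set.Icc (0 : ℝ) 1) (ht : t ∈ Set.Icc (0 : ℝ) 1)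
    (hst : |t - s| ≤ ε) : HRetract (PS (Xt P s)) ∅ (PS (Xt P t)) ∅ (projMap (tr e P q δ s t))
      (projMap (tr e P q δ t s)) (projHtpy fun y => tr e P q δ (s + y.1 * (t - s)) s
        (tr e P q δ s (s + y.1 * (t - s)) y.2)) := by
  have hts : |s - t| ≤ ε := by rwa [abs_sub_comm]
  have hu : ∀ r ∈ Set.Icc (0 : ℝ) 1, s + r * (t - s) ∈ Set.Icc (0 : ℝ) 1 := fun r hr => by
    have := (convex_Icc (0 : ℝ) 1).add_smul_sub_mem hs ht hr
    simpa using this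
  have hus : ∀ r ∈ Set.Icc (0 : ℝ) 1, |s + r * (t - s) - s| ≤ ε := fun r hr => by
    rw [add_sub_cancel_left, abs_mul, abs_of_nonneg hr.1]
    exact (mul_le_of_le_one_left (abs_nonneg _) hr.2).trans hst
  have S1 : ∀ r ∈ Set.Icc (0 : ℝ) 1, ∀ v ∈ Xt P s, StepAt e P q δ s (s + r * (t - s)) v :=
    fun r hr v hv => hS s hs _ (hus r hr) v hv.1 hv.2
  have T1 := fun r hr v hv => (S1 r hr v hv).tr_mem hδ
  have S2 : ∀ r ∈ Set.Icc (0 : ℝ) 1, ∀ v ∈ Xt P (s + r * (t - s)),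
      StepAt e P q δ (s + r * (t - s)) s v := fun r hr v hv =>
    hS _ (hu r hr) _ (by rw [abs_sub_comm]; exact hus r hr) v hv.1 hv.2
  have T2 := fun r hr v hv => (S2 r hr v hv).tr_mem hδ
  have Sf : ∀ v ∈ Xt P s, StepAt e P q δ s t v := fun v hv => hS s hs t hst v hv.1 hv.2
  have Sg : ∀ v ∈ Xt P t, StepAt e P q δ t s v := fun v hv => hS t ht s hts v hv.1 hv.2
  have hc := H.continuousOn_tr hδ
  refine
    { subset := Set.empty_subset _
      subset' := Set.empty_subset _
      cont_f := continuousOn_projMap (H.cone_Xt s) (fun v hv c hc => (Sf v hv).tr_smul H hδ hc)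
        (hc.comp (f := fun v => (s, t, v)) (by fun_prop) fun v hv => ⟨hv.1, hv.2, Sf v hv⟩)
        fun v hv => ((Sf v hv).tr_mem hδ).1
      fA := fun p hp => (H.cone_Xt t).toP_mem ((Sf _ hp).tr_mem hδ)
      fB := Set.mapsTo_empty _ _
      cont_g := continuousOn_projMap (H.cone_Xt t) (fun v hv c hc => (Sg v hv).tr_smul H hδ hc)
        (hc.comp (f := fun v => (t, s, v)) (by fun_prop) fun v hv => ⟨hv.1, hv.2, Sg v hv⟩)
        fun v hv => ((Sg v hv).tr_mem hδ).1
      gA := fun p hp => (H.cone_Xt s).toP_mem ((Sg _ hp).tr_mem hδ)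
      gB := Set.mapsTo_empty _ _
      cont_h := continuousOn_projHtpy (H.cone_Xt s) (fun r hr v hv c hc => ?_) ?_
        fun r hr v hv => (T2 r hr _ (T1 r hr v hv)).1
      hA := fun r hr p hp => (H.cone_Xt s).toP_mem (T2 r hr _ (T1 r hr _ hp))
      hB := fun _ _ _ h => h.elim
      h0 := fun p hp => ?_
      h1 := fun p hp => ?_ }
  · dsimp only
    rw [(S1 r hr v hv).tr_smul H hδ hc, (S2 r hr _ (T1 r hr v hv)).tr_smul H hδ hc]
  · have c1 : ContinuousOn (fun y : ℝ × (ι → ℂ) => tr e P q δ s (s + y.1 * (t - s)) y.2)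
        (Set.Icc 0 1 ×ˢ Xt P s) :=
      hc.comp (f := fun y : ℝ × (ι → ℂ) => (s, s + y.1 * (t - s), y.2)) (by fun_prop)
        fun y hy => ⟨hy.2.1, hy.2.2, S1 y.1 hy.1 y.2 hy.2⟩
    refine hc.comp (f := fun y : ℝ × (ι → ℂ) => (s + y.1 * (t - s), s,
      tr e P q δ s (s + y.1 * (t - s)) y.2)) ((by fun_prop : ContinuousOn _ _).prodMk
        (continuousOn_const.prodMk c1)) fun y hy => ?_
    have := T1 y.1 hy.1 y.2 hy.2
    exact ⟨this.1, this.2, S2 y.1 hy.1 _ this⟩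
  · have h1 := S1 0 ⟨le_rfl, zero_le_one⟩ _ hp
    rw [zero_mul, add_zero] at h1
    simp only [projHtpy, zero_mul, add_zero]
    rw [h1.tr_self hδ hp.2, h1.tr_self hδ hp.2, toP_rep]
  · rw [show projMap (tr e P q δ s t) p = toP (tr e P q δ s t p.rep) from rfl,
      projMap_toP (H.cone_Xt t) (fun v hv c hc => (Sg v hv).tr_smul H hδ hc)
        ((Sf _ hp).tr_mem hδ)]
    simp only [projHtpy, one_mul, add_sub_cancel]

theorem SmoothFamily.pj (H : SmoothFamily e P q) {n : ℕ} (h : Pj n (PS (Xt P 1)) ∅) :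
    Pj n (PS (Xt P 0)) ∅ := by
  obtain ⟨δ, hδ, ε, hε, hS⟩ := H.exists_stepAt
  obtain ⟨K, hK⟩ := exists_nat_one_div_lt hε
  have hK0 : (0 : ℝ) < K + 1 := by positivity
  have key : ∀ k : ℕ, k ≤ K + 1 → Pj n (PS (Xt P (1 - k / (K + 1)))) ∅ := by
    intro k
    induction k with
    | zero => simpa using h
    | succ k ih =>
      intro hk
      have hk' : ((k : ℝ) + 1) / (K + 1) ≤ 1 := by
        rw [div_le_one hK0]
        exact_mod_cast hk
      have h1 : (0 : ℝ) ≤ k / (K + 1) := by positivity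
      have h2 : ((k : ℝ) + 1) / (K + 1) = k / (K + 1) + 1 / (K + 1) := add_div _ _ _
      have h3 : (0 : ℝ) < 1 / (K + 1) := by positivity
      refine (H.hretract hδ hS (s := 1 - (k + 1 : ℕ) / (K + 1)) (t := 1 - k / (K + 1)) ?_ ?_ ?_).pj
        (ih (by omega))
      · push_cast
        constructor <;> linarith
      · constructor <;> linarith
      · push_cast
        rw [h2, abs_le]
        constructor <;> linarith
  have := key (K + 1) le_rfl
  push_cast at this
  rwa [div_self hK0.ne', sub_self] at this

end transport

end

section

open Finsupp Cvx Topology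

section pencil

variable {e : ℕ}

theorem eval_homogeneousComponent_mul {ι : Type} {h : MvPolynomial ι ℂ} (hh : h.IsHomogeneous e) {z : ι → ℂ}
    (hz : MvPolynomial.eval z h = 0) (D : ℕ) (a : MvPolynomial ι ℂ) :
    MvPolynomial.eval z (homogeneousComponent D (a * h)) = 0 := by
  induction a using MvPolynomial.induction_on' with
  | monomial u c =>
    have h1 : (MvPolynomial.monomial u c * h).IsHomogeneous (u.degree + e) :=
      (isHomogeneous_monomial c rfl).mul hh
    rw [homogeneousComponent_of_mem ((mem_homogeneousSubmodule _ _).2 h1)]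
    split_ifs
    · rw [map_mul, hz, mul_zero]
    · exact map_zero _
  | add p q hp hq => rw [add_mul, map_add, map_add, hp, hq, add_zero]

variable {ι : Type} [Fintype ι]

/-- The map sending coefficients to the component of degree `D` of a linear combination. -/
noncomputable def combComp (D : ℕ) (h : ι → MvPolynomial ι ℂ) :
    (ι → MvPolynomial ι ℂ) →ₗ[ℂ] homogeneousSubmodule ι ℂ D :=
  ((homogeneousComponent D).codRestrict _ fun p => homogeneousComponent_mem D p) ∘ₗ
    ∑ j, LinearMap.mulRight ℂ (h j) ∘ₗ LinearMap.proj j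

theorem combComp_apply (D : ℕ) (h a : ι → MvPolynomial ι ℂ) :
    (combComp D h a : MvPolynomial ι ℂ) = homogeneousComponent D (∑ j, a j * h j) := by
  simp [combComp]

theorem eval_combComp {h : ι → MvPolynomial ι ℂ} (hh : ∀ j, (h j).IsHomogeneous e) {z : ι → ℂ}
    (hz : ∀ j, MvPolynomial.eval z (h j) = 0) (D : ℕ) (a : ι → MvPolynomial ι ℂ) :
    MvPolynomial.eval z (combComp D h a : MvPolynomial ι ℂ) = 0 := by
  rw [combComp_apply, map_sum, map_sum]
  exact Finset.sum_eq_zero fun j _ => eval_homogeneousComponent_mul (hh j) (hz j) D (a j)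

/-- Homogeneous polynomials without common zeros generate a power of the irrelevant ideal. -/
theorem exists_combComp_surjective {h : ι → MvPolynomial ι ℂ}
    (h0 : ∀ z : ι → ℂ, (∀ j, MvPolynomial.eval z (h j) = 0) → z = 0) :
    ∃ D, Function.Surjective (combComp D h) := by
  set I := Ideal.span (Set.range h) with hI
  have h1 : idealOfVars ι ℂ ≤ I.radical := by
    rw [← MvPolynomial.vanishingIdeal_zeroLocus_eq_radical (K := ℂ), idealOfVars, Ideal.span_le]
    rintro _ ⟨k, rfl⟩ x hx
    have : x = 0 := h0 x fun j => by
      simpa [MvPolynomial.coe_aeval_eq_eval] using hx (h j) (Ideal.subset_span ⟨j, rfl⟩)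
    simp [this]
  obtain ⟨D, hD⟩ := Ideal.exists_radical_pow_le_of_fg I (IsNoetherian.noetherian _)
  refine ⟨D, fun ⟨p, hp⟩ => ?_⟩
  have hpI : p ∈ I := by
    refine hD (Ideal.pow_right_mono h1 D ?_)
    rw [mem_pow_idealOfVars_iff]
    intro x hx
    have := hp (MvPolynomial.mem_support_iff.1 hx)
    rw [degree_eq_weight_one]
    exact this.ge
  obtain ⟨a, ha⟩ := (Submodule.mem_span_range_iff_exists_fun _).1 hpI
  refine ⟨a, Subtype.ext ?_⟩
  rw [combComp_apply]
  simp only [smul_eq_mul] at ha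
  rw [ha, homogeneousComponent_of_mem hp, if_pos rfl]

theorem finite_bad {h h' : ι → MvPolynomial ι ℂ} (hh : ∀ j, (h j).IsHomogeneous e)
    (hh' : ∀ j, (h' j).IsHomogeneous e)
    (h0 : ∀ z : ι → ℂ, (∀ j, MvPolynomial.eval z (h j) = 0) → z = 0) :
    {τ : ℂ | ∃ z : ι → ℂ, z ≠ 0 ∧ ∀ j, MvPolynomial.eval z (h j + MvPolynomial.C τ * h' j) = 0}.Finite := by
  obtain ⟨D, hD⟩ := exists_combComp_surjective h0
  have : Module.Finite ℂ (homogeneousSubmodule ι ℂ D) :=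
    Module.Finite.iff_fg.2 (homogeneousSubmodule_fg ι ℂ D)
  obtain ⟨R, hR⟩ := (combComp D h).exists_rightInverse_of_surjective (LinearMap.range_eq_top.2 hD)
  let N : Module.End ℂ (homogeneousSubmodule ι ℂ D) := combComp D h' ∘ₗ R
  refine ((Module.End.finite_hasEigenvalue N).preimage
    (f := fun τ : ℂ => -τ⁻¹) (neg_injective.comp inv_injective).injOn).subset ?_
  rintro τ ⟨z, hz, hτ⟩
  have hc : ∀ a, combComp D (fun j => h j + MvPolynomial.C τ * h' j) a =
      combComp D h a + τ • combComp D h' a := fun a => Subtype.ext (by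
    rw [Submodule.coe_add, Submodule.coe_smul]
    simp only [combComp_apply]
    rw [← map_smul, ← map_add, Finset.smul_sum, ← Finset.sum_add_distrib]
    simp only [smul_eq_C_mul]
    congr 1
    exact Finset.sum_congr rfl fun j _ => by ring)
  let G : Module.End ℂ (homogeneousSubmodule ι ℂ D) := LinearMap.id + τ • N
  have hG : ∀ v, MvPolynomial.eval z (G v : MvPolynomial ι ℂ) = 0 := fun v => by
    have e1 : G v = combComp D (fun j => h j + MvPolynomial.C τ * h' j) (R v) := by
      rw [hc, ← LinearMap.comp_apply, hR]
      rfl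
    rw [e1]
    refine eval_combComp (e := e) (fun j => (hh j).add ?_) hτ D _
    simpa using (isHomogeneous_C ι τ).mul (hh' j)
  have hns : ¬ Function.Surjective G := fun hs => by
    obtain ⟨k, hk⟩ : ∃ k, z k ≠ 0 := Function.ne_iff.1 hz
    have hX : (X k ^ D : MvPolynomial ι ℂ).IsHomogeneous D := by
      simpa using (isHomogeneous_X ℂ k).pow D
    obtain ⟨v, hv⟩ := hs ⟨X k ^ D, hX⟩
    have := hG v
    rw [hv] at this
    simp only [map_pow, eval_X] at this
    exact pow_ne_zero D hk this
  rw [← LinearMap.injective_iff_surjective, ← LinearMap.ker_eq_bot, LinearMap.ker_eq_bot'] at hns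
  push Not at hns
  obtain ⟨v, hv, hv0⟩ := hns
  have hv' : v + τ • N v = 0 := hv
  have hτ0 : τ ≠ 0 := by
    rintro rfl
    rw [zero_smul, add_zero] at hv'
    exact hv0 hv'
  refine Module.End.hasEigenvalue_of_hasEigenvector (x := v)
    ⟨Module.End.mem_eigenspace_iff.2 ?_, hv0⟩
  have h2 : τ • N v = -v := by rw [eq_neg_iff_add_eq_zero, add_comm]; exact hv'
  have h3 := congrArg (fun w => τ⁻¹ • w) h2
  simp only [smul_smul, inv_mul_cancel₀ hτ0, one_smul] at h3
  rw [h3, smul_neg, neg_smul]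

end pencil

end

section

open Finsupp Cvx Topology

section hypersurface

variable {e N : ℕ}

/-- The homology of a smooth hypersurface is projective if this holds for one smooth hypersurface
of the same degree. -/
theorem pj_of_smooth {f g : MvPolynomial (Fin (N + 1)) ℂ} (hf : f.IsHomogeneous (e + 1))
    (hg : g.IsHomogeneous (e + 1))
    (hf0 : ∀ z, (∀ j, MvPolynomial.eval z (pderiv j f) = 0) → z = 0)
    (hg0 : ∀ z, (∀ j, MvPolynomial.eval z (pderiv j g) = 0) → z = 0) {n : ℕ}
    (h : Pj n (PS (Xf g)) ∅) : Pj n (PS (Xf f)) ∅ := by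
  have hgf : (g - f).IsHomogeneous (e + 1) := hg.sub hf
  have hb := finite_bad (h := fun j => pderiv j f) (h' := fun j => pderiv j (g - f)) (e := e)
    (fun j => hf.pderiv) (fun j => hgf.pderiv) hf0
  set Bad := {τ : ℂ | ∃ z : Fin (N + 1) → ℂ, z ≠ 0 ∧
    ∀ j, MvPolynomial.eval z (pderiv j f + MvPolynomial.C τ * pderiv j (g - f)) = 0} with hBad
  have h0 : (0 : ℂ) ∈ Badᶜ := fun ⟨z, hz, hj⟩ => hz (hf0 z fun j => by simpa using hj j)
  have h1 : (1 : ℂ) ∈ Badᶜ := fun ⟨z, hz, hj⟩ => hz (hg0 z fun j => by simpa using hj j)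
  have hJ := (hb.countable.isPathConnected_compl_of_one_lt_rank
    (by rw [Complex.rank_real_complex]; exact Nat.one_lt_ofNat)).joinedIn 0 h0 1 h1
  let γ : ℝ → ℂ := hJ.somePath.extend
  have hγ : Continuous γ := hJ.somePath.continuous_extend
  have hγB : ∀ t, γ t ∉ Bad := fun t => hJ.somePath_mem _
  obtain ⟨q, q1, q2, q3⟩ := exists_divided_difference f
  obtain ⟨r, r1, r2, r3⟩ := exists_divided_difference (g - f)
  have H : SmoothFamily e
      (fun x => MvPolynomial.eval x.2 f + γ x.1 * MvPolynomial.eval x.2 (g - f))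
      (fun i x => q i x.2 + γ x.1 * r i x.2) :=
    { cont := by
        have := MvPolynomial.continuous_eval f
        have := MvPolynomial.continuous_eval (g - f)
        fun_prop
      contq := fun i => by
        have := q1 i
        have := r1 i
        fun_prop
      diff := fun t x y => by
        simp only [mul_add, Finset.sum_add_distrib, ← q2]
        simp only [mul_left_comm _ (γ t), ← Finset.mul_sum, ← r2]
        ring
      hom := fun t c z => by
        rw [eval_smul hf, eval_smul hgf]
        ring
      homq := fun i t c z => by
        have e1 : (pderiv i f).IsHomogeneous e := hf.pderiv
        have e2 : (pderiv i (g - f)).IsHomogeneous e := hgf.pderiv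
        simp only [q3, r3]
        rw [eval_smul e1, eval_smul e2]
        ring
      ndg := fun t z hz _ => by
        by_contra! hc
        refine hγB t ⟨z, hz, fun j => ?_⟩
        have := hc j
        simp only [q3, r3] at this
        rw [map_add, map_mul, MvPolynomial.eval_C, this] }
  have e0 : Xt (fun x : ℝ × (Fin (N + 1) → ℂ) => MvPolynomial.eval x.2 f +
      γ x.1 * MvPolynomial.eval x.2 (g - f)) 0 = Xf f := by
    ext z
    simp [Xt, Xf, γ]
  have e1 : Xt (fun x : ℝ × (Fin (N + 1) → ℂ) => MvPolynomial.eval x.2 f +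
      γ x.1 * MvPolynomial.eval x.2 (g - f)) 1 = Xf g := by
    ext z
    simp [Xt, Xf, γ]
  have := H.pj (n := n)
  rw [e0, e1] at this
  exact this h

theorem eq_zero_of_pderiv_fermat (z : Fin (N + 1) → ℂ)
    (h : ∀ j, MvPolynomial.eval z (pderiv j (fermat (e + 1) N)) = 0) : z = 0 := by
  ext j
  have h1 : pderiv j (fermat (e + 1) N) =
      MvPolynomial.C (e + 1 : ℂ) * (X j ^ e : MvPolynomial (Fin (N + 1)) ℂ) := by
    rw [fermat, map_sum, Finset.sum_eq_single j]
    · simp [Derivation.leibniz_pow]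
    · intro i _ hij
      simp [Derivation.leibniz_pow, pderiv_X_of_ne hij]
    · simp
  have h2 := h j
  rw [h1, map_mul, MvPolynomial.eval_C, map_pow, eval_X, mul_eq_zero] at h2
  have h3 : (e + 1 : ℂ) ≠ 0 := by exact_mod_cast Nat.succ_ne_zero e
  exact eq_zero_of_pow_eq_zero (h2.resolve_left h3)

/-- The homology of a smooth hypersurface is projective. -/
theorem pj_hypersurface {d m : ℕ} {f : MvPolynomial (Fin (m + 2)) ℂ} (hf : f.IsHomogeneous d)
    (hd : 1 ≤ d) (hs : IsSmoothHypersurface f) (n : ℕ) : Pj n (PS (Xf f)) ∅ := by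
  obtain ⟨e, rfl⟩ := Nat.exists_eq_add_of_le' hd
  refine pj_of_smooth hf (fermat_isHomogeneous (e + 1) (m + 1)) (fun z hz => ?_)
    eq_zero_of_pderiv_fermat (pj_fermat (Nat.succ_ne_zero e) m n)
  by_contra h0
  have h1 := congrArg (MvPolynomial.eval z) hf.sum_X_mul_pderiv
  simp only [map_sum, map_mul, hz, mul_zero, Finset.sum_const_zero, map_nsmul] at h1
  obtain ⟨i, hi⟩ := hs z h0 ((smul_eq_zero.1 h1.symm).resolve_left (Nat.succ_ne_zero e))
  exact hi (hz i)

theorem PS_Xf (f : MvPolynomial (Fin (N + 1)) ℂ) : PS (Xf f) = projHypersurface f :=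
  Set.ext fun p => ⟨fun h => h.2, fun h => ⟨p.rep_nonzero, h⟩⟩

end hypersurface

end

section

open Finsupp Cvx Topology

theorem comb_vertex_comp {k n : ℕ} (g : Fin k → Fin n) (t : Dl k) :
    comb t (fun i => (stdSimplex.vertex (g i) : Dl n)) = stdSimplex.map g t := by
  apply Subtype.ext
  change ∑ j, t j • ((stdSimplex.vertex (g j) : Dl _) : Fin n → ℝ) = _
  funext i
  simp [Finset.sum_apply, Pi.single_apply, stdSimplex.map, FunOnFinite.linearMap_apply_apply]
  rw [Finset.sum_filter]
  exact Finset.sum_congr rfl fun x _ => by simp only [eq_comm]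

theorem map_sum_smul_apply {ι M N P R : Type} [CommRing R] [AddCommGroup M] [AddCommGroup N]
    [AddCommGroup P] [Module R M] [Module R N] [Module R P]
    (s : Finset ι) (c : ι → R) (f : ι → M →ₗ[R] N) (g : N →ₗ[R] P) (x : M) :
    g ((∑ i ∈ s, c i • f i) x) = ∑ i ∈ s, c i • g (f i x) := by
  simp [LinearMap.sum_apply]

section bridge
variable {E : Type} [TopologicalSpace E] {A : Set E}

/-- The singular simplices of a subspace of `E`, as singular simplices of `E`. -/
noncomputable def toSing (j : ℕ) (s : (TopCat.toSSet.obj (TopCat.of A)).obj (.op (.mk j))) : Sing E :=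
  ⟨j + 1, fun t => (TopCat.toSSetObjEquiv _ _ s t).1⟩

theorem toSing_injective (j : ℕ) : Function.Injective (toSing (A := A) j) := fun s t h => by
  apply (TopCat.toSSetObjEquiv _ _).injective
  ext x
  simp only [toSing, Sigma.mk.injEq, heq_eq_eq, true_and] at h
  exact congrFun h x

theorem range_toSing (j : ℕ) : Set.range (toSing (A := A) j) = sg A ∩ {s | s.1 = j + 1} := by
  ext s
  constructor
  · rintro ⟨s, rfl⟩
    exact ⟨⟨continuous_subtype_val.comp (ContinuousMap.continuous _), fun t => Subtype.property _⟩, rfl⟩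
  · rintro ⟨⟨h1, h2⟩, h3⟩
    obtain ⟨k, σ⟩ := s
    obtain rfl : k = j + 1 := h3
    refine ⟨(TopCat.toSSetObjEquiv (TopCat.of A) (.op (.mk j))).symm
      ⟨fun t => ⟨σ t, h2 t⟩, h1.subtype_mk _⟩, ?_⟩
    simp only [toSing, Equiv.apply_symm_apply]
    rfl

theorem toSing_face (j : ℕ) (i : Fin (j + 2))
    (s : (TopCat.toSSet.obj (TopCat.of A)).obj (.op (.mk (j + 1)))) :
    toSing j ((TopCat.toSSet.obj (TopCat.of A)).δ i s) =
      ⟨j + 1, fun t => (toSing (j + 1) s).2 (stdSimplex.map i.succAbove t)⟩ := by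
  rfl

/-- The chain groups of a subspace of `E`, as chains in `E`. -/
noncomputable def toCh (j : ℕ) : (singularChains.obj (TopCat.of A)).X j →ₗ[ℤ] Ch (Sing E) :=
  lmapDomain ℤ ℤ (toSing (A := A) j)

theorem toCh_injective (j : ℕ) : Function.Injective (toCh (A := A) j) :=
  Finsupp.mapDomain_injective (toSing_injective j)

theorem range_toCh (j : ℕ) : LinearMap.range (toCh (A := A) j) = C (sg A) ⊓ Dg E (j + 1) := by
  rw [← Finsupp.supported_inter, ← range_toSing, ← Set.image_univ, ← Finsupp.lmapDomain_supported,
    Finsupp.supported_univ, LinearMap.range_eq_map]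
  rfl

theorem toCh_d (j : ℕ) (x : (singularChains.obj (TopCat.of A)).X (j + 1)) :
    toCh j ((singularChains.obj (TopCat.of A)).d (j + 1) j x) = SimplexChains.d (toCh (j + 1) x) := by
  have : toCh j ∘ₗ ((singularChains.obj (TopCat.of A)).d (j + 1) j).hom =
      SimplexChains.d ∘ₗ toCh (j + 1) := by
    refine Finsupp.lhom_ext' fun s => LinearMap.ext_ring ?_
    have hR : SimplexChains.d (single (toSing (j + 1) s) (1 : ℤ)) =
        ∑ i : Fin (j + 2), (-1 : ℤ) ^ (i : ℕ) • single (toSing j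
          ((TopCat.toSSet.obj (TopCat.of A)).δ i s)) 1 := by
      rw [d_single, bd_single]
      simp only [verts, toSing_face]
      refine (map_sum (real (toSing (j + 1) s).2) _ _).trans ?_
      refine Finset.sum_congr rfl fun i _ => ?_
      rw [map_smul, real_single]
      congr 2
      exact congrArg (Sigma.mk (j + 1)) (funext fun t => congrArg (toSing (j + 1) s).2
        (comb_vertex_comp i.succAbove t))
    have hL : (toCh j) ((∑ i : Fin (j + 2), (-1 : ℤ) ^ (i : ℕ) •
        ((((SimplicialObject.whiskering Type (ModuleCat ℤ)).obj (ModuleCat.free ℤ)).obj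
          (TopCat.toSSet.obj (TopCat.of A))).δ i).hom) (single s (1 : ℤ) :
            (TopCat.toSSet.obj (TopCat.of A)).obj (.op (.mk (j + 1))) →₀ ℤ)) =
        ∑ i : Fin (j + 2), (-1 : ℤ) ^ (i : ℕ) • single (toSing (A := A) j
          ((TopCat.toSSet.obj (TopCat.of A)).δ i s)) 1 := by
      refine (map_sum_smul_apply _ _ _ _ _).trans (Finset.sum_congr rfl fun i _ => ?_)
      congr 1
      change mapDomain (toSing j) (mapDomain _ (single s (1 : ℤ))) = _
      rw [mapDomain_single, mapDomain_single]
      rfl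
    change toCh j (((singularChains.obj (TopCat.of A)).d (j + 1) j).hom _) =
      SimplexChains.d (mapDomain _ (single s 1))
    rw [mapDomain_single, hR, ← hL]
    congr 1
    have : ((singularChains.obj (TopCat.of A)).d (j + 1) j).hom =
        ∑ i : Fin (j + 2), (-1 : ℤ) ^ (i : ℕ) •
        ((((SimplicialObject.whiskering Type (ModuleCat ℤ)).obj (ModuleCat.free ℤ)).obj
          (TopCat.toSSet.obj (TopCat.of A))).δ i).hom := by
      simp only [singularChains, Functor.comp_obj,
        AlgebraicTopology.alternatingFaceMapComplex_obj_d,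
        AlgebraicTopology.AlternatingFaceMapComplex.objD, ModuleCat.hom_sum, ModuleCat.hom_smul]
      rfl
    exact LinearMap.congr_fun this _
  exact LinearMap.congr_fun this x

end bridge

end

section

open Finsupp Cvx Topology

section retraction
variable {E : Type} [TopologicalSpace E] {A : Set E}

theorem Pr.bot_of_projective {M : Type} [AddCommGroup M] [Module.Projective ℤ M]
    (Z : Submodule ℤ M) : Pr Z ⊥ := by
  refine projective_of_injective (P := M) (Submodule.liftQ _ Z.subtype fun x hx => hx) ?_
  rw [← LinearMap.ker_eq_bot, LinearMap.ker_eq_bot']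
  intro z hz
  obtain ⟨x, hx, rfl⟩ := subquot_surj z
  exact (subquot_eq_zero hx).2 hz

theorem eq_zero_of_mem_empty {j : ℕ} {x : Ch (Sing E)} (hx : x ∈ C (sg (∅ : Set E)))
    (hj : x ∈ Dg E (j + 1)) : x = 0 := by
  have h : x ∈ C (sg (∅ : Set E) ∩ {s | s.1 = j + 1}) := by
    rw [C, Finsupp.supported_inter]; exact ⟨hx, hj⟩
  have he : sg (∅ : Set E) ∩ {s | s.1 = j + 1} = ∅ := by
    ext s
    refine ⟨fun ⟨hs, h⟩ => ?_, fun h => h.elim⟩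
    obtain ⟨k, σ⟩ := s
    obtain rfl : k = j + 1 := h
    exact hs.2 (stdSimplex.vertex 0)
  rw [he] at h
  simpa using h

theorem mem_empty_of_Dg_zero {x : Ch (Sing E)} (hx : x ∈ Dg E 0) : x ∈ C (sg (∅ : Set E)) := by
  refine C_mono (fun s hs => ?_) hx
  obtain ⟨k, σ⟩ := s
  obtain rfl : k = 0 := hs
  exact ⟨continuous_of_discreteTopology, fun t => isEmptyElim t⟩

/-- If the homology of `A` is projective, then so is the cokernel of the boundary map. -/
theorem Pj.coker {j : ℕ} (h : Pj (j + 1) A ∅) :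
    Pr (C (sg A) ⊓ Dg E (j + 1)) ((C (sg A) ⊓ Dg E (j + 2)).map SimplexChains.d) := by
  have hZ : Pr (Z (j + 1) A (∅ : Set E)) ((C (sg A) ⊓ Dg E (j + 2)).map SimplexChains.d) := by
    refine Pr.of_inj LinearMap.id (fun z hz => hz) ?_ ?_ h
    · rintro _ _ ⟨y, hy, rfl⟩
      exact mem_Bd.2 ⟨y, hy.1, by simp⟩
    · intro z hz hB
      obtain ⟨y, h1, h2, h3⟩ := exists_of_mem_Bd hB (mem_Z.1 hz).2.1
      refine ⟨y, ⟨h1, h2⟩, ?_⟩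
      exact (sub_eq_zero.1 (eq_zero_of_mem_empty h3
        (sub_mem (mem_Z.1 hz).2.1 (d_mem_Dg h2)))).symm
  cases j with
  | zero =>
    refine Pr.of_inj LinearMap.id (fun z hz => ?_) (fun _ _ h => h) (fun _ _ h => h) hZ
    exact mem_Z.2 ⟨hz.1, hz.2, mem_empty_of_Dg_zero (d_mem_Dg hz.2)⟩
  | succ j =>
    refine Pr.of_ker SimplexChains.d (fun _ _ => Submodule.mem_top) ?_
      (Pr.bot_of_projective ⊤) ?_
    · rintro _ _ ⟨y, hy, rfl⟩
      exact d_d y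
    · refine Pr.of_inj LinearMap.id (fun z hz => ?_) (fun _ _ h => h) (fun _ _ h => h) hZ
      refine mem_Z.2 ⟨hz.1.1, hz.1.2, ?_⟩
      have : SimplexChains.d z = 0 := hz.2
      rw [LinearMap.id_apply, this]
      exact zero_mem _

theorem Pr.exists_retraction {M : Type} [AddCommGroup M] {Z B : Submodule ℤ M} (h : Pr Z B) :
    ∃ r : Z →ₗ[ℤ] Z, (∀ x, (r x : M) ∈ B) ∧ ∀ x : Z, (x : M) ∈ B → r x = x := by
  have : Module.Projective ℤ (Z ⧸ B.submoduleOf Z) := h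
  obtain ⟨s, hs⟩ := Module.projective_lifting_property (B.submoduleOf Z).mkQ LinearMap.id
    (B.submoduleOf Z).mkQ_surjective
  refine ⟨LinearMap.id - s ∘ₗ (B.submoduleOf Z).mkQ, fun x => ?_, fun x hx => ?_⟩
  · refine (subquot_eq_zero (Subtype.property _)).1 ?_
    have := LinearMap.congr_fun hs ((B.submoduleOf Z).mkQ x)
    simp only [LinearMap.comp_apply, LinearMap.id_apply] at this
    change (B.submoduleOf Z).mkQ (x - s ((B.submoduleOf Z).mkQ x)) = 0
    rw [map_sub, this, sub_self]
  · have : (B.submoduleOf Z).mkQ x = 0 := (subquot_eq_zero x.2).2 hx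
    simp only [LinearMap.sub_apply, LinearMap.comp_apply, LinearMap.id_apply, this, map_zero,
      sub_zero]

/-- If the homology of `A` is projective, then the boundaries form a direct summand. -/
theorem Pj.exists_retraction {j : ℕ} (h : Pj (j + 1) A ∅) :
    ∃ r : (singularChains.obj (TopCat.of A)).X j →+ (singularChains.obj (TopCat.of A)).X j,
      (∀ x, ∃ y, r x = (singularChains.obj (TopCat.of A)).d (j + 1) j y) ∧
      ∀ y, r ((singularChains.obj (TopCat.of A)).d (j + 1) j y) =
        (singularChains.obj (TopCat.of A)).d (j + 1) j y := by
  obtain ⟨r, h1, h2⟩ := h.coker.exists_retraction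
  have hm (j : ℕ) (x : (singularChains.obj (TopCat.of A)).X j) :
      toCh j x ∈ C (sg A) ⊓ Dg E (j + 1) := by
    rw [← range_toCh]; exact ⟨x, rfl⟩
  have hs (j : ℕ) (z) (hz : z ∈ C (sg A) ⊓ Dg E (j + 1)) :
      ∃ x : (singularChains.obj (TopCat.of A)).X j, toCh j x = z := by
    rwa [← range_toCh] at hz
  choose g hg using fun x => hs j _ (r ⟨_, hm j x⟩).2
  refine ⟨AddMonoidHom.mk' g fun x y => ?_, fun x => ?_, fun y => ?_⟩
  · refine toCh_injective j ?_
    change toCh j (g (x + y)) = toCh j (g x + g y)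
    rw [map_add, hg, hg, hg]
    have : (⟨toCh j (x + y), hm j _⟩ : ↥(C (sg A) ⊓ Dg E (j + 1))) =
      ⟨toCh j x, hm j x⟩ + ⟨toCh j y, hm j y⟩ := Subtype.ext (map_add _ _ _)
    rw [this, map_add]; rfl
  · obtain ⟨y, hy, hy'⟩ := h1 ⟨_, hm j x⟩
    obtain ⟨y, rfl⟩ := hs (j + 1) y hy
    refine ⟨y, toCh_injective j ?_⟩
    rw [toCh_d, hy']
    exact hg x
  · refine toCh_injective j ?_
    refine (hg _).trans ?_
    rw [h2 _ ⟨_, hm (j + 1) y, (toCh_d j y).symm⟩]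

end retraction

end

section

open Finsupp Cvx Topology

theorem eq_zero_of_smul_homology {R : Type} [CommRing R] (S : ShortComplex (ModuleCat.{0} R))
    {p : R} (h : ∀ (x : S.X₂) (y : S.X₁), S.f y = p • x → ∃ z, S.f z = x)
    {u : S.homology} (hu : p • u = 0) : u = 0 := by
  let e : S.homology ≃ₗ[R] (LinearMap.ker S.g.hom ⧸ LinearMap.range S.moduleCatToCycles) :=
    S.moduleCatHomologyIso.toLinearEquiv
  apply e.injective
  have hu' : p • e u = 0 := by rw [← map_smul, hu, map_zero]
  rw [map_zero]
  generalize e u = v at hu'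
  obtain ⟨⟨x, hx⟩, rfl⟩ := (LinearMap.range S.moduleCatToCycles).mkQ_surjective v
  rw [← map_smul] at hu'
  obtain ⟨y, hy⟩ := (Submodule.Quotient.mk_eq_zero _).1 hu'
  obtain ⟨z, hz⟩ := h x y (congrArg Subtype.val hy)
  exact (Submodule.Quotient.mk_eq_zero _).2 ⟨z, Subtype.ext hz⟩

theorem noZeroSMulDivisors_homology {c : ComplexShape ℕ}
    (K : HomologicalComplex (ModuleCat.{0} ℤ) c) {i j : ℕ} (hi : c.prev j = i)
    (h : ∀ (p : ℤ) (x : K.X j) (y : K.X i), p ≠ 0 → K.d i j y = p • x → ∃ z, K.d i j z = x) :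
    NoZeroSMulDivisors ℤ (K.homology j) := by
  subst hi
  refine ⟨fun {p u} hu => or_iff_not_imp_left.2 fun hp => ?_⟩
  exact eq_zero_of_smul_homology (K.sc j)
    (fun x y hy => h p x y hp (hy.trans (int_smul_eq_zsmul _ p x)))
    ((int_smul_eq_zsmul _ p _).trans hu)

section coefficients
variable {E : Type} [TopologicalSpace E] {A : Set E}

theorem chains_torsionFree {j : ℕ} {p : ℤ} (hp : p ≠ 0)
    {x : (singularChains.obj (TopCat.of A)).X j} (h : p • x = 0) : x = 0 := by
  apply toCh_injective j
  rw [map_zero]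
  have h' : p • toCh j x = 0 := by rw [← map_zsmul, h, map_zero]
  exact (smul_eq_zero.1 h').resolve_left hp

theorem homology_torsionFree {j : ℕ} (h : Pj (j + 1) A ∅) :
    NoZeroSMulDivisors ℤ (SingularHomology (TopCat.of A) j) := by
  obtain ⟨r, h1, h2⟩ := h.exists_retraction
  refine noZeroSMulDivisors_homology _ (ChainComplex.prev ℕ j) fun p x y hp hy => ?_
  obtain ⟨z, hz⟩ := h1 x
  refine ⟨z, ?_⟩
  rw [← hz, ← sub_eq_zero]
  refine chains_torsionFree hp ?_
  rw [zsmul_sub, ← map_zsmul, ← hy, h2, sub_self]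

theorem cochain_torsionFree {M : ModuleCat.{0} ℤ} {φ : M ⟶ ModuleCat.of ℤ ℤ} {p : ℤ}
    (hp : p ≠ 0) (h : p • φ = 0) : φ = 0 := by
  ext x
  have : p * φ x = 0 := congrArg (fun ψ : M ⟶ ModuleCat.of ℤ ℤ => (ψ x : ℤ)) h
  exact (mul_eq_zero.1 this).resolve_left hp

theorem cohomology_torsionFree (h : ∀ j, Pj (j + 1) A ∅) (j : ℕ) :
    NoZeroSMulDivisors ℤ (SingularCohomology ℤ (TopCat.of A) j) := by
  cases j with
  | zero =>
    refine noZeroSMulDivisors_homology _ CochainComplex.prev_nat_zero fun p x y hp hy => ⟨0, ?_⟩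
    rw [HomologicalComplex.shape _ _ _ (by simp)] at hy
    rw [map_zero]
    exact (cochain_torsionFree hp hy.symm).symm
  | succ j =>
    obtain ⟨r, h1, h2⟩ := (h j).exists_retraction
    refine noZeroSMulDivisors_homology _ (CochainComplex.prev_nat_succ j) fun p φ ψ hp hy => ?_
    change (singularChains.obj (TopCat.of A)).X (j + 1) ⟶ ModuleCat.of ℤ ℤ at φ
    change (singularChains.obj (TopCat.of A)).X j ⟶ ModuleCat.of ℤ ℤ at ψ
    have hy' (x) : (ψ ((singularChains.obj (TopCat.of A)).d (j + 1) j x) : ℤ) = p * φ x :=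
      congrArg (fun χ : (singularChains.obj (TopCat.of A)).X (j + 1) ⟶ ModuleCat.of ℤ ℤ =>
        (χ x : ℤ)) hy
    choose g hg using h1
    have hχ (x) : p * (φ (g x) : ℤ) = ψ (r x) := by rw [hg, hy']
    let χ : (singularChains.obj (TopCat.of A)).X j →+ ℤ := AddMonoidHom.mk' (fun x => φ (g x))
      fun x y => mul_left_cancel₀ hp (by
        rw [mul_add]; erw [hχ, hχ, hχ]; rw [map_add, map_add])
    let χ' : (singularChains.obj (TopCat.of A)).X j →ₗ[ℤ] ℤ :=
      { toFun := χ, map_add' := χ.map_add, map_smul' := fun n x =>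
          (congrArg χ (int_smul_eq_zsmul _ n x)).trans (map_zsmul χ n x) }
    refine ⟨(ModuleCat.ofHom χ' : _ ⟶ ModuleCat.of ℤ ℤ), ?_⟩
    change (singularChains.obj (TopCat.of A)).d (j + 1) j ≫ ModuleCat.ofHom χ' = φ
    ext x
    refine mul_left_cancel₀ hp ?_
    exact (hχ _).trans ((congrArg ψ (h2 x)).trans (hy' x))

end coefficients

end

end SimplexChains

/-- Let `X ⊆ ℙ^{n+1}(ℂ)` be a smooth hypersurface (cut out by a
homogeneous polynomial `f` of degree `d ≥ 1` with nowhere-vanishing gradient on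
the punctured cone) of odd dimension `n`.  Then all integral singular cohomology
groups `H^k(X, ℤ)` and all integral singular homology groups `H_k(X, ℤ)` are
torsion free. -/
theorem stmt_7 (n d : ℕ) (hn : Odd n) (f : MvPolynomial (Fin (n + 2)) ℂ)
    (hhom : f.IsHomogeneous d) (hd : 1 ≤ d) (hsm : IsSmoothHypersurface f) :
    ∀ k : ℕ,
      NoZeroSMulDivisors ℤ (SingularCohomology ℤ (TopCat.of (projHypersurface f)) k) ∧
      NoZeroSMulDivisors ℤ (SingularHomology (TopCat.of (projHypersurface f)) k) := by
  intro k
  rw [← SimplexChains.PS_Xf f]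
  have h := SimplexChains.pj_hypersurface hhom hd hsm
  exact ⟨SimplexChains.cohomology_torsionFree (fun j => h (j + 1)) k,
    SimplexChains.homology_torsionFree (h (k + 1))⟩
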